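/- Let q be a prime with q ≡ 1 (mod 4). There exists a polynomial Q of degree 6 (depending only on q), whose leading coefficient is A_3/2880 where A_3 = ∏_P (1 − (12|P|^5 − 23|P|^4 + 23|P|^3 − 15|P|^2 + 6|P| − 1)/(|P|^6(|P|+1))) (product over monic irreducible P), such that for every ε > 0, as g → ∞, Σ_{D ∈ H_{2g+1}} L(1/2, χ_D)^3 = (q^{2g+1}/ζ(2)) · Q(2g+1) + O_ε(q^{(3g/2)(1+ε)}). -/

import Mathlib

/- Setting: `F_q[x]` with `q` prime, `q ≡ 1 (mod 4)`.  `M_n` denotes the monic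
polynomials of degree `n`, `M_{≤n}` those of degree at most `n`, `H_n` the monic
squarefree polynomials of degree `n`. -/

open Polynomial

noncomputable section

attribute [local instance] Classical.propDecidable

abbrev Fqx (q : ℕ) := Polynomial (ZMod q)

/-- The (sub)type of monic irreducible polynomials over `F_q`. -/
abbrev MIrr (q : ℕ) := {P : Fqx q // P.Monic ∧ Irreducible P}

/-- The norm `|f| = q ^ deg f`, as a complex number. -/
def nm (q : ℕ) (f : Fqx q) : ℂ := (q : ℂ) ^ f.natDegree

/-- The monic polynomial `X ^ n + ∑ i < n, c i * X ^ i` of degree `n`; as `c` runs over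
`Fin n → ZMod q`, this enumerates the monic polynomials of degree `n` exactly once. -/
def monicOf (q n : ℕ) (c : Fin n → ZMod q) : Fqx q :=
  X ^ n + ∑ i : Fin n, C (c i) * X ^ (i : ℕ)

/-- The polynomial `∑ i < n, c i * X ^ i` of degree `< n`; as `c` runs over
`Fin n → ZMod q`, this enumerates the residues modulo a polynomial of degree `n`. -/
def polyOf (q n : ℕ) (c : Fin n → ZMod q) : Fqx q :=
  ∑ i : Fin n, C (c i) * X ^ (i : ℕ)

/-- The sum of `F` over the monic polynomials of degree `n` (empty if `n < 0`). -/
def sumMn (q : ℕ) [NeZero q] (n : ℤ) (F : Fqx q → ℂ) : ℂ :=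
  if 0 ≤ n then ∑ c : Fin n.toNat → ZMod q, F (monicOf q n.toNat c) else 0

/-- The sum of `F` over the monic polynomials of degree at most `n` (empty if `n < 0`). -/
def sumMle (q : ℕ) [NeZero q] (n : ℤ) (F : Fqx q → ℂ) : ℂ :=
  ∑ m ∈ Finset.range (n + 1).toNat, sumMn q m F

/-- The sum of `F` over `H_n`, the monic squarefree polynomials of degree `n`. -/
def sumH (q : ℕ) [NeZero q] (n : ℕ) (F : Fqx q → ℂ) : ℂ :=
  ∑ c : Fin n → ZMod q,
    if Squarefree (monicOf q n c) then F (monicOf q n c) else 0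

/-- The quadratic residue symbol `(f | P)` for `P` monic irreducible:  it is `0` if
`P ∣ f`, `1` if `P ∤ f` and `f` is a square modulo `P`, and `-1` otherwise. -/
def legSym (q : ℕ) (f P : Fqx q) : ℤ :=
  if P ∣ f then 0 else if ∃ g : Fqx q, P ∣ (g ^ 2 - f) then 1 else -1

/-- The Jacobi symbol `(f | u)`, extending the quadratic residue symbol
multiplicatively in the lower entry. -/
def jacSym (q : ℕ) [Fact q.Prime] (f u : Fqx q) : ℤ :=
  if u = 0 then (if IsUnit f then 1 else 0)
  else ((UniqueFactorizationMonoid.factors u).map fun P => legSym q f P).prod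

/-- The character `χ_D(f) = (D | f)`, as a complex number. -/
def chi (q : ℕ) [Fact q.Prime] (D f : Fqx q) : ℂ := jacSym q D f

/-- `d_k(f)`: the number of ways of writing `f` as an ordered product of `k` monic
polynomials. -/
def dk (q k : ℕ) (f : Fqx q) : ℕ :=
  Nat.card {t : Fin k → Fqx q // (∀ i, (t i).Monic) ∧ ∏ i, t i = f}

/-- The exponential `e(a/f) = exp(2πi a₁/q)`, where `a₁ ∈ F_q ≅ ℤ/q` is the coefficient
of `1/x` in the Laurent expansion of `a/f` at infinity, i.e. the coefficient of
`x^(deg f - 1)` in `a mod f`. -/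
def eQ (q : ℕ) (f a : Fqx q) : ℂ :=
  Complex.exp (2 * (Real.pi : ℂ) * Complex.I * (((a %ₘ f).coeff (f.natDegree - 1)).val : ℂ) / q)

/-- The generalized Gauss sum `G(V, χ_f) = ∑_{u mod f} χ_f(u) e(uV/f)`. -/
def gSum (q : ℕ) [Fact q.Prime] (V f : Fqx q) : ℂ :=
  ∑ c : Fin f.natDegree → ZMod q,
    chi q f (polyOf q f.natDegree c) * eQ q f (polyOf q f.natDegree c * V)

/-- `L(1/2, χ_D)`: since `L(s, χ_D) = ∑_{f ∈ M} χ_D(f) |f|^{-s}` is a polynomial of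
degree `deg D - 1` in `q^{-s}` (for `D` squarefree of odd degree), this is the finite
sum `∑_{n < deg D} (∑_{f ∈ M_n} χ_D(f)) q^{-n/2}`. -/
def Lhalf (q : ℕ) [Fact q.Prime] (D : Fqx q) : ℂ :=
  ∑ n ∈ Finset.range D.natDegree,
    sumMn q n (fun f => chi q D f) / (Real.sqrt ((q : ℝ) ^ n) : ℂ)

/-- The L-series `L(w, χ_V) = ∑_{f ∈ M} χ_V(f) w^(deg f)`. -/
def Lser (q : ℕ) [Fact q.Prime] (V : Fqx q) (w : ℂ) : ℂ :=
  ∑' f : {f : Fqx q // f.Monic}, chi q V f.1 * w ^ f.1.natDegree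

/-- The Euler phi function: the number of units in `F_q[x]/(f)`. -/
def polyPhi (q : ℕ) [Fact q.Prime] (f : Fqx q) : ℕ :=
  Nat.card ((Fqx q ⧸ Ideal.span {f}))ˣ

/-- `Z(u) = (1 - qu)⁻¹`. -/
def Zf (q : ℕ) (u : ℂ) : ℂ := (1 - q * u)⁻¹

/-- The Euler product `B(u) = ∏_P (1 + u^d(u^d - 3)/((|P|+1)(1+u^d)))`, `d = d(P)`. -/
def Bfun (q : ℕ) (u : ℂ) : ℂ :=
  ∏' P : MIrr q, (1 + u ^ P.1.natDegree * (u ^ P.1.natDegree - 3) /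
    ((nm q P.1 + 1) * (1 + u ^ P.1.natDegree)))

/-- The Euler product `B_3(u)` from the third-moment main term. -/
def B3fun (q : ℕ) (u : ℂ) : ℂ :=
  ∏' P : MIrr q,
    (1 - (6 * u ^ P.1.natDegree - (15 - 6 * nm q P.1) * u ^ (2 * P.1.natDegree)
      + (20 - 8 * nm q P.1) * u ^ (3 * P.1.natDegree)
      - (15 - 3 * nm q P.1) * u ^ (4 * P.1.natDegree)
      + 6 * u ^ (5 * P.1.natDegree) - u ^ (6 * P.1.natDegree)) / (nm q P.1 + 1))

/-- `∑_{C ∈ M_{≤ g-1}, C | f^∞} |C|⁻²`, where `C | f^∞` means that every monic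
irreducible factor of `C` divides `f`. -/
def sumCdiv (q : ℕ) [NeZero q] (g : ℕ) (f : Fqx q) : ℂ :=
  sumMle q ((g : ℤ) - 1) fun Cp =>
    if ∀ P : Fqx q, P.Monic → Irreducible P → P ∣ Cp → P ∣ f
    then ((q : ℂ) ^ (2 * Cp.natDegree))⁻¹ else 0

/-- The main term `q^(2g+1) (1 - 1/q) ∑_{f ∈ M_{≤N}, f = □} d_k(f) φ(f) |f|^{-3/2}
∑_{C ∈ M_{≤g-1}, C|f^∞} |C|⁻²`. -/
def Mterm (q : ℕ) [Fact q.Prime] (k : ℕ) (N : ℤ) (g : ℕ) : ℂ :=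
  (q : ℂ) ^ (2 * g + 1) * (1 - 1 / q) * sumMle q N fun f =>
    if IsSquare f then
      (dk q k f : ℂ) * polyPhi q f / (Real.sqrt ((q : ℝ) ^ (3 * f.natDegree)) : ℂ)
        * sumCdiv q g f
    else 0

/-- The secondary main term `S_{kg}(V = □)` (with `N = kg` or `kg - 1`). -/
def Ssq (q : ℕ) [Fact q.Prime] (k : ℕ) (N : ℤ) (g : ℕ) : ℂ :=
  (q : ℂ) ^ (2 * g + 1) * sumMle q N fun f =>
    if Even f.natDegree then
      (dk q k f : ℂ) / (Real.sqrt ((q : ℝ) ^ (3 * f.natDegree)) : ℂ) *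
        sumMle q ((g : ℤ) - 1) (fun Cp =>
          if ∀ P : Fqx q, P.Monic → Irreducible P → P ∣ Cp → P ∣ f then
            ((q : ℂ) ^ (2 * Cp.natDegree))⁻¹ *
              ((q - 1) * sumMle q ((f.natDegree : ℤ) / 2 - g - 2 + Cp.natDegree)
                  (fun l => gSum q (l ^ 2) f)
                - sumMn q ((f.natDegree : ℤ) / 2 - g - 1 + Cp.natDegree)
                    (fun l => gSum q (l ^ 2) f)
                - (q - 1) / q * sumMle q ((f.natDegree : ℤ) / 2 - g - 1 + Cp.natDegree)
                    (fun l => gSum q (l ^ 2) f)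
                + (1 / q) * sumMn q ((f.natDegree : ℤ) / 2 - g + Cp.natDegree)
                    (fun l => gSum q (l ^ 2) f))
          else 0)
    else 0

/-- The odd-degree part `S_{kg,o}` (with `N = kg` or `kg - 1`). -/
def Sodd (q : ℕ) [Fact q.Prime] (k : ℕ) (N : ℤ) (g : ℕ) : ℂ :=
  (q : ℂ) ^ (2 * g + 1) * (Real.sqrt q : ℂ) * sumMle q N fun f =>
    if Odd f.natDegree then
      (dk q k f : ℂ) / (Real.sqrt ((q : ℝ) ^ (3 * f.natDegree)) : ℂ) *
        sumMle q ((g : ℤ) - 1) (fun Cp =>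
          if ∀ P : Fqx q, P.Monic → Irreducible P → P ∣ Cp → P ∣ f then
            ((q : ℂ) ^ (2 * Cp.natDegree))⁻¹ *
              (sumMn q ((f.natDegree : ℤ) - 2 * g - 2 + 2 * Cp.natDegree)
                  (fun V => gSum q V f)
                - (1 / q) * sumMn q ((f.natDegree : ℤ) - 2 * g + 2 * Cp.natDegree)
                    (fun V => gSum q V f))
          else 0)
    else 0

/-- The even-degree, non-square-`V` part `S_{kg,e}(V ≠ □)` (with `N = kg` or `kg-1`). -/
def SevNS (q : ℕ) [Fact q.Prime] (k : ℕ) (N : ℤ) (g : ℕ) : ℂ :=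
  (q : ℂ) ^ (2 * g + 1) * sumMle q N fun f =>
    if Even f.natDegree then
      (dk q k f : ℂ) / (Real.sqrt ((q : ℝ) ^ (3 * f.natDegree)) : ℂ) *
        sumMle q ((g : ℤ) - 1) (fun Cp =>
          if ∀ P : Fqx q, P.Monic → Irreducible P → P ∣ Cp → P ∣ f then
            ((q : ℂ) ^ (2 * Cp.natDegree))⁻¹ *
              ((q - 1) * sumMle q ((f.natDegree : ℤ) - 2 * g - 3 + 2 * Cp.natDegree)
                  (fun V => if IsSquare V then 0 else gSum q V f)
                - sumMn q ((f.natDegree : ℤ) - 2 * g - 2 + 2 * Cp.natDegree)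
                    (fun V => if IsSquare V then 0 else gSum q V f)
                - (q - 1) / q * sumMle q ((f.natDegree : ℤ) - 2 * g - 1 + 2 * Cp.natDegree)
                    (fun V => if IsSquare V then 0 else gSum q V f)
                + (1 / q) * sumMn q ((f.natDegree : ℤ) - 2 * g + 2 * Cp.natDegree)
                    (fun V => if IsSquare V then 0 else gSum q V f))
          else 0)
    else 0

/-- `∏_{P | f} (1 - |P|⁻² z^{-d(P)})`, a finite product written as a `tprod`. -/
def prodC (q : ℕ) (z : ℂ) (f : Fqx q) : ℂ :=
  ∏' P : {P : Fqx q // P.Monic ∧ Irreducible P ∧ P ∣ f},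
    (1 - 1 / (nm q P.1 ^ 2 * z ^ P.1.natDegree))

/-- `M(V; z, w) = ∑_{f ∈ M} d₂(f) G(V,χ_f) / (√|f| ∏_{P|f}(1 - |P|⁻²z^{-d(P)})) w^(deg f)`. -/
def Mser (q : ℕ) [Fact q.Prime] (V : Fqx q) (z w : ℂ) : ℂ :=
  ∑' f : {f : Fqx q // f.Monic},
    (dk q 2 f.1 : ℂ) * gSum q V f.1 /
      ((Real.sqrt ((q : ℝ) ^ f.1.natDegree) : ℂ) * prodC q z f.1) * w ^ f.1.natDegree

/-- The local factor `M_P(V; z, w)`. -/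
def MPf (q : ℕ) [Fact q.Prime] (V : Fqx q) (z w : ℂ) (P : Fqx q) : ℂ :=
  if P ∣ V then
    1 + (1 - 1 / (nm q P ^ 2 * z ^ P.natDegree))⁻¹ *
      ∑' b : ℕ, (dk q 2 (P ^ (b + 1)) : ℂ) * gSum q V (P ^ (b + 1)) /
        (Real.sqrt ((q : ℝ) ^ ((b + 1) * P.natDegree)) : ℂ) * w ^ ((b + 1) * P.natDegree)
  else
    1 + 2 * (jacSym q V P : ℂ) * w ^ P.natDegree / (nm q P ^ 2 * z ^ P.natDegree - 1)
      + w ^ (2 * P.natDegree)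
      - 4 * w ^ (2 * P.natDegree) / (1 - 1 / (nm q P ^ 2 * z ^ P.natDegree))
      + 2 * (jacSym q V P : ℂ) * w ^ (3 * P.natDegree) /
          (1 - 1 / (nm q P ^ 2 * z ^ P.natDegree))

/-- The local factor `R_P(l²; z, w)`. -/
def RPf (q : ℕ) [Fact q.Prime] (l : Fqx q) (z w : ℂ) (P : Fqx q) : ℂ :=
  if P ∣ l then
    (1 - w ^ P.natDegree) ^ 2 *
      (1 + (1 - 1 / (nm q P ^ 2 * z ^ P.natDegree))⁻¹ *
        ∑' b : ℕ, (dk q 2 (P ^ (b + 1)) : ℂ) * gSum q (l ^ 2) (P ^ (b + 1)) /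
          (Real.sqrt ((q : ℝ) ^ ((b + 1) * P.natDegree)) : ℂ) * w ^ ((b + 1) * P.natDegree))
  else
    1 + 2 * w ^ P.natDegree / (nm q P ^ 2 * z ^ P.natDegree - 1)
      + w ^ (2 * P.natDegree)
      - 4 * w ^ (2 * P.natDegree) / (1 - 1 / (nm q P ^ 2 * z ^ P.natDegree))
      + 2 * w ^ (3 * P.natDegree) / (1 - 1 / (nm q P ^ 2 * z ^ P.natDegree))

/-- `R(z, w) = ∑_{l ∈ M} z^(deg l) ∏_P R_P(l²; z, w)`. -/
def Rser (q : ℕ) [Fact q.Prime] (z w : ℂ) : ℂ :=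
  ∑' l : {l : Fqx q // l.Monic}, z ^ l.1.natDegree * ∏' P : MIrr q, RPf q l.1 z w P.1

/-- The local factor `F_P(z, w)`. -/
def FPf (q : ℕ) (z w : ℂ) (P : Fqx q) : ℂ :=
  (1 - w ^ P.natDegree) ^ 2 *
    (1 - (1 - 2 * nm q P ^ 2 * (w * z) ^ P.natDegree - 2 * nm q P * (w ^ 2 * z) ^ P.natDegree
        + 2 * nm q P ^ 2 * (w * z ^ 2) ^ P.natDegree
        + (-2 * nm q P ^ 3 + 3 * nm q P ^ 2) * (w ^ 2 * z ^ 2) ^ P.natDegree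
        + nm q P ^ 2 * (w ^ 4 * z ^ 2) ^ P.natDegree
        - nm q P ^ 3 * (w ^ 4 * z ^ 3) ^ P.natDegree) /
      (nm q P ^ 2 * z ^ P.natDegree * (1 - nm q P * w ^ (2 * P.natDegree) * z ^ P.natDegree)))

/-- `F(z, w) = ∏_P F_P(z, w)`. -/
def Ffull (q : ℕ) (z w : ℂ) : ℂ := ∏' P : MIrr q, FPf q z w P.1

/-- `F(z) = F(z, 1/q)`. -/
def Fone (q : ℕ) (z : ℂ) : ℂ := Ffull q z (1 / q)

/-- `α(z) = (1/q) ∂_w F(z, w)|_{w = 1/q} / F(z, 1/q)`. -/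
def alphaF (q : ℕ) (z : ℂ) : ℂ := (1 / (q : ℂ)) * deriv (Ffull q z) (1 / q) / Fone q z

/-- The explicit formula for `F(z)`:
`∏_P (1 - 1/|P|)² (1 + 2/|P| + 1/|P|³ - (z^d + z^{-d})/|P|²)`. -/
def Fexp (q : ℕ) (z : ℂ) : ℂ :=
  ∏' P : MIrr q,
    ((1 - 1 / nm q P.1) ^ 2 *
      (1 + 2 / nm q P.1 + 1 / nm q P.1 ^ 3 -
        (z ^ P.1.natDegree + z⁻¹ ^ P.1.natDegree) / nm q P.1 ^ 2))

/-- The explicit formula for `α(z)`. -/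
def alphaExp (q : ℕ) (z : ℂ) : ℂ :=
  ∑' P : MIrr q,
    2 * (P.1.natDegree : ℂ) *
      (nm q P.1 ^ 2 + z ^ P.1.natDegree * (-3 * nm q P.1 ^ 3 - 3 * nm q P.1 + nm q P.1 ^ 2)
        + z ^ (2 * P.1.natDegree) * (nm q P.1 ^ 4 - nm q P.1 ^ 3 + 4 * nm q P.1 ^ 2 - nm q P.1 + 2)
        + z ^ (3 * P.1.natDegree) * (nm q P.1 ^ 2 - 2 * nm q P.1)) /
      ((nm q P.1 - 1) * (z ^ P.1.natDegree - nm q P.1) *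
        (nm q P.1 - z ^ P.1.natDegree - 2 * nm q P.1 ^ 2 * z ^ P.1.natDegree
          - nm q P.1 ^ 3 * z ^ P.1.natDegree + nm q P.1 * z ^ (2 * P.1.natDegree)))

/-- `A(V; z, w) = ∑_{f ∈ M} w^(deg f) d₃(f) G(V,χ_f)/(√|f| ∏_{P|f}(1 - |P|⁻²z^{-d(P)}))`. -/
def Aser (q : ℕ) [Fact q.Prime] (V : Fqx q) (z w : ℂ) : ℂ :=
  ∑' f : {f : Fqx q // f.Monic},
    w ^ f.1.natDegree * (dk q 3 f.1 : ℂ) * gSum q V f.1 /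
      ((Real.sqrt ((q : ℝ) ^ f.1.natDegree) : ℂ) * prodC q z f.1)

/-- The local factor `H_P(V; z, w)` of `A(V; z, w)`. -/
def HP3f (q : ℕ) [Fact q.Prime] (V : Fqx q) (z w : ℂ) (P : Fqx q) : ℂ :=
  if P ∣ V then
    1 + (1 - 1 / (nm q P ^ 2 * z ^ P.natDegree))⁻¹ *
      ∑' i : ℕ, w ^ ((i + 1) * P.natDegree) * (dk q 3 (P ^ (i + 1)) : ℂ) *
        gSum q V (P ^ (i + 1)) / (Real.sqrt ((q : ℝ) ^ ((i + 1) * P.natDegree)) : ℂ)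
  else
    1 + 3 * (jacSym q V P : ℂ) * w ^ P.natDegree / (nm q P ^ 2 * z ^ P.natDegree - 1)
      + 3 * w ^ (2 * P.natDegree)
      - 9 * w ^ (2 * P.natDegree) / (1 - 1 / (nm q P ^ 2 * z ^ P.natDegree))
      - (jacSym q V P : ℂ) * w ^ (3 * P.natDegree)
      + 9 * (jacSym q V P : ℂ) * w ^ (3 * P.natDegree) /
          (1 - 1 / (nm q P ^ 2 * z ^ P.natDegree))
      - 3 * w ^ (4 * P.natDegree) / (1 - 1 / (nm q P ^ 2 * z ^ P.natDegree))

/-- The local factor `A_P(l²; z, w)`. -/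
def APf (q : ℕ) [Fact q.Prime] (l : Fqx q) (z w : ℂ) (P : Fqx q) : ℂ :=
  if P ∣ l then
    (1 - w ^ P.natDegree) ^ 3 *
      (1 + ∑' i : ℕ, w ^ ((i + 1) * P.natDegree) * (dk q 3 (P ^ (i + 1)) : ℂ) *
        gSum q (l ^ 2) (P ^ (i + 1)) /
          ((Real.sqrt ((q : ℝ) ^ ((i + 1) * P.natDegree)) : ℂ) *
            (1 - 1 / (nm q P ^ 2 * z ^ P.natDegree))))
  else
    1 + 3 * w ^ P.natDegree / (nm q P ^ 2 * z ^ P.natDegree - 1)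
      + 3 * w ^ (2 * P.natDegree)
      - 9 * w ^ (2 * P.natDegree) / (1 - 1 / (nm q P ^ 2 * z ^ P.natDegree))
      - w ^ (3 * P.natDegree)
      + 9 * w ^ (3 * P.natDegree) / (1 - 1 / (nm q P ^ 2 * z ^ P.natDegree))
      - 3 * w ^ (4 * P.natDegree) / (1 - 1 / (nm q P ^ 2 * z ^ P.natDegree))

/-- `C(z, w) = ∑_{l ∈ M} z^(deg l) ∏_P A_P(l²; z, w)`. -/
def Cser (q : ℕ) [Fact q.Prime] (z w : ℂ) : ℂ :=
  ∑' l : {l : Fqx q // l.Monic}, z ^ l.1.natDegree * ∏' P : MIrr q, APf q l.1 z w P.1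

/-- The local factor `H_P(z, w)`. -/
def HPf (q : ℕ) (z w : ℂ) (P : Fqx q) : ℂ :=
  (1 - w ^ P.natDegree) ^ 3 * (1 - nm q P * (w ^ 2 * z) ^ P.natDegree) ^ 3 *
    (1 + (w * z) ^ P.natDegree) ^ 3 *
    (1 + 3 * w ^ P.natDegree + 3 * nm q P * (z * w ^ 2) ^ P.natDegree
      + 3 * w ^ (2 * P.natDegree) / nm q P - 3 * (z * w) ^ P.natDegree
      - 1 / (nm q P ^ 2 * z ^ P.natDegree) - 6 * (z * w ^ 2) ^ P.natDegree
      + nm q P * (z * w ^ 3) ^ P.natDegree - 3 * (z * w ^ 4) ^ P.natDegree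
      - nm q P * (z ^ 2 * w ^ 3) ^ P.natDegree + 3 * nm q P * (z ^ 2 * w ^ 4) ^ P.natDegree
      + nm q P * (z ^ 2 * w ^ 6) ^ P.natDegree - nm q P ^ 2 * (z ^ 3 * w ^ 6) ^ P.natDegree)

/-- `H(z, w) = ∏_P H_P(z, w)`. -/
def Hfull (q : ℕ) (z w : ℂ) : ℂ := ∏' P : MIrr q, HPf q z w P.1

end

set_option linter.unusedSectionVars false

noncomputable section
namespace TM
open scoped Classical

section
variable {q : ℕ} [Fact q.Prime]

lemma coeff_polyOf (n : ℕ) (c : Fin n → ZMod q) (i : ℕ) :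
    (polyOf q n c).coeff i = if h : i < n then c ⟨i, h⟩ else 0 := by
  unfold polyOf
  simp only [finsetSum_coeff, coeff_C_mul, coeff_X_pow]
  split_ifs with h
  · rw [Finset.sum_eq_single ⟨i, h⟩]
    · simp
    · intro b _ hb
      have : i ≠ b := fun h' => hb (Fin.ext h'.symm)
      simp [this]
    · simp
  · refine Finset.sum_eq_zero fun b _ => ?_
    have : i ≠ b := fun h' => h (h' ▸ b.2)
    simp [this]

lemma degree_polyOf_lt (n : ℕ) (c : Fin n → ZMod q) : (polyOf q n c).degree < n := by
  rw [degree_lt_iff_coeff_zero]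
  intro m hm
  rw [coeff_polyOf, dif_neg (not_lt.2 hm)]

lemma polyOf_injective (n : ℕ) : Function.Injective (polyOf q n) := by
  intro c c' h
  ext i
  have := congrArg (fun p => coeff p (i : ℕ)) h
  simpa [coeff_polyOf] using this

lemma monicOf_eq (n : ℕ) (c : Fin n → ZMod q) : monicOf q n c = X ^ n + polyOf q n c := rfl

lemma monicOf_injective (n : ℕ) : Function.Injective (monicOf q n) := by
  intro c c' h
  rw [monicOf_eq, monicOf_eq] at h
  exact polyOf_injective n (add_left_cancel h)

lemma exists_polyOf {n : ℕ} {f : Fqx q} (hf : f.degree < n) : ∃ c, polyOf q n c = f := by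
  refine ⟨fun i => f.coeff i, ?_⟩
  ext i
  rw [coeff_polyOf]
  split_ifs with h
  · rfl
  · exact ((degree_lt_iff_coeff_zero f n).1 hf i (not_lt.1 h)).symm

/-- The finset of monic polynomials of degree `n`. -/
def Mn (q : ℕ) [Fact q.Prime] (n : ℕ) : Finset (Fqx q) := Finset.univ.image (monicOf q n)

/-- The finset of polynomials of degree `< n`. -/
def Rn (q : ℕ) [Fact q.Prime] (n : ℕ) : Finset (Fqx q) := Finset.univ.image (polyOf q n)

/-- The finset of squarefree monic polynomials of degree `n`. -/
def Hn (q : ℕ) [Fact q.Prime] (n : ℕ) : Finset (Fqx q) := (Mn q n).filter Squarefree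

lemma mem_Rn {n : ℕ} {f : Fqx q} : f ∈ Rn q n ↔ f.degree < n := by
  simp only [Rn, Finset.mem_image, Finset.mem_univ, true_and]
  exact ⟨fun ⟨c, hc⟩ => hc ▸ degree_polyOf_lt n c, exists_polyOf⟩

lemma mem_Mn {n : ℕ} {f : Fqx q} : f ∈ Mn q n ↔ f.Monic ∧ f.natDegree = n := by
  simp only [Mn, Finset.mem_image, Finset.mem_univ, true_and]
  constructor
  · rintro ⟨c, rfl⟩
    rw [monicOf_eq]
    have hd := degree_polyOf_lt n c
    refine ⟨monic_X_pow_add hd, ?_⟩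
    rw [natDegree_add_eq_left_of_degree_lt (by rwa [degree_X_pow]), natDegree_X_pow]
  · rintro ⟨hm, rfl⟩
    have h : (f - X ^ f.natDegree).degree < (f.natDegree : WithBot ℕ) := by
      have h1 := degree_sub_lt_left (p := f) (q := X ^ f.natDegree)
        (by rw [degree_X_pow, degree_eq_natDegree hm.ne_zero]) hm.ne_zero
        (by rw [hm.leadingCoeff, (monic_X_pow _).leadingCoeff])
      rwa [degree_eq_natDegree hm.ne_zero] at h1
    obtain ⟨c, hc⟩ := exists_polyOf h
    exact ⟨c, by rw [monicOf_eq, hc]; ring⟩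

lemma mem_Hn {n : ℕ} {f : Fqx q} :
    f ∈ Hn q n ↔ f.Monic ∧ f.natDegree = n ∧ Squarefree f := by
  simp [Hn, mem_Mn, and_assoc]

lemma card_Mn (n : ℕ) : (Mn q n).card = q ^ n := by
  rw [Mn, Finset.card_image_of_injective _ (monicOf_injective n)]
  simp [ZMod.card]

lemma card_Rn (n : ℕ) : (Rn q n).card = q ^ n := by
  rw [Rn, Finset.card_image_of_injective _ (polyOf_injective n)]
  simp [ZMod.card]

lemma sumMn_eq (n : ℕ) (F : Fqx q → ℂ) : sumMn q n F = ∑ f ∈ Mn q n, F f := by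
  rw [sumMn, if_pos (Int.natCast_nonneg n), Mn,
    Finset.sum_image (fun _ _ _ _ h => monicOf_injective _ h)]
  rfl

lemma sumH_eq (n : ℕ) (F : Fqx q → ℂ) : sumH q n F = ∑ f ∈ Hn q n, F f := by
  rw [sumH, Hn, Finset.sum_filter, Mn,
    Finset.sum_image (fun _ _ _ _ h => monicOf_injective _ h)]

lemma Mn_zero : Mn q 0 = {1} := by
  ext f
  rw [mem_Mn, Finset.mem_singleton]
  exact ⟨fun h => h.1.natDegree_eq_zero.1 h.2, fun h => h ▸ ⟨monic_one, natDegree_one⟩⟩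

lemma Hn_zero : Hn q 0 = {1} := by
  rw [Hn, Mn_zero]
  ext f
  simp only [Finset.mem_filter, Finset.mem_singleton]
  exact ⟨fun h => h.1, fun h => ⟨h, h ▸ squarefree_one⟩⟩

/-- Monic irreducible polynomials of degree at most `J`. -/
def Pr (q : ℕ) [Fact q.Prime] (J : ℕ) : Finset (Fqx q) :=
  (Finset.range (J + 1)).biUnion fun d => (Mn q d).filter Irreducible

/-- Monic irreducible polynomials of degree `d`. -/
def Pd (q : ℕ) [Fact q.Prime] (d : ℕ) : Finset (Fqx q) := (Mn q d).filter Irreducible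

lemma mem_Pd {d : ℕ} {P : Fqx q} : P ∈ Pd q d ↔ P.Monic ∧ Irreducible P ∧ P.natDegree = d := by
  simp [Pd, mem_Mn]; tauto

lemma mem_Pr {J : ℕ} {P : Fqx q} : P ∈ Pr q J ↔ P.Monic ∧ Irreducible P ∧ P.natDegree ≤ J := by
  simp only [Pr, Finset.mem_biUnion, Finset.mem_range, Finset.mem_filter, mem_Mn]
  constructor
  · rintro ⟨d, hd, ⟨h1, h2⟩, h3⟩
    exact ⟨h1, h3, by omega⟩
  · rintro ⟨h1, h2, h3⟩
    exact ⟨P.natDegree, by omega, ⟨h1, rfl⟩, h2⟩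

lemma Pd_zero : Pd q 0 = ∅ := by
  ext P
  simp only [mem_Pd, Finset.notMem_empty, iff_false]
  rintro ⟨-, h, h0⟩
  exact h.natDegree_pos.ne' h0

lemma card_Pd_le (d : ℕ) : (Pd q d).card ≤ q ^ d :=
  (Finset.card_filter_le _ _).trans (card_Mn d).le

lemma sum_Pr {E : Type*} [AddCommMonoid E] (J : ℕ) (F : Fqx q → E) :
    ∑ P ∈ Pr q J, F P = ∑ d ∈ Finset.Icc 1 J, ∑ P ∈ Pd q d, F P := by
  rw [Pr, Finset.sum_biUnion]
  · rw [Finset.sum_range_succ']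
    change _ + ∑ P ∈ Pd q 0, F P = _
    rw [Pd_zero, Finset.sum_empty, add_zero, Finset.range_eq_Ico,
      Finset.sum_Ico_add' (fun d => ∑ P ∈ (Mn q d).filter Irreducible, F P) 0 J 1]
    rfl
  · intro d _ e _ hde
    simp only [Function.onFun]
    rw [Finset.disjoint_left]
    intro P h1 h2
    simp only [Finset.mem_filter, mem_Mn] at h1 h2
    exact hde (h1.1.2.symm.trans h2.1.2)

/-- Monic irreducible divisors. -/
def pf (f : Fqx q) : Finset (Fqx q) := (UniqueFactorizationMonoid.normalizedFactors f).toFinset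

/-- The exponent of `P` in `f`. -/
def vv (P f : Fqx q) : ℕ := (UniqueFactorizationMonoid.normalizedFactors f).count P

lemma normalize_monic {f : Fqx q} (hf : f.Monic) : normalize f = f := hf.normalize_eq_self

lemma mem_nf {f P : Fqx q} (hf : f ≠ 0) :
    P ∈ UniqueFactorizationMonoid.normalizedFactors f ↔ P.Monic ∧ Irreducible P ∧ P ∣ f := by
  rw [Polynomial.mem_normalizedFactors_iff hf]
  tauto

lemma mem_pf {f P : Fqx q} (hf : f ≠ 0) : P ∈ pf f ↔ P.Monic ∧ Irreducible P ∧ P ∣ f := by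
  rw [pf, Multiset.mem_toFinset, mem_nf hf]

lemma prod_nf {f : Fqx q} (hf : f.Monic) :
    (UniqueFactorizationMonoid.normalizedFactors f).prod = f := by
  have h := UniqueFactorizationMonoid.prod_normalizedFactors_eq (a := f) hf.ne_zero
  rw [h, normalize_monic hf]

lemma nf_mul {f g : Fqx q} (hf : f ≠ 0) (hg : g ≠ 0) :
    UniqueFactorizationMonoid.normalizedFactors (f * g) =
      UniqueFactorizationMonoid.normalizedFactors f +
      UniqueFactorizationMonoid.normalizedFactors g :=
  UniqueFactorizationMonoid.normalizedFactors_mul hf hg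

lemma vv_mul {f g : Fqx q} (P : Fqx q) (hf : f ≠ 0) (hg : g ≠ 0) :
    vv P (f * g) = vv P f + vv P g := by
  rw [vv, nf_mul hf hg, Multiset.count_add]; rfl

lemma pf_mul {f g : Fqx q} (hf : f ≠ 0) (hg : g ≠ 0) : pf (f * g) = pf f ∪ pf g := by
  rw [pf, nf_mul hf hg, Multiset.toFinset_add]; rfl

lemma pf_one : pf (1 : Fqx q) = ∅ := by simp [pf]

lemma vv_eq_zero {f P : Fqx q} (h : P ∉ pf f) : vv P f = 0 := by
  rw [pf, Multiset.mem_toFinset] at h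
  exact Multiset.count_eq_zero_of_notMem h

lemma vv_pos {f P : Fqx q} (h : P ∈ pf f) : 0 < vv P f := by
  rw [pf, Multiset.mem_toFinset] at h
  exact Multiset.count_pos.2 h

lemma eq_of_vv {f g : Fqx q} (hf : f.Monic) (hg : g.Monic)
    (h : ∀ P, P.Monic → Irreducible P → vv P f = vv P g) : f = g := by
  rw [← prod_nf hf, ← prod_nf hg]
  congr 1
  ext P
  by_cases hP : P.Monic ∧ Irreducible P
  · exact h P hP.1 hP.2
  · rw [Multiset.count_eq_zero_of_notMem, Multiset.count_eq_zero_of_notMem]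
    · rw [mem_nf hg.ne_zero]; tauto
    · rw [mem_nf hf.ne_zero]; tauto

lemma natDegree_eq_sum {f : Fqx q} (hf : f.Monic) :
    f.natDegree = ∑ P ∈ pf f, vv P f * P.natDegree := by
  conv_lhs => rw [← prod_nf hf]
  rw [natDegree_multiset_prod]
  · rw [Finset.sum_multiset_map_count]
    rfl
  · intro h0
    rw [mem_nf hf.ne_zero] at h0
    exact h0.1.ne_zero rfl

lemma nf_prime {P : Fqx q} (hm : P.Monic) (hi : Irreducible P) :
    UniqueFactorizationMonoid.normalizedFactors P = {P} := by
  rw [UniqueFactorizationMonoid.normalizedFactors_irreducible hi, normalize_monic hm]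

lemma nf_prime_pow {P : Fqx q} (hm : P.Monic) (hi : Irreducible P) (k : ℕ) :
    UniqueFactorizationMonoid.normalizedFactors (P ^ k) = Multiset.replicate k P := by
  rw [UniqueFactorizationMonoid.normalizedFactors_pow, nf_prime hm hi, Multiset.nsmul_singleton]

lemma vv_prime_pow {P : Fqx q} (hm : P.Monic) (hi : Irreducible P) (k : ℕ) :
    vv P (P ^ k) = k := by
  rw [vv, nf_prime_pow hm hi, Multiset.count_replicate_self]

lemma pf_prime_pow {P : Fqx q} (hm : P.Monic) (hi : Irreducible P) {k : ℕ} (hk : k ≠ 0) :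
    pf (P ^ k) = {P} := by
  rw [pf, nf_prime_pow hm hi, Multiset.toFinset_replicate, if_neg hk]

/-- The decomposition of a monic polynomial as `P ^ k * f'` with `P ∤ f'`. -/
lemma exists_pow_mul {f P : Fqx q} (hf : f.Monic) (hm : P.Monic) (hi : Irreducible P) :
    ∃ g : Fqx q, g.Monic ∧ f = P ^ vv P f * g ∧ P ∉ pf g := by
  have hle : P ^ vv P f ∣ f := by
    have h1 : Multiset.replicate (vv P f) P ≤ UniqueFactorizationMonoid.normalizedFactors f :=
      Multiset.le_count_iff_replicate_le.1 le_rfl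
    have := Multiset.prod_dvd_prod_of_le h1
    rwa [Multiset.prod_replicate, prod_nf hf] at this
  obtain ⟨g, hg⟩ := hle
  have hgm : g.Monic := (hm.pow _).of_mul_monic_left (hg ▸ hf)
  refine ⟨g, hgm, hg, fun hP => ?_⟩
  have h2 := vv_mul P (hm.pow (vv P f)).ne_zero hgm.ne_zero
  rw [← hg, vv_prime_pow hm hi] at h2
  have := vv_pos hP
  omega

/-! ### Multiplicative functions -/

/-- The multiplicative function with local values `g P k`. -/
def mf (g : Fqx q → ℕ → ℂ) (f : Fqx q) : ℂ := ∏ P ∈ pf f, g P (vv P f)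

lemma mf_one (g : Fqx q → ℕ → ℂ) : mf g 1 = 1 := by simp [mf, pf_one]

lemma mf_mul {g : Fqx q → ℕ → ℂ} {f h : Fqx q} (hf : f ≠ 0) (hh : h ≠ 0)
    (hd : Disjoint (pf f) (pf h)) : mf g (f * h) = mf g f * mf g h := by
  rw [mf, pf_mul hf hh, Finset.prod_union hd, mf, mf]
  congr 1
  · refine Finset.prod_congr rfl fun P hP => ?_
    rw [vv_mul P hf hh, vv_eq_zero (Finset.disjoint_left.1 hd hP), add_zero]
  · refine Finset.prod_congr rfl fun P hP => ?_
    rw [vv_mul P hf hh, vv_eq_zero (Finset.disjoint_right.1 hd hP), zero_add]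

lemma mf_prime_pow {g : Fqx q → ℕ → ℂ} (hg : ∀ P, g P 0 = 1) {P : Fqx q} (hm : P.Monic)
    (hi : Irreducible P) (k : ℕ) : mf g (P ^ k) = g P k := by
  rcases eq_or_ne k 0 with rfl | hk
  · simp [mf_one, hg]
  · rw [mf, pf_prime_pow hm hi hk, Finset.prod_singleton, vv_prime_pow hm hi]

/-- The local Euler factor. -/
def lf (J : ℕ) (g : ℕ → ℂ) (d : ℕ) : ℂ[X] := ∑ k ∈ Finset.range (J + 1), C (g k) * X ^ (k * d)

lemma sum_supported (g : Fqx q → ℕ → ℂ) (hg : ∀ P, g P 0 = 1) (J : ℕ) (S : Finset (Fqx q))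
    (hS : ∀ P ∈ S, P.Monic ∧ Irreducible P) (j : ℕ) (hj : j ≤ J) :
    (∏ P ∈ S, lf J (g P) P.natDegree).coeff j = ∑ f ∈ (Mn q j).filter (fun f => pf f ⊆ S), mf g f := by
  induction S using Finset.induction_on generalizing j with
  | empty =>
    rw [Finset.prod_empty, coeff_one]
    split_ifs with h
    · subst h
      rw [Mn_zero, Finset.sum_filter, Finset.sum_singleton, if_pos (by simp [pf_one]), mf_one]
    · symm
      refine Finset.sum_eq_zero fun f hf => ?_
      exfalso
      simp only [Finset.mem_filter, mem_Mn, Finset.subset_empty] at hf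
      have := natDegree_eq_sum hf.1.1
      rw [hf.2, Finset.sum_empty] at this
      omega
  | insert P S hPS ih =>
    have hS' : ∀ R ∈ S, R.Monic ∧ Irreducible R := fun R hR => hS R (Finset.mem_insert_of_mem hR)
    obtain ⟨hm, hi⟩ := hS P (Finset.mem_insert_self _ _)
    have hdpos := hi.natDegree_pos
    rw [Finset.prod_insert hPS, lf, Finset.sum_mul, finsetSum_coeff]
    rw [← Finset.sum_fiberwise_of_maps_to (g := fun f => vv P f) (t := Finset.range (J + 1))]
    · refine Finset.sum_congr rfl fun k _ => ?_
      rw [mul_assoc, coeff_C_mul, coeff_X_pow_mul']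
      split_ifs with hk
      · rw [ih hS' _ (by omega), Finset.mul_sum]
        refine Finset.sum_bij (fun f _ => P ^ k * f) ?_ ?_ ?_ ?_
        · intro f hf
          simp only [Finset.mem_filter, mem_Mn] at hf ⊢
          have hPf : P ∉ pf f := fun h => hPS (hf.2 h)
          refine ⟨⟨⟨(hm.pow k).mul hf.1.1, ?_⟩, ?_⟩, ?_⟩
          · rw [(hm.pow k).natDegree_mul hf.1.1, hm.natDegree_pow]; omega
          · rw [pf_mul (hm.pow k).ne_zero hf.1.1.ne_zero]
            refine Finset.union_subset ?_ (hf.2.trans (Finset.subset_insert _ _))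
            rcases eq_or_ne k 0 with rfl | hk0
            · simp [pf_one]
            · rw [pf_prime_pow hm hi hk0]; simp
          · rw [vv_mul P (hm.pow k).ne_zero hf.1.1.ne_zero, vv_prime_pow hm hi, vv_eq_zero hPf,
              add_zero]
        · intro f _ f' _ h
          exact mul_left_cancel₀ (hm.pow k).ne_zero h
        · intro f hf
          simp only [Finset.mem_filter, mem_Mn] at hf
          obtain ⟨f', hf'm, hff', hPf'⟩ := exists_pow_mul hf.1.1.1 hm hi
          rw [hf.2] at hff'
          refine ⟨f', ?_, hff'.symm⟩
          simp only [Finset.mem_filter, mem_Mn]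
          have hdeg := hf.1.1.2
          rw [hff', (hm.pow k).natDegree_mul hf'm, hm.natDegree_pow] at hdeg
          refine ⟨⟨hf'm, by omega⟩, fun R hR => ?_⟩
          have h1 := hf.1.2
          rw [hff', pf_mul (hm.pow k).ne_zero hf'm.ne_zero] at h1
          rcases Finset.mem_insert.1 (h1 (Finset.mem_union_right _ hR)) with h2 | h2
          · exact absurd (h2 ▸ hR) hPf'
          · exact h2
        · intro f hf
          simp only [Finset.mem_filter, mem_Mn] at hf
          rw [mf_mul (hm.pow k).ne_zero hf.1.1.ne_zero, mf_prime_pow hg hm hi]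
          rw [Finset.disjoint_left]
          intro R hR hR'
          have hk0 : k ≠ 0 := by
            rintro rfl
            simp [pf_one] at hR
          rw [pf_prime_pow hm hi hk0, Finset.mem_singleton] at hR
          exact hPS (hf.2 (hR ▸ hR'))
      · rw [mul_zero]
        symm
        refine Finset.sum_eq_zero fun f hf => ?_
        exfalso
        simp only [Finset.mem_filter, mem_Mn] at hf
        obtain ⟨f', hf'm, hff', hPf'⟩ := exists_pow_mul hf.1.1.1 hm hi
        have hdeg := hf.1.1.2
        rw [hff', (hm.pow _).natDegree_mul hf'm, hm.natDegree_pow, hf.2] at hdeg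
        omega
    · intro f hf
      simp only [Finset.mem_filter, mem_Mn] at hf
      rw [Finset.mem_range]
      obtain ⟨f', hf'm, hff', hPf'⟩ := exists_pow_mul hf.1.1 hm hi
      have hdeg := hf.1.2
      rw [hff', (hm.pow _).natDegree_mul hf'm, hm.natDegree_pow] at hdeg
      nlinarith

/-- The Euler product up to degree `J`. -/
lemma euler_product (g : Fqx q → ℕ → ℂ) (hg : ∀ P, g P 0 = 1) (J j : ℕ) (hj : j ≤ J) :
    ∑ f ∈ Mn q j, mf g f = (∏ P ∈ Pr q J, lf J (g P) P.natDegree).coeff j := by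
  rw [sum_supported g hg J (Pr q J) (fun P hP => ⟨(mem_Pr.1 hP).1, (mem_Pr.1 hP).2.1⟩) j hj]
  congr 1
  symm
  rw [Finset.filter_true_of_mem]
  intro f hf P hP
  rw [mem_Mn] at hf
  rw [mem_pf hf.1.ne_zero] at hP
  rw [mem_Pr]
  exact ⟨hP.1, hP.2.1, (natDegree_le_of_dvd hP.2.2 hf.1.ne_zero).trans (hf.2.le.trans hj)⟩

end

section
variable {q : ℕ} [Fact q.Prime]

/-- Congruence of polynomials up to degree `J`. -/
def TE (J : ℕ) (p r : ℂ[X]) : Prop := X ^ (J + 1) ∣ p - r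

lemma TE.refl (J : ℕ) (p : ℂ[X]) : TE J p p := by simp [TE]

lemma TE.of_eq {J : ℕ} {p r : ℂ[X]} (h : p = r) : TE J p r := h ▸ TE.refl J p

lemma TE.symm {J : ℕ} {p r : ℂ[X]} (h : TE J p r) : TE J r p := by
  unfold TE at *; rw [← neg_sub]; exact (dvd_neg).2 h

lemma TE.trans {J : ℕ} {p r s : ℂ[X]} (h : TE J p r) (h' : TE J r s) : TE J p s := by
  unfold TE at *; rw [← sub_add_sub_cancel p r s]; exact dvd_add h h'

lemma TE.mul {J : ℕ} {p r p' r' : ℂ[X]} (h : TE J p r) (h' : TE J p' r') :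
    TE J (p * p') (r * r') := by
  unfold TE at *
  have : p * p' - r * r' = (p - r) * p' + r * (p' - r') := by ring
  rw [this]
  exact dvd_add (h.mul_right _) (h'.mul_left _)

lemma TE.add {J : ℕ} {p r p' r' : ℂ[X]} (h : TE J p r) (h' : TE J p' r') :
    TE J (p + p') (r + r') := by
  unfold TE at *
  rw [add_sub_add_comm]
  exact dvd_add h h'

lemma TE.pow {J : ℕ} {p r : ℂ[X]} (h : TE J p r) (k : ℕ) : TE J (p ^ k) (r ^ k) := by
  induction k with
  | zero => simpa using TE.refl J _
  | succ k ih => rw [pow_succ, pow_succ]; exact ih.mul h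

lemma TE.prod {ι : Type*} {J : ℕ} {s : Finset ι} {p r : ι → ℂ[X]} (h : ∀ i ∈ s, TE J (p i) (r i)) :
    TE J (∏ i ∈ s, p i) (∏ i ∈ s, r i) := by
  induction s using Finset.induction_on with
  | empty => simpa using TE.refl J _
  | insert a s ha ih =>
    rw [Finset.prod_insert ha, Finset.prod_insert ha]
    exact (h a (Finset.mem_insert_self _ _)).mul
      (ih fun i hi => h i (Finset.mem_insert_of_mem hi))

lemma TE_iff {J : ℕ} {p r : ℂ[X]} : TE J p r ↔ ∀ j ≤ J, p.coeff j = r.coeff j := by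
  rw [TE, X_pow_dvd_iff]
  simp only [coeff_sub, sub_eq_zero, Nat.lt_succ_iff]

lemma TE.coeff {J : ℕ} {p r : ℂ[X]} (h : TE J p r) {j : ℕ} (hj : j ≤ J) :
    p.coeff j = r.coeff j := TE_iff.1 h j hj

/-- Cancel a polynomial with constant coefficient one. -/
lemma TE.cancel {J : ℕ} {p r s : ℂ[X]} (hs : s.coeff 0 ≠ 0) (h : TE J (p * s) (r * s)) :
    TE J p r := by
  unfold TE at *
  rw [← sub_mul] at h
  have hc : IsCoprime ((X : ℂ[X]) ^ (J + 1)) s := by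
    apply IsCoprime.pow_left
    exact ((irreducible_X (R := ℂ)).coprime_iff_not_dvd).2 (fun h' => hs (X_dvd_iff.1 h'))
  exact hc.dvd_of_dvd_mul_right h

/-! ### Squarefree decomposition -/

lemma vv_le_one {a : Fqx q} (ha : a.Monic) (hs : Squarefree a) (P : Fqx q) : vv P a ≤ 1 := by
  rw [UniqueFactorizationMonoid.squarefree_iff_nodup_normalizedFactors ha.ne_zero] at hs
  exact Multiset.nodup_iff_count_le_one.1 hs P

lemma exists_mul_sq (n : ℕ) : ∀ f : Fqx q, f.Monic → f.natDegree = n →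
    ∃ a b : Fqx q, a.Monic ∧ b.Monic ∧ Squarefree a ∧ f = a * b ^ 2 := by
  induction n using Nat.strong_induction_on with
  | _ n ih =>
    intro f hf hn
    by_cases hs : Squarefree f
    · exact ⟨f, 1, hf, monic_one, hs, by ring⟩
    · rw [UniqueFactorizationMonoid.squarefree_iff_nodup_normalizedFactors hf.ne_zero,
        Multiset.nodup_iff_count_le_one] at hs
      push Not at hs
      obtain ⟨P, hP⟩ := hs
      have hPm : P ∈ UniqueFactorizationMonoid.normalizedFactors f := by
        rw [← Multiset.count_pos]; omega
      rw [mem_nf hf.ne_zero] at hPm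
      obtain ⟨g, hg, hfg, -⟩ := exists_pow_mul hf hPm.1 hPm.2.1
      have hm : (P ^ (vv P f - 2) * g).Monic := (hPm.1.pow _).mul hg
      have hfac : f = P ^ 2 * (P ^ (vv P f - 2) * g) := by
        rw [← mul_assoc, ← pow_add, Nat.add_sub_cancel' (show 2 ≤ vv P f from hP)]
        exact hfg
      have hd := congrArg natDegree hfac
      rw [(hPm.1.pow 2).natDegree_mul hm, hPm.1.natDegree_pow] at hd
      have := hPm.2.1.natDegree_pos
      obtain ⟨a, b, ha, hb, has, hab⟩ := ih _ (by omega) _ hm rfl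
      refine ⟨a, P * b, ha, hPm.1.mul hb, has, ?_⟩
      rw [hfac, hab]; ring

lemma vv_mul_sq {a b : Fqx q} (P : Fqx q) (ha : a.Monic) (hb : b.Monic) :
    vv P (a * b ^ 2) = vv P a + 2 * vv P b := by
  rw [pow_two, vv_mul P ha.ne_zero (hb.mul hb).ne_zero, vv_mul P hb.ne_zero hb.ne_zero]
  ring

lemma mul_sq_inj {a b a' b' : Fqx q} (ha : a.Monic) (hb : b.Monic) (hs : Squarefree a)
    (ha' : a'.Monic) (hb' : b'.Monic) (hs' : Squarefree a') (h : a * b ^ 2 = a' * b' ^ 2) :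
    a = a' ∧ b = b' := by
  have key : ∀ P, vv P a = vv P a' ∧ vv P b = vv P b' := by
    intro P
    have h1 := vv_mul_sq P ha hb
    rw [h, vv_mul_sq P ha' hb'] at h1
    have := vv_le_one ha hs P
    have := vv_le_one ha' hs' P
    omega
  exact ⟨eq_of_vv ha ha' fun P _ _ => (key P).1, eq_of_vv hb hb' fun P _ _ => (key P).2⟩

lemma sum_mul_sq (N : ℕ) (F : Fqx q → ℂ) :
    ∑ f ∈ Mn q N, F f =
      ∑ B ∈ Finset.range (N / 2 + 1), ∑ b ∈ Mn q B, ∑ a ∈ Hn q (N - 2 * B), F (a * b ^ 2) := by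
  rw [Finset.sum_congr rfl fun B _ => (Finset.sum_product' (Mn q B) (Hn q (N - 2 * B))
    (fun b a => F (a * b ^ 2))).symm]
  rw [Finset.sum_sigma' (Finset.range (N / 2 + 1)) (fun B => Mn q B ×ˢ Hn q (N - 2 * B))
    (fun B x => F (x.2 * x.1 ^ 2))]
  symm
  refine Finset.sum_bij (fun x _ => x.2.2 * x.2.1 ^ 2) ?_ ?_ ?_ ?_
  · rintro ⟨B, b, a⟩ h
    simp only [Finset.mem_sigma, Finset.mem_range, Finset.mem_product, mem_Mn, mem_Hn] at h ⊢
    refine ⟨h.2.2.1.mul (h.2.1.1.pow 2), ?_⟩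
    rw [h.2.2.1.natDegree_mul (h.2.1.1.pow 2), h.2.1.1.natDegree_pow]
    omega
  · rintro ⟨B, b, a⟩ h ⟨B', b', a'⟩ h' heq
    simp only [Finset.mem_sigma, Finset.mem_range, Finset.mem_product, mem_Mn, mem_Hn] at h h' heq
    obtain ⟨h1, h2⟩ := mul_sq_inj h.2.2.1 h.2.1.1 h.2.2.2.2 h'.2.2.1 h'.2.1.1 h'.2.2.2.2 heq
    subst h1 h2
    obtain rfl : B = B' := h.2.1.2.symm.trans h'.2.1.2
    rfl
  · intro f hf
    rw [mem_Mn] at hf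
    obtain ⟨a, b, ha, hb, hs, hab⟩ := exists_mul_sq _ f hf.1 rfl
    have hd := hf.2
    rw [hab, ha.natDegree_mul (hb.pow 2), hb.natDegree_pow] at hd
    refine ⟨⟨b.natDegree, b, a⟩, ?_, hab.symm⟩
    simp only [Finset.mem_sigma, Finset.mem_range, Finset.mem_product, mem_Mn, mem_Hn]
    exact ⟨by omega, ⟨hb, trivial⟩, ha, by omega, hs⟩
  · intros; rfl

/-! ### Pointwise bounds for multiplicative functions -/

lemma prod_pf_le (h : Fqx q → ℕ → ℝ) (M t : ℝ) (hM : 1 ≤ M) (ht : 1 ≤ t) (d0 : ℕ)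
    (h0 : ∀ P k, 0 ≤ h P k)
    (h1 : ∀ P k, 1 ≤ k → h P k ≤ M * t ^ (k * P.natDegree))
    (h2 : ∀ P k, 1 ≤ k → d0 < P.natDegree → h P k ≤ t ^ (k * P.natDegree))
    (b : Fqx q) (hb : b.Monic) :
    ∏ P ∈ pf b, h P (vv P b) ≤ M ^ (Pr q d0).card * t ^ b.natDegree := by
  have hstep : ∀ P ∈ pf b, h P (vv P b) ≤
      (if P ∈ Pr q d0 then M else 1) * t ^ (vv P b * P.natDegree) := by
    intro P hP
    have hk := vv_pos hP
    split_ifs with hd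
    · exact h1 P _ hk
    · rw [one_mul]
      refine h2 P _ hk ?_
      rw [mem_pf hb.ne_zero] at hP
      by_contra hcon
      exact hd (mem_Pr.2 ⟨hP.1, hP.2.1, not_lt.1 hcon⟩)
  refine (Finset.prod_le_prod (fun P _ => h0 P _) hstep).trans ?_
  rw [Finset.prod_mul_distrib, Finset.prod_pow_eq_pow_sum, ← natDegree_eq_sum hb]
  gcongr
  rw [← Finset.prod_filter, Finset.prod_const]
  exact pow_le_pow_right₀ hM (Finset.card_le_card (fun P hP => (Finset.mem_filter.1 hP).2))

lemma card_pf_le {b : Fqx q} (hb : b.Monic) : (pf b).card ≤ b.natDegree := by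
  rw [natDegree_eq_sum hb, Finset.card_eq_sum_ones]
  refine Finset.sum_le_sum fun P hP => ?_
  have h1 := vv_pos hP
  rw [mem_pf hb.ne_zero] at hP
  have h2 := hP.2.1.natDegree_pos
  exact Nat.one_le_iff_ne_zero.2 (by positivity)

lemma sum_pf_le (R : ℝ) (hR0 : 0 ≤ R) (hR : R ≤ 1) (d0 : ℕ) {b : Fqx q} (hb : b.Monic) :
    ∑ P ∈ pf b, R ^ P.natDegree ≤ (Pr q d0).card + R ^ d0 * b.natDegree := by
  have hstep : ∀ P ∈ pf b, R ^ P.natDegree ≤ (if P ∈ Pr q d0 then 1 else 0) + R ^ d0 := by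
    intro P hP
    have hRd : 0 ≤ R ^ d0 := pow_nonneg hR0 _
    split_ifs with hd
    · have := pow_le_one₀ hR0 hR (n := P.natDegree)
      linarith
    · rw [zero_add]
      refine pow_le_pow_of_le_one hR0 hR ?_
      rw [mem_pf hb.ne_zero] at hP
      by_contra hcon
      exact hd (mem_Pr.2 ⟨hP.1, hP.2.1, (not_le.1 hcon).le⟩)
  refine (Finset.sum_le_sum hstep).trans ?_
  rw [Finset.sum_add_distrib, Finset.sum_const, nsmul_eq_mul, ← Finset.sum_filter,
    Finset.sum_const, nsmul_eq_mul, mul_one, mul_comm (R ^ d0)]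
  gcongr
  · exact fun P hP => (Finset.mem_filter.1 hP).2
  · exact card_pf_le hb

lemma exists_sum_pf_le (R : ℝ) (hR0 : 0 ≤ R) (hR : R < 1) (ε : ℝ) (hε : 0 < ε) :
    ∃ C : ℝ, 0 ≤ C ∧ ∀ b : Fqx q, b.Monic → ∑ P ∈ pf b, R ^ P.natDegree ≤ C + ε * b.natDegree := by
  obtain ⟨d0, hd0⟩ := exists_pow_lt_of_lt_one hε hR
  refine ⟨(Pr q d0).card, Nat.cast_nonneg _, fun b hb => ?_⟩
  refine (sum_pf_le R hR0 hR.le d0 hb).trans ?_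
  gcongr

end

section
variable {q : ℕ} [Fact q.Prime] [hq4 : Fact (q % 4 = 1)]

lemma q_ne_two : q ≠ 2 := by
  have := hq4.out
  rintro rfl
  norm_num at this

lemma q_ge_five : 5 ≤ q := by
  have h1 := hq4.out
  have h2 := (Fact.out : q.Prime).two_le
  omega

lemma isSquare_neg_one : IsSquare (-1 : ZMod q) := by
  rw [ZMod.exists_sq_eq_neg_one_iff]
  have := hq4.out
  omega

/-! ### The residue field -/

instance adjoinRoot_finite (P : Fqx q) [h : Fact (Irreducible P)] : Finite (AdjoinRoot P) := by
  have := (AdjoinRoot.powerBasis h.out.ne_zero).finite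
  exact Module.finite_of_finite (ZMod q)

instance adjoinRoot_fintype (P : Fqx q) [Fact (Irreducible P)] : Fintype (AdjoinRoot P) :=
  Fintype.ofFinite _

lemma ringChar_adjoinRoot (P : Fqx q) [Fact (Irreducible P)] : ringChar (AdjoinRoot P) ≠ 2 := by
  have h : CharP (AdjoinRoot P) q := charP_of_injective_algebraMap' (ZMod q) q
  rw [ringChar.eq (AdjoinRoot P) q]
  exact q_ne_two

lemma legSym_eq (f P : Fqx q) [Fact (Irreducible P)] :
    legSym q f P = quadraticChar (AdjoinRoot P) (AdjoinRoot.mk P f) := by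
  rw [quadraticChar_apply, quadraticCharFun, legSym]
  simp only [AdjoinRoot.mk_eq_zero]
  split_ifs with h1 h2 h3 h3
  · rfl
  · rfl
  · obtain ⟨g, hg⟩ := h2
    refine absurd ⟨AdjoinRoot.mk P g, ?_⟩ h3
    rw [← map_mul, AdjoinRoot.mk_eq_mk, ← pow_two, ← dvd_neg, neg_sub]
    exact hg
  · obtain ⟨y, hy⟩ := h3
    obtain ⟨g, rfl⟩ := AdjoinRoot.mk_surjective y
    rw [← map_mul, AdjoinRoot.mk_eq_mk, ← pow_two, ← dvd_neg, neg_sub] at hy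
    exact absurd ⟨g, hy⟩ h2
  · rfl

section
variable {P : Fqx q}

lemma legSym_mul (hP : Irreducible P) (f g : Fqx q) :
    legSym q (f * g) P = legSym q f P * legSym q g P := by
  have := Fact.mk hP
  rw [legSym_eq, legSym_eq, legSym_eq, map_mul, map_mul]

lemma legSym_congr (hP : Irreducible P) {f g : Fqx q} (h : P ∣ f - g) :
    legSym q f P = legSym q g P := by
  have := Fact.mk hP
  rw [legSym_eq, legSym_eq, AdjoinRoot.mk_eq_mk.2 h]

lemma legSym_eq_zero_iff (f : Fqx q) : legSym q f P = 0 ↔ P ∣ f := by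
  unfold legSym; split_ifs <;> simp_all

lemma legSym_abs_le (f : Fqx q) : |legSym q f P| ≤ 1 := by
  unfold legSym; split_ifs <;> simp

lemma legSym_sq (f : Fqx q) : legSym q f P ^ 2 = if P ∣ f then 0 else 1 := by
  unfold legSym; split_ifs <;> simp

lemma legSym_assoc {P' : Fqx q} (h : Associated P P') (f : Fqx q) :
    legSym q f P = legSym q f P' := by
  unfold legSym
  simp only [h.dvd_iff_dvd_left]

lemma legSym_one (hP : Irreducible P) : legSym q 1 P = 1 := by
  have := Fact.mk hP
  rw [legSym_eq, map_one, map_one]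

lemma legSym_sq_arg (hP : Irreducible P) (f : Fqx q) :
    legSym q (f ^ 2) P = if P ∣ f then 0 else 1 := by
  rw [pow_two, legSym_mul hP, ← pow_two, legSym_sq]

end

/-! ### The Jacobi symbol -/

lemma jacSym_eq (D : Fqx q) {f : Fqx q} (hf : f ≠ 0) :
    jacSym q D f =
      ((UniqueFactorizationMonoid.normalizedFactors f).map fun P => legSym q D P).prod := by
  rw [jacSym, if_neg hf, UniqueFactorizationMonoid.normalizedFactors, Multiset.map_map]
  congr 1
  refine Multiset.map_congr rfl fun P _ => ?_
  exact legSym_assoc (associated_normalize P) D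

lemma chi_eq (D : Fqx q) {f : Fqx q} (hf : f ≠ 0) :
    chi q D f =
      ((UniqueFactorizationMonoid.normalizedFactors f).map fun P => (legSym q D P : ℂ)).prod := by
  rw [chi, jacSym_eq D hf]
  rw [Int.cast_multiset_prod, Multiset.map_map]
  rfl

lemma chi_prime (D : Fqx q) {P : Fqx q} (hm : P.Monic) (hi : Irreducible P) :
    chi q D P = (legSym q D P : ℂ) := by
  rw [chi_eq D hi.ne_zero, nf_prime hm hi]
  simp

lemma chi_one_right (D : Fqx q) : chi q D 1 = 1 := by
  rw [chi_eq D one_ne_zero]; simp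

lemma chi_mul_right (D : Fqx q) {f g : Fqx q} (hf : f ≠ 0) (hg : g ≠ 0) :
    chi q D (f * g) = chi q D f * chi q D g := by
  rw [chi_eq D hf, chi_eq D hg, chi_eq D (mul_ne_zero hf hg), nf_mul hf hg, Multiset.map_add,
    Multiset.prod_add]

lemma chi_pow_right (D : Fqx q) {f : Fqx q} (hf : f ≠ 0) (k : ℕ) :
    chi q D (f ^ k) = chi q D f ^ k := by
  induction k with
  | zero => simp [chi_one_right]
  | succ k ih => rw [pow_succ, chi_mul_right D (pow_ne_zero _ hf) hf, ih, pow_succ]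

lemma chi_mul_left (D E : Fqx q) {f : Fqx q} (hf : f ≠ 0) :
    chi q (D * E) f = chi q D f * chi q E f := by
  rw [chi_eq _ hf, chi_eq _ hf, chi_eq _ hf, ← Multiset.prod_map_mul]
  congr 1
  refine Multiset.map_congr rfl fun P hP => ?_
  rw [legSym_mul ((mem_nf hf).1 hP).2.1]
  push_cast; rfl

lemma chi_congr {D E f : Fqx q} (hf : f ≠ 0) (h : f ∣ D - E) : chi q D f = chi q E f := by
  rw [chi_eq _ hf, chi_eq _ hf]
  congr 1
  refine Multiset.map_congr rfl fun P hP => ?_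
  rw [legSym_congr ((mem_nf hf).1 hP).2.1 (((mem_nf hf).1 hP).2.2.trans h)]

lemma chi_one_left {f : Fqx q} (hf : f ≠ 0) : chi q 1 f = 1 := by
  rw [chi_eq _ hf, Multiset.prod_eq_one]
  intro x hx
  rw [Multiset.mem_map] at hx
  obtain ⟨P, hP, rfl⟩ := hx
  rw [legSym_one ((mem_nf hf).1 hP).2.1]; simp

lemma norm_chi_le {D f : Fqx q} (hf : f ≠ 0) : ‖chi q D f‖ ≤ 1 := by
  rw [chi_eq _ hf]
  generalize UniqueFactorizationMonoid.normalizedFactors f = s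
  induction s using Multiset.induction_on with
  | empty => simp
  | cons P s ih =>
    rw [Multiset.map_cons, Multiset.prod_cons, norm_mul]
    have h1 : ‖(legSym q D P : ℂ)‖ ≤ 1 := by
      rw [Complex.norm_intCast]
      exact_mod_cast legSym_abs_le D
    exact mul_le_one₀ h1 (norm_nonneg _) ih

lemma chi_eq_mf (D : Fqx q) {f : Fqx q} (hf : f.Monic) :
    chi q D f = mf (fun P k => chi q D P ^ k) f := by
  rw [chi_eq D hf.ne_zero, Finset.prod_multiset_map_count, mf]
  refine Finset.prod_congr rfl fun P hP => ?_
  rw [mem_pf hf.ne_zero] at hP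
  rw [chi_prime D hP.1 hP.2.1]
  rfl

lemma chi_sq_right (D : Fqx q) {f : Fqx q} (hf : f.Monic) :
    chi q D (f ^ 2) = if ∃ P ∈ pf f, P ∣ D then 0 else 1 := by
  rw [chi_pow_right D hf.ne_zero, chi_eq_mf D hf, mf, ← Finset.prod_pow]
  split_ifs with h
  · obtain ⟨P, hP, hPD⟩ := h
    refine Finset.prod_eq_zero hP ?_
    have hk := vv_pos hP
    rw [mem_pf hf.ne_zero] at hP
    rw [chi_prime D hP.1 hP.2.1, (legSym_eq_zero_iff D).2 hPD]
    simp [hk.ne']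
  · push Not at h
    refine Finset.prod_eq_one fun P hP => ?_
    have hPD := h P hP
    rw [mem_pf hf.ne_zero] at hP
    rw [← pow_mul, mul_comm, pow_mul, chi_prime D hP.1 hP.2.1]
    have := legSym_sq (P := P) D
    rw [if_neg hPD] at this
    have h2 : ((legSym q D P : ℤ) : ℂ) ^ 2 = 1 := by exact_mod_cast this
    rw [h2, one_pow]

end

section
variable {q : ℕ} [Fact q.Prime] [hq4 : Fact (q % 4 = 1)]

/-! ### Additive characters on residues -/

/-- The standard additive character of `ZMod q`. -/
def psi : AddChar (ZMod q) ℂ := ZMod.stdAddChar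

lemma psi_one_ne : psi (1 : ZMod q) ≠ 1 := by
  intro h
  have := ZMod.injective_stdAddChar (N := q) (h.trans (AddChar.map_zero_eq_one _).symm)
  exact one_ne_zero this

lemma psi_prim : (psi : AddChar (ZMod q) ℂ).IsPrimitive := ZMod.isPrimitive_stdAddChar q

/-- The exponential `e(a/f)`. -/
def ee (f a : Fqx q) : ℂ := psi ((a %ₘ f).coeff (f.natDegree - 1))

lemma ee_add (f a b : Fqx q) : ee f (a + b) = ee f a * ee f b := by
  rw [ee, add_modByMonic, coeff_add, AddChar.map_add_eq_mul]; rfl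

lemma ee_zero (f : Fqx q) : ee f 0 = 1 := by
  rw [ee, zero_modByMonic, coeff_zero, AddChar.map_zero_eq_one]

lemma ee_congr {f a b : Fqx q} (hf : f.Monic) (h : f ∣ a - b) : ee f a = ee f b := by
  have h' := (modByMonic_eq_zero_iff_dvd hf).2 h
  rw [sub_modByMonic, sub_eq_zero] at h'
  rw [ee, ee, h']

lemma dvd_mod_sub {f : Fqx q} (a : Fqx q) : f ∣ a %ₘ f - a := by
  rw [modByMonic_eq_sub_mul_div]
  simp

lemma ee_mod {f : Fqx q} (hf : f.Monic) (a : Fqx q) : ee f (a %ₘ f) = ee f a :=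
  ee_congr hf (dvd_mod_sub a)

lemma ee_small {f a : Fqx q} (hf : f.Monic) (h : a.degree < f.natDegree) :
    ee f a = psi (a.coeff (f.natDegree - 1)) := by
  rw [ee, (modByMonic_eq_self_iff hf).2]
  rwa [degree_eq_natDegree hf.ne_zero]

lemma mod_degree_lt {f : Fqx q} (hf : f.Monic) (a : Fqx q) : (a %ₘ f).degree < f.natDegree := by
  rw [← degree_eq_natDegree hf.ne_zero]; exact degree_modByMonic_lt _ hf

lemma mod_mem_Rn {f : Fqx q} (hf : f.Monic) (a : Fqx q) : a %ₘ f ∈ Rn q f.natDegree :=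
  mem_Rn.2 (mod_degree_lt hf a)

lemma ee_mul_left {f g : Fqx q} (hf : f.Monic) (hg : g.Monic) (h1 : 1 ≤ f.natDegree) (a : Fqx q) :
    ee (f * g) (g * a) = ee f a := by
  have hr : (g * a) %ₘ (f * g) = g * (a %ₘ f) := by
    refine (div_modByMonic_unique (a /ₘ f) _ (hf.mul hg) ⟨?_, ?_⟩).2
    · conv_rhs => rw [← modByMonic_add_div a f]
      ring
    · rw [degree_mul, degree_mul, add_comm]
      refine WithBot.add_lt_add_right (degree_ne_bot.2 hg.ne_zero) (degree_modByMonic_lt _ hf)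
  rw [ee, hr, ee, hf.natDegree_mul hg]
  have : f.natDegree + g.natDegree - 1 = g.natDegree + (f.natDegree - 1) := by omega
  rw [this, coeff_mul_add_eq_of_natDegree_le le_rfl]
  · rw [hg.coeff_natDegree, one_mul]
  · have := mod_degree_lt hf a
    by_cases h0 : a %ₘ f = 0
    · simp [h0]
    · rw [degree_eq_natDegree h0] at this
      have : (a %ₘ f).natDegree < f.natDegree := by exact_mod_cast this
      omega

/-! ### Sums over residues -/

lemma sum_perm {f : Fqx q} (hf : f.Monic) (F : Fqx q → ℂ)
    (hF : ∀ u, F (u %ₘ f) = F u) (φ : Fqx q → Fqx q) (hφ : ∀ u v, f ∣ φ u - φ v → f ∣ u - v) :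
    ∑ u ∈ Rn q f.natDegree, F (φ u) = ∑ u ∈ Rn q f.natDegree, F u := by
  have hmaps : ∀ u ∈ Rn q f.natDegree, φ u %ₘ f ∈ Rn q f.natDegree := fun u _ => mod_mem_Rn hf _
  have hinj : Set.InjOn (fun u => φ u %ₘ f) (Rn q f.natDegree : Set (Fqx q)) := by
    intro u hu v hv h
    simp only at h
    have h1 : f ∣ φ u - φ v := by
      rw [← modByMonic_eq_zero_iff_dvd hf, sub_modByMonic, h, sub_self]
    have h2 := hφ u v h1
    rw [Finset.mem_coe, mem_Rn] at hu hv
    have h3 : (u - v).degree < f.degree := by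
      rw [degree_eq_natDegree hf.ne_zero]
      exact lt_of_le_of_lt (degree_sub_le _ _) (max_lt hu hv)
    exact sub_eq_zero.1 (eq_zero_of_dvd_of_degree_lt h2 h3)
  refine Finset.sum_nbij (fun u => φ u %ₘ f) hmaps hinj ?_ (fun u _ => (hF _).symm)
  exact Finset.surjOn_of_injOn_of_card_le _ hmaps hinj le_rfl

lemma sum_Rn_eq_zero (k : ℕ) (φ : Fqx q → ℂ) (hφ : ∀ a b, φ (a + b) = φ a * φ b) {w : Fqx q}
    (hw : w ∈ Rn q k) (hw1 : φ w ≠ 1) : ∑ l ∈ Rn q k, φ l = 0 := by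
  have h : ∑ l ∈ Rn q k, φ (l + w) = ∑ l ∈ Rn q k, φ l := by
    refine Finset.sum_nbij' (fun l => l + w) (fun l => l - w) ?_ ?_ ?_ ?_ ?_
    · intro l hl
      rw [mem_Rn] at *
      exact lt_of_le_of_lt (degree_add_le _ _) (max_lt hl hw)
    · intro l hl
      rw [mem_Rn] at *
      exact lt_of_le_of_lt (degree_sub_le _ _) (max_lt hl hw)
    · intros; simp
    · intros; simp
    · intros; rfl
  simp only [hφ] at h
  rw [← Finset.sum_mul] at h
  have h' : (∑ l ∈ Rn q k, φ l) * (φ w - 1) = 0 := by linear_combination h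
  exact (mul_eq_zero.1 h').resolve_right (sub_ne_zero.2 hw1)

lemma sum_ee_Rn {f : Fqx q} (hf : f.Monic) (u : Fqx q) (k : ℕ) :
    ∑ l ∈ Rn q k, ee f (l * u) =
      if (u %ₘ f).degree < ((f.natDegree - k : ℕ) : WithBot ℕ) then (q : ℂ) ^ k else 0 := by
  have hred : ∀ l, ee f (l * u) = ee f (l * (u %ₘ f)) := fun l => by
    refine ee_congr hf ?_
    rw [← mul_sub, ← dvd_neg, ← mul_neg, neg_sub]
    exact (dvd_mod_sub u).mul_left _
  simp only [hred]
  have hlt := mod_degree_lt hf u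
  set r := u %ₘ f with hr
  split_ifs with h
  · rw [Finset.sum_congr rfl (g := fun _ => (1 : ℂ))]
    · rw [Finset.sum_const, card_Rn, nsmul_eq_mul, mul_one]; push_cast; rfl
    · intro l hl
      rw [mem_Rn] at hl
      rcases eq_or_ne l 0 with rfl | hl0
      · rw [zero_mul, ee_zero]
      rcases eq_or_ne r 0 with h0 | hr0
      · rw [h0, mul_zero, ee_zero]
      rw [degree_eq_natDegree hl0] at hl
      rw [degree_eq_natDegree hr0] at h hlt
      have hl' : l.natDegree < k := by exact_mod_cast hl
      have h' : r.natDegree < f.natDegree - k := by exact_mod_cast h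
      have hd : (l * r).natDegree < f.natDegree - 1 := by
        rw [natDegree_mul hl0 hr0]; omega
      rw [ee_small hf, coeff_eq_zero_of_natDegree_lt hd, AddChar.map_zero_eq_one]
      rw [degree_eq_natDegree (mul_ne_zero hl0 hr0)]
      exact_mod_cast lt_of_lt_of_le hd (Nat.sub_le _ _)
  · have hr0 : r ≠ 0 := by
      intro h0
      rw [h0, degree_zero] at h
      exact h (WithBot.bot_lt_coe _)
    rw [degree_eq_natDegree hr0] at h hlt
    have hlt' : r.natDegree < f.natDegree := by exact_mod_cast hlt
    have h' : f.natDegree - k ≤ r.natDegree := by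
      by_contra hcon
      exact h (by exact_mod_cast (not_le.1 hcon))
    have hlead : r.leadingCoeff ≠ 0 := leadingCoeff_ne_zero.2 hr0
    refine sum_Rn_eq_zero k (fun l => ee f (l * r))
      (fun a b => by rw [add_mul, ee_add])
      (w := C r.leadingCoeff⁻¹ * X ^ (f.natDegree - 1 - r.natDegree)) ?_ ?_
    · rw [mem_Rn]
      refine lt_of_le_of_lt (degree_C_mul_X_pow_le _ _) ?_
      exact_mod_cast (by omega : f.natDegree - 1 - r.natDegree < k)
    · have hne : C r.leadingCoeff⁻¹ * X ^ (f.natDegree - 1 - r.natDegree) * r ≠ 0 :=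
        mul_ne_zero (mul_ne_zero (C_ne_zero.2 (inv_ne_zero hlead)) (pow_ne_zero _ X_ne_zero)) hr0
      rw [ee_small hf]
      · have : f.natDegree - 1 = r.natDegree + (f.natDegree - 1 - r.natDegree) := by omega
        rw [mul_assoc, coeff_C_mul]
        have hc : (X ^ (f.natDegree - 1 - r.natDegree) * r).coeff (f.natDegree - 1) =
            r.leadingCoeff := by
          conv_lhs => rw [this]
          rw [← this, mul_comm (X ^ _) r]
          conv_lhs => arg 2; rw [this]
          rw [coeff_mul_X_pow, coeff_natDegree]
        rw [hc, inv_mul_cancel₀ hlead]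
        exact psi_one_ne
      · rw [degree_eq_natDegree hne, mul_assoc,
          natDegree_C_mul (inv_ne_zero hlead), natDegree_X_pow_mul _ hr0]
        exact_mod_cast (by omega)

lemma sum_Rn_split (k m : ℕ) (F : Fqx q → ℂ) :
    ∑ u ∈ Rn q (k + m), F u = ∑ w ∈ Rn q m, ∑ l ∈ Rn q k, F (l + X ^ k * w) := by
  rw [← Finset.sum_product' (Rn q m) (Rn q k) (fun w l => F (l + X ^ k * w))]
  symm
  have hmaps : ∀ x ∈ Rn q m ×ˢ Rn q k, x.2 + X ^ k * x.1 ∈ Rn q (k + m) := by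
    rintro ⟨w, l⟩ h
    simp only [Finset.mem_product, mem_Rn] at h ⊢
    refine lt_of_le_of_lt (degree_add_le _ _) (max_lt (h.2.trans_le ?_) ?_)
    · exact_mod_cast Nat.le_add_right k m
    · rcases eq_or_ne w 0 with rfl | hw
      · simp
      · rw [degree_mul, degree_X_pow, degree_eq_natDegree hw]
        rw [degree_eq_natDegree hw] at h
        have := h.1
        have : w.natDegree < m := by exact_mod_cast this
        exact_mod_cast (by omega : k + w.natDegree < k + m)
  have hinj : Set.InjOn (fun x : Fqx q × Fqx q => x.2 + X ^ k * x.1)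
      ((Rn q m ×ˢ Rn q k : Finset (Fqx q × Fqx q)) : Set (Fqx q × Fqx q)) := by
    rintro ⟨w, l⟩ h ⟨w', l'⟩ h' heq
    simp only [Finset.coe_product, Set.mem_prod, Finset.mem_coe, mem_Rn] at h h' heq
    have hd : (X ^ k : Fqx q).degree = k := degree_X_pow k
    have h1 := div_modByMonic_unique w l (monic_X_pow k) ⟨rfl, by rw [hd]; exact h.2⟩
    have h2 := div_modByMonic_unique w' l' (monic_X_pow k) ⟨rfl, by rw [hd]; exact h'.2⟩
    rw [heq] at h1
    exact Prod.ext (h1.1.symm.trans h2.1) (h1.2.symm.trans h2.2)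
  refine Finset.sum_nbij (fun x => x.2 + X ^ k * x.1) hmaps hinj ?_ (fun _ _ => rfl)
  refine Finset.surjOn_of_injOn_of_card_le _ hmaps hinj ?_
  rw [Finset.card_product, card_Rn, card_Rn, card_Rn, pow_add, mul_comm]

lemma Rn_zero : Rn q 0 = {0} := by
  ext u
  rw [mem_Rn, Finset.mem_singleton, Nat.cast_zero, Nat.WithBot.lt_zero_iff, degree_eq_bot]

lemma sum_Rn_one (F : Fqx q → ℂ) : ∑ u ∈ Rn q 1, F u = ∑ c : ZMod q, F (C c) := by
  symm
  refine Finset.sum_nbij (fun c => C c) ?_ (fun a _ b _ h => C_injective h) ?_ (fun _ _ => rfl)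
  · intro c _
    rw [mem_Rn]
    exact lt_of_le_of_lt degree_C_le (by exact_mod_cast zero_lt_one)
  · intro u hu
    rw [Finset.mem_coe, mem_Rn] at hu
    refine ⟨u.coeff 0, Finset.mem_coe.2 (Finset.mem_univ _), ?_⟩
    refine (eq_C_of_degree_le_zero ?_).symm
    exact Nat.WithBot.lt_one_iff_le_zero.1 (by exact_mod_cast hu)

/-! ### Quadratic Gauss sums -/

/-- The quadratic character of `ZMod q`. -/
def sg (c : ZMod q) : ℂ := (quadraticChar (ZMod q) c : ℂ)

/-- The quadratic Gauss sum of `ZMod q`. -/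
def tau (q : ℕ) [Fact q.Prime] : ℂ := ∑ c : ZMod q, sg c * psi c

lemma ringChar_zmod : ringChar (ZMod q) ≠ 2 := by
  rw [ZMod.ringChar_zmod_n]; exact q_ne_two

lemma sum_sq_field {F : Type*} [Field F] [Fintype F] [DecidableEq F] (hF : ringChar F ≠ 2) (G : F → ℂ) :
    ∑ x, G (x ^ 2) = ∑ y, (1 + (quadraticChar F y : ℂ)) * G y := by
  rw [← Finset.sum_fiberwise (Finset.univ : Finset F) (fun x => x ^ 2)]
  refine Finset.sum_congr rfl fun y _ => ?_
  rw [Finset.sum_congr rfl (g := fun _ => G y)]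
  · rw [Finset.sum_const, nsmul_eq_mul]
    congr 1
    have h := quadraticChar_card_sqrts hF y
    have h2 : (Finset.univ.filter fun x : F => x ^ 2 = y) = {x : F | x ^ 2 = y}.toFinset := by
      ext; simp
    rw [h2]
    have h3 : ((({x : F | x ^ 2 = y}.toFinset.card : ℕ) : ℤ) : ℂ) =
        ((quadraticChar F y + 1 : ℤ) : ℂ) := by rw [h]
    push_cast at h3
    rw [h3]; ring
  · intro x hx
    rw [(Finset.mem_filter.1 hx).2]

lemma sum_psi_mul {c : ZMod q} (hc : c ≠ 0) : ∑ y : ZMod q, psi (c * y) = 0 := by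
  have := AddChar.sum_mulShift (ψ := psi) c (psi_prim (q := q))
  rw [if_neg hc] at this
  simp only [mul_comm c]
  simpa using this

lemma sg_mul (a b : ZMod q) : sg (a * b) = sg a * sg b := by
  unfold sg; rw [map_mul]; push_cast; rfl

lemma sg_sq {c : ZMod q} (hc : c ≠ 0) : sg c * sg c = 1 := by
  rw [← sg_mul, ← pow_two]
  unfold sg
  rw [quadraticChar_sq_one' hc]; simp

lemma sum_sg_psi_mul {c : ZMod q} (hc : c ≠ 0) :
    ∑ y : ZMod q, sg y * psi (c * y) = sg c * tau q := by
  rw [tau, Finset.mul_sum]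
  refine Fintype.sum_bijective (fun y => c * y) (mulLeft_bijective₀ c hc) _ _ fun y => ?_
  rw [sg_mul, ← mul_assoc, ← mul_assoc, sg_sq hc, one_mul]

lemma sum_psi_sq {c : ZMod q} (hc : c ≠ 0) : ∑ w : ZMod q, psi (c * w ^ 2) = sg c * tau q := by
  rw [sum_sq_field ringChar_zmod (fun y => psi (c * y)), ← sum_sg_psi_mul hc]
  simp only [add_mul, one_mul, Finset.sum_add_distrib]
  rw [sum_psi_mul hc, zero_add]
  refine Finset.sum_congr rfl fun y _ => ?_
  unfold sg
  congr

lemma tau_sq : tau q ^ 2 = q := by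
  have h1 : ((quadraticChar (ZMod q)).ringHomComp (Int.castRingHom ℂ)) ≠ 1 := by
    have := quadraticChar_ne_one (F := ZMod q) ringChar_zmod
    rwa [MulChar.ringHomComp_ne_one_iff (RingHom.injective_int _)]
  have h2 : ((quadraticChar (ZMod q)).ringHomComp (Int.castRingHom ℂ)).IsQuadratic :=
    (quadraticChar_isQuadratic (ZMod q)).comp _
  have h := gaussSum_sq h1 h2 (psi_prim (q := q))
  have h3 : gaussSum ((quadraticChar (ZMod q)).ringHomComp (Int.castRingHom ℂ)) psi = tau q := by
    rw [gaussSum, tau]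
    rfl
  rw [h3] at h
  rw [h, ZMod.card]
  have h4 : quadraticChar (ZMod q) (-1) = 1 :=
    (quadraticChar_one_iff_isSquare (by simp)).2 isSquare_neg_one
  simp [MulChar.ringHomComp_apply, h4]

lemma tau_ne_zero : tau q ≠ 0 := by
  intro h
  have := tau_sq (q := q)
  rw [h] at this
  have hq : (q : ℂ) ≠ 0 := Nat.cast_ne_zero.2 (Fact.out : q.Prime).ne_zero
  exact hq (by rw [← this]; ring)

/-- The quadratic sum `∑ e(c u² / f)`. -/
lemma sum_ee_sq {f : Fqx q} (hf : f.Monic) {c : ZMod q} (hc : c ≠ 0) :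
    ∑ u ∈ Rn q f.natDegree, ee f (C c * u ^ 2) = sg c ^ f.natDegree * tau q ^ f.natDegree := by
  set d := f.natDegree with hd
  obtain ⟨k, m, hkm, hcase⟩ : ∃ k m, k + m = d ∧ (m = k ∨ m = k + 1) := ⟨d / 2, d - d / 2, by omega, by omega⟩
  have h2 : (2 : ZMod q) ≠ 0 := by
    intro h
    have h' : ((2 : ℕ) : ZMod q) = 0 := by exact_mod_cast h
    rw [ZMod.natCast_eq_zero_iff] at h'
    have := Nat.le_of_dvd (by norm_num) h'
    have := q_ge_five (q := q)
    omega
  rw [← hkm, sum_Rn_split]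
  have hinner : ∀ w ∈ Rn q m, ∑ l ∈ Rn q k, ee f (C c * (l + X ^ k * w) ^ 2) =
      if w ∈ Rn q (m - k) then (q : ℂ) ^ k * ee f (C c * (X ^ k * w) ^ 2) else 0 := by
    intro w hw
    rw [mem_Rn] at hw
    have hexp : ∀ l ∈ Rn q k, ee f (C c * (l + X ^ k * w) ^ 2) =
        ee f (C c * (X ^ k * w) ^ 2) * ee f (l * (C (2 * c) * (X ^ k * w))) := by
      intro l hl
      have e1 : C c * (l + X ^ k * w) ^ 2 =
          C c * (X ^ k * w) ^ 2 + l * (C (2 * c) * (X ^ k * w)) + C c * l ^ 2 := by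
        rw [C_mul, C_ofNat]; ring
      rw [e1, ee_add, ee_add]
      have e2 : ee f (C c * l ^ 2) = 1 := by
        rw [mem_Rn] at hl
        rcases eq_or_ne l 0 with rfl | hl0
        · simp [ee_zero]
        rw [degree_eq_natDegree hl0] at hl
        have hl' : l.natDegree < k := by exact_mod_cast hl
        have hdeg : (C c * l ^ 2).natDegree < f.natDegree - 1 := by
          rw [natDegree_C_mul hc, natDegree_pow]; omega
        rw [ee_small hf, coeff_eq_zero_of_natDegree_lt hdeg, AddChar.map_zero_eq_one]
        refine lt_of_le_of_lt degree_le_natDegree ?_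
        exact_mod_cast lt_of_lt_of_le hdeg (Nat.sub_le _ _)
      rw [e2, mul_one]
    rw [Finset.sum_congr rfl hexp, ← Finset.mul_sum, sum_ee_Rn hf]
    have hdw : (C (2 * c) * (X ^ k * w)).degree = k + w.degree := by
      rw [degree_C_mul (mul_ne_zero h2 hc), degree_mul, degree_X_pow]
    have hmod : (C (2 * c) * (X ^ k * w)) %ₘ f = C (2 * c) * (X ^ k * w) := by
      rw [modByMonic_eq_self_iff hf, hdw, degree_eq_natDegree hf.ne_zero, ← hd, ← hkm]
      push_cast
      rcases eq_or_ne w 0 with rfl | hw0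
      · simp only [degree_zero, WithBot.add_bot]; exact WithBot.bot_lt_coe (k + m)
      rw [degree_eq_natDegree hw0] at hw ⊢
      have : w.natDegree < m := by exact_mod_cast hw
      exact_mod_cast (by omega : k + w.natDegree < k + m)
    rw [hmod, hdw]
    simp only [mem_Rn]
    have hiff : ((k : WithBot ℕ) + w.degree < ((f.natDegree - k : ℕ) : WithBot ℕ)) ↔
        w.degree < ((m - k : ℕ) : WithBot ℕ) := by
      rcases eq_or_ne w 0 with rfl | hw0
      · simp only [degree_zero, WithBot.add_bot]
        exact ⟨fun _ => WithBot.bot_lt_coe _, fun _ => WithBot.bot_lt_coe _⟩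
      rw [degree_eq_natDegree hw0]
      have e : ∀ a b : ℕ, ((a : WithBot ℕ) < (b : WithBot ℕ)) ↔ a < b := fun a b => by
        exact_mod_cast Iff.rfl
      rw [show ((k : WithBot ℕ) + (w.natDegree : WithBot ℕ)) = ((k + w.natDegree : ℕ) : WithBot ℕ)
        by push_cast; rfl, e, e]
      omega
    simp only [hiff]
    split_ifs <;> ring
  rw [Finset.sum_congr rfl hinner, ← Finset.sum_filter]
  have hfil : (Rn q m).filter (fun w => w ∈ Rn q (m - k)) = Rn q (m - k) := by
    ext w
    simp only [Finset.mem_filter, mem_Rn]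
    refine ⟨fun h => h.2, fun h => ⟨h.trans_le ?_, h⟩⟩
    exact_mod_cast Nat.sub_le m k
  rw [hfil, ← mul_pow]
  rcases hcase with rfl | rfl
  · rw [Nat.sub_self, Rn_zero, Finset.sum_singleton, mul_zero, ← two_mul, pow_mul, mul_pow, tau_sq,
      pow_two (sg c), sg_sq hc]
    simp [ee_zero]
  · rw [Nat.add_sub_cancel_left, sum_Rn_one, ← Finset.mul_sum]
    have : ∀ w : ZMod q, ee f (C c * (X ^ k * C w) ^ 2) = psi (c * w ^ 2) := by
      intro w
      have e1 : C c * (X ^ k * C w) ^ 2 = C (c * w ^ 2) * X ^ (2 * k) := by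
        rw [C_mul, C_pow]; ring
      rw [e1, ee_small hf]
      · rw [coeff_C_mul_X_pow, if_pos (by omega)]
      · refine lt_of_le_of_lt (degree_C_mul_X_pow_le _ _) ?_
        exact_mod_cast (by omega : 2 * k < d)
    simp only [this]
    rw [sum_psi_sq hc, show k + (k + 1) = 2 * k + 1 by ring, pow_succ, pow_mul, mul_pow, tau_sq,
      pow_two (sg c), sg_sq hc, one_mul]

end

section
variable {q : ℕ} [Fact q.Prime] [hq4 : Fact (q % 4 = 1)]

lemma monic_induction {p : Fqx q → Prop} (h1 : p 1)
    (hmul : ∀ P f : Fqx q, P.Monic → Irreducible P → f.Monic → p f → p (P * f))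
    (f : Fqx q) (hf : f.Monic) : p f := by
  induction hn : f.natDegree using Nat.strong_induction_on generalizing f with
  | _ n ih =>
    by_cases hu : IsUnit f
    · rw [hf.eq_one_of_isUnit hu]; exact h1
    · obtain ⟨P, hP, hPi, g, rfl⟩ := exists_monic_irreducible_factor f hu
      have hg : g.Monic := hP.of_mul_monic_left hf
      have hd : 0 < P.natDegree := hPi.natDegree_pos
      refine hmul P g hP hPi hg (ih g.natDegree ?_ g hg rfl)
      rw [← hn, hP.natDegree_mul hg]; omega

section prime
variable {P : Fqx q}

lemma sum_adjoinRoot (hP : P.Monic) [Fact (Irreducible P)]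
    (G : AdjoinRoot P → ℂ) :
    ∑ u ∈ Rn q P.natDegree, G (AdjoinRoot.mk P u) = ∑ x, G x := by
  refine Finset.sum_nbij (fun u => AdjoinRoot.mk P u) (fun _ _ => Finset.mem_univ _) ?_ ?_
    (fun _ _ => rfl)
  · intro u hu v hv h
    rw [Finset.mem_coe, mem_Rn] at hu hv
    have h3 : (u - v).degree < P.degree := by
      rw [degree_eq_natDegree hP.ne_zero]
      exact lt_of_le_of_lt (degree_sub_le _ _) (max_lt hu hv)
    exact sub_eq_zero.1 (eq_zero_of_dvd_of_degree_lt (AdjoinRoot.mk_eq_mk.1 h) h3)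
  · intro x _
    obtain ⟨u, rfl⟩ := AdjoinRoot.mk_surjective x
    exact ⟨u %ₘ P, mod_mem_Rn hP u, AdjoinRoot.mk_eq_mk.2 (dvd_mod_sub u)⟩

lemma sum_sq_residues (hP : P.Monic) (hi : Irreducible P) (F : Fqx q → ℂ)
    (hF : ∀ u v, P ∣ u - v → F u = F v) :
    ∑ u ∈ Rn q P.natDegree, F (u ^ 2) =
      ∑ u ∈ Rn q P.natDegree, (1 + (legSym q u P : ℂ)) * F u := by
  have := Fact.mk hi
  set G : AdjoinRoot P → ℂ := fun x => F (Function.surjInv AdjoinRoot.mk_surjective x) with hG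
  have hGm : ∀ u, G (AdjoinRoot.mk P u) = F u := fun u => by
    refine hF _ _ (AdjoinRoot.mk_eq_mk.1 ?_)
    exact Function.surjInv_eq _ _
  have h1 := sum_adjoinRoot hP (fun x => G (x ^ 2))
  have h2 := sum_adjoinRoot hP (fun x => (1 + (quadraticChar (AdjoinRoot P) x : ℂ)) * G x)
  rw [sum_sq_field (ringChar_adjoinRoot P) G, ← h2] at h1
  simp only [← map_pow, hGm, ← legSym_eq] at h1
  exact h1

lemma sum_legSym (hP : P.Monic) (hi : Irreducible P) :
    ∑ u ∈ Rn q P.natDegree, (legSym q u P : ℂ) = 0 := by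
  have h := sum_sq_residues hP hi (fun _ => 1) (fun _ _ _ => rfl)
  simp only [mul_one, Finset.sum_add_distrib] at h
  linear_combination -h

lemma sum_ee_full (hP : P.Monic) {V : Fqx q} (hV : ¬ P ∣ V) :
    ∑ u ∈ Rn q P.natDegree, ee P (u * V) = 0 := by
  rw [sum_ee_Rn hP, if_neg]
  rw [Nat.sub_self, Nat.cast_zero, Nat.WithBot.lt_zero_iff, degree_eq_bot,
    modByMonic_eq_zero_iff_dvd hP]
  exact hV

lemma legSym_sq_one {V : Fqx q} (hV : ¬ P ∣ V) : (legSym q V P : ℂ) * legSym q V P = 1 := by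
  have := legSym_sq (P := P) V
  rw [if_neg hV, pow_two] at this
  exact_mod_cast this

/-- `S(V; P) = G(V, P)`. -/
lemma sum_ee_sq_prime (hP : P.Monic) (hi : Irreducible P) {V : Fqx q} (hV : ¬ P ∣ V) :
    ∑ u ∈ Rn q P.natDegree, ee P (u ^ 2 * V) =
      ∑ u ∈ Rn q P.natDegree, (legSym q u P : ℂ) * ee P (u * V) := by
  rw [sum_sq_residues hP hi (fun u => ee P (u * V))]
  · simp only [add_mul, one_mul, Finset.sum_add_distrib]
    rw [sum_ee_full hP hV, zero_add]
  · intro u v h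
    refine ee_congr hP ?_
    rw [← sub_mul]
    exact h.mul_right _

lemma gauss_prime (hP : P.Monic) (hi : Irreducible P) (V : Fqx q) :
    ∑ u ∈ Rn q P.natDegree, (legSym q u P : ℂ) * ee P (u * V) =
      legSym q V P * tau q ^ P.natDegree := by
  by_cases hV : P ∣ V
  · rw [(legSym_eq_zero_iff V).2 hV, Int.cast_zero, zero_mul, ← sum_legSym hP hi]
    refine Finset.sum_congr rfl fun u _ => ?_
    have : ee P (u * V) = ee P 0 := ee_congr hP (by rw [sub_zero]; exact hV.mul_left _)
    rw [this, ee_zero, mul_one]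
  · have hone : ¬ P ∣ 1 := fun h => hi.not_isUnit (isUnit_of_dvd_one h)
    have h1 : ∑ u ∈ Rn q P.natDegree, (legSym q u P : ℂ) * ee P u = tau q ^ P.natDegree := by
      have h := sum_ee_sq_prime hP hi hone
      simp only [mul_one] at h
      rw [← h]
      have h' := sum_ee_sq hP (one_ne_zero (α := ZMod q))
      simp only [map_one, one_mul] at h'
      rw [h']
      simp [sg]
    rw [← h1]
    have hperm := sum_perm hP (fun u => (legSym q u P : ℂ) * ee P u) (fun u => by
      rw [legSym_congr hi (dvd_mod_sub u), ee_mod hP]) (fun u => u * V) (fun u v h => by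
      rw [← sub_mul] at h
      exact (hi.prime.dvd_or_dvd h).resolve_right hV)
    rw [← hperm, Finset.mul_sum]
    refine Finset.sum_congr rfl fun u _ => ?_
    rw [legSym_mul hi]
    push_cast
    linear_combination (-(legSym q u P : ℂ) * ee P (u * V)) * legSym_sq_one hV

lemma sum_ee_sq_prime' (hP : P.Monic) (hi : Irreducible P) {V : Fqx q} (hV : ¬ P ∣ V) :
    ∑ u ∈ Rn q P.natDegree, ee P (u ^ 2 * V) = legSym q V P * tau q ^ P.natDegree :=
  (sum_ee_sq_prime hP hi hV).trans (gauss_prime hP hi V)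

end prime

lemma sum_crt {f g : Fqx q} (hf : f.Monic) (hg : g.Monic) (hfg : IsCoprime f g) (H : Fqx q → ℂ) :
    ∑ u ∈ Rn q (f * g).natDegree, H u =
      ∑ u ∈ Rn q f.natDegree, ∑ v ∈ Rn q g.natDegree, H (u * g + v * f) := by
  rw [← Finset.sum_product' (Rn q f.natDegree) (Rn q g.natDegree) (fun u v => H (u * g + v * f))]
  symm
  have hdeg : (f * g).natDegree = f.natDegree + g.natDegree := hf.natDegree_mul hg
  have hmaps : ∀ x ∈ Rn q f.natDegree ×ˢ Rn q g.natDegree,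
      x.1 * g + x.2 * f ∈ Rn q (f * g).natDegree := by
    rintro ⟨u, v⟩ h
    simp only [Finset.mem_product, mem_Rn] at h ⊢
    have aux : ∀ (a b : Fqx q) (m : ℕ), a.degree < m → b ≠ 0 →
        (a * b).degree < ((m + b.natDegree : ℕ) : WithBot ℕ) := by
      intro a b m ha hb
      rcases eq_or_ne a 0 with rfl | h0
      · rw [zero_mul, degree_zero]; exact WithBot.bot_lt_coe _
      · rw [degree_mul, degree_eq_natDegree h0, degree_eq_natDegree hb]
        rw [degree_eq_natDegree h0] at ha
        have : a.natDegree < m := by exact_mod_cast ha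
        exact_mod_cast (by omega : a.natDegree + b.natDegree < m + b.natDegree)
    rw [hdeg]
    refine lt_of_le_of_lt (degree_add_le _ _) (max_lt (aux _ _ _ h.1 hg.ne_zero) ?_)
    rw [add_comm]
    exact aux _ _ _ h.2 hf.ne_zero
  have hinj : Set.InjOn (fun x : Fqx q × Fqx q => x.1 * g + x.2 * f)
      ((Rn q f.natDegree ×ˢ Rn q g.natDegree : Finset (Fqx q × Fqx q)) :
        Set (Fqx q × Fqx q)) := by
    rintro ⟨u, v⟩ h ⟨u', v'⟩ h' heq
    simp only [Finset.coe_product, Set.mem_prod, Finset.mem_coe, mem_Rn] at h h' heq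
    have e1 : (u - u') * g = (v' - v) * f := by linear_combination heq
    have d1 : f ∣ u - u' := hfg.dvd_of_dvd_mul_right (Dvd.intro_left _ e1.symm)
    have d2 : g ∣ v' - v := hfg.symm.dvd_of_dvd_mul_right (Dvd.intro_left _ e1)
    have h3 : (u - u').degree < f.degree := by
      rw [degree_eq_natDegree hf.ne_zero]
      exact lt_of_le_of_lt (degree_sub_le _ _) (max_lt h.1 h'.1)
    have h4 : (v' - v).degree < g.degree := by
      rw [degree_eq_natDegree hg.ne_zero]
      exact lt_of_le_of_lt (degree_sub_le _ _) (max_lt h'.2 h.2)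
    exact Prod.ext (sub_eq_zero.1 (eq_zero_of_dvd_of_degree_lt d1 h3))
      (sub_eq_zero.1 (eq_zero_of_dvd_of_degree_lt d2 h4)).symm
  refine Finset.sum_nbij (fun x => x.1 * g + x.2 * f) hmaps hinj ?_ (fun _ _ => rfl)
  refine Finset.surjOn_of_injOn_of_card_le _ hmaps hinj ?_
  rw [Finset.card_product, card_Rn, card_Rn, card_Rn, hdeg, pow_add]

lemma ee_crt {f g : Fqx q} (hf : f.Monic) (hg : g.Monic) (h1 : 1 ≤ f.natDegree)
    (h2 : 1 ≤ g.natDegree) (a b : Fqx q) : ee (f * g) (g * a + f * b) = ee f a * ee g b := by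
  rw [ee_add, ee_mul_left hf hg h1, mul_comm f g, ee_mul_left hg hf h2]

section recip

lemma not_dvd_of_ne {P R : Fqx q} (hP : P.Monic) (hi : Irreducible P) (hR : R.Monic)
    (hRi : Irreducible R) (hne : P ≠ R) : ¬ P ∣ R := fun h =>
  hne (eq_of_monic_of_associated hP hR (hi.associated_of_dvd hRi h))

lemma legSym_recip {P R : Fqx q} (hP : P.Monic) (hi : Irreducible P) (hR : R.Monic)
    (hRi : Irreducible R) : (legSym q P R : ℂ) = legSym q R P := by
  rcases eq_or_ne P R with rfl | hne
  · rfl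
  have hPR := not_dvd_of_ne hP hi hR hRi hne
  have hRP := not_dvd_of_ne hR hRi hP hi hne.symm
  have hcop : IsCoprime P R := (hi.coprime_iff_not_dvd).2 hPR
  have hdP := hi.natDegree_pos
  have hdR := hRi.natDegree_pos
  have h1 := sum_ee_sq (hP.mul hR) (one_ne_zero (α := ZMod q))
  rw [sum_crt hP hR hcop] at h1
  have h2 : ∀ u v : Fqx q, ee (P * R) (C 1 * (u * R + v * P) ^ 2) =
      ee P (u ^ 2 * R) * ee R (v ^ 2 * P) := by
    intro u v
    rw [← ee_crt hP hR hdP hdR]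
    refine ee_congr (hP.mul hR) ⟨2 * u * v, ?_⟩
    rw [C_1]; ring
  simp only [h2, ← Finset.mul_sum, ← Finset.sum_mul] at h1
  rw [sum_ee_sq_prime' hP hi hPR, sum_ee_sq_prime' hR hRi hRP, hP.natDegree_mul hR] at h1
  have hs : sg (1 : ZMod q) = 1 := by simp [sg]
  rw [hs, one_pow, one_mul, pow_add] at h1
  have hτ : tau q ^ P.natDegree * tau q ^ R.natDegree ≠ 0 :=
    mul_ne_zero (pow_ne_zero _ tau_ne_zero) (pow_ne_zero _ tau_ne_zero)
  have h3 : (legSym q R P : ℂ) * legSym q P R = 1 := by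
    apply mul_right_cancel₀ hτ
    linear_combination h1
  have h4 := legSym_sq_one hPR
  linear_combination (legSym q R P : ℂ) * h3 - (legSym q P R : ℂ) * h4

lemma chi_recip {D f : Fqx q} (hD : D.Monic) (hf : f.Monic) : chi q D f = chi q f D := by
  refine monic_induction (p := fun D => ∀ f : Fqx q, f.Monic → chi q D f = chi q f D) ?_ ?_ D hD f hf
  · intro f hf
    rw [chi_one_left hf.ne_zero, chi_one_right]
  · intro P D hP hi hD ih f hf
    rw [chi_mul_left _ _ hf.ne_zero, chi_mul_right _ hP.ne_zero hD.ne_zero, ih f hf]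
    congr 1
    refine monic_induction (p := fun f => chi q P f = chi q f P) ?_ ?_ f hf
    · rw [chi_one_left hP.ne_zero, chi_one_right]
    · intro R f hR hRi hf ih
      rw [chi_mul_left _ _ hP.ne_zero, chi_mul_right _ hR.ne_zero hf.ne_zero, ih]
      congr 1
      rw [chi_prime _ hR hRi, chi_prime _ hP hi, legSym_recip hP hi hR hRi]

lemma chi_C {c : ZMod q} (hc : c ≠ 0) {f : Fqx q} (hf : f.Monic) :
    chi q (C c) f = sg c ^ f.natDegree := by
  refine monic_induction (p := fun f => chi q (C c) f = sg c ^ f.natDegree) ?_ ?_ f hf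
  · rw [chi_one_right]; simp
  · intro P f hP hi hf ih
    rw [chi_mul_right _ hP.ne_zero hf.ne_zero, ih, hP.natDegree_mul hf, pow_add]
    congr 1
    have hnd : ¬ P ∣ C c := fun h => hi.not_isUnit (isUnit_of_dvd_unit h (isUnit_C.2 (isUnit_iff_ne_zero.2 hc)))
    have h1 := sum_ee_sq hP hc
    have h2 := sum_ee_sq_prime' hP hi hnd
    simp only [mul_comm _ (C c)] at h2
    rw [h1] at h2
    rw [chi_prime _ hP hi]
    exact (mul_right_cancel₀ (pow_ne_zero _ tau_ne_zero) h2).symm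

lemma gauss_sqfree {a : Fqx q} (ha : a.Monic) (hsq : Squarefree a) (V : Fqx q) :
    ∑ u ∈ Rn q a.natDegree, chi q u a * ee a (u * V) = chi q V a * tau q ^ a.natDegree := by
  refine monic_induction (p := fun a => Squarefree a →
    ∑ u ∈ Rn q a.natDegree, chi q u a * ee a (u * V) = chi q V a * tau q ^ a.natDegree) ?_ ?_ a ha hsq
  · intro _
    rw [natDegree_one, Rn_zero, Finset.sum_singleton, zero_mul, ee_zero, chi_one_right,
      chi_one_right, pow_zero]
  · intro P b hP hi hb ih hsq
    have hbsq := hsq.squarefree_of_dvd (Dvd.intro_left _ rfl)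
    have hPb : ¬ P ∣ b := by
      rintro ⟨c, rfl⟩
      exact hi.not_isUnit (hsq P ⟨c, by ring⟩)
    have hcop : IsCoprime P b := (hi.coprime_iff_not_dvd).2 hPb
    have hG : ∑ u ∈ Rn q P.natDegree, chi q u P * ee P (u * V) = chi q V P * tau q ^ P.natDegree := by
      simp only [chi_prime _ hP hi]
      exact gauss_prime hP hi V
    rcases Nat.eq_zero_or_pos b.natDegree with h0 | hdb
    · have : b = 1 := hb.natDegree_eq_zero.1 h0
      subst this
      rw [mul_one]; exact hG
    rw [sum_crt hP hb hcop]
    have hχ : chi q P b * chi q b P = 1 := by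
      rw [chi_recip hP hb, chi_prime _ hP hi]
      exact legSym_sq_one hPb
    have key : ∀ u v : Fqx q, chi q (u * b + v * P) (P * b) * ee (P * b) ((u * b + v * P) * V) =
        (chi q u P * ee P (u * V)) * (chi q v b * ee b (v * V)) := by
      intro u v
      have e1 : (u * b + v * P) * V = b * (u * V) + P * (v * V) := by ring
      rw [e1, ee_crt hP hb hi.natDegree_pos hdb, chi_mul_right _ hP.ne_zero hb.ne_zero,
        chi_congr (E := u * b) hP.ne_zero ⟨v, by ring⟩, chi_congr (E := v * P) hb.ne_zero ⟨u, by ring⟩,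
        chi_mul_left _ _ hP.ne_zero, chi_mul_left _ _ hb.ne_zero]
      linear_combination (chi q u P * ee P (u * V) * (chi q v b * ee b (v * V))) * hχ
    simp only [key, ← Finset.mul_sum, ← Finset.sum_mul]
    rw [hG, ih hbsq, chi_mul_right _ hP.ne_zero hb.ne_zero, hP.natDegree_mul hb, pow_add]
    ring

end recip

end

section
variable {q : ℕ} [Fact q.Prime] [hq4 : Fact (q % 4 = 1)]

/-- `∑_{h ∈ M_m} (h | a)`. -/
def XX (a : Fqx q) (m : ℕ) : ℂ := ∑ h ∈ Mn q m, chi q h a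

lemma sum_Mn_eq_Rn (m : ℕ) (F : Fqx q → ℂ) :
    ∑ h ∈ Mn q m, F h = ∑ l ∈ Rn q m, F (X ^ m + l) := by
  symm
  refine Finset.sum_nbij' (fun l => X ^ m + l) (fun h => h - X ^ m) ?_ ?_ ?_ ?_ (fun _ _ => rfl)
  · intro l hl
    rw [mem_Rn] at hl
    rw [mem_Mn]
    refine ⟨monic_X_pow_add hl, ?_⟩
    rw [add_comm]
    rw [natDegree_add_eq_right_of_degree_lt, natDegree_X_pow]
    rwa [degree_X_pow]
  · intro h hh
    rw [mem_Mn] at hh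
    rw [mem_Rn]
    have hd : h.degree = m := by rw [degree_eq_natDegree hh.1.ne_zero, hh.2]
    have := degree_sub_lt_left (p := h) (q := X ^ m) (by rw [hd, degree_X_pow]) hh.1.ne_zero
      (by rw [hh.1.leadingCoeff, (monic_X_pow m).leadingCoeff])
    rwa [hd] at this
  · intros; simp
  · intros; simp

lemma sum_Rn_succ (r : ℕ) (F : Fqx q → ℂ) :
    ∑ u ∈ Rn q (r + 1), F u = ∑ u ∈ Rn q r, F u +
      ∑ c ∈ Finset.univ.erase (0 : ZMod q), ∑ h ∈ Mn q r, F (C c * h) := by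
  rw [sum_Rn_split, sum_Rn_one, ← Finset.add_sum_erase _ _ (Finset.mem_univ (0 : ZMod q))]
  simp only [map_zero, mul_zero, add_zero]
  congr 1
  refine Finset.sum_congr rfl fun c hc => ?_
  have hc0 : c ≠ 0 := (Finset.mem_erase.1 hc).1
  rw [sum_Mn_eq_Rn]
  refine Finset.sum_nbij' (fun l => C c⁻¹ * l) (fun l => C c * l) ?_ ?_ ?_ ?_ ?_
  · intro l hl
    rw [mem_Rn] at *
    rwa [degree_C_mul (inv_ne_zero hc0)]
  · intro l hl
    rw [mem_Rn] at *
    rwa [degree_C_mul hc0]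
  · intro l _
    rw [← mul_assoc, ← C_mul, mul_inv_cancel₀ hc0, C_1, one_mul]
  · intro l _
    rw [← mul_assoc, ← C_mul, inv_mul_cancel₀ hc0, C_1, one_mul]
  · intro l _
    congr 1
    rw [mul_add, ← mul_assoc, ← C_mul, mul_inv_cancel₀ hc0, C_1, one_mul]
    ring

lemma sum_sg_psi : ∑ c ∈ Finset.univ.erase (0 : ZMod q), sg c * psi c = tau q := by
  rw [tau, ← Finset.add_sum_erase _ _ (Finset.mem_univ (0 : ZMod q))]
  simp [sg]

lemma sum_sg : ∑ c ∈ Finset.univ.erase (0 : ZMod q), sg c = 0 := by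
  have h : ∑ c : ZMod q, sg c = 0 := by
    have := quadraticChar_sum_zero (F := ZMod q) ringChar_zmod
    unfold sg
    exact_mod_cast this
  rw [← Finset.add_sum_erase _ _ (Finset.mem_univ (0 : ZMod q))] at h
  simpa [sg] using h

lemma sum_psi_erase : ∑ c ∈ Finset.univ.erase (0 : ZMod q), psi c = -1 := by
  have h := sum_psi_mul (one_ne_zero (α := ZMod q))
  simp only [one_mul] at h
  rw [← Finset.add_sum_erase _ _ (Finset.mem_univ (0 : ZMod q)), AddChar.map_zero_eq_one] at h
  linear_combination h

lemma sg_pow {c : ZMod q} (hc : c ≠ 0) (A : ℕ) : sg c ^ A = if Even A then 1 else sg c := by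
  have h : sg c ^ 2 = 1 := by rw [pow_two, sg_sq hc]
  split_ifs with hA
  · obtain ⟨k, rfl⟩ := hA
    rw [← two_mul, pow_mul, h, one_pow]
  · obtain ⟨k, rfl⟩ := Nat.not_even_iff_odd.1 hA
    rw [pow_succ, pow_mul, h, one_pow, one_mul]

/-- The kernel of the functional equation. -/
def kk (q A r j : ℕ) : ℂ :=
  if Even A then (if j < r then (q : ℂ) - 1 else -1) else (if j < r then 0 else (Real.sqrt q : ℂ))

section FE
variable {a : Fqx q}

lemma gauss_XX (ha : a.Monic) (hsq : Squarefree a) (m : ℕ) :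
    tau q ^ a.natDegree * XX a m =
      (q : ℂ) ^ m * ∑ u ∈ Rn q (a.natDegree - m), chi q u a * ee a (u * X ^ m) := by
  have h1 : tau q ^ a.natDegree * XX a m =
      ∑ h ∈ Mn q m, ∑ u ∈ Rn q a.natDegree, chi q u a * ee a (u * h) := by
    rw [XX, Finset.mul_sum]
    refine Finset.sum_congr rfl fun h _ => ?_
    rw [gauss_sqfree ha hsq, mul_comm]
  rw [h1, Finset.sum_comm, Finset.mul_sum]
  have h2 : ∀ u ∈ Rn q a.natDegree, ∑ h ∈ Mn q m, chi q u a * ee a (u * h) =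
      if u ∈ Rn q (a.natDegree - m) then (q : ℂ) ^ m * (chi q u a * ee a (u * X ^ m)) else 0 := by
    intro u hu
    rw [mem_Rn] at hu
    rw [← Finset.mul_sum, sum_Mn_eq_Rn]
    simp only [mul_add, ee_add, ← Finset.mul_sum]
    simp only [mul_comm u _]
    rw [sum_ee_Rn ha, (modByMonic_eq_self_iff ha).2 (by rwa [degree_eq_natDegree ha.ne_zero])]
    simp only [mem_Rn]
    split_ifs <;> ring
  rw [Finset.sum_congr rfl h2, ← Finset.sum_filter]
  refine Finset.sum_congr ?_ fun _ _ => rfl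
  ext u
  simp only [Finset.mem_filter, mem_Rn]
  refine ⟨fun h => h.2, fun h => ⟨h.trans_le ?_, h⟩⟩
  exact_mod_cast Nat.sub_le _ _

lemma q_ne_zero : (q : ℂ) ≠ 0 := Nat.cast_ne_zero.2 (Fact.out : q.Prime).ne_zero

lemma chi_zero_left (ha : a.Monic) (h1 : 1 ≤ a.natDegree) : chi q 0 a = 0 := by
  obtain ⟨P, hP, hPi, g, rfl⟩ := exists_monic_irreducible_factor a
    (fun h => by rw [ha.eq_one_of_isUnit h] at h1; simp at h1)
  have hg : g.Monic := hP.of_mul_monic_left ha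
  rw [chi_mul_right _ hP.ne_zero hg.ne_zero, chi_prime _ hP hPi,
    (legSym_eq_zero_iff 0).2 (dvd_zero _)]
  simp

lemma XX_eq_zero (ha : a.Monic) (hsq : Squarefree a) (h1 : 1 ≤ a.natDegree) {m : ℕ}
    (hm : a.natDegree ≤ m) : XX a m = 0 := by
  have h := gauss_XX ha hsq m
  rw [Nat.sub_eq_zero_of_le hm, Rn_zero, Finset.sum_singleton, chi_zero_left ha h1] at h
  simpa [tau_ne_zero] using h

lemma sum_chi_psi (ha : a.Monic) (h1 : 1 ≤ a.natDegree) (r : ℕ) :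
    ∑ u ∈ Rn q (r + 1), chi q u a * psi (u.coeff r) =
      (∑ c ∈ Finset.univ.erase (0 : ZMod q), sg c ^ a.natDegree * psi c) * XX a r +
      ∑ j ∈ Finset.range r, (∑ c ∈ Finset.univ.erase (0 : ZMod q), sg c ^ a.natDegree) * XX a j := by
  have hR : ∀ r, ∑ u ∈ Rn q r, chi q u a =
      ∑ j ∈ Finset.range r, (∑ c ∈ Finset.univ.erase (0 : ZMod q), sg c ^ a.natDegree) * XX a j := by
    intro r
    induction r with
    | zero => rw [Rn_zero, Finset.sum_singleton, chi_zero_left ha h1]; simp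
    | succ r ih =>
      rw [sum_Rn_succ, ih, Finset.sum_range_succ, Finset.sum_mul]
      congr 1
      refine Finset.sum_congr rfl fun c hc => ?_
      have hc0 : c ≠ 0 := (Finset.mem_erase.1 hc).1
      rw [XX, Finset.mul_sum]
      refine Finset.sum_congr rfl fun h _ => ?_
      rw [chi_mul_left _ _ ha.ne_zero, chi_C hc0 ha]
  rw [sum_Rn_succ, ← hR r, add_comm, Finset.sum_mul]
  congr 1
  · refine Finset.sum_congr rfl fun c hc => ?_
    have hc0 : c ≠ 0 := (Finset.mem_erase.1 hc).1
    rw [XX, Finset.mul_sum]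
    refine Finset.sum_congr rfl fun h hh => ?_
    rw [mem_Mn] at hh
    have hcf : (C c * h).coeff r = c := by
      rw [coeff_C_mul, ← hh.2, hh.1.coeff_natDegree, mul_one]
    rw [chi_mul_left _ _ ha.ne_zero, chi_C hc0 ha, hcf]
    ring
  · refine Finset.sum_congr rfl fun u hu => ?_
    rw [mem_Rn] at hu
    rw [coeff_eq_zero_of_degree_lt hu, AddChar.map_zero_eq_one, mul_one]

lemma tau_FE (ha : a.Monic) (hsq : Squarefree a) (h1 : 1 ≤ a.natDegree) {r m : ℕ}
    (hr : r + m + 1 = a.natDegree) :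
    tau q ^ a.natDegree * XX a m = (q : ℂ) ^ m *
      ((∑ c ∈ Finset.univ.erase (0 : ZMod q), sg c ^ a.natDegree * psi c) * XX a r +
      ∑ j ∈ Finset.range r, (∑ c ∈ Finset.univ.erase (0 : ZMod q), sg c ^ a.natDegree) * XX a j) := by
  rw [gauss_XX ha hsq, ← sum_chi_psi ha h1, show a.natDegree - m = r + 1 by omega]
  congr 1
  refine Finset.sum_congr rfl fun u hu => ?_
  rw [mem_Rn] at hu
  congr 1
  rw [ee_small ha]
  · rw [show a.natDegree - 1 = r + m by omega, coeff_mul_X_pow]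
  · rcases eq_or_ne u 0 with rfl | h0
    · rw [zero_mul, degree_zero]; exact WithBot.bot_lt_coe _
    rw [degree_mul, degree_X_pow, degree_eq_natDegree h0]
    rw [degree_eq_natDegree h0] at hu
    have : u.natDegree < r + 1 := by exact_mod_cast hu
    exact_mod_cast (by omega : u.natDegree + m < a.natDegree)

lemma XX_FE_odd (ha : a.Monic) (hsq : Squarefree a) {r m k : ℕ}
    (hr : r + m + 1 = a.natDegree) (hk : a.natDegree = 2 * k + 1) :
    (q : ℂ) ^ k * XX a m = (q : ℂ) ^ m * XX a r := by
  have h := tau_FE ha hsq (by omega) hr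
  have hne : ¬ Even a.natDegree := by rw [hk, Nat.not_even_iff_odd]; exact ⟨k, rfl⟩
  have e1 : ∑ c ∈ Finset.univ.erase (0 : ZMod q), sg c ^ a.natDegree * psi c = tau q := by
    rw [← sum_sg_psi (q := q)]
    refine Finset.sum_congr rfl fun c hc => ?_
    rw [sg_pow (Finset.mem_erase.1 hc).1, if_neg hne]
  have e2 : ∑ c ∈ Finset.univ.erase (0 : ZMod q), sg c ^ a.natDegree = 0 := by
    rw [← sum_sg (q := q)]
    refine Finset.sum_congr rfl fun c hc => ?_
    rw [sg_pow (Finset.mem_erase.1 hc).1, if_neg hne]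
  rw [e1, e2] at h
  simp only [zero_mul, Finset.sum_const_zero, add_zero] at h
  rw [hk, pow_succ, pow_mul, tau_sq] at h
  refine mul_left_cancel₀ (tau_ne_zero (q := q)) ?_
  linear_combination h

lemma XX_FE_even (ha : a.Monic) (hsq : Squarefree a) (h1 : 1 ≤ a.natDegree) {r m k : ℕ}
    (hr : r + m + 1 = a.natDegree) (hk : a.natDegree = 2 * k) :
    (q : ℂ) ^ k * XX a m = (q : ℂ) ^ m *
      (-XX a r + ((q : ℂ) - 1) * ∑ j ∈ Finset.range r, XX a j) := by
  have h := tau_FE ha hsq h1 hr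
  have he : Even a.natDegree := by rw [hk]; exact even_two_mul k
  have e1 : ∑ c ∈ Finset.univ.erase (0 : ZMod q), sg c ^ a.natDegree * psi c = -1 := by
    rw [← sum_psi_erase (q := q)]
    refine Finset.sum_congr rfl fun c hc => ?_
    rw [sg_pow (Finset.mem_erase.1 hc).1, if_pos he, one_mul]
  have e2 : ∑ c ∈ Finset.univ.erase (0 : ZMod q), sg c ^ a.natDegree = (q : ℂ) - 1 := by
    rw [Finset.sum_congr rfl (g := fun _ => (1 : ℂ)) fun c hc => by
      rw [sg_pow (Finset.mem_erase.1 hc).1, if_pos he]]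
    rw [Finset.sum_const, Finset.card_erase_of_mem (Finset.mem_univ _), Finset.card_univ, ZMod.card,
      nsmul_eq_mul, mul_one, Nat.cast_sub (Fact.out : q.Prime).one_le, Nat.cast_one]
  rw [e1, e2, hk, pow_mul, tau_sq, ← Finset.mul_sum] at h
  linear_combination h

/-- For even degree the character is trivial on constants. -/
lemma sum_XX_even (ha : a.Monic) (hsq : Squarefree a) (h1 : 1 ≤ a.natDegree)
    (he : Even a.natDegree) : ∑ j ∈ Finset.range a.natDegree, XX a j = 0 := by
  have h := gauss_sqfree ha hsq 0
  rw [chi_zero_left ha h1, zero_mul] at h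
  simp only [mul_zero, ee_zero, mul_one] at h
  have h2 := sum_chi_psi ha h1 a.natDegree
  have h3 : ∑ u ∈ Rn q (a.natDegree + 1), chi q u a * psi (u.coeff a.natDegree) = 0 := by
    rw [sum_Rn_succ]
    have e1 : ∑ u ∈ Rn q a.natDegree, chi q u a * psi (u.coeff a.natDegree) = 0 := by
      rw [← h]
      refine Finset.sum_congr rfl fun u hu => ?_
      rw [mem_Rn] at hu
      rw [coeff_eq_zero_of_degree_lt hu, AddChar.map_zero_eq_one, mul_one]
    rw [e1, zero_add]
    refine Finset.sum_eq_zero fun c hc => ?_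
    have hc0 : c ≠ 0 := (Finset.mem_erase.1 hc).1
    have : ∀ h' ∈ Mn q a.natDegree, chi q (C c * h') a * psi ((C c * h').coeff a.natDegree) =
        sg c ^ a.natDegree * psi c * chi q h' a := by
      intro h' hh
      rw [mem_Mn] at hh
      have hcf : (C c * h').coeff a.natDegree = c := by
        rw [coeff_C_mul, ← hh.2, hh.1.coeff_natDegree, mul_one]
      rw [chi_mul_left _ _ ha.ne_zero, chi_C hc0 ha, hcf]
      ring
    rw [Finset.sum_congr rfl this, ← Finset.mul_sum]
    have := XX_eq_zero ha hsq h1 le_rfl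
    rw [XX] at this
    rw [this, mul_zero]
  rw [h3, XX_eq_zero ha hsq h1 le_rfl, mul_zero, zero_add, ← Finset.mul_sum] at h2
  have e2 : ∑ c ∈ Finset.univ.erase (0 : ZMod q), sg c ^ a.natDegree = (q : ℂ) - 1 := by
    rw [Finset.sum_congr rfl (g := fun _ => (1 : ℂ)) fun c hc => by
      rw [sg_pow (Finset.mem_erase.1 hc).1, if_pos he]]
    rw [Finset.sum_const, Finset.card_erase_of_mem (Finset.mem_univ _), Finset.card_univ, ZMod.card,
      nsmul_eq_mul, mul_one, Nat.cast_sub (Fact.out : q.Prime).one_le, Nat.cast_one]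
  rw [e2] at h2
  refine (mul_eq_zero.1 h2.symm).resolve_left (sub_ne_zero.2 ?_)
  exact_mod_cast (Fact.out : q.Prime).one_lt.ne'

end FE

end

section
section Stepanov
variable {F : Type*} [Field F]

lemma pow_dvd_hasseDeriv (W g : F[X]) (n k : ℕ) : W ^ (n - k) ∣ hasseDeriv k (W ^ n * g) := by
  induction n generalizing k with
  | zero => simp
  | succ n ih =>
    rw [pow_succ', mul_assoc, hasseDeriv_mul]
    refine Finset.dvd_sum fun ij hij => ?_
    have hij := Finset.HasAntidiagonal.mem_antidiagonal.1 hij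
    rcases Nat.eq_zero_or_pos ij.1 with h0 | h0
    · rw [h0, hasseDeriv_zero']
      have : W ^ (n + 1 - k) ∣ W * W ^ (n - ij.2) := by
        rw [← pow_succ']
        exact pow_dvd_pow _ (by omega)
      exact this.trans (mul_dvd_mul_left _ (ih ij.2))
    · exact ((pow_dvd_pow _ (by omega)).trans (ih ij.2)).mul_left _

/-- The quotient of `hasseDeriv k (W ^ n * g)` by `W ^ (n - k)`. -/
def hq {W : F[X]} (hW : W.Monic) (n k : ℕ) : F[X] →ₗ[F] F[X] where
  toFun g := hasseDeriv k (W ^ n * g) /ₘ W ^ (n - k)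
  map_add' a b := by
    have key : ∀ g, W ^ (n - k) * (hasseDeriv k (W ^ n * g) /ₘ W ^ (n - k)) =
        hasseDeriv k (W ^ n * g) := fun g => by
      have := modByMonic_add_div (hasseDeriv k (W ^ n * g)) (W ^ (n - k))
      rwa [(modByMonic_eq_zero_iff_dvd (hW.pow _)).2 (pow_dvd_hasseDeriv W g n k), zero_add] at this
    apply mul_left_cancel₀ (hW.pow (n - k)).ne_zero
    rw [key, mul_add (W ^ (n - k)), key, key, mul_add, map_add]
  map_smul' c a := by
    have key : ∀ g, W ^ (n - k) * (hasseDeriv k (W ^ n * g) /ₘ W ^ (n - k)) =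
        hasseDeriv k (W ^ n * g) := fun g => by
      have := modByMonic_add_div (hasseDeriv k (W ^ n * g)) (W ^ (n - k))
      rwa [(modByMonic_eq_zero_iff_dvd (hW.pow _)).2 (pow_dvd_hasseDeriv W g n k), zero_add] at this
    apply mul_left_cancel₀ (hW.pow (n - k)).ne_zero
    rw [RingHom.id_apply, key, mul_smul_comm c (W ^ (n - k)), key, mul_smul_comm, map_smul]

lemma mul_hq {W : F[X]} (hW : W.Monic) (n k : ℕ) (g : F[X]) :
    hasseDeriv k (W ^ n * g) = W ^ (n - k) * hq hW n k g := by
  have := modByMonic_add_div (hasseDeriv k (W ^ n * g)) (W ^ (n - k))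
  rw [(modByMonic_eq_zero_iff_dvd (hW.pow _)).2 (pow_dvd_hasseDeriv W g n k), zero_add] at this
  exact this.symm

lemma natDegree_hq_le {W : F[X]} (hW : W.Monic) {n k : ℕ} (hk : k ≤ n) (g : F[X]) :
    (hq hW n k g).natDegree ≤ g.natDegree + k * W.natDegree := by
  change (hasseDeriv k (W ^ n * g) /ₘ W ^ (n - k)).natDegree ≤ _
  rw [natDegree_divByMonic _ (hW.pow _), hW.natDegree_pow]
  have h1 := natDegree_hasseDeriv_le (W ^ n * g) k
  have h2 : (W ^ n * g).natDegree ≤ n * W.natDegree + g.natDegree := by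
    rw [← hW.natDegree_pow]; exact natDegree_mul_le
  have h3 : (n - k) * W.natDegree + k * W.natDegree = n * W.natDegree := by
    rw [← add_mul, Nat.sub_add_cancel hk]
  omega

lemma X_sub_C_pow_dvd_of_hasseDeriv {f : F[X]} {x : F} {l : ℕ}
    (h : ∀ k < l, (hasseDeriv k f).eval x = 0) : (X - C x) ^ l ∣ f := by
  rw [X_sub_C_pow_dvd_iff, X_pow_dvd_iff]
  intro k hk
  have := taylor_coeff x f k
  rw [taylor_apply] at this
  rw [this, h k hk]

variable [Fintype F] 

lemma X_sub_C_pow_card (x : F) : (X - C x) ^ Fintype.card F = X ^ Fintype.card F - C x := by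
  rw [← FiniteField.expand_card]; simp

lemma sqfree_ratio {W r s : F[X]} {c : F} (hc : c ≠ 0) (hW : Squarefree W) (hu : ¬ IsUnit W)
    (h : W * r ^ 2 = C c * s ^ 2) : r = 0 ∧ s = 0 := by
  have hW0 : W ≠ 0 := hW.ne_zero
  have hcu : IsUnit (C c : F[X]) := isUnit_C.2 (isUnit_iff_ne_zero.2 hc)
  have hr : r = 0 := by
    by_contra hr
    have key : ∀ n : ℕ, ∀ r s : F[X], r ≠ 0 → r.natDegree = n → W * r ^ 2 ≠ C c * s ^ 2 := by
      intro n
      induction n using Nat.strong_induction_on with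
      | _ n ih =>
        intro r s hr hn h
        have h1 : W ∣ s ^ 2 := (hcu.dvd_mul_left).1 (Dvd.intro _ h)
        obtain ⟨s', rfl⟩ := (hW.dvd_pow_iff_dvd two_ne_zero).1 h1
        have h2 : r ^ 2 = W * (C c * s' ^ 2) := by
          apply mul_left_cancel₀ hW0
          linear_combination h
        obtain ⟨r', rfl⟩ := (hW.dvd_pow_iff_dvd two_ne_zero).1 (Dvd.intro _ h2.symm)
        have h3 : W * r' ^ 2 = C c * s' ^ 2 := by
          apply mul_left_cancel₀ hW0
          linear_combination h2
        have hr' : r' ≠ 0 := right_ne_zero_of_mul hr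
        have hd : 0 < W.natDegree := natDegree_pos_iff_degree_pos.2
          (degree_pos_of_ne_zero_of_nonunit hW0 hu)
        refine ih r'.natDegree ?_ r' s' hr' rfl h3
        rw [← hn, natDegree_mul hW0 hr']; omega
    exact key _ r s hr rfl h
  refine ⟨hr, ?_⟩
  rw [hr] at h
  have : C c * s ^ 2 = 0 := by rw [← h]; ring
  simpa [hc] using this

/-- The auxiliary function in Stepanov's method is nonzero. -/
lemma stepanov_ne {W : F[X]} (hW : Squarefree W) (hu : ¬ IsUnit W) {x₀ : F} (hx : W.eval x₀ ≠ 0)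
    {c K : ℕ} (hc : 2 * c + 1 = Fintype.card F) (hK : W.natDegree + 2 * K ≤ Fintype.card F) (J : ℕ)
    (r s : ℕ → F[X]) (hr : ∀ j, (r j).degree < K) (hs : ∀ j, (s j).degree < K)
    (h : ∑ j ∈ Finset.range J, (r j + s j * W ^ c) * (X ^ Fintype.card F - C x₀) ^ j = 0) :
    ∀ j < J, r j = 0 ∧ s j = 0 := by
  set Q := Fintype.card F with hQ
  have hQ1 : 0 < Q := Fintype.card_pos
  set Y : F[X] := X ^ Q - C x₀ with hY
  have hYd : Y.degree = Q := degree_X_pow_sub_C hQ1 _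
  have hY0 : Y ≠ 0 := by intro h0; rw [h0, degree_zero] at hYd; exact WithBot.bot_ne_coe hYd
  induction J generalizing r s with
  | zero => intro j hj; omega
  | succ J ih =>
    rw [Finset.sum_range_succ'] at h
    set A := ∑ j ∈ Finset.range J, r (j + 1) * Y ^ j with hA
    set B := ∑ j ∈ Finset.range J, s (j + 1) * Y ^ j with hB
    have h1 : ∑ j ∈ Finset.range J, (r (j + 1) + s (j + 1) * W ^ c) * Y ^ (j + 1) =
        Y * (A + B * W ^ c) := by
      rw [hA, hB, Finset.sum_mul, ← Finset.sum_add_distrib, Finset.mul_sum]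
      refine Finset.sum_congr rfl fun j _ => ?_
      ring
    rw [h1, pow_zero, mul_one] at h
    have hWQ : Y ∣ W ^ Q - C (W.eval x₀) := by
      rw [← FiniteField.expand_card, expand_eq_comp_X_pow]
      have : W.comp (X ^ Q) - C (W.eval x₀) = (W - C (W.eval x₀)).comp (X ^ Q) := by simp
      rw [this]
      obtain ⟨V, hV⟩ := dvd_iff_isRoot.2 (show (W - C (W.eval x₀)).IsRoot x₀ by simp [IsRoot])
      rw [hV, mul_comp, sub_comp, X_comp, C_comp]
      exact Dvd.intro _ rfl
    obtain ⟨V, hV⟩ := hWQ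
    have h2 : Y ∣ W * (r 0) ^ 2 - C (W.eval x₀) * (s 0) ^ 2 := by
      have hQ' : W ^ Q = W * (W ^ c) ^ 2 := by rw [← hc]; ring
      rw [hQ'] at hV
      have e0 : r 0 + Y * A = -((s 0 + Y * B) * W ^ c) := by linear_combination h
      refine ⟨V * (s 0) ^ 2 + W * (W ^ c) ^ 2 * B * (2 * s 0 + Y * B) - W * A * (2 * r 0 + Y * A), ?_⟩
      linear_combination (s 0) ^ 2 * hV + W * (r 0 + Y * A - (s 0 + Y * B) * W ^ c) * e0
    have h3 : W * (r 0) ^ 2 - C (W.eval x₀) * (s 0) ^ 2 = 0 := by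
      refine eq_zero_of_dvd_of_degree_lt h2 ?_
      rw [hYd]
      have hlt : ∀ t : F[X], t.degree < K → ∀ U : F[X], U.natDegree ≤ W.natDegree →
          (U * t ^ 2).degree < Q := by
        intro t ht U hU
        rcases eq_or_ne t 0 with rfl | h0
        · simp
        refine lt_of_le_of_lt degree_le_natDegree ?_
        rw [degree_eq_natDegree h0] at ht
        have ht' : t.natDegree < K := by exact_mod_cast ht
        have := natDegree_mul_le (p := U) (q := t ^ 2)
        rw [natDegree_pow] at this
        exact_mod_cast (by omega : (U * t ^ 2).natDegree < Q)
      refine lt_of_le_of_lt (degree_sub_le _ _) (max_lt (hlt _ (hr 0) _ le_rfl) (hlt _ (hs 0) _ ?_))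
      simp
    obtain ⟨hr0, hs0⟩ := sqfree_ratio hx hW hu (sub_eq_zero.1 h3)
    rw [hr0, hs0] at h
    have h4 : A + B * W ^ c = 0 := by
      have : Y * (A + B * W ^ c) = 0 := by linear_combination h
      exact (mul_eq_zero.1 this).resolve_left hY0
    have h5 := ih (fun j => r (j + 1)) (fun j => s (j + 1)) (fun j => hr _) (fun j => hs _) (by
      rw [← h4, hA, hB, Finset.sum_mul, ← Finset.sum_add_distrib]
      refine Finset.sum_congr rfl fun j _ => ?_
      ring)
    intro j hj
    cases j with
    | zero => exact ⟨hr0, hs0⟩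
    | succ j => exact h5 j (by omega)

variable {W : F[X]}

/-- The linear conditions in Stepanov's method. -/
def stCond (hW : W.Monic) (x₀ e : F) (c l J K B : ℕ) :
    (Fin J → degreeLT F K) × (Fin J → degreeLT F K) →ₗ[F] (Fin l × Fin B → F) where
  toFun v ki := (∑ j : Fin J, (X - C x₀) ^ (j : ℕ) *
    (hq hW l ki.1 (v.1 j) + e • hq hW (l + c) ki.1 (v.2 j))).coeff ki.2
  map_add' u v := by
    funext ki
    rw [Pi.add_apply, ← coeff_add, ← Finset.sum_add_distrib]
    congr 1
    refine Finset.sum_congr rfl fun j _ => ?_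
    simp only [Prod.fst_add, Prod.snd_add, Pi.add_apply, Submodule.coe_add, map_add, smul_add]
    ring
  map_smul' t u := by
    funext ki
    rw [Pi.smul_apply, RingHom.id_apply, ← coeff_smul, Finset.smul_sum]
    congr 1
    refine Finset.sum_congr rfl fun j _ => ?_
    simp only [Prod.smul_fst, Prod.smul_snd, Pi.smul_apply, Submodule.coe_smul, map_smul]
    rw [smul_comm e t, ← smul_add, mul_smul_comm]

lemma stCond_apply (hW : W.Monic) (x₀ e : F) (c l J K B : ℕ)
    (v : (Fin J → degreeLT F K) × (Fin J → degreeLT F K)) (ki : Fin l × Fin B) :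
    stCond hW x₀ e c l J K B v ki = (∑ j : Fin J, (X - C x₀) ^ (j : ℕ) *
    (hq hW l ki.1 (v.1 j) + e • hq hW (l + c) ki.1 (v.2 j))).coeff ki.2 := rfl

lemma exists_stCond (hW : W.Monic) (x₀ e : F) {c K J l B : ℕ} (hcount : l * B < 2 * K * J) :
    ∃ v : (Fin J → degreeLT F K) × (Fin J → degreeLT F K), v ≠ 0 ∧
      stCond hW x₀ e c l J K B v = 0 := by
  have hfr : ∀ n, Module.finrank F (degreeLT F n) = n := fun n => by
    rw [(degreeLTEquiv F n).finrank_eq, Module.finrank_fin_fun]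
  have hfin : ∀ n, Module.Finite F (degreeLT F n) := fun n =>
    Module.Finite.equiv (degreeLTEquiv F n).symm
  have := hfin K
  have hker : LinearMap.ker (stCond hW x₀ e c l J K B) ≠ ⊥ := by
    refine LinearMap.ker_ne_bot_of_finrank_lt ?_
    rw [Module.finrank_fintype_fun_eq_card, Fintype.card_prod, Fintype.card_fin, Fintype.card_fin,
      Module.finrank_prod, Module.finrank_pi_fintype]
    simp only [hfr, Finset.sum_const, Finset.card_univ, Fintype.card_fin, smul_eq_mul]
    calc l * B < 2 * K * J := hcount
      _ = J * K + J * K := by ring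
  obtain ⟨v, hv, hv0⟩ := Submodule.exists_mem_ne_zero_of_ne_bot hker
  exact ⟨v, hv0, hv⟩

lemma coeff_of_stCond (hW : W.Monic) {x₀ e : F} {c l J K B : ℕ}
    {v : (Fin J → degreeLT F K) × (Fin J → degreeLT F K)} (hv : stCond hW x₀ e c l J K B v = 0)
    {r s : ℕ → F[X]} (hr : ∀ j : Fin J, r j = v.1 j) (hs : ∀ j : Fin J, s j = v.2 j)
    {k i : ℕ} (hk : k < l) (hi : i < B) :
    (∑ j ∈ Finset.range J, (X - C x₀) ^ j *
      (hq hW l k (r j) + e • hq hW (l + c) k (s j))).coeff i = 0 := by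
  have h3 : stCond hW x₀ e c l J K B v (⟨k, hk⟩, ⟨i, hi⟩) = 0 := by rw [hv]; rfl
  rw [← h3, stCond_apply, Finset.sum_range]
  simp only [hr, hs]

lemma exists_stepanov (hW : W.Monic) (x₀ e : F) {c K J l : ℕ}
    (hcount : l * (K + J + l * W.natDegree) < 2 * K * J) :
    ∃ r s : ℕ → F[X], (∀ j, (r j).degree < K) ∧ (∀ j, (s j).degree < K) ∧
      (¬ ∀ j < J, r j = 0 ∧ s j = 0) ∧ ∀ k < l, ∑ j ∈ Finset.range J, (X - C x₀) ^ j *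
      (hq hW l k (r j) + e • hq hW (l + c) k (s j)) = 0 := by
  have hK1 : 0 < K := by
    rcases Nat.eq_zero_or_pos K with h | h
    · subst h; simp at hcount
    · exact h
  obtain ⟨v, hv0, hv⟩ := exists_stCond (c := c) hW x₀ e hcount
  have hext : ∀ u : Fin J → degreeLT F K, ∃ r : ℕ → F[X], (∀ j, (r j).degree < K) ∧
      ∀ j : Fin J, r j = u j := fun u => by
    refine ⟨fun j => if h : j < J then (u ⟨j, h⟩ : F[X]) else 0, fun j => ?_, fun j => by simp⟩
    beta_reduce
    split_ifs with h
    · exact mem_degreeLT.1 (u ⟨j, h⟩).2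
    · rw [degree_zero]; exact WithBot.bot_lt_coe _
  obtain ⟨r, hdr, hr⟩ := hext v.1
  obtain ⟨s, hds, hs⟩ := hext v.2
  have hnd : ∀ t : F[X], t.degree < K → t.natDegree ≤ K - 1 := fun t ht => by
    rcases eq_or_ne t 0 with rfl | h0
    · simp
    rw [degree_eq_natDegree h0] at ht
    have : t.natDegree < K := by exact_mod_cast ht
    omega
  have hcond : ∀ k < l, ∑ j ∈ Finset.range J, (X - C x₀) ^ j *
      (hq hW l k (r j) + e • hq hW (l + c) k (s j)) = 0 := by
    intro k hk
    have hdeg : (∑ j ∈ Finset.range J, (X - C x₀) ^ j *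
      (hq hW l k (r j) + e • hq hW (l + c) k (s j))).natDegree < K + J + l * W.natDegree := by
      have : (∑ j ∈ Finset.range J, (X - C x₀) ^ j *
        (hq hW l k (r j) + e • hq hW (l + c) k (s j))).natDegree ≤ J + ((K - 1) + l * W.natDegree) := by
        refine natDegree_sum_le_of_forall_le _ _ fun j hj => ?_
        refine natDegree_mul_le.trans (Nat.add_le_add ?_ ?_)
        · rw [natDegree_pow, natDegree_X_sub_C]
          have := Finset.mem_range.1 hj; omega
        · have hkm : k * W.natDegree ≤ l * W.natDegree := Nat.mul_le_mul_right _ hk.le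
          refine (natDegree_add_le _ _).trans (max_le ?_ ((natDegree_smul_le _ _).trans ?_))
          · have h1 := natDegree_hq_le hW hk.le (r j)
            have h2 := hnd _ (hdr j)
            refine h1.trans ?_
            exact Nat.add_le_add h2 hkm
          · have h1 := natDegree_hq_le hW (n := l + c) (k := k) (by omega) (s j)
            have h2 := hnd _ (hds j)
            exact h1.trans (Nat.add_le_add h2 hkm)
      refine lt_of_le_of_lt this ?_
      omega
    ext i
    rw [coeff_zero]
    by_cases hi : i < K + J + l * W.natDegree
    · exact coeff_of_stCond hW hv hr hs hk hi
    · exact coeff_eq_zero_of_natDegree_lt (lt_of_lt_of_le hdeg (not_lt.1 hi))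
  refine ⟨r, s, hdr, hds, fun h1 => hv0 ?_, hcond⟩
  refine Prod.ext (funext fun j => Subtype.ext ?_) (funext fun j => Subtype.ext ?_)
  · have := (h1 j j.2).1
    rw [← hr, this]; rfl
  · have := (h1 j j.2).2
    rw [← hs, this]; rfl

lemma stepanov_count (hW : W.Monic) (hsq : Squarefree W) (hu : ¬ IsUnit W) {x₀ : F}
    (hx : W.eval x₀ ≠ 0) (e : F) {c K J l : ℕ} (hc : 2 * c + 1 = Fintype.card F)
    (hK : W.natDegree + 2 * K ≤ Fintype.card F) (hl : l ≤ Fintype.card F)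
    (hcount : l * (K + J + l * W.natDegree) < 2 * K * J) :
    (Finset.univ.filter fun x : F => W.eval x ^ c = e).card * l ≤
      l * W.natDegree + K + c * W.natDegree + (J - 1) * Fintype.card F := by
  obtain ⟨r, s, hdr, hds, hne, hcond⟩ := exists_stepanov (c := c) hW x₀ e hcount
  have hnd : ∀ t : F[X], t.degree < K → t.natDegree ≤ K - 1 := fun t ht => by
    rcases eq_or_ne t 0 with rfl | h0
    · simp
    rw [degree_eq_natDegree h0] at ht
    have : t.natDegree < K := by exact_mod_cast ht
    omega
  set Q := Fintype.card F with hQ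
  set m := W.natDegree with hm
  set Rs := ∑ j ∈ Finset.range J, (r j + s j * W ^ c) * (X ^ Q - C x₀) ^ j with hRs
  have hRs0 : Rs ≠ 0 := fun h0 => hne (stepanov_ne hsq hu hx hc hK J r s hdr hds h0)
  set R := W ^ l * Rs with hR
  have hR0 : R ≠ 0 := mul_ne_zero (pow_ne_zero _ hW.ne_zero) hRs0
  have hdvd : ∀ x ∈ Finset.univ.filter (fun x : F => W.eval x ^ c = e), (X - C x) ^ l ∣ R := by
    intro x hx'
    have hxe : W.eval x ^ c = e := (Finset.mem_filter.1 hx').2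
    set z := x - x₀ with hz
    have h1 : (X - C x) ^ l ∣ R - ∑ j ∈ Finset.range J,
        (C (z ^ j) * (W ^ l * r j) + C (z ^ j) * (W ^ (l + c) * s j)) := by
      rw [hR, hRs, Finset.mul_sum, ← Finset.sum_sub_distrib]
      refine Finset.dvd_sum fun j _ => ?_
      have e1 : W ^ l * ((r j + s j * W ^ c) * (X ^ Q - C x₀) ^ j) -
          (C (z ^ j) * (W ^ l * r j) + C (z ^ j) * (W ^ (l + c) * s j)) =
          (W ^ l * (r j + s j * W ^ c)) * ((X ^ Q - C x₀) ^ j - C z ^ j) := by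
        rw [C_pow, pow_add]; ring
      rw [e1]
      refine Dvd.dvd.mul_left ?_ _
      refine dvd_trans ?_ (sub_dvd_pow_sub_pow _ _ j)
      have e2 : X ^ Q - C x₀ - C z = (X - C x) ^ Q := by
        rw [X_sub_C_pow_card, hz, C_sub]; ring
      rw [e2]
      exact pow_dvd_pow _ hl
    have h2 : (X - C x) ^ l ∣ ∑ j ∈ Finset.range J,
        (C (z ^ j) * (W ^ l * r j) + C (z ^ j) * (W ^ (l + c) * s j)) := by
      refine X_sub_C_pow_dvd_of_hasseDeriv fun k hk => ?_
      have h3 : hasseDeriv k (∑ j ∈ Finset.range J,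
          (C (z ^ j) * (W ^ l * r j) + C (z ^ j) * (W ^ (l + c) * s j))) =
          W ^ (l - k) * ∑ j ∈ Finset.range J, (C (z ^ j)) *
          (hq hW l k (r j) + W ^ c * hq hW (l + c) k (s j)) := by
        rw [map_sum, Finset.mul_sum]
        refine Finset.sum_congr rfl fun j _ => ?_
        rw [map_add, ← smul_eq_C_mul, ← smul_eq_C_mul, map_smul, map_smul, mul_hq hW, mul_hq hW,
          show l + c - k = (l - k) + c by omega, pow_add, smul_eq_C_mul, smul_eq_C_mul]
        ring
      rw [h3, eval_mul]
      have h4 := congrArg (eval x) (hcond k hk)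
      rw [eval_finsetSum, eval_zero] at h4
      rw [eval_finsetSum]
      rw [← mul_zero (eval x (W ^ (l - k))), ← h4]
      congr 1
      refine Finset.sum_congr rfl fun j _ => ?_
      simp [hz, hxe]
    have := dvd_add h1 h2
    rwa [sub_add_cancel] at this
  have hprod : ∏ x ∈ Finset.univ.filter (fun x : F => W.eval x ^ c = e), (X - C x) ^ l ∣ R := by
    refine Finset.prod_dvd_of_coprime (fun x _ y _ hxy => ?_) hdvd
    exact IsCoprime.pow (isCoprime_X_sub_C_of_isUnit_sub (isUnit_iff_ne_zero.2 (sub_ne_zero.2 hxy)))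
  have hle := natDegree_le_of_dvd hprod hR0
  rw [natDegree_prod_of_monic _ _ (fun x _ => (monic_X_sub_C x).pow l)] at hle
  simp only [natDegree_pow, natDegree_X_sub_C, mul_one, Finset.sum_const, smul_eq_mul] at hle
  refine hle.trans ?_
  have hRsd : Rs.natDegree ≤ K + c * m + (J - 1) * Q := by
    refine natDegree_sum_le_of_forall_le _ _ fun j hj => ?_
    refine natDegree_mul_le.trans (Nat.add_le_add ?_ ?_)
    · refine (natDegree_add_le _ _).trans (max_le ?_ (natDegree_mul_le.trans ?_))
      · have := hnd _ (hdr j); omega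
      · have := hnd _ (hds j)
        rw [hW.natDegree_pow, ← hm]; omega
    · rw [natDegree_pow, natDegree_X_pow_sub_C]
      refine Nat.mul_le_mul_right _ ?_
      have := Finset.mem_range.1 hj; omega
  have := natDegree_mul_le (p := W ^ l) (q := Rs)
  rw [hW.natDegree_pow, ← hm, ← hR] at this
  omega

end Stepanov

end

section
section Stepanov
variable {F : Type*} [Field F] [Fintype F] {W : F[X]}

lemma stepanov_card_le (hF : ringChar F ≠ 2) (hW : W.Monic) (hsq : Squarefree W)
    (hu : ¬ IsUnit W) {l : ℕ} (hl1 : l * l ≤ Fintype.card F)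
    (hl2 : Fintype.card F ≤ l * l + l + l) (hl : 8 * W.natDegree ≤ l) (e : F) :
    2 * (Finset.univ.filter fun x : F => W.eval x ^ (Fintype.card F / 2) = e).card ≤
      Fintype.card F + 16 * W.natDegree * l := by
  have hm1 : 1 ≤ W.natDegree := by
    by_contra h
    exact hu ((hW.natDegree_eq_zero.1 (by omega)) ▸ isUnit_one)
  have hodd := FiniteField.odd_card_of_char_ne_two hF
  obtain ⟨x₀, hx⟩ : ∃ x₀, W.eval x₀ ≠ 0 := by
    by_contra! h
    have h1 := card_roots' W
    have h2 : (Finset.univ : Finset F) ⊆ W.roots.toFinset := fun x _ => by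
      simp [hW.ne_zero, h x]
    have h3 := (Finset.card_le_card h2).trans W.roots.toFinset_card_le
    rw [Finset.card_univ] at h3
    nlinarith
  set Q := Fintype.card F with hQ
  set m := W.natDegree with hm
  have hc : 2 * (Q / 2) + 1 = Q := by omega
  set c := Q / 2
  obtain ⟨K, hK1, hK2⟩ : ∃ K, 2 * K + m ≤ Q ∧ Q ≤ 2 * K + m + 1 :=
    ⟨(Q - m) / 2, by have : m ≤ Q := by nlinarith
                     omega, by omega⟩
  obtain ⟨J, hJ1, hJ2⟩ : ∃ J, l + 6 * m ≤ 2 * J ∧ 2 * J ≤ l + 1 + 6 * m :=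
    ⟨(l + 1) / 2 + 3 * m, by omega, by omega⟩
  have hcount : l * (K + J + l * m) < 2 * K * J := by
    have h1 : K * (l + 6 * m) ≤ K * (2 * J) := Nat.mul_le_mul_left _ hJ1
    have h2 : 3 * m * Q ≤ 3 * m * (2 * K + m + 1) := Nat.mul_le_mul_left _ hK2
    have h3 : l * (2 * J) ≤ l * (l + 1 + 6 * m) := Nat.mul_le_mul_left _ hJ2
    have h4 : 3 * m * (l * l) ≤ 3 * m * Q := Nat.mul_le_mul_left _ hl1
    have h5 : (m * l) * (8 * m) ≤ (m * l) * l := Nat.mul_le_mul_left _ hl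
    have h6 : m * (8 * m) ≤ m * l := Nat.mul_le_mul_left _ hl
    have h7 : l * l * 1 ≤ l * l * m := Nat.mul_le_mul_left _ hm1
    have h8 : m * l * 1 ≤ m * l * m := Nat.mul_le_mul_left _ hm1
    have h9 : l * 1 ≤ l * m := Nat.mul_le_mul_left _ hm1
    have h10 : m * 1 ≤ m * m := Nat.mul_le_mul_left _ hm1
    nlinarith
  have h := stepanov_count hW hsq hu hx e hc (by omega) (show l ≤ Q by nlinarith) hcount
  rw [← hQ, ← hm] at h
  have hl0 : 0 < l := by omega
  refine le_of_mul_le_mul_right (a := l) ?_ hl0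
  have hJ : (2 * (J - 1)) * Q + Q ≤ (l + 6 * m) * Q := by
    calc (2 * (J - 1)) * Q + Q = (2 * (J - 1) + 1) * Q := by ring
      _ ≤ _ := Nat.mul_le_mul_right _ (by omega)
  have hmQ : m * Q ≤ m * (l * l + l + l) := Nat.mul_le_mul_left _ hl2
  have h5 : (m * l) * 8 ≤ (m * l) * l := Nat.mul_le_mul_left _ (by omega)
  have hcm : 2 * (c * m) + m = Q * m := by rw [← hc]; ring
  nlinarith

/-- Weil's bound (with a weaker constant) for the complete quadratic character sum. -/
theorem abs_sum_quadraticChar_le (hF : ringChar F ≠ 2) (hW : W.Monic) (hsq : Squarefree W)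
    (hu : ¬ IsUnit W) :
    |((∑ x : F, quadraticChar F (W.eval x) : ℤ) : ℝ)| ≤
      17 * W.natDegree * Real.sqrt (Fintype.card F) := by
  have hm1 : 1 ≤ W.natDegree := by
    by_contra h
    exact hu ((hW.natDegree_eq_zero.1 (by omega)) ▸ isUnit_one)
  set Q := Fintype.card F with hQ
  have hQ0 : 0 < Q := Fintype.card_pos
  set l := Nat.sqrt Q with hl
  have hl1 : l * l ≤ Q := Nat.sqrt_le Q
  have hl2 : Q ≤ l * l + l + l := Nat.sqrt_le_add Q
  have hl0 : 1 ≤ l := by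
    rw [hl]; exact Nat.sqrt_pos.2 hQ0
  have hls : (l : ℝ) ≤ Real.sqrt Q := Real.le_sqrt_of_sq_le (by
    have : ((l * l : ℕ) : ℝ) ≤ Q := by exact_mod_cast hl1
    push_cast at this; nlinarith)
  set N : ℤ → ℕ := fun e => (Finset.univ.filter fun x : F => quadraticChar F (W.eval x) = e).card
    with hN
  have hS : ∑ x : F, quadraticChar F (W.eval x) = (N 1 : ℤ) - N (-1) := by
    simp only [hN, Finset.card_filter, Nat.cast_sum, ← Finset.sum_sub_distrib]
    refine Finset.sum_congr rfl fun x _ => ?_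
    by_cases h0 : W.eval x = 0
    · simp [h0]
    · rcases quadraticChar_dichotomy h0 with h | h <;> simp [h]
  have hT : N 0 + N 1 + N (-1) = Q := by
    simp only [hN, Finset.card_filter, ← Finset.sum_add_distrib]
    rw [hQ, ← Finset.card_univ, Finset.card_eq_sum_ones]
    refine Finset.sum_congr rfl fun x _ => ?_
    by_cases h0 : W.eval x = 0
    · simp [h0]
    · rcases quadraticChar_dichotomy h0 with h | h <;> simp [h]
  have key : |((∑ x : F, quadraticChar F (W.eval x) : ℤ))| ≤ 17 * W.natDegree * l := by
    rw [hS]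
    by_cases hbig : 8 * W.natDegree ≤ l
    · have hN0 : N 0 ≤ W.natDegree := by
        refine le_trans ?_ (card_roots' W)
        refine le_trans (Finset.card_le_card (fun x hx => ?_)) W.roots.toFinset_card_le
        have := (Finset.mem_filter.1 hx).2
        rw [quadraticChar_eq_zero_iff] at this
        simp [hW.ne_zero, this]
      have hb : ∀ e : ℤ, e = 1 ∨ e = -1 → 2 * N e ≤ Q + 16 * W.natDegree * l := by
        intro e he
        refine le_trans (Nat.mul_le_mul_left 2 (Finset.card_le_card (fun x hx => ?_)))
          (stepanov_card_le hF hW hsq hu hl1 hl2 hbig (e : F))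
        rw [Finset.mem_filter] at hx ⊢
        refine ⟨hx.1, ?_⟩
        rw [← quadraticChar_eq_pow_of_char_ne_two' hF, hx.2]
      have h1 := hb 1 (Or.inl rfl)
      have h2 := hb (-1) (Or.inr rfl)
      have h3 : W.natDegree * 1 ≤ W.natDegree * l := Nat.mul_le_mul_left _ hl0
      rw [abs_le]
      zify at *
      constructor <;> nlinarith
    · have h1 : l * l ≤ (8 * W.natDegree) * l := Nat.mul_le_mul_right _ (by omega)
      have h2 : 1 * l ≤ W.natDegree * l := Nat.mul_le_mul_right _ hm1
      rw [abs_le]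
      zify at *
      constructor <;> nlinarith
  calc |((∑ x : F, quadraticChar F (W.eval x) : ℤ) : ℝ)|
      = ((|(∑ x : F, quadraticChar F (W.eval x))| : ℤ) : ℝ) := by rw [Int.cast_abs]
    _ ≤ ((17 * W.natDegree * l : ℤ) : ℝ) := by exact_mod_cast key
    _ = 17 * W.natDegree * l := by push_cast; ring
    _ ≤ _ := by gcongr

end Stepanov

end

section
lemma quadraticChar_ringEquiv {F K : Type*} [Field F] [Fintype F] [Field K] [Fintype K]
    (φ : F ≃+* K) (a : F) : quadraticChar K (φ a) = quadraticChar F a := by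
  have h : IsSquare (φ a) ↔ IsSquare a :=
    ⟨fun h => by simpa using h.map φ.symm, fun h => h.map φ⟩
  simp only [quadraticChar_apply, quadraticCharFun, map_eq_zero_iff φ φ.injective, h]

variable {q : ℕ} [Fact q.Prime] [hq4 : Fact (q % 4 = 1)]

section Galois
variable {K : Type*} [Field K] [Fintype K] [Algebra (ZMod q) K]

lemma quadraticChar_aeval {P W : Fqx q} (hi : Irreducible P)
    (hK : Fintype.card K = q ^ P.natDegree) {x : K} (hx : aeval x P = 0) :
    quadraticChar K (aeval x W) = legSym q W P := by
  have hf : Fact (Irreducible P) := ⟨hi⟩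
  rw [legSym_eq]
  set φ : AdjoinRoot P →+* K := AdjoinRoot.lift (algebraMap (ZMod q) K) x hx with hφ
  have hbij : Function.Bijective φ := by
    rw [Fintype.bijective_iff_injective_and_card]
    refine ⟨φ.injective, ?_⟩
    rw [hK, Module.card_eq_pow_finrank (K := ZMod q) (V := AdjoinRoot P), ZMod.card,
      (AdjoinRoot.powerBasis hi.ne_zero).finrank, AdjoinRoot.powerBasis_dim]
  have := quadraticChar_ringEquiv (RingEquiv.ofBijective φ hbij) (AdjoinRoot.mk P W)
  rw [← this]
  rfl

lemma card_minpoly_le (P : Fqx q) :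
    (Finset.univ.filter fun x : K => minpoly (ZMod q) x = P).card ≤ P.natDegree := by
  rcases eq_or_ne P 0 with rfl | h0
  · rw [Finset.card_eq_zero.2]
    · simp
    · refine Finset.filter_eq_empty_iff.2 fun x _ => minpoly.ne_zero ?_
      exact Algebra.IsIntegral.isIntegral x
  · have h1 : P.map (algebraMap (ZMod q) K) ≠ 0 := map_ne_zero h0
    refine le_trans (Finset.card_le_card (fun x hx => ?_))
      ((Multiset.toFinset_card_le _).trans ((card_roots' (P.map (algebraMap (ZMod q) K))).trans
        natDegree_map_le))
    rw [Multiset.mem_toFinset, mem_roots h1, IsRoot, eval_map, ← aeval_def,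
      ← (Finset.mem_filter.1 hx).2, minpoly.aeval]

lemma card_minpoly_eq {P : Fqx q} (hm : P.Monic) (hi : Irreducible P)
    (hK : Fintype.card K = q ^ P.natDegree) :
    (Finset.univ.filter fun x : K => minpoly (ZMod q) x = P).card = P.natDegree := by
  have hf : Fact (Irreducible P) := ⟨hi⟩
  have hc : Fintype.card (AdjoinRoot P) = Fintype.card K := by
    rw [hK, Module.card_eq_pow_finrank (K := ZMod q) (V := AdjoinRoot P), ZMod.card,
      (AdjoinRoot.powerBasis hi.ne_zero).finrank, AdjoinRoot.powerBasis_dim]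
  have φ := FiniteField.algEquivOfCardEq q hc
  have hx : aeval (φ (AdjoinRoot.root P)) P = 0 := by
    rw [aeval_algHom_apply, AdjoinRoot.aeval_eq, AdjoinRoot.mk_self, map_zero]
  have hmin := minpoly.eq_of_irreducible_of_monic hi hx hm
  have hs : (P.map (algebraMap (ZMod q) K)).Splits := by
    rw [hmin]; exact Normal.splits inferInstance _
  have hsep : P.Separable := PerfectField.separable_of_irreducible hi
  rw [← card_rootSet_eq_natDegree hsep hs, ← Set.toFinset_card]
  congr 1
  ext x
  rw [Finset.mem_filter, Set.mem_toFinset, mem_rootSet_of_ne hi.ne_zero]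
  constructor
  · rintro ⟨-, h⟩; rw [← h, minpoly.aeval]
  · intro h; exact ⟨Finset.mem_univ _, (minpoly.eq_of_irreducible_of_monic hi h hm).symm⟩

end Galois

lemma sum_legSym_sqfree {W : Fqx q} (hW : W.Monic) (hsq : Squarefree W) (hd1 : 1 ≤ W.natDegree)
    {d : ℕ} (hd : 1 ≤ d) :
    |((∑ P ∈ Pd q d, legSym q W P : ℤ) : ℝ)| ≤ 18 * W.natDegree * Real.sqrt q ^ d := by
  set K := GaloisField q d
  have hfin : Fintype K := Fintype.ofFinite K
  have hcard : Fintype.card K = q ^ d := by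
    rw [← Nat.card_eq_fintype_card]; exact GaloisField.card q d (by omega)
  have hchar : ringChar K ≠ 2 := by
    have h : CharP K q := charP_of_injective_algebraMap' (ZMod q) q
    rw [ringChar.eq K q]
    exact q_ne_two
  have hWK : (W.map (algebraMap (ZMod q) K)).Monic := hW.map _
  have hsK : Squarefree (W.map (algebraMap (ZMod q) K)) :=
    ((PerfectField.separable_iff_squarefree.2 hsq).map).squarefree
  have hdK : (W.map (algebraMap (ZMod q) K)).natDegree = W.natDegree := hW.natDegree_map _
  have hweil := abs_sum_quadraticChar_le hchar hWK hsK (fun h => by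
    have := natDegree_eq_zero_of_isUnit h; omega)
  rw [hdK, hcard] at hweil
  have hsqrt : Real.sqrt ((q ^ d : ℕ) : ℝ) = Real.sqrt q ^ d := by
    push_cast
    rw [Real.sqrt_eq_iff_mul_self_eq (by positivity) (by positivity), ← mul_pow,
      Real.mul_self_sqrt (by positivity)]
  rw [hsqrt] at hweil
  set T := Real.sqrt q with hT
  have hT2 : 2 ≤ T := Real.le_sqrt_of_sq_le (by
    have := q_ge_five (q := q)
    have : (5 : ℝ) ≤ q := by exact_mod_cast this
    linarith)
  set f : K → ℤ := fun x => quadraticChar K (eval x (W.map (algebraMap (ZMod q) K))) with hf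
  set mp : K → Fqx q := fun x => minpoly (ZMod q) x with hmp
  have hxint : ∀ x : K, IsIntegral (ZMod q) x := fun x => Algebra.IsIntegral.isIntegral x
  set S := Finset.univ.filter fun x : K => (mp x).natDegree = d with hS
  have h1 : ∑ x ∈ S, f x = d * ∑ P ∈ Pd q d, legSym q W P := by
    rw [← Finset.sum_fiberwise_of_maps_to (g := mp) (t := Pd q d), Finset.mul_sum]
    · refine Finset.sum_congr rfl fun P hP => ?_
      obtain ⟨hPm, hPi, hPd⟩ := mem_Pd.1 hP
      have e1 : S.filter (fun x => mp x = P) = Finset.univ.filter fun x : K => mp x = P := by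
        ext x
        simp only [hS, Finset.mem_filter, Finset.mem_univ, true_and, and_iff_right_iff_imp]
        rintro rfl; exact hPd
      rw [e1, Finset.sum_congr rfl (g := fun _ => legSym q W P), Finset.sum_const,
        card_minpoly_eq hPm hPi (by rw [hcard, hPd]), hPd, nsmul_eq_mul]
      intro x hx
      simp only [hf]
      rw [eval_map, ← aeval_def]
      refine quadraticChar_aeval hPi (by rw [hcard, hPd]) ?_
      rw [← (Finset.mem_filter.1 hx).2, minpoly.aeval]
    · intro x hx
      exact mem_Pd.2 ⟨minpoly.monic (hxint x), minpoly.irreducible (hxint x),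
        (Finset.mem_filter.1 hx).2⟩
  have h2 : ∀ t : Finset K, |((∑ x ∈ t, f x : ℤ) : ℝ)| ≤ t.card := by
    intro t
    push_cast
    refine (Finset.abs_sum_le_sum_abs _ _).trans ?_
    rw [Finset.card_eq_sum_ones]
    push_cast
    refine Finset.sum_le_sum fun x _ => ?_
    simp only [hf]
    by_cases h0 : eval x (W.map (algebraMap (ZMod q) K)) = 0
    · simp [h0]
    · rcases quadraticChar_dichotomy h0 with h | h <;> rw [h] <;> simp
  have h3 : ((Finset.univ.filter fun x : K => ¬ (mp x).natDegree = d).card : ℝ) ≤ d * T ^ d := by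
    have e1 : (Finset.univ.filter fun x : K => ¬ (mp x).natDegree = d).card ≤
        ∑ e ∈ Finset.Icc 1 (d / 2), ∑ P ∈ Pd q e, e := by
      rw [← Finset.sum_sigma (Finset.Icc 1 (d / 2)) (fun e => Pd q e) (fun s => s.1)]
      refine (Finset.card_eq_sum_card_fiberwise
        (f := fun x : K => (⟨(mp x).natDegree, mp x⟩ : Σ _ : ℕ, Fqx q))
        (t := (Finset.Icc 1 (d / 2)).sigma (fun e => Pd q e)) ?_).trans_le ?_
      · intro x hx
        have hx' := (Finset.mem_filter.1 hx).2
        have hdvd : (mp x).natDegree ∣ d := by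
          have := minpoly.degree_dvd (K := ZMod q) (x := x) (hxint x)
          rwa [GaloisField.finrank q (by omega)] at this
        have hpos := (minpoly.irreducible (hxint x)).natDegree_pos
        simp only [Finset.coe_sigma, Set.mem_sigma_iff, Finset.mem_coe, Finset.mem_Icc]
        refine ⟨⟨hpos, ?_⟩, mem_Pd.2 ⟨minpoly.monic (hxint x), minpoly.irreducible (hxint x), rfl⟩⟩
        obtain ⟨k, hk⟩ := hdvd
        rcases k with _ | _ | k
        · omega
        · exact absurd (by rw [hk]; ring) hx'
        · rw [Nat.le_div_iff_mul_le (by norm_num), hk]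
          exact Nat.mul_le_mul_left _ (by omega)
      · refine Finset.sum_le_sum fun s hs => ?_
        obtain ⟨e, P⟩ := s
        have := mem_Pd.1 (Finset.mem_sigma.1 hs).2
        refine le_trans (Finset.card_le_card ?_) ((card_minpoly_le (K := K) P).trans this.2.2.le)
        intro x hx
        simp only [Finset.mem_filter, Sigma.mk.injEq, Finset.mem_univ, true_and] at hx ⊢
        exact eq_of_heq hx.2.2
    have e2 : (∑ e ∈ Finset.Icc 1 (d / 2), ∑ P ∈ Pd q e, e) ≤
        (d / 2) * ∑ e ∈ Finset.Icc 1 (d / 2), q ^ e := by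
      rw [Finset.mul_sum]
      refine Finset.sum_le_sum fun e he => ?_
      rw [Finset.sum_const, smul_eq_mul, mul_comm]
      exact Nat.mul_le_mul (Finset.mem_Icc.1 he).2 (card_Pd_le e)
    have e3 : ∀ n, ∑ e ∈ Finset.Icc 1 n, q ^ e ≤ 2 * q ^ n := by
      intro n
      induction n with
      | zero => simp
      | succ n ih =>
        rw [Finset.sum_Icc_succ_top (by omega)]
        have : 2 * q ^ n ≤ q * q ^ n := Nat.mul_le_mul_right _ (Fact.out : q.Prime).two_le
        rw [pow_succ]; nlinarith
    have e4 := e1.trans (e2.trans (Nat.mul_le_mul_left _ (e3 (d / 2))))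
    have e5 : ((q : ℝ)) ^ (d / 2) ≤ T ^ d := by
      have : (q : ℝ) = T ^ 2 := by rw [hT, Real.sq_sqrt (by positivity)]
      rw [this, ← pow_mul]
      exact pow_le_pow_right₀ (by linarith) (by omega)
    have e6 : d / 2 * (2 * q ^ (d / 2)) ≤ d * q ^ (d / 2) := by
      rw [← mul_assoc]; exact Nat.mul_le_mul_right _ (by omega)
    calc _ ≤ ((d * q ^ (d / 2) : ℕ) : ℝ) := by exact_mod_cast e4.trans e6
      _ ≤ _ := by push_cast; gcongr
  have h4 : ∑ x, f x = ∑ x ∈ S, f x +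
      ∑ x ∈ Finset.univ.filter (fun x : K => ¬ (mp x).natDegree = d), f x :=
    (Finset.sum_filter_add_sum_filter_not _ _ _).symm
  have h5 := h2 (Finset.univ.filter (fun x : K => ¬ (mp x).natDegree = d))
  have hd' : (1 : ℝ) ≤ d := by exact_mod_cast hd
  have hdW : (1 : ℝ) ≤ W.natDegree := by exact_mod_cast hd1
  have hTd : 0 < T ^ d := by positivity
  have h6 : (d : ℝ) * |((∑ P ∈ Pd q d, legSym q W P : ℤ) : ℝ)| ≤
      17 * W.natDegree * T ^ d + d * T ^ d := by
    have : (d : ℝ) * |((∑ P ∈ Pd q d, legSym q W P : ℤ) : ℝ)| = |((∑ x ∈ S, f x : ℤ) : ℝ)| := by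
      rw [h1, Int.cast_mul, abs_mul]; simp
    rw [this, eq_sub_of_add_eq h4.symm, Int.cast_sub]
    refine (abs_sub _ _).trans ?_
    exact add_le_add hweil (h5.trans h3)
  refine le_of_mul_le_mul_left (h6.trans ?_) (by linarith : (0 : ℝ) < d)
  have a1 : (d : ℝ) * T ^ d ≤ d * T ^ d * W.natDegree := le_mul_of_one_le_right (by positivity) hdW
  have a2 : 17 * W.natDegree * T ^ d ≤ d * (17 * W.natDegree * T ^ d) :=
    le_mul_of_one_le_left (by positivity) hd'
  linarith

/-- The sum of a nontrivial quadratic character over the primes of given degree. -/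
theorem norm_sum_chi_Pd_le {W : Fqx q} (hW : W.Monic) (hns : ¬ ∃ b : Fqx q, b.Monic ∧ W = b ^ 2)
    {d : ℕ} (hd : 1 ≤ d) :
    ‖∑ P ∈ Pd q d, chi q W P‖ ≤ 18 * W.natDegree * Real.sqrt q ^ d := by
  obtain ⟨a, b, ha, hb, hsq, hab⟩ := exists_mul_sq _ W hW rfl
  have hda : 1 ≤ a.natDegree := by
    by_contra h
    have : a = 1 := ha.natDegree_eq_zero.1 (by omega)
    exact hns ⟨b, hb, by rw [hab, this, one_mul]⟩
  have hdeg : W.natDegree = a.natDegree + 2 * b.natDegree := by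
    rw [hab, ha.natDegree_mul (hb.pow 2), hb.natDegree_pow]
  have hT : 1 ≤ Real.sqrt q ^ d := one_le_pow₀ (Real.one_le_sqrt.2 (by
    exact_mod_cast (Fact.out : q.Prime).one_lt.le))
  have h1 : ∑ P ∈ Pd q d, chi q W P = ((∑ P ∈ Pd q d, legSym q a P : ℤ) : ℂ) -
      ∑ P ∈ (Pd q d).filter (fun P => P ∣ b), (legSym q a P : ℂ) := by
    push_cast
    rw [Finset.sum_filter, ← Finset.sum_sub_distrib]
    refine Finset.sum_congr rfl fun P hP => ?_
    obtain ⟨hPm, hPi, hPd⟩ := mem_Pd.1 hP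
    rw [chi_prime W hPm hPi, hab, legSym_mul hPi, pow_two, legSym_mul hPi]
    have h2 := legSym_sq (P := P) b
    by_cases h : P ∣ b
    · have := (legSym_eq_zero_iff (P := P) b).2 h
      simp [this, h]
    · rw [if_neg h, pow_two] at h2
      simp [h2, h]
  have hcard : ((Pd q d).filter (fun P => P ∣ b)).card ≤ b.natDegree := by
    rw [natDegree_eq_sum hb, Finset.card_eq_sum_ones]
    refine (Finset.sum_le_sum (g := fun P => vv P b * P.natDegree) fun P hP => ?_).trans
      (Finset.sum_le_sum_of_subset fun P hP => ?_)
    · obtain ⟨h1, h2⟩ := Finset.mem_filter.1 hP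
      obtain ⟨hPm, hPi, hPd⟩ := mem_Pd.1 h1
      exact Nat.mul_pos (vv_pos ((mem_pf hb.ne_zero).2 ⟨hPm, hPi, h2⟩)) (by omega)
    · obtain ⟨h1, h2⟩ := Finset.mem_filter.1 hP
      obtain ⟨hPm, hPi, hPd⟩ := mem_Pd.1 h1
      exact (mem_pf hb.ne_zero).2 ⟨hPm, hPi, h2⟩
  rw [h1]
  refine (norm_sub_le _ _).trans ?_
  have h2 : ‖((∑ P ∈ Pd q d, legSym q a P : ℤ) : ℂ)‖ ≤ 18 * a.natDegree * Real.sqrt q ^ d := by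
    rw [Complex.norm_intCast]
    exact sum_legSym_sqfree ha hsq hda hd
  have h3 : ‖∑ P ∈ (Pd q d).filter (fun P => P ∣ b), (legSym q a P : ℂ)‖ ≤ b.natDegree := by
    refine (norm_sum_le_of_le (n := fun _ => (1 : ℝ)) _ fun P hP => ?_).trans ?_
    · obtain ⟨hPm, hPi, hPd⟩ := mem_Pd.1 (Finset.mem_filter.1 hP).1
      rw [← chi_prime a hPm hPi]; exact norm_chi_le hPi.ne_zero
    · rw [Finset.sum_const, nsmul_eq_mul, mul_one]; exact_mod_cast hcard
  have h4 : (b.natDegree : ℝ) ≤ b.natDegree * Real.sqrt q ^ d :=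
    le_mul_of_one_le_right (by positivity) hT
  have h5 : (0 : ℝ) ≤ b.natDegree * Real.sqrt q ^ d := by positivity
  rw [hdeg, Nat.cast_add, Nat.cast_mul]
  push_cast at h2 h3 ⊢
  linarith

end

section
variable {q : ℕ} [Fact q.Prime] [hq4 : Fact (q % 4 = 1)]

/-! ### Analytic tools -/

/-- Cauchy's estimate for the coefficients of a polynomial. -/
lemma norm_coeff_mul_le (p : ℂ[X]) (n : ℕ) {ρ B : ℝ} (hρ : 0 ≤ ρ)
    (h : ∀ z : ℂ, ‖z‖ = ρ → ‖p.eval z‖ ≤ B) : ‖p.coeff n‖ * ρ ^ n ≤ B := by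
  set M := max p.natDegree n + 1 with hM
  have hM0 : M ≠ 0 := by omega
  have hζ := Complex.isPrimitiveRoot_exp M hM0
  set ζ := Complex.exp (2 * Real.pi * Complex.I / M) with hζd
  have hζ0 : ζ ≠ 0 := Complex.exp_ne_zero _
  have hζn : ‖ζ‖ = 1 := hζ.norm'_eq_one hM0
  have key : ∑ i ∈ Finset.range M, p.eval (ρ * ζ ^ i) * (ζ⁻¹ ^ n) ^ i = M * (p.coeff n * ρ ^ n) := by
    have h1 : ∀ i ∈ Finset.range M, p.eval (ρ * ζ ^ i) * (ζ⁻¹ ^ n) ^ i =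
        ∑ k ∈ Finset.range M, p.coeff k * ρ ^ k * (ζ ^ k * ζ⁻¹ ^ n) ^ i := by
      intro i _
      rw [eval_eq_sum_range' (lt_of_le_of_lt (le_max_left p.natDegree n) (Nat.lt_succ_self _)),
        Finset.sum_mul]
      refine Finset.sum_congr rfl fun k _ => ?_
      rw [mul_pow, mul_pow, ← pow_mul, ← pow_mul, mul_comm i k]; ring
    rw [Finset.sum_congr rfl h1, Finset.sum_comm]
    simp_rw [← Finset.mul_sum]
    rw [Finset.sum_eq_single n]
    · have : ζ ^ n * ζ⁻¹ ^ n = 1 := by rw [← mul_pow, mul_inv_cancel₀ hζ0, one_pow]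
      simp only [this, one_pow, Finset.sum_const, Finset.card_range, nsmul_eq_mul, mul_one]
      ring
    · intro k hk hkn
      have hk' := Finset.mem_range.1 hk
      have hne : ζ ^ k * ζ⁻¹ ^ n ≠ 1 := by
        intro h1
        have h2 : ζ ^ k = ζ ^ n := by
          rw [inv_pow] at h1
          exact eq_of_mul_inv_eq_one h1
        exact hkn (hζ.pow_inj hk' (by omega) h2)
      have h3 : (ζ ^ k * ζ⁻¹ ^ n) ^ M = 1 := by
        rw [mul_pow, ← pow_mul, ← pow_mul, mul_comm k, mul_comm n, pow_mul, pow_mul, inv_pow,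
          hζ.pow_eq_one]
        simp
      have h4 := geom_sum_mul (ζ ^ k * ζ⁻¹ ^ n) M
      rw [h3, sub_self] at h4
      rw [(mul_eq_zero.1 h4).resolve_right (sub_ne_zero.2 hne), mul_zero]
    · intro hn; exact absurd (Finset.mem_range.2 (by omega)) hn
  have h2 : ‖(M : ℂ) * (p.coeff n * ρ ^ n)‖ ≤ M * B := by
    rw [← key]
    refine (norm_sum_le_of_le (n := fun _ => B) _ fun i _ => ?_).trans (by simp)
    rw [norm_mul, norm_pow, norm_pow, norm_inv, hζn]
    simp only [inv_one, one_pow, mul_one]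
    refine h _ ?_
    rw [norm_mul, norm_pow, hζn, one_pow, mul_one, Complex.norm_real, Real.norm_of_nonneg hρ]
  rw [norm_mul, norm_mul, norm_pow, Complex.norm_natCast, Complex.norm_real,
    Real.norm_of_nonneg hρ] at h2
  exact le_of_mul_le_mul_left h2 (by positivity)

lemma norm_one_add_le_exp (w : ℂ) : ‖1 + w‖ ≤ Real.exp (w.re + ‖w‖ ^ 2 / 2) := by
  have h1 : ‖1 + w‖ ^ 2 = 1 + (2 * w.re + ‖w‖ ^ 2) := by
    rw [← Complex.normSq_eq_norm_sq, ← Complex.normSq_eq_norm_sq, Complex.normSq_apply,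
      Complex.normSq_apply]
    simp only [Complex.add_re, Complex.one_re, Complex.add_im, Complex.one_im]
    ring
  have h2 : ‖1 + w‖ ^ 2 ≤ Real.exp (w.re + ‖w‖ ^ 2 / 2) ^ 2 := by
    rw [h1, ← Real.exp_nat_mul]
    refine (le_of_eq (add_comm _ _)).trans ((Real.add_one_le_exp _).trans (le_of_eq ?_))
    congr 1; push_cast; ring
  exact le_of_sq_le_sq h2 (Real.exp_pos _).le

lemma norm_prod_one_add_le_exp {ι : Type*} (s : Finset ι) (w : ι → ℂ) :
    ‖∏ i ∈ s, (1 + w i)‖ ≤ Real.exp (‖∑ i ∈ s, w i‖ + ∑ i ∈ s, ‖w i‖ ^ 2 / 2) := by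
  rw [norm_prod]
  calc ∏ i ∈ s, ‖1 + w i‖ ≤ ∏ i ∈ s, Real.exp ((w i).re + ‖w i‖ ^ 2 / 2) :=
        Finset.prod_le_prod (fun _ _ => norm_nonneg _) fun i _ => norm_one_add_le_exp _
    _ = Real.exp ((∑ i ∈ s, w i).re + ∑ i ∈ s, ‖w i‖ ^ 2 / 2) := by
        rw [← Real.exp_sum, Finset.sum_add_distrib, Complex.re_sum]
    _ ≤ _ := by
        refine Real.exp_le_exp.2 (add_le_add_left ?_ _)
        exact (le_abs_self _).trans (Complex.abs_re_le_norm _)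

lemma norm_prod_one_add_le_exp' {ι : Type*} (s : Finset ι) (w : ι → ℂ) :
    ‖∏ i ∈ s, (1 + w i)‖ ≤ Real.exp (∑ i ∈ s, ‖w i‖) := by
  rw [norm_prod, Real.exp_sum]
  refine Finset.prod_le_prod (fun _ _ => norm_nonneg _) fun i _ => ?_
  refine (norm_add_le _ _).trans ?_
  rw [norm_one, add_comm]
  exact Real.add_one_le_exp _

lemma sum_pow_Icc_le {θ : ℝ} (h0 : 0 ≤ θ) (h1 : θ < 1) (J : ℕ) :
    ∑ d ∈ Finset.Icc 1 J, θ ^ d ≤ 1 / (1 - θ) := by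
  rw [one_div, ← tsum_geometric_of_lt_one h0 h1]
  exact (summable_geometric_of_lt_one h0 h1).sum_le_tsum _ fun i _ => pow_nonneg h0 i

lemma sum_pow_range_le {θ : ℝ} (h0 : 0 ≤ θ) (h1 : θ < 1) (J : ℕ) :
    ∑ d ∈ Finset.range J, θ ^ d ≤ 1 / (1 - θ) := by
  rw [one_div, ← tsum_geometric_of_lt_one h0 h1]
  exact (summable_geometric_of_lt_one h0 h1).sum_le_tsum _ fun i _ => pow_nonneg h0 i

lemma sum_Pr_pow_le {θ : ℝ} (h0 : 0 ≤ θ) (h1 : q * θ < 1) (J : ℕ) :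
    ∑ P ∈ Pr q J, θ ^ P.natDegree ≤ 1 / (1 - q * θ) := by
  rw [sum_Pr J (fun P => θ ^ P.natDegree)]
  refine le_trans (Finset.sum_le_sum fun d _ => ?_) (sum_pow_Icc_le (by positivity) h1 J)
  rw [Finset.sum_congr rfl fun P hP => by rw [(mem_Pd.1 hP).2.2], Finset.sum_const, nsmul_eq_mul,
    mul_pow]
  refine mul_le_mul_of_nonneg_right ?_ (pow_nonneg h0 d)
  exact_mod_cast card_Pd_le d

/-- The Dirichlet-type sum over squarefree monics as a coefficient of an Euler product. -/
lemma sum_Hn_prod (v : Fqx q → ℂ) {A J : ℕ} (hA : A ≤ J) :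
    ∑ a ∈ Hn q A, ∏ P ∈ pf a, v P = (∏ P ∈ Pr q J, (1 + C (v P) * X ^ P.natDegree)).coeff A := by
  set g : Fqx q → ℕ → ℂ := fun P k => if k = 0 then 1 else if k = 1 then v P else 0 with hg
  have h1 := euler_product g (fun P => by simp [hg]) J A hA
  have h2 : ∏ P ∈ Pr q J, lf J (g P) P.natDegree =
      ∏ P ∈ Pr q J, (1 + C (v P) * X ^ P.natDegree) := by
    refine Finset.prod_congr rfl fun P hP => ?_
    obtain ⟨hPm, hPi, hPd⟩ := mem_Pr.1 hP
    obtain ⟨J', rfl⟩ : ∃ J', J = J' + 1 := ⟨J - 1, by have := hPi.natDegree_pos; omega⟩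
    rw [lf, Finset.sum_range_succ', Finset.sum_range_succ']
    simp only [hg]
    rw [Finset.sum_eq_zero fun k _ => by simp]
    simp [add_comm]
  rw [← h2, ← h1]
  have h3 : Hn q A = (Mn q A).filter Squarefree := by
    ext f; simp [mem_Hn, mem_Mn, and_assoc]
  rw [h3, Finset.sum_filter]
  refine Finset.sum_congr rfl fun f hf => ?_
  have hf' := (mem_Mn.1 hf).1
  split_ifs with hs
  · refine Finset.prod_congr rfl fun P hP => ?_
    have : vv P f = 1 := le_antisymm (vv_le_one hf' hs P) (vv_pos hP)
    simp [hg, this]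
  · obtain ⟨P, hP⟩ : ∃ P ∈ pf f, 2 ≤ vv P f := by
      by_contra! h
      apply hs
      rw [UniqueFactorizationMonoid.squarefree_iff_nodup_normalizedFactors hf'.ne_zero]
      refine Multiset.nodup_iff_count_le_one.2 fun P => ?_
      by_cases hP : P ∈ pf f
      · exact Nat.lt_succ_iff.1 (h P hP)
      · have := vv_eq_zero hP
        rw [vv] at this; omega
    symm
    refine Finset.prod_eq_zero hP.1 ?_
    have := hP.2
    simp only [hg]
    rw [if_neg (by omega), if_neg (by omega)]

end

section
variable {q : ℕ} [Fact q.Prime] [hq4 : Fact (q % 4 = 1)]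

/-- Truncation of `1 / (1 - y ^ (2 d))`. -/
def cP (K d : ℕ) (y : ℂ) : ℂ := ∑ k ∈ Finset.range (K + 1), y ^ (2 * d * k)

lemma norm_pow_le_pow {y : ℂ} {ρ : ℝ} (hy : ‖y‖ ≤ ρ) (k : ℕ) : ‖y ^ k‖ ≤ ρ ^ k := by
  rw [norm_pow]; exact pow_le_pow_left₀ (norm_nonneg _) hy k

lemma norm_cP_le {K d : ℕ} (hd : 1 ≤ d) {y : ℂ} {ρ : ℝ} (hy : ‖y‖ ≤ ρ) (hρ : ρ < 1) :
    ‖cP K d y‖ ≤ 1 / (1 - ρ ^ 2) := by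
  have hρ0 : 0 ≤ ρ := (norm_nonneg _).trans hy
  have h2 : ρ ^ 2 < 1 := by nlinarith
  refine (norm_sum_le_of_le (n := fun k => (ρ ^ 2) ^ k) _ fun k _ => ?_).trans
    (sum_pow_range_le (by positivity) h2 _)
  refine (norm_pow_le_pow hy _).trans ?_
  rw [← pow_mul]
  exact pow_le_pow_of_le_one hρ0 hρ.le (by nlinarith)

lemma norm_cP_sub_one_le {K d : ℕ} (hd : 1 ≤ d) {y : ℂ} {ρ : ℝ} (hy : ‖y‖ ≤ ρ) (hρ : ρ < 1) :
    ‖cP K d y - 1‖ ≤ ρ ^ (2 * d) * (1 / (1 - ρ ^ 2)) := by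
  have hρ0 : 0 ≤ ρ := (norm_nonneg _).trans hy
  have h2 : ρ ^ 2 < 1 := by nlinarith
  rw [cP, Finset.sum_range_succ']
  simp only [mul_zero, pow_zero, add_sub_cancel_right]
  refine (norm_sum_le_of_le (n := fun k => ρ ^ (2 * d) * (ρ ^ 2) ^ k) _ fun k _ => ?_).trans ?_
  · refine (norm_pow_le_pow hy _).trans ?_
    rw [← pow_mul, ← pow_add]
    exact pow_le_pow_of_le_one hρ0 hρ.le (by nlinarith)
  · rw [← Finset.mul_sum]
    exact mul_le_mul_of_nonneg_left (sum_pow_range_le (by positivity) h2 _) (by positivity)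

/-- The ratio `d₃(P ^ (2 * k + 1)) / d₃(P ^ (2 * k))`. -/
def beta (k : ℕ) : ℂ := (2 * k + 3) / (2 * k + 1)

lemma norm_beta_le (k : ℕ) : ‖beta k‖ ≤ 3 := by
  have h1 : beta k = (((2 * k + 3) / (2 * k + 1) : ℝ) : ℂ) := by rw [beta]; push_cast; ring
  have h0 : (0 : ℝ) ≤ k := Nat.cast_nonneg k
  rw [h1, Complex.norm_real, Real.norm_of_nonneg (by positivity), div_le_iff₀ (by positivity)]
  linarith

/-- The local weights `v_P`. -/
def vf (K : ℕ) (y : ℂ) (b W P : Fqx q) : ℂ :=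
  chi q W P * (if P ∈ pf b then beta (vv P b) else 3 * cP K P.natDegree y)

lemma one_le_c0 {ρ : ℝ} (h0 : 0 ≤ ρ) (hρ : ρ < 1) : 1 ≤ 1 / (1 - ρ ^ 2) := by
  have h2 : ρ ^ 2 < 1 := by nlinarith
  rw [le_div_iff₀ (by linarith)]; nlinarith [sq_nonneg ρ]

lemma norm_vf_le {K : ℕ} {y : ℂ} {ρ : ℝ} (hy : ‖y‖ ≤ ρ) (hρ : ρ < 1) (b W : Fqx q) {P : Fqx q}
    (hP : Irreducible P) : ‖vf K y b W P‖ ≤ 3 * (1 / (1 - ρ ^ 2)) := by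
  have hρ0 : 0 ≤ ρ := (norm_nonneg _).trans hy
  have hc := one_le_c0 hρ0 hρ
  rw [vf, norm_mul]
  refine (mul_le_of_le_one_left (norm_nonneg _) (norm_chi_le hP.ne_zero)).trans ?_
  split_ifs
  · exact (norm_beta_le _).trans (by linarith)
  · rw [norm_mul, Complex.norm_ofNat]
    exact mul_le_mul_of_nonneg_left (norm_cP_le hP.natDegree_pos hy hρ) (by norm_num)

/-- Sup bound for the Euler product twisted by a nontrivial character. -/
lemma exists_norm_prod_nonsq_le {ρ R : ℝ} (hρ0 : 0 ≤ ρ) (hρ : ρ < 1) (hR0 : 0 ≤ R)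
    (hR : q * R ^ 2 < 1) {ε : ℝ} (hε : 0 < ε) :
    ∃ C : ℝ, ∀ (J K : ℕ) (y u : ℂ) (b W : Fqx q), ‖y‖ ≤ ρ → ‖u‖ = R → b.Monic → W.Monic →
      (¬ ∃ w : Fqx q, w.Monic ∧ W = w ^ 2) →
      ‖∏ P ∈ Pr q J, (1 + vf K y b W P * u ^ P.natDegree)‖ ≤
        Real.exp (C + ε * (W.natDegree + b.natDegree)) := by
  set c := 1 / (1 - ρ ^ 2) with hc
  have hc1 : 1 ≤ c := one_le_c0 hρ0 hρ
  set s := Real.sqrt q with hs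
  have hq1 : (1 : ℝ) ≤ q := by exact_mod_cast (Fact.out : q.Prime).one_lt.le
  have hss : s ^ 2 = q := Real.sq_sqrt (by positivity)
  have hs0 : 0 ≤ s := Real.sqrt_nonneg _
  have hR1 : R < 1 := by
    by_contra! h
    nlinarith [one_le_pow₀ h (n := 2)]
  set θ := s * R with hθ
  have hθ0 : 0 ≤ θ := by positivity
  have hθ1 : θ < 1 := by
    have : θ ^ 2 < 1 := by rw [hθ, mul_pow, hss]; exact hR
    by_contra! h
    nlinarith [one_le_pow₀ h (n := 2)]
  set τ := Real.sqrt θ with hτ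
  have hτ0 : 0 ≤ τ := Real.sqrt_nonneg _
  have hττ : τ * τ = θ := Real.mul_self_sqrt hθ0
  have hτ1 : τ < 1 := by
    by_contra! h
    nlinarith
  obtain ⟨C1, hC1, hb1⟩ := exists_sum_pf_le (q := q) R hR0 hR1 (ε / (6 * c)) (by positivity)
  obtain ⟨d0, hd0⟩ := exists_pow_lt_of_lt_one
    (show 0 < ε * (1 - τ) / (54 * c) from div_pos (mul_pos hε (by linarith)) (by linarith)) hτ1
  set C2 := ∑ d ∈ Finset.Icc 1 d0, (q * R) ^ d with hC2
  refine ⟨3 * c * C2 + 6 * c * C1 + 9 * c ^ 2 / 2 * (1 / (1 - q * R ^ 2)),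
    fun J K y u b W hy hu hb hW hns => ?_⟩
  refine (norm_prod_one_add_le_exp _ _).trans (Real.exp_le_exp.2 ?_)
  have hsq : ∑ P ∈ Pr q J, ‖vf K y b W P * u ^ P.natDegree‖ ^ 2 / 2 ≤
      9 * c ^ 2 / 2 * (1 / (1 - q * R ^ 2)) := by
    refine le_trans (Finset.sum_le_sum (g := fun P => 9 * c ^ 2 / 2 * (R ^ 2) ^ P.natDegree)
      fun P hP => ?_) ?_
    · have h1 := norm_vf_le (K := K) hy hρ b W (mem_Pr.1 hP).2.1
      rw [← hc] at h1
      rw [norm_mul, norm_pow, hu, mul_pow, ← pow_mul, mul_comm _ 2, pow_mul]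
      have h2 : ‖vf K y b W P‖ ^ 2 ≤ (3 * c) ^ 2 := pow_le_pow_left₀ (norm_nonneg _) h1 2
      have h3 : 0 ≤ (R ^ 2) ^ P.natDegree := by positivity
      nlinarith [mul_le_mul_of_nonneg_right h2 h3]
    · rw [← Finset.mul_sum]
      exact mul_le_mul_of_nonneg_left (sum_Pr_pow_le (by positivity) hR J) (by positivity)
  have hlin : ∑ P ∈ Pr q J, vf K y b W P * u ^ P.natDegree =
      (∑ d ∈ Finset.Icc 1 J, 3 * cP K d y * u ^ d * ∑ P ∈ Pd q d, chi q W P) +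
      ∑ P ∈ (Pr q J).filter (fun P => P ∈ pf b),
        chi q W P * (beta (vv P b) - 3 * cP K P.natDegree y) * u ^ P.natDegree := by
    have e1 : ∑ d ∈ Finset.Icc 1 J, 3 * cP K d y * u ^ d * ∑ P ∈ Pd q d, chi q W P =
        ∑ P ∈ Pr q J, 3 * cP K P.natDegree y * u ^ P.natDegree * chi q W P := by
      rw [sum_Pr J (fun P => 3 * cP K P.natDegree y * u ^ P.natDegree * chi q W P)]
      refine Finset.sum_congr rfl fun d _ => ?_
      rw [Finset.mul_sum]
      refine Finset.sum_congr rfl fun P hP => by rw [(mem_Pd.1 hP).2.2]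
    rw [e1, Finset.sum_filter, ← Finset.sum_add_distrib]
    refine Finset.sum_congr rfl fun P _ => ?_
    rw [vf]
    split_ifs <;> ring
  have hA : ‖∑ d ∈ Finset.Icc 1 J, 3 * cP K d y * u ^ d * ∑ P ∈ Pd q d, chi q W P‖ ≤
      3 * c * C2 + ε * W.natDegree := by
    have hterm : ∀ d ∈ Finset.Icc 1 J, ‖3 * cP K d y * u ^ d * ∑ P ∈ Pd q d, chi q W P‖ ≤
        3 * c * (if d ≤ d0 then (q * R) ^ d else 0) + 54 * c * W.natDegree * τ ^ d0 * τ ^ d := by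
      intro d hd
      have hd1 := (Finset.mem_Icc.1 hd).1
      have hpi1 : ‖∑ P ∈ Pd q d, chi q W P‖ ≤ (q : ℝ) ^ d := by
        refine (norm_sum_le_of_le (n := fun _ => (1 : ℝ)) _ fun P hP =>
          norm_chi_le (mem_Pd.1 hP).2.1.ne_zero).trans ?_
        rw [Finset.sum_const, nsmul_eq_mul, mul_one]
        exact_mod_cast card_Pd_le d
      have hpi2 := norm_sum_chi_Pd_le hW hns hd1
      have hcd := norm_cP_le (K := K) hd1 hy hρ
      rw [← hc] at hcd
      have hRd : 0 ≤ R ^ d := pow_nonneg hR0 d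
      have hn : ‖3 * cP K d y * u ^ d * ∑ P ∈ Pd q d, chi q W P‖ ≤
          3 * c * (R ^ d * ‖∑ P ∈ Pd q d, chi q W P‖) := by
        rw [norm_mul, norm_mul, norm_mul, norm_pow, hu, Complex.norm_ofNat, mul_assoc]
        exact mul_le_mul_of_nonneg_right (by linarith) (by positivity)
      refine hn.trans ?_
      have hpos : 0 ≤ 54 * c * W.natDegree * τ ^ d0 * τ ^ d := by positivity
      split_ifs with h
      · have : R ^ d * ‖∑ P ∈ Pd q d, chi q W P‖ ≤ (q * R) ^ d := by
          rw [mul_pow, mul_comm]; exact mul_le_mul_of_nonneg_right hpi1 hRd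
        have := mul_le_mul_of_nonneg_left this (by positivity : 0 ≤ 3 * c)
        linarith
      · have h1 : R ^ d * ‖∑ P ∈ Pd q d, chi q W P‖ ≤ 18 * W.natDegree * θ ^ d := by
          refine (mul_le_mul_of_nonneg_left hpi2 hRd).trans (le_of_eq ?_)
          rw [hθ, mul_pow]; ring
        have h2 : θ ^ d ≤ τ ^ d0 * τ ^ d := by
          rw [← hττ, mul_pow]
          exact mul_le_mul_of_nonneg_right (pow_le_pow_of_le_one hτ0 hτ1.le (by omega))
            (by positivity)
        have h3 : R ^ d * ‖∑ P ∈ Pd q d, chi q W P‖ ≤ 18 * W.natDegree * (τ ^ d0 * τ ^ d) :=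
          h1.trans (mul_le_mul_of_nonneg_left h2 (by positivity))
        have := mul_le_mul_of_nonneg_left h3 (by positivity : 0 ≤ 3 * c)
        linarith
    refine (norm_sum_le_of_le _ hterm).trans ?_
    rw [Finset.sum_add_distrib, ← Finset.mul_sum, ← Finset.mul_sum]
    have h1 : ∑ d ∈ Finset.Icc 1 J, (if d ≤ d0 then (q * R) ^ d else 0) ≤ C2 := by
      rw [← Finset.sum_filter, hC2]
      refine Finset.sum_le_sum_of_subset_of_nonneg (fun d hd => ?_) fun d _ _ => by positivity
      simp only [Finset.mem_filter, Finset.mem_Icc] at hd ⊢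
      omega
    have h2 := sum_pow_Icc_le hτ0 hτ1 J
    have h3 : 54 * c * W.natDegree * τ ^ d0 * ∑ d ∈ Finset.Icc 1 J, τ ^ d ≤ ε * W.natDegree := by
      have h4 : 54 * c * W.natDegree * τ ^ d0 ≤ W.natDegree * (ε * (1 - τ)) := by
        rw [lt_div_iff₀ (by positivity)] at hd0
        have := mul_le_mul_of_nonneg_left hd0.le (Nat.cast_nonneg W.natDegree : (0 : ℝ) ≤ _)
        linarith
      refine (mul_le_mul h4 h2 (Finset.sum_nonneg fun i _ => pow_nonneg hτ0 i)
        (mul_nonneg (Nat.cast_nonneg _) (mul_nonneg hε.le (by linarith)))).trans (le_of_eq ?_)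
      have : 1 - τ ≠ 0 := by linarith
      field_simp
    have h5 := mul_le_mul_of_nonneg_left h1 (by positivity : 0 ≤ 3 * c)
    linarith
  have hB : ‖∑ P ∈ (Pr q J).filter (fun P => P ∈ pf b),
        chi q W P * (beta (vv P b) - 3 * cP K P.natDegree y) * u ^ P.natDegree‖ ≤
      6 * c * C1 + ε * b.natDegree := by
    refine (norm_sum_le_of_le (n := fun P => 6 * c * R ^ P.natDegree) _ fun P hP => ?_).trans ?_
    · have hPi := (mem_Pr.1 (Finset.mem_filter.1 hP).1).2.1
      rw [norm_mul, norm_mul, norm_pow, hu]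
      refine mul_le_mul_of_nonneg_right ?_ (pow_nonneg hR0 _)
      refine (mul_le_of_le_one_left (norm_nonneg _) (norm_chi_le hPi.ne_zero)).trans ?_
      refine (norm_sub_le _ _).trans ?_
      rw [norm_mul, Complex.norm_ofNat]
      have h1 := norm_cP_le (K := K) hPi.natDegree_pos hy hρ
      have h2 := norm_beta_le (vv P b)
      rw [← hc] at h1
      linarith
    · rw [← Finset.mul_sum]
      have h1 : ∑ P ∈ (Pr q J).filter (fun P => P ∈ pf b), R ^ P.natDegree ≤
          ∑ P ∈ pf b, R ^ P.natDegree :=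
        Finset.sum_le_sum_of_subset_of_nonneg (fun P hP => (Finset.mem_filter.1 hP).2)
          fun _ _ _ => pow_nonneg hR0 _
      have h2 := mul_le_mul_of_nonneg_left (h1.trans (hb1 b hb)) (by positivity : 0 ≤ 6 * c)
      refine h2.trans (le_of_eq ?_)
      field_simp
  rw [hlin]
  have := norm_add_le (∑ d ∈ Finset.Icc 1 J, 3 * cP K d y * u ^ d * ∑ P ∈ Pd q d, chi q W P)
    (∑ P ∈ (Pr q J).filter (fun P => P ∈ pf b),
        chi q W P * (beta (vv P b) - 3 * cP K P.natDegree y) * u ^ P.natDegree)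
  linarith

end

section
variable {q : ℕ} [Fact q.Prime] [hq4 : Fact (q % 4 = 1)]

lemma TE_geom (J d : ℕ) (c : ℂ) (hd : 1 ≤ d) :
    TE J (lf J (fun k => c ^ k) d * (1 - C c * X ^ d)) 1 := by
  have h : lf J (fun k => c ^ k) d = ∑ k ∈ Finset.range (J + 1), (C c * X ^ d) ^ k := by
    rw [lf]
    refine Finset.sum_congr rfl fun k _ => ?_
    rw [mul_pow, ← C_pow, ← pow_mul, mul_comm k d]
  rw [h, mul_comm, mul_neg_geom_sum, TE, sub_sub_cancel_left, dvd_neg, mul_pow, ← pow_mul]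
  exact (pow_dvd_pow X (by nlinarith)).mul_left _

lemma lf_coeff_zero (J d : ℕ) (g : ℕ → ℂ) (hg : g 0 = 1) (hd : 1 ≤ d) : (lf J g d).coeff 0 = 1 := by
  rw [lf, Polynomial.finsetSum_coeff, Finset.sum_range_succ']
  simp only [coeff_C_mul, coeff_X_pow]
  rw [Finset.sum_eq_zero]
  · simp [hg]
  · intro i _
    rw [if_neg, mul_zero]
    have : 0 < (i + 1) * d := by positivity
    omega

/-- The truncated Euler product of `1 / ζ`. -/
lemma TE_zeta (J : ℕ) :
    TE J (∏ P ∈ Pr q J, ((1 : ℂ[X]) - X ^ P.natDegree)) (1 - C (q : ℂ) * X) := by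
  set Z := ∏ P ∈ Pr q J, lf J (fun k => (1 : ℂ) ^ k) P.natDegree with hZ
  have hZ1 : TE J Z (lf J (fun k => (q : ℂ) ^ k) 1) := by
    rw [TE_iff]
    intro j hj
    have h := euler_product (q := q) (fun _ k => (1 : ℂ) ^ k) (fun _ => one_pow _) J j hj
    rw [← h, lf, Polynomial.finsetSum_coeff]
    simp only [mf, one_pow, Finset.prod_const_one, Finset.sum_const, card_Mn, mul_one,
      coeff_C_mul, coeff_X_pow, nsmul_eq_mul]
    rw [Finset.sum_eq_single j]
    · simp
    · intro k _ hk; simp [Ne.symm hk]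
    · intro h; exact absurd (Finset.mem_range.2 (by omega)) h
  have h1 := TE_geom J 1 (q : ℂ) le_rfl
  rw [pow_one] at h1
  have hc : Z.coeff 0 ≠ 0 := by
    rw [hZ1.coeff (Nat.zero_le J), lf_coeff_zero J 1 _ (pow_zero _) le_rfl]
    exact one_ne_zero
  refine TE.cancel hc ?_
  have h2 : TE J ((∏ P ∈ Pr q J, ((1 : ℂ[X]) - X ^ P.natDegree)) * Z) 1 := by
    rw [hZ, ← Finset.prod_mul_distrib]
    refine (TE.prod (r := fun _ => 1) fun P hP => ?_).trans (TE.of_eq Finset.prod_const_one)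
    have := TE_geom J P.natDegree 1 (mem_Pr.1 hP).2.1.natDegree_pos
    rw [map_one, one_mul] at this
    rwa [mul_comm]
  refine h2.trans (TE.symm ?_)
  rw [mul_comm]
  exact (hZ1.mul (TE.refl _ _)).trans h1

lemma norm_sq_factor_bad {U v : ℂ} {V : ℝ} (hU : ‖U‖ ≤ 1) (hv : ‖v‖ ≤ V) :
    ‖(1 - U) ^ 3 * (1 + v * U) - 1‖ ≤ (8 * V + 7) * ‖U‖ := by
  have e : (1 - U) ^ 3 * (1 + v * U) - 1 = (v * (1 - U) ^ 3 + (-3 + 3 * U - U * U)) * U := by ring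
  rw [e, norm_mul]
  refine mul_le_mul_of_nonneg_right ?_ (norm_nonneg _)
  have h1 : ‖1 - U‖ ≤ 2 := (norm_sub_le _ _).trans (by rw [norm_one]; linarith)
  have h2 : ‖v * (1 - U) ^ 3‖ ≤ V * 2 ^ 3 := by
    rw [norm_mul, norm_pow]
    exact mul_le_mul hv (pow_le_pow_left₀ (norm_nonneg _) h1 3) (by positivity)
      ((norm_nonneg _).trans hv)
  have h3 : ‖-3 + 3 * U - U * U‖ ≤ 7 := by
    refine (norm_sub_le _ _).trans ?_
    have := norm_add_le (-3 : ℂ) (3 * U)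
    rw [norm_neg, norm_mul, Complex.norm_ofNat] at this
    rw [norm_mul]
    nlinarith [norm_nonneg U]
  have := norm_add_le (v * (1 - U) ^ 3) (-3 + 3 * U - U * U)
  linarith

lemma norm_sq_factor_good {U v : ℂ} {V : ℝ} (hU : ‖U‖ ≤ 1) (hv : ‖v‖ ≤ V) :
    ‖(1 - U) ^ 3 * (1 + v * U) - 1‖ ≤ ‖v - 3‖ * ‖U‖ + (7 * V + 4) * ‖U‖ ^ 2 := by
  have e : (1 - U) ^ 3 * (1 + v * U) - 1 =
      (v - 3) * U + ((3 - 3 * v) + (3 * v - 1) * U - v * (U * U)) * U ^ 2 := by ring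
  rw [e]
  refine (norm_add_le _ _).trans ?_
  rw [norm_mul, norm_mul _ (U ^ 2), norm_pow]
  refine add_le_add le_rfl (mul_le_mul_of_nonneg_right ?_ (by positivity))
  have h1 : ‖3 - 3 * v‖ ≤ 3 + 3 * V := (norm_sub_le _ _).trans (by
    rw [norm_mul, Complex.norm_ofNat]; linarith)
  have h2 : ‖3 * v - 1‖ ≤ 3 * V + 1 := (norm_sub_le _ _).trans (by
    rw [norm_mul, Complex.norm_ofNat, norm_one]; linarith)
  have h3 : ‖(3 * v - 1) * U‖ ≤ 3 * V + 1 := by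
    rw [norm_mul]
    exact (mul_le_of_le_one_right (norm_nonneg _) hU).trans h2
  have h4 : ‖v * (U * U)‖ ≤ V := by
    rw [norm_mul, norm_mul]
    refine (mul_le_of_le_one_right (norm_nonneg _) ?_).trans hv
    nlinarith [norm_nonneg U]
  have := norm_sub_le ((3 - 3 * v) + (3 * v - 1) * U) (v * (U * U))
  have := norm_add_le (3 - 3 * v) ((3 * v - 1) * U)
  linarith

lemma vf_sq {K : ℕ} {y : ℂ} {b w P : Fqx q} (hm : P.Monic) (hP : Irreducible P) (hw : ¬ P ∣ w)
    (hb : P ∉ pf b) : vf K y b (w ^ 2) P = 3 * cP K P.natDegree y := by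
  rw [vf, if_neg hb, chi_prime _ hm hP, legSym_sq_arg hP, if_neg hw]
  simp

/-- Sup bound for the Euler product in the square case. -/
lemma exists_norm_prod_sq_le {R : ℝ} (hR0 : 0 ≤ R)
    (hR : q * R ^ 2 < 1) {ε : ℝ} (hε : 0 < ε) :
    ∃ C : ℝ, ∀ (J K : ℕ) (y u : ℂ) (b w : Fqx q), ‖y‖ ^ 2 = 1 / q → ‖u‖ = R → b.Monic → w.Monic →
      ‖∏ P ∈ Pr q J, ((1 - u ^ P.natDegree) ^ 3 * (1 + vf K y b (w ^ 2) P * u ^ P.natDegree))‖ ≤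
        Real.exp (C + ε * (w.natDegree + b.natDegree)) := by
  have hq1 : (1 : ℝ) < q := by exact_mod_cast (Fact.out : q.Prime).one_lt
  have hR1 : R < 1 := by
    by_contra! h
    nlinarith [one_le_pow₀ h (n := 2)]
  set c : ℝ := 1 / (1 - 1 / q) with hc
  have hc1 : 1 ≤ c := by
    rw [hc, le_div_iff₀ (by rw [sub_pos, div_lt_one (by linarith)]; exact hq1)]
    have : (0 : ℝ) ≤ 1 / q := by positivity
    linarith
  obtain ⟨C1, hC1, hb1⟩ := exists_sum_pf_le (q := q) R hR0 hR1 (ε / (24 * c + 7)) (by positivity)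
  refine ⟨3 * c * (1 / (1 - q * (R / q))) + (21 * c + 4) * (1 / (1 - q * R ^ 2)) +
    (24 * c + 7) * C1, fun J K y u b w hy hu hb hw => ?_⟩
  have hy1 : ‖y‖ < 1 := by
    by_contra! h
    have h1 : 1 ≤ ‖y‖ ^ 2 := one_le_pow₀ h
    rw [hy, le_div_iff₀ (by linarith)] at h1
    linarith
  have key : ∀ P ∈ Pr q J,
      ‖(1 - u ^ P.natDegree) ^ 3 * (1 + vf K y b (w ^ 2) P * u ^ P.natDegree) - 1‖ ≤
      3 * c * (R / q) ^ P.natDegree + (21 * c + 4) * (R ^ 2) ^ P.natDegree +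
        (24 * c + 7) * (if P ∈ pf (w * b) then R ^ P.natDegree else 0) := by
    intro P hP
    obtain ⟨-, hPi, hPm⟩ : P.natDegree ≤ J ∧ Irreducible P ∧ P.Monic :=
      ⟨(mem_Pr.1 hP).2.2, (mem_Pr.1 hP).2.1, (mem_Pr.1 hP).1⟩
    have hU : ‖u ^ P.natDegree‖ = R ^ P.natDegree := by rw [norm_pow, hu]
    have hU1 : ‖u ^ P.natDegree‖ ≤ 1 := by rw [hU]; exact pow_le_one₀ hR0 hR1.le
    have hv := norm_vf_le (K := K) (le_refl ‖y‖) hy1 b (w ^ 2) hPi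
    rw [hy, ← hc] at hv
    have p1 : 0 ≤ 3 * c * (R / q) ^ P.natDegree := by positivity
    have p2 : 0 ≤ (21 * c + 4) * (R ^ 2) ^ P.natDegree := by positivity
    split_ifs with h
    · have := norm_sq_factor_bad hU1 hv
      rw [hU] at this
      refine this.trans ?_
      have : 8 * (3 * c) + 7 = 24 * c + 7 := by ring
      rw [this]
      linarith
    · have h' := norm_sq_factor_good hU1 hv
      rw [mem_pf (mul_ne_zero hw.ne_zero hb.ne_zero)] at h
      have hw' : ¬ P ∣ w := fun hd => h ⟨hPm, hPi, hd.mul_right _⟩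
      have hb' : P ∉ pf b := fun hd =>
        h ⟨hPm, hPi, ((mem_pf hb.ne_zero).1 hd).2.2.mul_left _⟩
      have hv3 : ‖vf K y b (w ^ 2) P - 3‖ ≤ 3 * c * (1 / q) ^ P.natDegree := by
        rw [vf_sq hPm hPi hw' hb', show (3 : ℂ) * cP K P.natDegree y - 3 =
          3 * (cP K P.natDegree y - 1) by ring, norm_mul, Complex.norm_ofNat]
        have := norm_cP_sub_one_le (K := K) hPi.natDegree_pos (le_refl ‖y‖) hy1
        rw [pow_mul, hy, ← hc] at this
        linarith
      refine h'.trans ?_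
      rw [hU, ← pow_mul, mul_comm _ 2, pow_mul]
      have h5 := mul_le_mul_of_nonneg_right hv3 (pow_nonneg hR0 P.natDegree)
      have h6 : (R / q) ^ P.natDegree = (1 / q) ^ P.natDegree * R ^ P.natDegree := by
        rw [← mul_pow]; congr 1; ring
      rw [h6]
      linarith
  have := norm_prod_one_add_le_exp' (Pr q J) (fun P =>
    (1 - u ^ P.natDegree) ^ 3 * (1 + vf K y b (w ^ 2) P * u ^ P.natDegree) - 1)
  simp only [add_sub_cancel] at this
  refine this.trans (Real.exp_le_exp.2 ((Finset.sum_le_sum key).trans ?_))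
  rw [Finset.sum_add_distrib, Finset.sum_add_distrib, ← Finset.mul_sum, ← Finset.mul_sum,
    ← Finset.mul_sum]
  have s1 : ∑ P ∈ Pr q J, (R / q) ^ P.natDegree ≤ 1 / (1 - q * (R / q)) := by
    apply sum_Pr_pow_le (by positivity)
    rw [mul_div_cancel₀ _ (by positivity)]
    exact hR1
  have s2 := sum_Pr_pow_le (q := q) (by positivity) hR J
  have s3 : ∑ P ∈ Pr q J, (if P ∈ pf (w * b) then R ^ P.natDegree else 0) ≤
      C1 + ε / (24 * c + 7) * (w.natDegree + b.natDegree) := by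
    rw [← Finset.sum_filter]
    refine le_trans (Finset.sum_le_sum_of_subset_of_nonneg
      (fun P hP => (Finset.mem_filter.1 hP).2) fun _ _ _ => pow_nonneg hR0 _) ?_
    have := hb1 _ (hw.mul hb)
    rw [hw.natDegree_mul hb] at this
    exact_mod_cast this
  have t1 := mul_le_mul_of_nonneg_left s1 (by positivity : 0 ≤ 3 * c)
  have t2 := mul_le_mul_of_nonneg_left s2 (by positivity : 0 ≤ 21 * c + 4)
  have t3 := mul_le_mul_of_nonneg_left s3 (by positivity : 0 ≤ 24 * c + 7)
  have t4 : (24 * c + 7) * (C1 + ε / (24 * c + 7) * (w.natDegree + b.natDegree)) =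
      (24 * c + 7) * C1 + ε * (w.natDegree + b.natDegree) := by
    field_simp
  linarith

end

section
variable {q : ℕ} [Fact q.Prime] [hq4 : Fact (q % 4 = 1)]

def FW (K : ℕ) (y : ℂ) (b W : Fqx q) (A : ℕ) : ℂ := ∑ a ∈ Hn q A, ∏ P ∈ pf a, vf K y b W P

/-- As `FW`, without the term `a = 1`. -/
def FT (K : ℕ) (y : ℂ) (b W : Fqx q) (A : ℕ) : ℂ :=
  ∑ a ∈ (Hn q A).erase 1, ∏ P ∈ pf a, vf K y b W P

/-- The coefficients of `(1 - q² u²)³ = ∑ e3 q i * u ^ (2 * i)`. -/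
def e3 (q i : ℕ) : ℂ := (-1) ^ i * (Nat.choose 3 i : ℂ) * (q : ℂ) ^ (2 * i)

def EF (K : ℕ) (y : ℂ) (b W : Fqx q) (A : ℕ) : ℂ :=
  ∑ i ∈ Finset.range 4, e3 q i * (if 2 * i ≤ A then FW K y b W (A - 2 * i) else 0)

def EFT (K : ℕ) (y : ℂ) (b W : Fqx q) (A : ℕ) : ℂ :=
  ∑ i ∈ Finset.range 4, e3 q i * (if 2 * i ≤ A then FT K y b W (A - 2 * i) else 0)

lemma norm_FT_sub_le (K : ℕ) (y : ℂ) (b W : Fqx q) (A : ℕ) :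
    ‖FT K y b W A - FW K y b W A‖ ≤ 1 := by
  rw [FT, FW]
  by_cases h : (1 : Fqx q) ∈ Hn q A
  · rw [← Finset.sum_erase_add _ _ h, sub_add_cancel_left, pf_one, Finset.prod_empty, norm_neg,
      norm_one]
  · rw [Finset.erase_eq_of_notMem h, sub_self, norm_zero]
    exact zero_le_one

lemma norm_e3_le {i : ℕ} (hi : i ∈ Finset.range 4) : ‖e3 q i‖ ≤ 3 * (q : ℝ) ^ 6 := by
  have hq1 : (1 : ℝ) ≤ q := by exact_mod_cast (Fact.out : q.Prime).one_lt.le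
  have hi' := Finset.mem_range.1 hi
  rw [e3, norm_mul, norm_mul, norm_pow, norm_neg, norm_one, one_pow, one_mul, norm_pow,
    Complex.norm_natCast, Complex.norm_natCast]
  refine mul_le_mul ?_ (pow_le_pow_right₀ hq1 (by omega)) (by positivity) (by norm_num)
  interval_cases i <;> simp [Nat.choose]

lemma norm_EFT_sub_le (K : ℕ) (y : ℂ) (b W : Fqx q) (A : ℕ) :
    ‖EFT K y b W A - EF K y b W A‖ ≤ 12 * (q : ℝ) ^ 6 := by
  rw [EFT, EF, ← Finset.sum_sub_distrib]
  refine (norm_sum_le_of_le (n := fun _ => 3 * (q : ℝ) ^ 6) _ fun i hi => ?_).trans ?_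
  · rw [← mul_sub, norm_mul]
    refine (mul_le_of_le_one_right (norm_nonneg _) ?_).trans (norm_e3_le hi)
    split_ifs
    · exact norm_FT_sub_le _ _ _ _ _
    · simp
  · rw [Finset.sum_const, Finset.card_range, nsmul_eq_mul]
    exact le_of_eq (by push_cast; ring)

lemma sqrt_facts : 1 ≤ Real.sqrt q ∧ Real.sqrt q ^ 2 = q := by
  have hq1 : (1 : ℝ) ≤ q := by exact_mod_cast (Fact.out : q.Prime).one_lt.le
  exact ⟨Real.one_le_sqrt.2 hq1, Real.sq_sqrt (by linarith)⟩

lemma le_of_mul_inv_pow_le {x B t : ℝ} (ht : 0 < t) (A : ℕ) (h : x * (1 / t) ^ A ≤ B) :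
    x ≤ B * t ^ A := by
  rw [one_div, inv_pow, ← div_eq_mul_inv, div_le_iff₀ (by positivity)] at h
  exact h

lemma radius_facts {κ : ℝ} (hκ : 1 < κ) : (q : ℝ) * (1 / (Real.sqrt q * κ)) ^ 2 < 1 := by
  obtain ⟨hs1, hs2⟩ := sqrt_facts (q := q)
  have hq1 : (1 : ℝ) ≤ q := by exact_mod_cast (Fact.out : q.Prime).one_lt.le
  have hκ0 : 0 < κ := by linarith
  rw [div_pow, mul_pow, hs2, one_pow, mul_one_div, div_lt_one (by positivity)]
  exact lt_mul_of_one_lt_right (by linarith) (one_lt_pow₀ hκ two_ne_zero)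

lemma exp_bound {κ : ℝ} (hκ : 1 < κ) (C : ℝ) (m : ℕ) :
    Real.exp (C + Real.log κ * m) = Real.exp C * κ ^ m := by
  rw [Real.exp_add, mul_comm (Real.log κ), Real.exp_nat_mul, Real.exp_log (by linarith)]

lemma eval_prod_form (s : Finset (Fqx q)) (v : Fqx q → ℂ) (z : ℂ) :
    (∏ P ∈ s, ((1 : ℂ[X]) + C (v P) * X ^ P.natDegree)).eval z =
      ∏ P ∈ s, (1 + v P * z ^ P.natDegree) := by
  rw [eval_prod]; simp

lemma exists_FW_nonsq_le {κ : ℝ} (hκ : 1 < κ) :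
    ∃ C : ℝ, 0 ≤ C ∧ ∀ (K A : ℕ) (y : ℂ) (b W : Fqx q), ‖y‖ = 1 / κ → b.Monic → W.Monic →
      (¬ ∃ w : Fqx q, w.Monic ∧ W = w ^ 2) →
      ‖FW K y b W A‖ ≤ C * (Real.sqrt q * κ) ^ A * κ ^ (b.natDegree + W.natDegree) := by
  obtain ⟨hs1, hs2⟩ := sqrt_facts (q := q)
  have hκ0 : 0 < κ := by linarith
  obtain ⟨C, hC⟩ := exists_norm_prod_nonsq_le (q := q) (ρ := 1 / κ) (R := 1 / (Real.sqrt q * κ))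
    (by positivity) (by rw [div_lt_one hκ0]; exact hκ) (by positivity) (radius_facts hκ)
    (Real.log_pos hκ)
  refine ⟨Real.exp C, (Real.exp_pos _).le, fun K A y b W hy hb hW hns => ?_⟩
  have h := norm_coeff_mul_le (∏ P ∈ Pr q A, ((1 : ℂ[X]) + Polynomial.C (vf K y b W P) * X ^ P.natDegree)) A
    (ρ := 1 / (Real.sqrt q * κ)) (B := Real.exp C * κ ^ (b.natDegree + W.natDegree))
    (by positivity) (fun z hz => by
      rw [eval_prod_form]
      refine (hC A K y z b W hy.le hz hb hW hns).trans (le_of_eq ?_)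
      rw [← exp_bound hκ]
      push_cast; ring_nf)
  rw [← sum_Hn_prod _ le_rfl] at h
  have := le_of_mul_inv_pow_le (by positivity) A h
  rw [FW]
  refine this.trans (le_of_eq (by ring))

lemma exists_EFT_nonsq_le {κ : ℝ} (hκ : 1 < κ) :
    ∃ C : ℝ, 0 ≤ C ∧ ∀ (K A : ℕ) (y : ℂ) (b W : Fqx q), ‖y‖ = 1 / κ → b.Monic → W.Monic →
      (¬ ∃ w : Fqx q, w.Monic ∧ W = w ^ 2) →
      ‖EFT K y b W A‖ ≤ C * (Real.sqrt q * κ) ^ A * κ ^ (b.natDegree + W.natDegree) := by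
  obtain ⟨C, hC0, hC⟩ := exists_FW_nonsq_le (q := q) hκ
  obtain ⟨hs1, hs2⟩ := sqrt_facts (q := q)
  have hs1κ : 1 ≤ Real.sqrt q * κ := by nlinarith
  refine ⟨12 * (q : ℝ) ^ 6 * C + 12 * (q : ℝ) ^ 6, by positivity,
    fun K A y b W hy hb hW hns => ?_⟩
  have h1 : ‖EF K y b W A‖ ≤
      12 * (q : ℝ) ^ 6 * (C * (Real.sqrt q * κ) ^ A * κ ^ (b.natDegree + W.natDegree)) := by
    rw [EF]
    refine (norm_sum_le_of_le (n := fun _ => 3 * (q : ℝ) ^ 6 *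
      (C * (Real.sqrt q * κ) ^ A * κ ^ (b.natDegree + W.natDegree))) _ fun i hi => ?_).trans ?_
    · rw [norm_mul]
      refine mul_le_mul (norm_e3_le hi) ?_ (norm_nonneg _) (by positivity)
      split_ifs
      · refine (hC K (A - 2 * i) y b W hy hb hW hns).trans ?_
        gcongr
        exact Nat.sub_le _ _
      · rw [norm_zero]; positivity
    · rw [Finset.sum_const, Finset.card_range, nsmul_eq_mul]
      exact le_of_eq (by push_cast; ring)
  have h2 := norm_EFT_sub_le K y b W A
  have h3 : ‖EFT K y b W A‖ ≤ ‖EFT K y b W A - EF K y b W A‖ + ‖EF K y b W A‖ := by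
    simpa using norm_add_le (EFT K y b W A - EF K y b W A) (EF K y b W A)
  have h4 : 1 ≤ (Real.sqrt q * κ) ^ A * κ ^ (b.natDegree + W.natDegree) :=
    one_le_mul_of_one_le_of_one_le (one_le_pow₀ hs1κ) (one_le_pow₀ hκ.le)
  nlinarith [mul_le_mul_of_nonneg_left h4 (by positivity : 0 ≤ 12 * (q : ℝ) ^ 6)]

lemma EF_eq_coeff (K : ℕ) (y : ℂ) (b W : Fqx q) (A : ℕ) :
    EF K y b W A = ((1 - C ((q : ℂ) ^ 2) * X ^ 2) ^ 3 *
      ∏ P ∈ Pr q A, ((1 : ℂ[X]) + C (vf K y b W P) * X ^ P.natDegree)).coeff A := by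
  set p := ∏ P ∈ Pr q A, ((1 : ℂ[X]) + C (vf K y b W P) * X ^ P.natDegree) with hp
  have h1 : (1 - C ((q : ℂ) ^ 2) * X ^ 2 : ℂ[X]) ^ 3 =
      ∑ i ∈ Finset.range 4, C (e3 q i) * X ^ (2 * i) := by
    simp only [Finset.sum_range_succ, Finset.sum_range_zero, e3, Nat.choose]
    simp only [C_mul, C_pow, C_neg, map_one, Nat.cast_one]
    have : (C (3 : ℂ) : ℂ[X]) = 3 := rfl
    norm_num [this]
    ring
  rw [h1, Finset.sum_mul, Polynomial.finsetSum_coeff, EF]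
  refine Finset.sum_congr rfl fun i _ => ?_
  rw [mul_assoc, coeff_C_mul, coeff_X_pow_mul']
  congr 1
  split_ifs with h
  · rw [FW, sum_Hn_prod _ (Nat.sub_le A (2 * i))]
  · rfl

lemma exists_EFT_sq_le {κ : ℝ} (hκ : 1 < κ) :
    ∃ C : ℝ, 0 ≤ C ∧ ∀ (K A : ℕ) (y : ℂ) (b W : Fqx q), ‖y‖ = 1 / Real.sqrt q → b.Monic →
      (∃ w : Fqx q, w.Monic ∧ W = w ^ 2) →
      ‖EFT K y b W A‖ ≤ C * (Real.sqrt q * κ) ^ A * κ ^ (b.natDegree + W.natDegree) := by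
  obtain ⟨hs1, hs2⟩ := sqrt_facts (q := q)
  have hκ0 : 0 < κ := by linarith
  have hs1κ : 1 ≤ Real.sqrt q * κ := by nlinarith
  obtain ⟨C, hC⟩ := exists_norm_prod_sq_le (q := q) (R := 1 / (Real.sqrt q * κ))
    (by positivity) (radius_facts hκ) (Real.log_pos hκ)
  refine ⟨(1 + q) ^ 3 * Real.exp C + 12 * (q : ℝ) ^ 6, by positivity,
    fun K A y b W hy hb ⟨w, hw, hWw⟩ => ?_⟩
  subst hWw
  set p := ∏ P ∈ Pr q A, ((1 : ℂ[X]) + Polynomial.C (vf K y b (w ^ 2) P) * X ^ P.natDegree) with hp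
  have hTE : TE A ((1 - Polynomial.C ((q : ℂ) ^ 2) * X ^ 2) ^ 3 * p)
      ((1 + Polynomial.C (q : ℂ) * X) ^ 3 *
        ((∏ P ∈ Pr q A, ((1 : ℂ[X]) - X ^ P.natDegree)) ^ 3 * p)) := by
    have e : (1 - Polynomial.C ((q : ℂ) ^ 2) * X ^ 2 : ℂ[X]) ^ 3 * p =
        (1 + Polynomial.C (q : ℂ) * X) ^ 3 * ((1 - Polynomial.C (q : ℂ) * X) ^ 3 * p) := by
      rw [C_pow]; ring
    rw [e]
    exact (TE.refl _ _).mul (((TE_zeta A).symm.pow 3).mul (TE.refl _ _))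
  have h1 : ‖EF K y b (w ^ 2) A‖ ≤ (1 + q) ^ 3 *
      (Real.exp C * κ ^ (w.natDegree + b.natDegree)) * (Real.sqrt q * κ) ^ A := by
    rw [EF_eq_coeff, hTE.coeff le_rfl]
    refine le_of_mul_inv_pow_le (by positivity) A (norm_coeff_mul_le _ A (by positivity)
      fun z hz => ?_)
    rw [eval_mul, eval_mul, eval_pow, eval_pow, hp, eval_prod_form, eval_prod, norm_mul,
      ← Finset.prod_pow, ← Finset.prod_mul_distrib, norm_pow]
    simp only [eval_sub, eval_one, eval_pow, eval_X, eval_add, eval_mul, eval_C]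
    refine mul_le_mul ?_ ?_ (norm_nonneg _) (by positivity)
    · refine pow_le_pow_left₀ (norm_nonneg _) ((norm_add_le _ _).trans ?_) 3
      rw [norm_one, norm_mul, Complex.norm_natCast, hz]
      refine add_le_add le_rfl (mul_le_of_le_one_right (by positivity) ?_)
      rw [div_le_one (by positivity)]
      exact hs1κ
    · refine (hC A K y z b w ?_ hz hb hw).trans (le_of_eq ?_)
      · rw [hy, div_pow, one_pow, hs2]
      · rw [← exp_bound hκ]; push_cast; ring_nf
  have h2 := norm_EFT_sub_le K y b (w ^ 2) A
  have h3 : ‖EFT K y b (w ^ 2) A‖ ≤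
      ‖EFT K y b (w ^ 2) A - EF K y b (w ^ 2) A‖ + ‖EF K y b (w ^ 2) A‖ := by
    have := norm_add_le (EFT K y b (w ^ 2) A - EF K y b (w ^ 2) A) (EF K y b (w ^ 2) A)
    rwa [sub_add_cancel] at this
  have h5 : κ ^ (w.natDegree + b.natDegree) ≤ κ ^ (b.natDegree + (w ^ 2).natDegree) :=
    pow_le_pow_right₀ hκ.le (by rw [natDegree_pow]; omega)
  have h4 : 1 ≤ (Real.sqrt q * κ) ^ A * κ ^ (b.natDegree + (w ^ 2).natDegree) :=
    one_le_mul_of_one_le_of_one_le (one_le_pow₀ hs1κ) (one_le_pow₀ hκ.le)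
  have h6 : (1 + (q : ℝ)) ^ 3 * (Real.exp C * κ ^ (w.natDegree + b.natDegree)) *
      (Real.sqrt q * κ) ^ A ≤ (1 + (q : ℝ)) ^ 3 * (Real.exp C *
        κ ^ (b.natDegree + (w ^ 2).natDegree)) * (Real.sqrt q * κ) ^ A := by gcongr
  nlinarith [mul_le_mul_of_nonneg_left h4 (by positivity : 0 ≤ 12 * (q : ℝ) ^ 6)]

end

section
variable {q : ℕ} [Fact q.Prime] [hq4 : Fact (q % 4 = 1)]

/-- Polynomial version of `cP`. -/
def cPp (K d : ℕ) : ℂ[X] := ∑ k ∈ Finset.range (K + 1), X ^ (2 * d * k)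

lemma eval_cPp (K d : ℕ) (y : ℂ) : (cPp K d).eval y = cP K d y := by
  rw [cPp, cP, eval_finsetSum]; simp

lemma TE_cPp {J K d : ℕ} (hd : 1 ≤ d) (hK : J ≤ K) : TE J ((1 - X ^ (2 * d)) * cPp K d) 1 := by
  have : cPp K d = ∑ k ∈ Finset.range (K + 1), (X ^ (2 * d)) ^ k := by
    simp only [cPp, pow_mul]
  rw [this, mul_neg_geom_sum, TE, sub_sub_cancel_left, dvd_neg, ← pow_mul]
  exact pow_dvd_pow X (by nlinarith)

lemma TE_zeta_two (J : ℕ) :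
    TE J (∏ P ∈ Pr q J, ((1 : ℂ[X]) - X ^ (2 * P.natDegree))) (1 - C (q : ℂ) * X ^ 2) := by
  obtain ⟨r, hr⟩ := TE_zeta (q := q) J
  have h := congrArg (expand ℂ 2) hr
  rw [map_sub, map_prod, map_mul, map_pow, expand_X] at h
  simp only [map_sub, map_mul, map_one, map_pow, expand_X, expand_C, ← pow_mul] at h
  rw [TE, h]
  exact (pow_dvd_pow X (by omega)).mul_right _

/-- The polynomial `∑ (h | a) y ^ deg h`. -/
def Lp (a : Fqx q) : ℂ[X] := ∑ m ∈ Finset.range a.natDegree, C (XX a m) * X ^ m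

lemma Lp_coeff {a : Fqx q} (ha : a.Monic) (hsq : Squarefree a) (h1 : 1 ≤ a.natDegree) (m : ℕ) :
    (Lp a).coeff m = XX a m := by
  rw [Lp, Polynomial.finsetSum_coeff]
  simp only [coeff_C_mul, coeff_X_pow, mul_ite, mul_one, mul_zero]
  rw [Finset.sum_ite_eq]
  split_ifs with h
  · rfl
  · exact (XX_eq_zero ha hsq h1 (by simpa using h)).symm

lemma XX_eq {a : Fqx q} (ha : a.Monic) (m : ℕ) : XX a m = ∑ h ∈ Mn q m, chi q a h :=
  Finset.sum_congr rfl fun _ hh => chi_recip (mem_Mn.1 hh).1 ha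

lemma TE_Lp {a : Fqx q} (ha : a.Monic) (hsq : Squarefree a) (h1 : 1 ≤ a.natDegree) (J : ℕ) :
    TE J (∏ P ∈ Pr q J, lf J (fun k => chi q a P ^ k) P.natDegree) (Lp a) := by
  rw [TE_iff]
  intro j hj
  rw [Lp_coeff ha hsq h1, XX_eq ha, ← euler_product (q := q) (fun P k => chi q a P ^ k)
    (fun _ => pow_zero _) J j hj]
  exact Finset.sum_congr rfl fun f hf => (chi_eq_mf a (mem_Mn.1 hf).1).symm

lemma chi_sq_eq (a : Fqx q) {P : Fqx q} (hm : P.Monic) (hP : Irreducible P) :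
    chi q a P ^ 2 = if P ∣ a then 0 else 1 := by
  rw [chi_prime a hm hP, ← Int.cast_pow, legSym_sq]
  split_ifs <;> simp

lemma prod_ite_Pr (J : ℕ) {s : Finset (Fqx q)} (hs : s ⊆ Pr q J) (F : Fqx q → ℂ[X]) :
    ∏ P ∈ Pr q J, (if P ∈ s then F P else 1) = ∏ P ∈ s, F P := by
  rw [Finset.prod_ite_mem, Finset.inter_eq_right.2 hs]

lemma pf_subset_Pr {a : Fqx q} (ha : a ≠ 0) {J : ℕ} (hJ : a.natDegree ≤ J) : pf a ⊆ Pr q J := by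
  intro P hP
  obtain ⟨h1, h2, h3⟩ := (mem_pf ha).1 hP
  exact mem_Pr.2 ⟨h1, h2, (natDegree_le_of_dvd h3 ha).trans hJ⟩

lemma chi_sqfree (v : Fqx q) {D : Fqx q} (hD : D.Monic) (hs : Squarefree D) :
    chi q v D = ∏ P ∈ pf D, chi q v P := by
  rw [chi_eq_mf v hD, mf]
  refine Finset.prod_congr rfl fun P hP => ?_
  have := vv_pos hP
  have := vv_le_one hD hs P
  rw [show vv P D = 1 by omega, pow_one]

/-- Character sums over square-free polynomials as coefficients of an Euler product. -/
lemma sum_Hn_chi {a b : Fqx q} (ha : a.Monic) (hsq : Squarefree a) (h1 : 1 ≤ a.natDegree)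
    (hb : b.Monic) {n K : ℕ} (hK : n + a.natDegree + b.natDegree ≤ K) :
    ∑ D ∈ Hn q n, chi q D (a * b ^ 2) =
      (Lp a * (1 - C (q : ℂ) * X ^ 2) * (∏ P ∈ pf b, cPp K P.natDegree) *
        (∏ P ∈ pf a \ pf b, cPp K P.natDegree) *
        ∏ P ∈ pf b, (1 - C (chi q a P) * X ^ P.natDegree)).coeff n := by
  set J := n + a.natDegree + b.natDegree with hJ
  have hD : ∀ D ∈ Hn q n, chi q D (a * b ^ 2) =
      ∏ P ∈ pf D, (if P ∈ pf b then 0 else chi q a P) := by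
    intro D hD
    obtain ⟨hDm, -, hDs⟩ := mem_Hn.1 hD
    rw [chi_mul_right D ha.ne_zero (pow_ne_zero 2 hb.ne_zero), chi_recip hDm ha,
      chi_sq_right D hb, chi_sqfree a hDm hDs]
    split_ifs with h
    · obtain ⟨P, hP, hPD⟩ := h
      have hP' := (mem_pf hb.ne_zero).1 hP
      rw [mul_zero, Finset.prod_eq_zero ((mem_pf hDm.ne_zero).2 ⟨hP'.1, hP'.2.1, hPD⟩)]
      rw [if_pos hP]
    · rw [mul_one]
      refine Finset.prod_congr rfl fun P hP => ?_
      rw [if_neg fun hb' => h ⟨P, hb', ((mem_pf hDm.ne_zero).1 hP).2.2⟩]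
  rw [Finset.sum_congr rfl hD, sum_Hn_prod _ (by omega : n ≤ J)]
  refine TE.coeff (J := J) ?_ (by omega)
  have hpb : pf b ⊆ Pr q J := pf_subset_Pr hb.ne_zero (by omega)
  have hpa : pf a \ pf b ⊆ Pr q J :=
    Finset.sdiff_subset.trans (pf_subset_Pr ha.ne_zero (by omega))
  have key : ∀ P ∈ Pr q J, TE J (1 + C (if P ∈ pf b then 0 else chi q a P) * X ^ P.natDegree)
      (lf J (fun k => chi q a P ^ k) P.natDegree * (1 - X ^ (2 * P.natDegree)) *
        (if P ∈ pf b then cPp K P.natDegree else 1) *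
        (if P ∈ pf a \ pf b then cPp K P.natDegree else 1) *
        (if P ∈ pf b then 1 - C (chi q a P) * X ^ P.natDegree else 1)) := by
    intro P hP
    obtain ⟨hPm, hPi, -⟩ := mem_Pr.1 hP
    have hg := TE_geom J P.natDegree (chi q a P) hPi.natDegree_pos
    have hc := TE_cPp (J := J) (K := K) hPi.natDegree_pos hK
    by_cases h : P ∈ pf b
    · simp only [h, if_true, Finset.mem_sdiff, not_true, and_false, if_false, map_zero, zero_mul,
        add_zero, mul_one]
      refine ((hg.mul hc).trans (TE.of_eq (by ring))).symm.trans (TE.of_eq (by ring))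
    · simp only [h, if_false, Finset.mem_sdiff, not_false_eq_true, and_true, mul_one]
      have hs := chi_sq_eq a hPm hPi
      by_cases h' : P ∈ pf a
      · have hd := ((mem_pf ha.ne_zero).1 h').2.2
        rw [if_pos hd] at hs
        have h0 : chi q a P = 0 := pow_eq_zero_iff two_ne_zero |>.1 hs
        rw [h0, map_zero, zero_mul, sub_zero, mul_one] at hg
        simp only [h', if_true, h0, map_zero, zero_mul, add_zero]
        refine ((hg.mul hc).trans (TE.of_eq (by ring))).symm.trans (TE.of_eq (by ring))
      · have hd : ¬ P ∣ a := fun hd => h' ((mem_pf ha.ne_zero).2 ⟨hPm, hPi, hd⟩)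
        rw [if_neg hd] at hs
        simp only [h', if_false, mul_one]
        have e : (1 - X ^ (2 * P.natDegree) : ℂ[X]) = (1 - C (chi q a P) * X ^ P.natDegree) *
            (1 + C (chi q a P) * X ^ P.natDegree) := by
          have : (C (chi q a P) : ℂ[X]) ^ 2 = 1 := by rw [← C_pow, hs, map_one]
          calc (1 - X ^ (2 * P.natDegree) : ℂ[X]) =
                1 - C (chi q a P) ^ 2 * (X ^ P.natDegree) ^ 2 := by
                rw [this, one_mul, ← pow_mul, mul_comm 2]
            _ = _ := by ring
        rw [e, ← mul_assoc]
        refine TE.symm ((hg.mul (TE.refl _ _)).trans (TE.of_eq (one_mul _)))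
  refine (TE.prod key).trans ?_
  simp only [Finset.prod_mul_distrib]
  rw [prod_ite_Pr J hpb, prod_ite_Pr J hpa, prod_ite_Pr J hpb]
  exact ((((TE_Lp ha hsq h1 J).mul (TE_zeta_two J)).mul (TE.refl _ _)).mul (TE.refl _ _)).mul
    (TE.refl _ _)

lemma sqrt_cast_sq : ((Real.sqrt q : ℝ) : ℂ) ^ 2 = q := by
  rw [← Complex.ofReal_pow, (sqrt_facts (q := q)).2, Complex.ofReal_natCast]

lemma sqrt_cast_ne_zero : ((Real.sqrt q : ℝ) : ℂ) ≠ 0 := by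
  rw [Complex.ofReal_ne_zero]
  linarith [(sqrt_facts (q := q)).1]

lemma sum_kk_odd {A : ℕ} (hA : ¬ Even A) (r : ℕ) (F : ℕ → ℂ) :
    ∑ j ∈ Finset.range (r + 1), kk q A r j * F j = (Real.sqrt q : ℂ) * F r := by
  rw [Finset.sum_range_succ, Finset.sum_eq_zero]
  · rw [kk, if_neg hA, if_neg (lt_irrefl r), zero_add]
  · intro j hj
    rw [kk, if_neg hA, if_pos (Finset.mem_range.1 hj), zero_mul]

lemma sum_kk_even {A : ℕ} (hA : Even A) (r : ℕ) (F : ℕ → ℂ) :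
    ∑ j ∈ Finset.range (r + 1), kk q A r j * F j =
      -F r + ((q : ℂ) - 1) * ∑ j ∈ Finset.range r, F j := by
  rw [Finset.sum_range_succ, Finset.mul_sum, add_comm]
  congr 1
  · rw [kk, if_pos hA, if_neg (lt_irrefl r), neg_one_mul]
  · exact Finset.sum_congr rfl fun j hj => by rw [kk, if_pos hA, if_pos (Finset.mem_range.1 hj)]

lemma sum_kk_eq_zero {a : Fqx q} (ha : a.Monic) (hsq : Squarefree a) (h1 : 1 ≤ a.natDegree)
    {i r : ℕ} (hr : a.natDegree ≤ r) :
    ∑ j ∈ Finset.range (r + 1), kk q (a.natDegree + 2 * i) r j * XX a j = 0 := by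
  have h0 := XX_eq_zero ha hsq h1 hr
  by_cases he : Even a.natDegree
  · have hA : Even (a.natDegree + 2 * i) := he.add (even_two_mul i)
    rw [sum_kk_even hA, h0, neg_zero, zero_add,
      ← Finset.sum_subset (Finset.range_mono hr), sum_XX_even ha hsq h1 he, mul_zero]
    intro j _ hj
    exact XX_eq_zero ha hsq h1 (by simpa using hj)
  · have hA : ¬ Even (a.natDegree + 2 * i) := by
      rw [Nat.even_add]; simp [he]
    rw [sum_kk_odd hA, h0, mul_zero]

lemma XX_eq_sum_kk {a : Fqx q} (ha : a.Monic) (hsq : Squarefree a) (h1 : 1 ≤ a.natDegree)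
    (i : ℕ) {r m : ℕ} (hr : r + m + 1 = a.natDegree) :
    XX a m = (Real.sqrt q : ℂ) ^ a.natDegree / (q : ℂ) ^ (r + 1) *
      ∑ j ∈ Finset.range (r + 1), kk q (a.natDegree + 2 * i) r j * XX a j := by
  have hq0 := q_ne_zero (q := q)
  have hs0 := sqrt_cast_ne_zero (q := q)
  have hs2 := sqrt_cast_sq (q := q)
  rcases Nat.even_or_odd' a.natDegree with ⟨k, hk | hk⟩
  · have he : Even a.natDegree := by rw [hk]; exact even_two_mul k
    have hA : Even (a.natDegree + 2 * i) := he.add (even_two_mul i)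
    rw [sum_kk_even hA]
    have h := XX_FE_even ha hsq h1 hr hk
    rw [hk, pow_mul, hs2]
    refine mul_left_cancel₀ (pow_ne_zero k hq0) (h.trans ?_)
    rw [← mul_assoc, mul_div_assoc', ← pow_add, show k + k = m + (r + 1) by omega, pow_add,
      mul_div_cancel_right₀ _ (pow_ne_zero _ hq0)]
  · have he : ¬ Even a.natDegree := by rw [hk, Nat.not_even_iff_odd]; exact odd_two_mul_add_one k
    have hA : ¬ Even (a.natDegree + 2 * i) := by
      rw [Nat.even_add]; simp [he]
    rw [sum_kk_odd hA]
    have h := XX_FE_odd ha hsq hr hk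
    refine mul_left_cancel₀ (pow_ne_zero k hq0) (h.trans ?_)
    rw [hk, pow_succ, pow_mul, hs2]
    have : (q : ℂ) ^ k * ((q : ℂ) ^ k * (Real.sqrt q : ℂ) / (q : ℂ) ^ (r + 1) *
        ((Real.sqrt q : ℂ) * XX a r)) = (q : ℂ) ^ (k + k) * ((Real.sqrt q : ℂ) ^ 2) *
          XX a r / (q : ℂ) ^ (r + 1) := by rw [pow_add]; ring
    rw [this, hs2, ← pow_succ, show k + k + 1 = m + (r + 1) by omega, pow_add]
    field_simp

/-- The functional equation for `Lp`, as a polynomial identity. -/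
lemma X_pow_mul_Lp {a : Fqx q} (ha : a.Monic) (hsq : Squarefree a) (h1 : 1 ≤ a.natDegree)
    (i : ℕ) {A : ℕ} (hA : A = a.natDegree + 2 * i) :
    X ^ (2 * i) * Lp a = ∑ r ∈ Finset.range A,
      C ((Real.sqrt q : ℂ) ^ a.natDegree / (q : ℂ) ^ (r + 1) *
        ∑ j ∈ Finset.range (r + 1), kk q A r j * XX a j) * X ^ (A - 1 - r) := by
  subst hA
  rw [← Finset.sum_subset (Finset.range_mono (Nat.le_add_right a.natDegree (2 * i)))]
  · rw [Lp, Finset.mul_sum, ← Finset.sum_range_reflect]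
    refine Finset.sum_congr rfl fun r hr => ?_
    have hr' := Finset.mem_range.1 hr
    rw [← XX_eq_sum_kk ha hsq h1 i (by omega : r + (a.natDegree - 1 - r) + 1 = a.natDegree),
      mul_left_comm, ← pow_add]
    congr 2
    omega
  · intro r _ hr
    rw [sum_kk_eq_zero ha hsq h1 (by simpa using hr), mul_zero, map_zero, zero_mul]

end

section
variable {q : ℕ} [Fact q.Prime] [hq4 : Fact (q % 4 = 1)]

/-- Polynomial version of `vf`. -/
def vfp (K : ℕ) (b W P : Fqx q) : ℂ[X] :=
  C (chi q W P) * (if P ∈ pf b then C (beta (vv P b)) else 3 * cPp K P.natDegree)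

lemma eval_vfp (K : ℕ) (b W P : Fqx q) (y : ℂ) : (vfp K b W P).eval y = vf K y b W P := by
  rw [vfp, vf, eval_mul, eval_C]
  split_ifs
  · rw [eval_C]
  · rw [eval_mul, eval_cPp, show (3 : ℂ[X]) = C 3 from rfl, eval_C]

/-- Polynomial version of `EFT`. -/
def EFTp (K : ℕ) (b W : Fqx q) (A : ℕ) : ℂ[X] :=
  ∑ i ∈ Finset.range 4, e3 q i • (if 2 * i ≤ A then
    ∑ a ∈ (Hn q (A - 2 * i)).erase 1, ∏ P ∈ pf a, vfp K b W P else 0)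

lemma eval_EFTp (K : ℕ) (b W : Fqx q) (A : ℕ) (y : ℂ) :
    (EFTp K b W A).eval y = EFT K y b W A := by
  rw [EFTp, EFT, eval_finsetSum]
  refine Finset.sum_congr rfl fun i _ => ?_
  rw [eval_smul, smul_eq_mul]
  split_ifs
  · rw [eval_finsetSum, FT]
    congr 1
    refine Finset.sum_congr rfl fun a _ => ?_
    rw [eval_prod]
    exact Finset.prod_congr rfl fun P _ => eval_vfp K b W P y
  · rw [eval_zero]

/-- The The ratio `d₃(a b²) / d₃(b²)` for square-free `a`. -/
def phi (b a : Fqx q) : ℂ := ∏ P ∈ pf a, (if P ∈ pf b then beta (vv P b) else 3)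

lemma prod_vfp (K : ℕ) (b W : Fqx q) {a : Fqx q} (ha : a.Monic) (hsq : Squarefree a) :
    ∏ P ∈ pf a, vfp K b W P =
      C (chi q W a * phi b a) * ∏ P ∈ pf a \ pf b, cPp K P.natDegree := by
  rw [chi_sqfree W ha hsq, phi, ← Finset.prod_mul_distrib, map_prod,
    ← Finset.filter_notMem_eq_sdiff, Finset.prod_filter, ← Finset.prod_mul_distrib]
  refine Finset.prod_congr rfl fun P _ => ?_
  rw [vfp]
  by_cases h : P ∈ pf b
  · simp [h]
  · simp only [h, if_false, not_false_eq_true, if_true, C_mul]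
    rw [show (3 : ℂ[X]) = C 3 from rfl, mul_assoc]

lemma chi_prod (v : Fqx q) (S : Finset (Fqx q)) (hS : ∀ P ∈ S, P.Monic) :
    chi q v (∏ P ∈ S, P) = ∏ P ∈ S, chi q v P := by
  induction S using Finset.induction_on with
  | empty => simp [chi_one_right]
  | insert P S hP ih =>
    have hS' : ∀ Q ∈ S, Q.Monic := fun Q hQ => hS Q (Finset.mem_insert_of_mem hQ)
    have h0 : (∏ Q ∈ S, Q) ≠ 0 := (monic_prod_of_monic S id hS').ne_zero
    rw [Finset.prod_insert hP, Finset.prod_insert hP,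
      chi_mul_right _ (hS P (Finset.mem_insert_self _ _)).ne_zero h0, ih hS']

lemma prod_one_sub_chi (a b : Fqx q) (hb : b ≠ 0) :
    ∏ P ∈ pf b, ((1 : ℂ[X]) - C (chi q a P) * X ^ P.natDegree) =
      ∑ S ∈ (pf b).powerset, C ((-1) ^ S.card * chi q a (∏ P ∈ S, P)) *
        X ^ (∑ P ∈ S, P.natDegree) := by
  have h : ∀ P ∈ pf b, ((1 : ℂ[X]) - C (chi q a P) * X ^ P.natDegree) =
      C (-1) * (C (chi q a P) * X ^ P.natDegree) + 1 := fun P _ => by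
    rw [map_neg, map_one]; ring
  rw [Finset.prod_congr rfl h, Finset.prod_add]
  refine Finset.sum_congr rfl fun S hS => ?_
  rw [chi_prod a S fun P hP => ((mem_pf hb).1 (Finset.mem_powerset.1 hS hP)).1,
    Finset.prod_const_one, mul_one, Finset.prod_mul_distrib, Finset.prod_mul_distrib,
    Finset.prod_const, Finset.prod_pow_eq_pow_sum, C_mul, C_pow, map_prod, mul_assoc]

/-- The dual sum attached to `b`, applied to a family of polynomials. -/
def Op (K A : ℕ) (b : Fqx q) (F : Fqx q → ℂ[X]) : ℂ[X] :=
  ∑ S ∈ (pf b).powerset, ∑ r ∈ Finset.range A, ∑ j ∈ Finset.range (r + 1), ∑ V ∈ Mn q j,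
    ((-1 : ℂ) ^ S.card * (1 / (q : ℂ) ^ (r + 1)) * kk q A r j) •
      ((1 - C (q : ℂ) * X ^ 2) * (∏ P ∈ pf b, cPp K P.natDegree) *
        X ^ (∑ P ∈ S, P.natDegree + (A - 1 - r)) * F ((∏ P ∈ S, P) * V))

lemma Op_add (K A : ℕ) (b : Fqx q) (F G : Fqx q → ℂ[X]) :
    Op K A b (fun W => F W + G W) = Op K A b F + Op K A b G := by
  simp only [Op, mul_add, smul_add, Finset.sum_add_distrib]

lemma Op_zero (K A : ℕ) (b : Fqx q) : Op K A b (fun _ => 0) = 0 := by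
  simp only [Op, mul_zero, smul_zero, Finset.sum_const_zero]

lemma Op_smul (K A : ℕ) (b : Fqx q) (c : ℂ) (F : Fqx q → ℂ[X]) :
    Op K A b (fun W => c • F W) = c • Op K A b F := by
  simp only [Op, mul_smul_comm, smul_comm _ c, Finset.smul_sum]

lemma Op_sum {ι : Type*} (K A : ℕ) (b : Fqx q) (s : Finset ι) (F : ι → Fqx q → ℂ[X]) :
    Op K A b (fun W => ∑ i ∈ s, F i W) = ∑ i ∈ s, Op K A b (F i) := by
  induction s using Finset.induction_on with
  | empty => simp only [Finset.sum_empty]; exact Op_zero K A b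
  | insert i s hi ih => simp only [Finset.sum_insert hi]; rw [Op_add, ih]

lemma phi_smul_eq_Op {K A i : ℕ} {a b : Fqx q} (ha : a.Monic) (hsq : Squarefree a)
    (h1 : 1 ≤ a.natDegree) (hb : b.Monic) (hA : A = a.natDegree + 2 * i) :
    phi b a • (X ^ (2 * i) * (Lp a * (1 - C (q : ℂ) * X ^ 2) * (∏ P ∈ pf b, cPp K P.natDegree) *
        (∏ P ∈ pf a \ pf b, cPp K P.natDegree) *
        ∏ P ∈ pf b, (1 - C (chi q a P) * X ^ P.natDegree))) =
      (Real.sqrt q : ℂ) ^ a.natDegree • Op K A b (fun W => ∏ P ∈ pf a, vfp K b W P) := by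
  set G : ℂ[X] := (1 - C (q : ℂ) * X ^ 2) * (∏ P ∈ pf b, cPp K P.natDegree) with hG
  set Pa : ℂ[X] := ∏ P ∈ pf a \ pf b, cPp K P.natDegree with hPa
  have hL : Lp a * (1 - C (q : ℂ) * X ^ 2) * (∏ P ∈ pf b, cPp K P.natDegree) = Lp a * G := by
    rw [hG, mul_assoc]
  rw [hL, prod_one_sub_chi a b hb.ne_zero]
  have hL2 : ∀ T : ℂ[X], X ^ (2 * i) * (Lp a * G * Pa * T) = (T * (X ^ (2 * i) * Lp a)) * (G * Pa) :=
    fun T => by ring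
  rw [hL2, X_pow_mul_Lp ha hsq h1 i hA, Finset.sum_mul_sum, Finset.sum_mul, Finset.smul_sum, Op,
    Finset.smul_sum]
  refine Finset.sum_congr rfl fun S hS => ?_
  have hSm : (∏ P ∈ S, P).Monic := monic_prod_of_monic S id fun P hP =>
    ((mem_pf hb.ne_zero).1 (Finset.mem_powerset.1 hS hP)).1
  rw [Finset.sum_mul, Finset.smul_sum, Finset.smul_sum]
  refine Finset.sum_congr rfl fun r _ => ?_
  have hV : ∀ j, ∑ V ∈ Mn q j, ((-1 : ℂ) ^ S.card * (1 / (q : ℂ) ^ (r + 1)) * kk q A r j) •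
      (G * X ^ (∑ P ∈ S, P.natDegree + (A - 1 - r)) *
        ∏ P ∈ pf a, vfp K b ((∏ P ∈ S, P) * V) P) =
      ((-1 : ℂ) ^ S.card * (1 / (q : ℂ) ^ (r + 1)) * kk q A r j) •
        ((chi q a (∏ P ∈ S, P) * XX a j * phi b a) •
        (G * X ^ (∑ P ∈ S, P.natDegree + (A - 1 - r)) * Pa)) := by
    intro j
    rw [← Finset.smul_sum, XX_eq ha, Finset.mul_sum, Finset.sum_mul, Finset.sum_smul]
    congr 1
    refine Finset.sum_congr rfl fun V hV => ?_
    rw [prod_vfp K b _ ha hsq, ← hPa, smul_eq_C_mul]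
    have : chi q ((∏ P ∈ S, P) * V) a = chi q a (∏ P ∈ S, P) * chi q a V := by
      rw [chi_recip (hSm.mul (mem_Mn.1 hV).1) ha,
        chi_mul_right a hSm.ne_zero (mem_Mn.1 hV).1.ne_zero]
    rw [this]
    ring
  rw [Finset.sum_congr rfl fun j _ => hV j]
  simp only [smul_smul, ← Finset.sum_smul]
  rw [smul_eq_C_mul, smul_eq_C_mul]
  have e : (Real.sqrt q : ℂ) ^ a.natDegree * ∑ j ∈ Finset.range (r + 1),
      ((-1 : ℂ) ^ S.card * (1 / (q : ℂ) ^ (r + 1)) * kk q A r j) *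
        (chi q a (∏ P ∈ S, P) * XX a j * phi b a) =
      phi b a * ((-1) ^ S.card * chi q a (∏ P ∈ S, P)) *
        ((Real.sqrt q : ℂ) ^ a.natDegree / (q : ℂ) ^ (r + 1) *
        ∑ j ∈ Finset.range (r + 1), kk q A r j * XX a j) := by
    simp only [Finset.mul_sum]
    refine Finset.sum_congr rfl fun j _ => by ring
  rw [e, pow_add]
  simp only [C_mul]
  ring

/-- The triple difference of the non-square part, in dual form. -/
lemma sum_nonsq_eq {A n K : ℕ} {b : Fqx q} (hb : b.Monic) (hK : n + A + b.natDegree ≤ K) :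
    ∑ i ∈ Finset.range 4, ((-1) ^ i * (Nat.choose 3 i : ℂ) * (q : ℂ) ^ (3 * i)) *
      (if 2 * i ≤ A ∧ 2 * i ≤ n then ∑ a ∈ (Hn q (A - 2 * i)).erase 1,
        phi b a * ∑ D ∈ Hn q (n - 2 * i), chi q D (a * b ^ 2) else 0) =
      (Real.sqrt q : ℂ) ^ A * (Op K A b fun W => EFTp K b W A).coeff n := by
  have h1 : (Op K A b fun W => EFTp K b W A) = ∑ i ∈ Finset.range 4, e3 q i •
      (if 2 * i ≤ A then ∑ a ∈ (Hn q (A - 2 * i)).erase 1,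
        Op K A b (fun W => ∏ P ∈ pf a, vfp K b W P) else 0) := by
    simp only [EFTp]
    rw [Op_sum]
    refine Finset.sum_congr rfl fun i _ => ?_
    rw [Op_smul]
    split_ifs
    · rw [Op_sum]
    · rw [Op_zero]
  rw [h1, Polynomial.finsetSum_coeff, Finset.mul_sum]
  refine Finset.sum_congr rfl fun i _ => ?_
  by_cases hiA : 2 * i ≤ A
  swap
  · rw [if_neg (fun h => hiA h.1), if_neg hiA]; simp
  rw [if_pos hiA, coeff_smul, Polynomial.finsetSum_coeff, smul_eq_mul]
  have hs : (Real.sqrt q : ℂ) ^ A * e3 q i =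
      ((-1) ^ i * (Nat.choose 3 i : ℂ) * (q : ℂ) ^ (3 * i)) * (Real.sqrt q : ℂ) ^ (A - 2 * i) := by
    rw [e3, show A = (A - 2 * i) + 2 * i by omega, pow_add, pow_mul _ 2, sqrt_cast_sq,
      Nat.add_sub_cancel, show 3 * i = 2 * i + i by ring, pow_add]
    ring
  rw [← mul_assoc, hs, mul_assoc (_ * _ * _) ((Real.sqrt q : ℂ) ^ (A - 2 * i)), Finset.mul_sum]
  have hmain : ∀ a ∈ (Hn q (A - 2 * i)).erase 1,
      (Real.sqrt q : ℂ) ^ (A - 2 * i) * (Op K A b (fun W => ∏ P ∈ pf a, vfp K b W P)).coeff n =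
      if 2 * i ≤ n then phi b a * ∑ D ∈ Hn q (n - 2 * i), chi q D (a * b ^ 2) else 0 := by
    intro a ha
    obtain ⟨ha1, ha2⟩ := Finset.mem_erase.1 ha
    obtain ⟨ham, had, has⟩ := mem_Hn.1 ha2
    have h1 : 1 ≤ a.natDegree := by
      by_contra! h
      exact ha1 (ham.natDegree_eq_zero.1 (by omega))
    have h := phi_smul_eq_Op (K := K) ham has h1 hb (show A = a.natDegree + 2 * i by omega)
    have hc := congrArg (fun p : ℂ[X] => p.coeff n) h
    simp only [coeff_smul, smul_eq_mul] at hc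
    rw [← had, ← hc, coeff_X_pow_mul']
    split_ifs with hn
    · rw [sum_Hn_chi (K := K) ham has h1 hb (by omega)]
    · rw [mul_zero]
  rw [Finset.sum_congr rfl hmain]
  by_cases hn : 2 * i ≤ n
  · rw [if_pos ⟨hiA, hn⟩]; simp only [hn, if_true]
  · rw [if_neg fun h => hn h.2]; simp only [hn, if_false, Finset.sum_const_zero]

end

section
variable {q : ℕ} [Fact q.Prime] [hq4 : Fact (q % 4 = 1)]

/-- The polynomial whose coefficients are summed in `Op`. -/
def Bp (K A : ℕ) (b W : Fqx q) (k : ℕ) : ℂ[X] :=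
  (1 - C (q : ℂ) * X ^ 2) * (∏ P ∈ pf b, cPp K P.natDegree) * X ^ k * EFTp K b W A

lemma eval_Bp_le {K A k : ℕ} {b W : Fqx q} (hb : b.Monic) {y : ℂ} {ρ E : ℝ} (hy : ‖y‖ = ρ)
    (hρ : ρ < 1) (hE : ‖EFT K y b W A‖ ≤ E) :
    ‖(Bp K A b W k).eval y‖ ≤
      (1 + q) * (1 / (1 - ρ ^ 2)) ^ (pf b).card * ρ ^ k * E := by
  have hρ0 : 0 ≤ ρ := hy ▸ norm_nonneg y
  have hc := one_le_c0 hρ0 hρ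
  rw [Bp, eval_mul, eval_mul, eval_mul, eval_EFTp, norm_mul, norm_mul, norm_mul, eval_pow, eval_X,
    norm_pow, hy, eval_prod, norm_prod]
  refine mul_le_mul (mul_le_mul_of_nonneg_right (mul_le_mul ?_ ?_ ?_ (by positivity))
    (by positivity)) hE (norm_nonneg _) (by positivity)
  · simp only [eval_sub, eval_one, eval_mul, eval_C, eval_pow, eval_X]
    refine (norm_sub_le _ _).trans ?_
    rw [norm_one, norm_mul, norm_pow, hy, Complex.norm_natCast]
    exact add_le_add le_rfl (mul_le_of_le_one_right (by positivity) (pow_le_one₀ hρ0 hρ.le))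
  · refine (Finset.prod_le_prod (fun _ _ => norm_nonneg _) (g := fun _ => 1 / (1 - ρ ^ 2))
      fun P hP => ?_).trans (by rw [Finset.prod_const])
    rw [eval_cPp]
    exact norm_cP_le ((mem_pf hb.ne_zero).1 hP).2.1.natDegree_pos hy.le hρ
  · exact Finset.prod_nonneg fun _ _ => norm_nonneg _

lemma exists_Bp_nonsq_le {κ : ℝ} (hκ : 1 < κ) :
    ∃ C c : ℝ, 0 ≤ C ∧ 1 ≤ c ∧ ∀ (K A n k : ℕ) (b W : Fqx q), b.Monic → W.Monic →
      (¬ ∃ w : Fqx q, w.Monic ∧ W = w ^ 2) →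
      ‖(Bp K A b W k).coeff n‖ ≤ C * c ^ (pf b).card * Real.sqrt q ^ A *
        κ ^ (n + A + b.natDegree + W.natDegree) := by
  obtain ⟨C, hC0, hC⟩ := exists_EFT_nonsq_le (q := q) hκ
  have hκ0 : 0 < κ := by linarith
  have hρ1 : 1 / κ < 1 := by rw [div_lt_one hκ0]; exact hκ
  refine ⟨(1 + q) * C, 1 / (1 - (1 / κ) ^ 2), by positivity, one_le_c0 (by positivity) hρ1,
    fun K A n k b W hb hW hns => ?_⟩
  have hc := one_le_c0 (by positivity) hρ1
  have h := norm_coeff_mul_le (Bp K A b W k) n (ρ := 1 / κ) (by positivity)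
    (fun z hz => eval_Bp_le hb hz hρ1 (hC K A z b W hz hb hW hns))
  refine (le_of_mul_inv_pow_le hκ0 n h).trans ?_
  have h1 : (1 / κ) ^ k ≤ 1 := pow_le_one₀ (by positivity) hρ1.le
  calc _ ≤ (1 + q) * (1 / (1 - (1 / κ) ^ 2)) ^ (pf b).card * 1 *
        (C * (Real.sqrt q * κ) ^ A * κ ^ (b.natDegree + W.natDegree)) * κ ^ n := by gcongr
    _ = _ := by rw [mul_pow]; ring

lemma exists_Bp_sq_le {κ : ℝ} (hκ : 1 < κ) :
    ∃ C c : ℝ, 0 ≤ C ∧ 1 ≤ c ∧ ∀ (K A n k : ℕ) (b W : Fqx q), b.Monic →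
      (∃ w : Fqx q, w.Monic ∧ W = w ^ 2) →
      ‖(Bp K A b W k).coeff n‖ * Real.sqrt q ^ k ≤ C * c ^ (pf b).card * Real.sqrt q ^ (A + n) *
        κ ^ (A + b.natDegree + W.natDegree) := by
  obtain ⟨C, hC0, hC⟩ := exists_EFT_sq_le (q := q) hκ
  obtain ⟨hs1, hs2⟩ := sqrt_facts (q := q)
  have hs0 : 0 < Real.sqrt q := by linarith
  have hρ1 : 1 / Real.sqrt q < 1 := by
    rw [div_lt_one hs0]
    have : (1 : ℝ) < q := by exact_mod_cast (Fact.out : q.Prime).one_lt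
    exact Real.lt_sqrt_of_sq_lt (by simpa using this)
  refine ⟨(1 + q) * C, 1 / (1 - (1 / Real.sqrt q) ^ 2), by positivity,
    one_le_c0 (by positivity) hρ1, fun K A n k b W hb hsq => ?_⟩
  have hc := one_le_c0 (by positivity) hρ1
  have h := norm_coeff_mul_le (Bp K A b W k) n (ρ := 1 / Real.sqrt q) (by positivity)
    (fun z hz => eval_Bp_le hb hz hρ1 (hC K A z b W hz hb hsq))
  refine (mul_le_mul_of_nonneg_right (le_of_mul_inv_pow_le hs0 n h) (by positivity)).trans
    (le_of_eq ?_)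
  rw [one_div (Real.sqrt q), inv_pow _ k, mul_pow, pow_add _ A n]
  field_simp
  ring

lemma norm_kk_le (A r j : ℕ) : ‖kk q A r j‖ ≤ q := by
  obtain ⟨hs1, hs2⟩ := sqrt_facts (q := q)
  have hq1 : (1 : ℝ) ≤ q := by exact_mod_cast (Fact.out : q.Prime).one_lt.le
  rw [kk]
  split_ifs
  · rw [← Nat.cast_one, ← Nat.cast_sub (Fact.out : q.Prime).one_lt.le, Complex.norm_natCast]
    exact_mod_cast Nat.sub_le _ _
  · simpa using hq1
  · simp
  · rw [Complex.norm_real, Real.norm_of_nonneg (by positivity)]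
    nlinarith

lemma card_filter_sq_le {e : Fqx q} (he : e.Monic) (j : ℕ) :
    (((Mn q j).filter fun V => ∃ w : Fqx q, w.Monic ∧ e * V = w ^ 2).card : ℝ) ≤
      Real.sqrt q ^ (e.natDegree + j) := by
  obtain ⟨hs1, hs2⟩ := sqrt_facts (q := q)
  set s := (Mn q j).filter fun V => ∃ w : Fqx q, w.Monic ∧ e * V = w ^ 2 with hs
  have hc : s.card ≤ (Mn q ((e.natDegree + j) / 2)).card := by
    have hw : ∀ V ∈ s, ∃ w : Fqx q, w.Monic ∧ e * V = w ^ 2 := fun V hV =>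
      (Finset.mem_filter.1 hV).2
    choose! w hwm hwe using hw
    refine Finset.card_le_card_of_injOn w (fun V hV => ?_) fun V hV V' hV' h => ?_
    · have hVm := mem_Mn.1 (Finset.mem_filter.1 hV).1
      have := congrArg natDegree (hwe V hV)
      rw [he.natDegree_mul hVm.1, natDegree_pow, hVm.2] at this
      exact Finset.mem_coe.2 (mem_Mn.2 ⟨hwm V hV, by omega⟩)
    · have h1 := hwe V hV
      rw [h, ← hwe V' hV'] at h1
      exact mul_left_cancel₀ he.ne_zero h1
  calc (s.card : ℝ) ≤ ((Mn q ((e.natDegree + j) / 2)).card : ℝ) := by exact_mod_cast hc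
    _ = Real.sqrt q ^ (2 * ((e.natDegree + j) / 2)) := by
        rw [card_Mn, pow_mul, hs2]; push_cast; rfl
    _ ≤ _ := pow_le_pow_right₀ hs1 (by omega)

lemma exists_sum_Bp_le {κ : ℝ} (hκ : 1 < κ) :
    ∃ C c : ℝ, 0 ≤ C ∧ 1 ≤ c ∧ ∀ (K A n r j : ℕ) (b e : Fqx q), b.Monic → e.Monic →
      e.natDegree ≤ b.natDegree → r < A → j ≤ r →
      ∑ V ∈ Mn q j, ‖(Bp K A b (e * V) (e.natDegree + (A - 1 - r))).coeff n‖ ≤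
        C * c ^ (pf b).card * κ ^ (n + 2 * A + 2 * b.natDegree) *
          ((q : ℝ) ^ r * (Real.sqrt q ^ A + Real.sqrt q ^ n)) := by
  obtain ⟨C1, c1, hC1, hc1, h1⟩ := exists_Bp_nonsq_le (q := q) hκ
  obtain ⟨C2, c2, hC2, hc2, h2⟩ := exists_Bp_sq_le (q := q) hκ
  obtain ⟨hs1, hs2⟩ := sqrt_facts (q := q)
  have hs0 : 0 < Real.sqrt q := by linarith
  have hq1 : (1 : ℝ) ≤ q := by exact_mod_cast (Fact.out : q.Prime).one_lt.le
  refine ⟨C1 + C2 * Real.sqrt q, max c1 c2, by positivity, le_max_of_le_left hc1,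
    fun K A n r j b e hb he hdeg hr hj => ?_⟩
  set m := max c1 c2 with hm
  have hm1 : 1 ≤ m := le_max_of_le_left hc1
  set T := κ ^ (n + 2 * A + 2 * b.natDegree) with hT
  have hT0 : 0 ≤ T := by positivity
  have hWdeg : ∀ V ∈ Mn q j, (e * V).natDegree = e.natDegree + j := fun V hV => by
    rw [he.natDegree_mul (mem_Mn.1 hV).1, (mem_Mn.1 hV).2]
  have hns : ∀ V ∈ (Mn q j).filter (fun V => ¬ ∃ w : Fqx q, w.Monic ∧ e * V = w ^ 2),
      ‖(Bp K A b (e * V) (e.natDegree + (A - 1 - r))).coeff n‖ ≤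
        C1 * m ^ (pf b).card * Real.sqrt q ^ A * T := by
    intro V hV
    obtain ⟨hV1, hV2⟩ := Finset.mem_filter.1 hV
    refine (h1 K A n _ b (e * V) hb (he.mul (mem_Mn.1 hV1).1) hV2).trans ?_
    rw [hWdeg V hV1]
    have : κ ^ (n + A + b.natDegree + (e.natDegree + j)) ≤ T :=
      pow_le_pow_right₀ hκ.le (by omega)
    gcongr
    exact le_max_left _ _
  have hsq : ∀ V ∈ (Mn q j).filter (fun V => ∃ w : Fqx q, w.Monic ∧ e * V = w ^ 2),
      ‖(Bp K A b (e * V) (e.natDegree + (A - 1 - r))).coeff n‖ * Real.sqrt q ^ (e.natDegree + j) ≤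
        C2 * Real.sqrt q * m ^ (pf b).card * ((q : ℝ) ^ r * Real.sqrt q ^ n) * T := by
    intro V hV
    obtain ⟨hV1, hV2⟩ := Finset.mem_filter.1 hV
    have h := h2 K A n (e.natDegree + (A - 1 - r)) b (e * V) hb hV2
    rw [hWdeg V hV1] at h
    have hk : κ ^ (A + b.natDegree + (e.natDegree + j)) ≤ T :=
      pow_le_pow_right₀ hκ.le (by omega)
    have h' : ‖(Bp K A b (e * V) (e.natDegree + (A - 1 - r))).coeff n‖ *
        Real.sqrt q ^ (e.natDegree + (A - 1 - r)) * Real.sqrt q ^ (j + r + 1) ≤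
        C2 * m ^ (pf b).card * Real.sqrt q ^ (A + n) * T * Real.sqrt q ^ (r + r + 1) := by
      refine mul_le_mul (h.trans ?_) (pow_le_pow_right₀ hs1 (by omega)) (by positivity)
        (by positivity)
      gcongr
      exact le_max_right _ _
    have e1 : Real.sqrt q ^ (e.natDegree + (A - 1 - r)) * Real.sqrt q ^ (j + r + 1) =
        Real.sqrt q ^ (e.natDegree + j) * Real.sqrt q ^ A := by
      rw [← pow_add, ← pow_add]; congr 1; omega
    have e2 : Real.sqrt q ^ (A + n) * Real.sqrt q ^ (r + r + 1) =
        (Real.sqrt q * ((q : ℝ) ^ r * Real.sqrt q ^ n)) * Real.sqrt q ^ A := by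
      have hqr : (q : ℝ) ^ r = Real.sqrt q ^ (2 * r) := by rw [pow_mul, hs2]
      rw [hqr]; ring
    refine le_of_mul_le_mul_right ?_ (pow_pos hs0 A)
    calc _ = ‖(Bp K A b (e * V) (e.natDegree + (A - 1 - r))).coeff n‖ *
          (Real.sqrt q ^ (e.natDegree + j) * Real.sqrt q ^ A) := by ring
      _ ≤ C2 * m ^ (pf b).card * Real.sqrt q ^ (A + n) * T * Real.sqrt q ^ (r + r + 1) := by
          rw [← e1, ← mul_assoc]; exact h'
      _ = C2 * m ^ (pf b).card * T * (Real.sqrt q ^ (A + n) * Real.sqrt q ^ (r + r + 1)) := by ring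
      _ = _ := by rw [e2]; ring
  rw [← Finset.sum_filter_add_sum_filter_not (Mn q j)
    (fun V => ∃ w : Fqx q, w.Monic ∧ e * V = w ^ 2)]
  have s1 := Finset.sum_le_card_nsmul _ _ _ hns
  have hqr : (q : ℝ) ^ j ≤ (q : ℝ) ^ r := pow_le_pow_right₀ hq1 hj
  have s1' : (((Mn q j).filter (fun V => ¬ ∃ w : Fqx q, w.Monic ∧ e * V = w ^ 2)).card : ℝ) ≤
      (q : ℝ) ^ r := by
    refine le_trans ?_ hqr
    have := Finset.card_filter_le (Mn q j) (fun V => ¬ ∃ w : Fqx q, w.Monic ∧ e * V = w ^ 2)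
    rw [card_Mn] at this
    exact_mod_cast this
  have s2 : ∑ V ∈ (Mn q j).filter (fun V => ∃ w : Fqx q, w.Monic ∧ e * V = w ^ 2),
      ‖(Bp K A b (e * V) (e.natDegree + (A - 1 - r))).coeff n‖ ≤
      C2 * Real.sqrt q * m ^ (pf b).card * ((q : ℝ) ^ r * Real.sqrt q ^ n) * T := by
    refine le_of_mul_le_mul_right ?_ (pow_pos hs0 (e.natDegree + j))
    rw [Finset.sum_mul]
    refine (Finset.sum_le_card_nsmul _ _ _ hsq).trans ?_
    rw [nsmul_eq_mul, mul_comm]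
    exact mul_le_mul_of_nonneg_left (card_filter_sq_le he j) (by positivity)
  rw [nsmul_eq_mul] at s1
  have s3 := s1.trans (mul_le_mul_of_nonneg_right s1'
    (by positivity : 0 ≤ C1 * m ^ (pf b).card * Real.sqrt q ^ A * T))
  have p1 : 0 ≤ C2 * Real.sqrt q * m ^ (pf b).card * T * ((q : ℝ) ^ r * Real.sqrt q ^ A) := by
    positivity
  have p2 : 0 ≤ C1 * m ^ (pf b).card * T * ((q : ℝ) ^ r * Real.sqrt q ^ n) := by positivity
  nlinarith

lemma natDegree_prod_le {b : Fqx q} (hb : b.Monic) {S : Finset (Fqx q)} (hS : S ⊆ pf b) :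
    (∏ P ∈ S, P).Monic ∧ (∏ P ∈ S, P).natDegree = ∑ P ∈ S, P.natDegree ∧
      ∑ P ∈ S, P.natDegree ≤ b.natDegree := by
  have hm : ∀ P ∈ S, P.Monic := fun P hP => ((mem_pf hb.ne_zero).1 (hS hP)).1
  refine ⟨monic_prod_of_monic S id hm, natDegree_prod_of_monic S _ hm, ?_⟩
  rw [natDegree_eq_sum hb]
  refine (Finset.sum_le_sum_of_subset hS).trans (Finset.sum_le_sum fun P hP => ?_)
  exact Nat.le_mul_of_pos_left _ (vv_pos hP)

set_option maxHeartbeats 1000000 in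
lemma exists_Op_le {κ : ℝ} (hκ : 1 < κ) :
    ∃ C c : ℝ, 0 ≤ C ∧ 1 ≤ c ∧ ∀ (K A n : ℕ) (b : Fqx q), b.Monic →
      ‖(Op K A b fun W => EFTp K b W A).coeff n‖ ≤
        C * c ^ (pf b).card * (A : ℝ) ^ 2 * κ ^ (n + 2 * A + 2 * b.natDegree) *
          (Real.sqrt q ^ A + Real.sqrt q ^ n) := by
  obtain ⟨C, c, hC, hc, h⟩ := exists_sum_Bp_le (q := q) hκ
  have hq0 : (0 : ℝ) < q := by exact_mod_cast (Fact.out : q.Prime).pos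
  refine ⟨C, 2 * c, hC, by linarith, fun K A n b hb => ?_⟩
  set T := C * c ^ (pf b).card * κ ^ (n + 2 * A + 2 * b.natDegree) with hT
  have hκ0 : 0 < κ := by linarith
  have hT0 : 0 ≤ T := by positivity
  have hj : ∀ S ∈ (pf b).powerset, ∀ r ∈ Finset.range A, ∀ j ∈ Finset.range (r + 1),
      ‖∑ V ∈ Mn q j, (((-1 : ℂ) ^ S.card * (1 / (q : ℂ) ^ (r + 1)) * kk q A r j) •
      ((1 - Polynomial.C (q : ℂ) * X ^ 2) * (∏ P ∈ pf b, cPp K P.natDegree) *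
        X ^ (∑ P ∈ S, P.natDegree + (A - 1 - r)) * EFTp K b ((∏ P ∈ S, P) * V) A)).coeff n‖ ≤
      T * (Real.sqrt q ^ A + Real.sqrt q ^ n) := by
    intro S hS r hr j hj
    obtain ⟨hm, hd, hle⟩ := natDegree_prod_le hb (Finset.mem_powerset.1 hS)
    have hr' := Finset.mem_range.1 hr
    have hj' : j ≤ r := Nat.lt_succ_iff.1 (Finset.mem_range.1 hj)
    have hV := h K A n r j b (∏ P ∈ S, P) hb hm (hd ▸ hle) hr' hj'
    rw [hd] at hV
    refine (norm_sum_le_of_le (n := fun V => (1 / (q : ℝ) ^ r) *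
      ‖(Bp K A b ((∏ P ∈ S, P) * V) (∑ P ∈ S, P.natDegree + (A - 1 - r))).coeff n‖) _
      fun V _ => ?_).trans ?_
    · rw [coeff_smul, smul_eq_mul, norm_mul]
      refine mul_le_mul_of_nonneg_right ?_ (norm_nonneg _)
      rw [norm_mul, norm_mul, norm_pow, norm_neg, norm_one, one_pow, one_mul, norm_div, norm_one,
        norm_pow, Complex.norm_natCast]
      refine (mul_le_mul_of_nonneg_left (norm_kk_le A r j) (by positivity)).trans (le_of_eq ?_)
      field_simp
      ring
    · rw [← Finset.mul_sum]
      refine (mul_le_mul_of_nonneg_left hV (by positivity)).trans (le_of_eq ?_)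
      rw [hT]
      field_simp
  have hX : (Op K A b fun W => EFTp K b W A).coeff n =
      ∑ S ∈ (pf b).powerset, ∑ r ∈ Finset.range A, ∑ j ∈ Finset.range (r + 1), ∑ V ∈ Mn q j,
      (((-1 : ℂ) ^ S.card * (1 / (q : ℂ) ^ (r + 1)) * kk q A r j) •
      ((1 - Polynomial.C (q : ℂ) * X ^ 2) * (∏ P ∈ pf b, cPp K P.natDegree) *
        X ^ (∑ P ∈ S, P.natDegree + (A - 1 - r)) * EFTp K b ((∏ P ∈ S, P) * V) A)).coeff n := by
    simp only [Op, Polynomial.finsetSum_coeff]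
  rw [hX]
  set Y := T * (Real.sqrt q ^ A + Real.sqrt q ^ n) with hY
  have hY0 : 0 ≤ Y := by positivity
  refine (norm_sum_le_of_le (n := fun _ => (A : ℝ) ^ 2 * Y) _ fun S hS => ?_).trans ?_
  · refine (norm_sum_le_of_le (n := fun _ => (A : ℝ) * Y) _ fun r hr => ?_).trans ?_
    · refine (norm_sum_le_of_le (n := fun _ => Y) _ fun j hj' => hj S hS r hr j hj').trans ?_
      rw [Finset.sum_const, Finset.card_range, nsmul_eq_mul]
      refine mul_le_mul_of_nonneg_right ?_ hY0
      exact_mod_cast Finset.mem_range.1 hr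
    · rw [Finset.sum_const, Finset.card_range, nsmul_eq_mul]
      exact le_of_eq (by ring)
  · rw [Finset.sum_const, Finset.card_powerset, nsmul_eq_mul, hY, hT, mul_pow]
    exact le_of_eq (by push_cast; ring)

end

section
variable {q : ℕ} [Fact q.Prime] [hq4 : Fact (q % 4 = 1)]

lemma exists_poly_le_pow (m : ℕ) {κ : ℝ} (hκ : 1 < κ) :
    ∃ C : ℝ, 1 ≤ C ∧ ∀ k : ℕ, ((k : ℝ) + 1) ^ m ≤ C * κ ^ k := by
  obtain ⟨B, hB⟩ := (tendsto_pow_const_div_const_pow_of_one_lt m hκ).bddAbove_range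
  have hκ0 : 0 < κ := by linarith
  refine ⟨max 1 (B * κ), le_max_left _ _, fun k => ?_⟩
  have h := hB ⟨k + 1, rfl⟩
  simp only at h
  rw [div_le_iff₀ (by positivity), pow_succ] at h
  push_cast at h
  refine h.trans ?_
  rw [← mul_assoc, mul_right_comm]
  exact mul_le_mul_of_nonneg_right (le_max_right _ _) (by positivity)

/-- The ternary divisor function. -/
def d3 (f : Fqx q) : ℂ := mf (fun _ k => ((k + 2).choose 2 : ℂ)) f

/-- The ternary divisor function at `b ^ 2`. -/
def d3s (b : Fqx q) : ℂ := mf (fun _ k => ((k + 1) * (2 * k + 1) : ℂ)) b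

lemma choose_two (n : ℕ) : ((n + 2).choose 2 : ℂ) = (n + 1) * (n + 2) / 2 := by
  rw [Nat.cast_choose_two]
  push_cast
  ring

lemma d3_mul_sq {a b : Fqx q} (ha : a.Monic) (hs : Squarefree a) (hb : b.Monic) :
    d3 (a * b ^ 2) = d3s b * phi b a := by
  have hpf : pf (a * b ^ 2) = pf a ∪ pf b := by
    rw [pow_two, pf_mul ha.ne_zero (hb.mul hb).ne_zero, pf_mul hb.ne_zero hb.ne_zero,
      Finset.union_self]
  have e1 : d3s b = ∏ P ∈ pf a ∪ pf b, (((vv P b : ℂ) + 1) * (2 * vv P b + 1)) := by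
    rw [d3s, mf]
    refine Finset.prod_subset Finset.subset_union_right fun P _ hP => ?_
    rw [vv_eq_zero hP]; simp
  have e2 : phi b a = ∏ P ∈ pf a ∪ pf b,
      (if P ∈ pf a then (if P ∈ pf b then beta (vv P b) else 3) else 1) := by
    rw [phi, Finset.prod_ite_mem, Finset.inter_eq_right.2 Finset.subset_union_left]
  rw [d3, mf, hpf, e1, e2, ← Finset.prod_mul_distrib]
  refine Finset.prod_congr rfl fun P hP => ?_
  rw [vv_mul_sq P ha hb, choose_two]
  have hne : (2 * (vv P b : ℂ) + 1) ≠ 0 := by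
    exact_mod_cast Nat.succ_ne_zero (2 * vv P b)
  by_cases h1 : P ∈ pf a
  · have : vv P a = 1 := le_antisymm (vv_le_one ha hs P) (vv_pos h1)
    rw [this, if_pos h1]
    by_cases h2 : P ∈ pf b
    · rw [if_pos h2, beta]
      push_cast
      field_simp
      ring
    · rw [if_neg h2, vv_eq_zero h2]
      push_cast
      norm_num
  · rw [vv_eq_zero h1, if_neg h1]
    push_cast
    ring

lemma exists_d3s_le {κ : ℝ} (hκ : 1 < κ) (c : ℝ) (hc : 1 ≤ c) :
    ∃ C : ℝ, 0 ≤ C ∧ ∀ b : Fqx q, b.Monic → ‖d3s b‖ * c ^ (pf b).card ≤ C * κ ^ b.natDegree := by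
  have hκ0 : 0 < κ := by linarith
  obtain ⟨M, hM1, hM⟩ := exists_poly_le_pow 2 hκ
  obtain ⟨d0, hd0⟩ := pow_unbounded_of_one_lt (6 * c) hκ
  have hbase (k : ℕ) : ((k : ℝ) + 1) * (2 * k + 1) ≤ 6 ^ k := by
    induction k with
    | zero => norm_num
    | succ k ih =>
      rw [pow_succ]
      push_cast
      have : (0 : ℝ) ≤ k := Nat.cast_nonneg k
      nlinarith
  refine ⟨(2 * M * c) ^ (Pr q d0).card, by positivity, fun b hb => ?_⟩
  have h := prod_pf_le (q := q) (fun P k =>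
    if P.natDegree = 0 then 0 else ((k : ℝ) + 1) * (2 * k + 1) * c) (2 * M * c) κ
    (by nlinarith) hκ.le d0 (fun P k => by split_ifs <;> positivity) ?_ ?_ b hb
  · refine le_trans (le_of_eq ?_) h
    rw [d3s, mf, norm_prod, ← Finset.prod_const, ← Finset.prod_mul_distrib]
    refine Finset.prod_congr rfl fun P hP => ?_
    rw [if_neg ((mem_pf hb.ne_zero).1 hP).2.1.natDegree_pos.ne']
    have : (((vv P b : ℂ) + 1) * (2 * vv P b + 1)) =
      ((((vv P b : ℝ) + 1) * (2 * vv P b + 1) : ℝ) : ℂ) := by push_cast; ring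
    rw [this, Complex.norm_real, Real.norm_of_nonneg (by positivity)]
  · intro P k hk
    split_ifs with h0
    · positivity
    · calc ((k : ℝ) + 1) * (2 * k + 1) * c ≤ ((k : ℝ) + 1) * (2 * (k + 1)) * c := by
            gcongr; linarith
        _ = 2 * c * ((k : ℝ) + 1) ^ 2 := by ring
        _ ≤ 2 * c * (M * κ ^ (k * P.natDegree)) := by
            gcongr
            exact (hM k).trans (mul_le_mul_of_nonneg_left (pow_le_pow_right₀ hκ.le
              (Nat.le_mul_of_pos_right k (Nat.pos_of_ne_zero h0))) (by linarith))
        _ = _ := by ring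
  · intro P k hk hP
    rw [if_neg (by omega)]
    calc ((k : ℝ) + 1) * (2 * k + 1) * c ≤ 6 ^ k * c ^ k := by
          gcongr
          · exact hbase k
          · exact le_self_pow₀ hc (by omega)
      _ = (6 * c) ^ k := (mul_pow _ _ _).symm
      _ ≤ (κ ^ P.natDegree) ^ k := by
          gcongr
          exact hd0.le.trans (pow_le_pow_right₀ hκ.le hP.le)
      _ = _ := by rw [← pow_mul, mul_comm]

/-- The contribution to the cubic moment of the `f` that are not squares. -/
def Kns (q : ℕ) [Fact q.Prime] (N n : ℕ) : ℂ :=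
  ∑ B ∈ Finset.range (N / 2 + 1), ∑ b ∈ Mn q B, d3s b *
    ∑ a ∈ (Hn q (N - 2 * B)).erase 1, phi b a * ∑ D ∈ Hn q n, chi q D (a * b ^ 2)

lemma sum_Kns (N n : ℕ) :
    ∑ i ∈ Finset.range 4, ((-1) ^ i * (Nat.choose 3 i : ℂ) * (q : ℂ) ^ (3 * i)) *
      (if 2 * i ≤ N ∧ 2 * i ≤ n then Kns q (N - 2 * i) (n - 2 * i) else 0) =
    ∑ B ∈ Finset.range (N / 2 + 1), ∑ b ∈ Mn q B, d3s b *
      ((Real.sqrt q : ℂ) ^ (N - 2 * B) *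
        (Op (n + N + B) (N - 2 * B) b fun W => EFTp (n + N + B) b W (N - 2 * B)).coeff n) := by
  have h1 : ∀ B ∈ Finset.range (N / 2 + 1), ∀ b ∈ Mn q B, d3s b *
      ((Real.sqrt q : ℂ) ^ (N - 2 * B) *
        (Op (n + N + B) (N - 2 * B) b fun W => EFTp (n + N + B) b W (N - 2 * B)).coeff n) =
      ∑ i ∈ Finset.range 4, ((-1) ^ i * (Nat.choose 3 i : ℂ) * (q : ℂ) ^ (3 * i)) *
        (if 2 * i ≤ N - 2 * B ∧ 2 * i ≤ n then d3s b * ∑ a ∈ (Hn q (N - 2 * B - 2 * i)).erase 1,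
        phi b a * ∑ D ∈ Hn q (n - 2 * i), chi q D (a * b ^ 2) else 0) := by
    intro B _ b hb
    rw [← sum_nonsq_eq (mem_Mn.1 hb).1 (by rw [(mem_Mn.1 hb).2]; omega), Finset.mul_sum]
    refine Finset.sum_congr rfl fun i _ => ?_
    rw [mul_left_comm, mul_ite, mul_zero]
  rw [Finset.sum_congr rfl fun B hB => Finset.sum_congr rfl fun b hb => h1 B hB b hb]
  rw [Finset.sum_congr rfl fun B _ => Finset.sum_comm, Finset.sum_comm]
  refine Finset.sum_congr rfl fun i _ => ?_
  simp_rw [← Finset.mul_sum]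
  congr 1
  by_cases hn : 2 * i ≤ n
  swap
  · simp [hn]
  by_cases hN : 2 * i ≤ N
  swap
  · rw [if_neg (by omega)]
    refine (Finset.sum_eq_zero fun B _ => Finset.sum_eq_zero fun b _ => ?_).symm
    rw [if_neg (by omega)]
  rw [if_pos ⟨hN, hn⟩, Kns]
  have hsub : Finset.range ((N - 2 * i) / 2 + 1) ⊆ Finset.range (N / 2 + 1) :=
    Finset.range_subset_range.2 (by omega)
  rw [← Finset.sum_subset hsub]
  · refine Finset.sum_congr rfl fun B hB => Finset.sum_congr rfl fun b _ => ?_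
    rw [if_pos ⟨by have := Finset.mem_range.1 hB; omega, hn⟩,
      show N - 2 * B - 2 * i = N - 2 * i - 2 * B by omega]
  · intro B hB hB'
    refine Finset.sum_eq_zero fun b _ => ?_
    rw [if_neg (by rw [Finset.mem_range] at hB hB'; omega)]

lemma exists_sum_Kns_le {κ : ℝ} (hκ : 1 < κ) :
    ∃ C : ℝ, 0 ≤ C ∧ ∀ N n : ℕ,
    ‖∑ i ∈ Finset.range 4, ((-1) ^ i * (Nat.choose 3 i : ℂ) * (q : ℂ) ^ (3 * i)) *
      (if 2 * i ≤ N ∧ 2 * i ≤ n then Kns q (N - 2 * i) (n - 2 * i) else 0)‖ ≤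
      C * κ ^ (n + 3 * N) * (Real.sqrt q ^ N * (Real.sqrt q ^ N + Real.sqrt q ^ n)) := by
  obtain ⟨hs1, hs2⟩ := sqrt_facts (q := q)
  obtain ⟨C1, c, hC1, hc, h1⟩ := exists_Op_le (q := q) hκ
  obtain ⟨C2, hC2, h2⟩ := exists_d3s_le (q := q) hκ c hc
  obtain ⟨C3, hC3, h3⟩ := exists_poly_le_pow 3 hκ
  have hκ0 : 0 < κ := by linarith
  have hs0 : 0 < Real.sqrt q := by linarith
  refine ⟨C1 * C2 * C3, by positivity, fun N n => ?_⟩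
  rw [sum_Kns]
  set Y := Real.sqrt q ^ N * (Real.sqrt q ^ N + Real.sqrt q ^ n) with hY
  have hb : ∀ B ∈ Finset.range (N / 2 + 1), ∀ b ∈ Mn q B, ‖d3s b *
      ((Real.sqrt q : ℂ) ^ (N - 2 * B) *
        (Op (n + N + B) (N - 2 * B) b fun W => EFTp (n + N + B) b W (N - 2 * B)).coeff n)‖ ≤
      C1 * C2 * ((N : ℝ) + 1) ^ 2 * κ ^ (n + 2 * N) * (Y * (1 / (q : ℝ) ^ B)) := by
    intro B hB b hb
    obtain ⟨hbm, hbd⟩ := mem_Mn.1 hb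
    have hB' : 2 * B ≤ N := by have := Finset.mem_range.1 hB; omega
    have k1 := h1 (n + N + B) (N - 2 * B) n b hbm
    have k2 := h2 b hbm
    rw [hbd] at k1 k2
    rw [norm_mul, norm_mul, norm_pow, Complex.norm_real, Real.norm_of_nonneg hs0.le]
    have k3 : ((N - 2 * B : ℕ) : ℝ) ^ 2 ≤ ((N : ℝ) + 1) ^ 2 := by
      gcongr
      exact_mod_cast (by omega : N - 2 * B ≤ N + 1)
    have k4 : Real.sqrt q ^ (N - 2 * B) * (Real.sqrt q ^ (N - 2 * B) + Real.sqrt q ^ n) ≤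
        Y * (1 / (q : ℝ) ^ B) := by
      have e : Real.sqrt q ^ N = Real.sqrt q ^ (N - 2 * B) * (q : ℝ) ^ B := by
        rw [← hs2, ← pow_mul, hs2, ← pow_add]; congr 1; omega
      have hle : Real.sqrt q ^ (N - 2 * B) ≤ Real.sqrt q ^ N := pow_le_pow_right₀ hs1 (by omega)
      rw [hY, mul_one_div, le_div_iff₀ (by have := (Fact.out : q.Prime).pos; positivity)]
      calc _ = (Real.sqrt q ^ (N - 2 * B) * (q : ℝ) ^ B) *
            (Real.sqrt q ^ (N - 2 * B) + Real.sqrt q ^ n) := by ring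
        _ = Real.sqrt q ^ N * (Real.sqrt q ^ (N - 2 * B) + Real.sqrt q ^ n) := by rw [← e]
        _ ≤ _ := by gcongr
    have k5 : κ ^ (n + 2 * (N - 2 * B) + 2 * B) * κ ^ B ≤ κ ^ (n + 2 * N) := by
      rw [← pow_add]; exact pow_le_pow_right₀ hκ.le (by omega)
    calc _ ≤ ‖d3s b‖ * (Real.sqrt q ^ (N - 2 * B) * (C1 * c ^ (pf b).card *
          ((N - 2 * B : ℕ) : ℝ) ^ 2 * κ ^ (n + 2 * (N - 2 * B) + 2 * B) *
          (Real.sqrt q ^ (N - 2 * B) + Real.sqrt q ^ n))) := by gcongr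
      _ = C1 * (‖d3s b‖ * c ^ (pf b).card) * ((N - 2 * B : ℕ) : ℝ) ^ 2 *
          κ ^ (n + 2 * (N - 2 * B) + 2 * B) *
          (Real.sqrt q ^ (N - 2 * B) * (Real.sqrt q ^ (N - 2 * B) + Real.sqrt q ^ n)) := by ring
      _ ≤ C1 * (C2 * κ ^ B) * ((N : ℝ) + 1) ^ 2 *
          κ ^ (n + 2 * (N - 2 * B) + 2 * B) * (Y * (1 / (q : ℝ) ^ B)) := by gcongr
      _ = C1 * C2 * ((N : ℝ) + 1) ^ 2 * (κ ^ (n + 2 * (N - 2 * B) + 2 * B) * κ ^ B) *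
          (Y * (1 / (q : ℝ) ^ B)) := by ring
      _ ≤ _ := by gcongr
  have hsum : ∀ B ∈ Finset.range (N / 2 + 1), ‖∑ b ∈ Mn q B, d3s b *
      ((Real.sqrt q : ℂ) ^ (N - 2 * B) *
        (Op (n + N + B) (N - 2 * B) b fun W => EFTp (n + N + B) b W (N - 2 * B)).coeff n)‖ ≤
      C1 * C2 * ((N : ℝ) + 1) ^ 2 * κ ^ (n + 2 * N) * Y := by
    intro B hB
    refine (norm_sum_le_of_le _ (hb B hB)).trans (le_of_eq ?_)
    rw [Finset.sum_const, card_Mn, nsmul_eq_mul]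
    have : (q : ℝ) ≠ 0 := by exact_mod_cast (Fact.out : q.Prime).ne_zero
    push_cast
    field_simp
  refine (norm_sum_le_of_le _ hsum).trans ?_
  rw [Finset.sum_const, Finset.card_range, nsmul_eq_mul]
  have hN : ((N / 2 + 1 : ℕ) : ℝ) ≤ N + 1 := by
    exact_mod_cast (by omega : N / 2 + 1 ≤ N + 1)
  calc _ ≤ ((N : ℝ) + 1) * (C1 * C2 * ((N : ℝ) + 1) ^ 2 * κ ^ (n + 2 * N) * Y) := by gcongr
    _ = C1 * C2 * ((N : ℝ) + 1) ^ 3 * κ ^ (n + 2 * N) * Y := by ring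
    _ ≤ C1 * C2 * (C3 * κ ^ N) * κ ^ (n + 2 * N) * Y := by
        gcongr
        exact h3 N
    _ = _ := by ring

end

section
/-- Multiplication by `1 - x ^ (2 * k) * s` of a double series in `s` and `x`. -/
def Tk (k : ℕ) (u : ℕ → ℕ → ℂ) (g N : ℕ) : ℂ :=
  u g N - if 1 ≤ g ∧ 2 * k ≤ N then u (g - 1) (N - 2 * k) else 0

lemma Tk_add (k : ℕ) (u v : ℕ → ℕ → ℂ) : Tk k (u + v) = Tk k u + Tk k v := by
  funext g N
  simp only [Tk, Pi.add_apply]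
  split_ifs <;> ring

lemma Tk_comm (j k : ℕ) (u : ℕ → ℕ → ℂ) : Tk j (Tk k u) = Tk k (Tk j u) := by
  funext g N
  simp only [Tk]
  have e : N - 2 * j - 2 * k = N - 2 * k - 2 * j := by omega
  by_cases hg : 1 ≤ g
  swap
  · simp [hg]
  by_cases hg2 : 1 ≤ g - 1
  swap
  · simp only [hg, hg2, true_and, false_and, if_false]
    split_ifs <;> ring
  simp only [hg, hg2, true_and, e]
  by_cases hj : 2 * j ≤ N <;> by_cases hk : 2 * k ≤ N <;> simp only [hj, hk, if_true, if_false]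
  · by_cases hjk : 2 * j + 2 * k ≤ N
    · rw [if_pos (by omega), if_pos (by omega)]; ring
    · rw [if_neg (by omega), if_neg (by omega)]; ring
  · rw [if_neg (by omega)]; ring
  · rw [if_neg (by omega)]; ring

lemma Tk_one_cube (u : ℕ → ℕ → ℂ) (g N : ℕ) :
    Tk 1 (Tk 1 (Tk 1 u)) g N = ∑ i ∈ Finset.range 4, ((-1) ^ i * (Nat.choose 3 i : ℂ)) *
      (if 2 * i ≤ N ∧ i ≤ g then u (g - i) (N - 2 * i) else 0) := by
  have h3 : Nat.choose 3 2 = 3 := rfl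
  have h : ∀ i, (if 2 * i ≤ N ∧ i ≤ g then u (g - i) (N - 2 * i) else 0) =
    if i ≤ g then (if 2 * i ≤ N then u (g - i) (N - 2 * i) else 0) else 0 := fun i => by
      split_ifs <;> first | rfl | omega
  simp only [h]
  simp only [Tk, Finset.sum_range_succ, Finset.sum_range_zero, Nat.choose_zero_right,
    Nat.choose_one_right, Nat.choose_self, h3, Nat.sub_sub]
  rcases Nat.lt_or_ge g 1 with h1 | h1
  · simp [h1.not_ge, show ¬ 2 ≤ g by omega, show ¬ 3 ≤ g by omega]
  rcases Nat.lt_or_ge N 2 with n1 | n1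
  · simp [n1.not_ge, show ¬ 4 ≤ N by omega, show ¬ 6 ≤ N by omega]
  rcases Nat.lt_or_ge g 2 with h2 | h2
  · simp [h1, n1, show ¬ 1 ≤ g - 1 by omega, show ¬ 2 ≤ g by omega, show ¬ 3 ≤ g by omega]
    ring
  rcases Nat.lt_or_ge N 4 with n2 | n2
  · simp [h1, n1, show ¬ 2 ≤ N - 2 by omega, show ¬ 4 ≤ N by omega, show ¬ 6 ≤ N by omega]
    ring
  rcases Nat.lt_or_ge g 3 with h3 | h3
  · simp [h1, n1, h2, n2, show 1 ≤ g - 1 by omega, show 2 ≤ N - 2 by omega,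
      show ¬ 1 ≤ g - 2 by omega, show ¬ 3 ≤ g by omega]
    ring
  rcases Nat.lt_or_ge N 6 with n3 | n3
  · simp [h1, n1, h2, n2, show 1 ≤ g - 1 by omega, show 2 ≤ N - 2 by omega,
      show ¬ 2 ≤ N - 4 by omega, show ¬ 6 ≤ N by omega]
    ring
  simp [h1, n1, h2, n2, h3, n3, show 1 ≤ g - 1 by omega, show 2 ≤ N - 2 by omega,
    show 1 ≤ g - 2 by omega, show 2 ≤ N - 4 by omega]
  ring

/-- The growth condition satisfied by the coefficients of the regularised cubic moment. -/
def Bd (q : ℕ) (u : ℕ → ℕ → ℂ) : Prop :=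
  ∀ κ : ℝ, 1 < κ → ∃ C : ℝ, 0 ≤ C ∧ ∀ g N : ℕ,
    ‖u g N‖ ≤ C * κ ^ (3 * (N + g)) * (Real.sqrt q ^ N / (q : ℝ) ^ (2 * g) + 1 / (q : ℝ) ^ g)

lemma Bd.add {q : ℕ} {u v : ℕ → ℕ → ℂ} (hu : Bd q u) (hv : Bd q v) : Bd q (u + v) := by
  intro κ hκ
  obtain ⟨C, hC, h1⟩ := hu κ hκ
  obtain ⟨D, hD, h2⟩ := hv κ hκ
  refine ⟨C + D, by positivity, fun g N => (norm_add_le _ _).trans ?_⟩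
  have := add_le_add (h1 g N) (h2 g N)
  linarith

variable {q : ℕ} [Fact q.Prime] [hq4 : Fact (q % 4 = 1)]

lemma Bd.Tk {u : ℕ → ℕ → ℂ} (hu : Bd q u) (k : ℕ) : Bd q (Tk k u) := by
  intro κ hκ
  obtain ⟨C, hC, h⟩ := hu κ hκ
  obtain ⟨hs1, hs2⟩ := sqrt_facts (q := q)
  have hq1 : (1 : ℝ) ≤ q := by exact_mod_cast (Fact.out : q.Prime).one_lt.le
  refine ⟨C * (1 + q ^ 2), by positivity, fun g N => (norm_sub_le _ _).trans ?_⟩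
  set R := κ ^ (3 * (N + g)) * (Real.sqrt q ^ N / (q : ℝ) ^ (2 * g) + 1 / (q : ℝ) ^ g) with hR
  have hR0 : 0 ≤ R := by have := hκ.le; positivity
  have h1 := h g N
  rw [mul_assoc, ← hR] at h1
  have h2 : ‖if 1 ≤ g ∧ 2 * k ≤ N then u (g - 1) (N - 2 * k) else 0‖ ≤ C * (q : ℝ) ^ 2 * R := by
    split_ifs with hc
    · refine (h _ _).trans ?_
      obtain ⟨m, rfl⟩ : ∃ m, g = m + 1 := ⟨g - 1, by omega⟩
      rw [mul_assoc, mul_assoc C, Nat.add_sub_cancel]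
      refine mul_le_mul_of_nonneg_left ?_ hC
      rw [hR, mul_left_comm]
      refine mul_le_mul (pow_le_pow_right₀ hκ.le (by omega)) ?_ (by positivity)
        (by have := hκ.le; positivity)
      rw [mul_add]
      refine add_le_add ?_ ?_
      · have e : (q : ℝ) ^ 2 * (Real.sqrt q ^ N / (q : ℝ) ^ (2 * (m + 1))) =
          Real.sqrt q ^ N / (q : ℝ) ^ (2 * m) := by
          rw [Nat.mul_succ, pow_add]; field_simp
        rw [e]
        gcongr
        · omega
      · have e : (q : ℝ) ^ 2 * (1 / (q : ℝ) ^ (m + 1)) = q * (1 / (q : ℝ) ^ m) := by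
          rw [pow_succ]; field_simp; ring
        rw [e]
        exact le_mul_of_one_le_left (by positivity) hq1
    · rw [norm_zero]; positivity
  calc _ ≤ C * R + C * (q : ℝ) ^ 2 * R := add_le_add h1 h2
    _ = C * (1 + q ^ 2) * R := by ring
    _ = _ := by rw [hR]; ring

/-- The normalised non-square contribution. -/
def mns (q : ℕ) [Fact q.Prime] (g N : ℕ) : ℂ :=
  Kns q N (2 * g + 1) / ((q : ℂ) ^ (2 * g + 1) * (Real.sqrt q : ℂ) ^ N)

lemma Tk_one_cube_norm (K : ℕ → ℕ → ℂ) (g N : ℕ) :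
    Tk 1 (Tk 1 (Tk 1 fun g N => K N (2 * g + 1) /
      ((q : ℂ) ^ (2 * g + 1) * (Real.sqrt q : ℂ) ^ N))) g N =
    (∑ i ∈ Finset.range 4, ((-1) ^ i * (Nat.choose 3 i : ℂ) * (q : ℂ) ^ (3 * i)) *
      (if 2 * i ≤ N ∧ 2 * i ≤ 2 * g + 1 then K (N - 2 * i) (2 * g + 1 - 2 * i) else 0)) /
      ((q : ℂ) ^ (2 * g + 1) * (Real.sqrt q : ℂ) ^ N) := by
  rw [Tk_one_cube, Finset.sum_div]
  refine Finset.sum_congr rfl fun i _ => ?_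
  by_cases h : 2 * i ≤ N ∧ i ≤ g
  · rw [if_pos h, if_pos ⟨h.1, by omega⟩, show 2 * (g - i) + 1 = 2 * g + 1 - 2 * i by omega]
    have hq0 := q_ne_zero (q := q)
    have hs0 := sqrt_cast_ne_zero (q := q)
    have e : (q : ℂ) ^ (2 * g + 1) * (Real.sqrt q : ℂ) ^ N = (q : ℂ) ^ (3 * i) *
        ((q : ℂ) ^ (2 * g + 1 - 2 * i) * (Real.sqrt q : ℂ) ^ (N - 2 * i)) := by
      have e1 : (Real.sqrt q : ℂ) ^ N = (q : ℂ) ^ i * (Real.sqrt q : ℂ) ^ (N - 2 * i) := by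
        rw [← sqrt_cast_sq (q := q), ← pow_mul, ← pow_add]; congr 1; omega
      have e2 : (q : ℂ) ^ (2 * g + 1) = (q : ℂ) ^ (2 * i) * (q : ℂ) ^ (2 * g + 1 - 2 * i) := by
        rw [← pow_add]; congr 1; omega
      rw [e1, e2]; ring
    rw [e]
    field_simp
  · rw [if_neg h, if_neg (by omega)]; simp

lemma Bd_mns : Bd q (Tk 1 (Tk 1 (Tk 1 (mns q)))) := by
  intro κ hκ
  obtain ⟨C, hC, h⟩ := exists_sum_Kns_le (q := q) hκ
  obtain ⟨hs1, hs2⟩ := sqrt_facts (q := q)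
  have hq1 : (1 : ℝ) ≤ q := by exact_mod_cast (Fact.out : q.Prime).one_lt.le
  have hs0 : 0 < Real.sqrt q := by linarith
  have hκ0 : 0 < κ := by linarith
  refine ⟨C * κ, by positivity, fun g N => ?_⟩
  have e : mns q = fun g N => Kns q N (2 * g + 1) /
      ((q : ℂ) ^ (2 * g + 1) * (Real.sqrt q : ℂ) ^ N) := rfl
  rw [e, Tk_one_cube_norm (q := q) (Kns q), norm_div, norm_mul, norm_pow, norm_pow,
    Complex.norm_natCast, Complex.norm_real, Real.norm_of_nonneg hs0.le, div_le_iff₀ (by positivity)]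
  refine (h N (2 * g + 1)).trans ?_
  have e1 : (Real.sqrt q ^ N / (q : ℝ) ^ (2 * g) + 1 / (q : ℝ) ^ g) *
      ((q : ℝ) ^ (2 * g + 1) * Real.sqrt q ^ N) =
      Real.sqrt q ^ N * (q * Real.sqrt q ^ N + (q : ℝ) ^ (g + 1)) := by
    rw [pow_succ (q : ℝ) (2 * g), pow_succ, pow_mul' (q : ℝ) 2 g]
    field_simp
  have e2 : Real.sqrt q ^ (2 * g + 1) ≤ (q : ℝ) ^ (g + 1) := by
    have : (q : ℝ) ^ (g + 1) = Real.sqrt q ^ (2 * (g + 1)) := by rw [pow_mul, hs2]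
    rw [this]
    exact pow_le_pow_right₀ hs1 (by omega)
  have e3 : κ ^ (2 * g + 1 + 3 * N) ≤ κ * κ ^ (3 * (N + g)) := by
    rw [← pow_succ']
    exact pow_le_pow_right₀ hκ.le (by omega)
  have e4 : Real.sqrt q ^ N ≤ q * Real.sqrt q ^ N := le_mul_of_one_le_left (by positivity) hq1
  rw [mul_assoc _ _ ((q : ℝ) ^ (2 * g + 1) * Real.sqrt q ^ N), e1, mul_assoc C κ]
  gcongr

end

section
variable {q : ℕ} [Fact q.Prime] [hq4 : Fact (q % 4 = 1)]

/-- The number of squarefree polynomials of degree `n` not divisible by any prime of `S`. -/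
def sv (q : ℕ) [Fact q.Prime] (S : Finset (Fqx q)) (n : ℕ) : ℂ :=
  ∑ D ∈ Hn q n, ∏ P ∈ pf D, (if P ∈ S then 0 else 1)

lemma sv_pf {b : Fqx q} (hb : b.Monic) (n : ℕ) :
    sv q (pf b) n = ∑ D ∈ Hn q n, chi q D (b ^ 2) := by
  refine Finset.sum_congr rfl fun D hD => ?_
  have hD0 := (mem_Hn.1 hD).1.ne_zero
  rw [chi_sq_right D hb]
  split_ifs with h
  · obtain ⟨P, hP, hPD⟩ := h
    have h1 := (mem_pf hb.ne_zero).1 hP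
    exact Finset.prod_eq_zero ((mem_pf hD0).2 ⟨h1.1, h1.2.1, hPD⟩) (if_pos hP)
  · refine Finset.prod_eq_one fun P hP => if_neg fun hPb => h ⟨P, hPb, ((mem_pf hD0).1 hP).2.2⟩

lemma sv_eq (S : Finset (Fqx q)) {n J : ℕ} (hn : n ≤ J) :
    sv q S n = (∏ P ∈ Pr q J, (1 + C (if P ∈ S then (0 : ℂ) else 1) * X ^ P.natDegree)).coeff n :=
  sum_Hn_prod (q := q) (fun P => if P ∈ S then (0 : ℂ) else 1) hn

lemma sv_insert {S : Finset (Fqx q)} {P : Fqx q} (hm : P.Monic) (hi : Irreducible P) (hP : P ∉ S)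
    {n : ℕ} (hn : P.natDegree ≤ n) :
    sv q S n = sv q (insert P S) n + sv q (insert P S) (n - P.natDegree) := by
  have hPr : P ∈ Pr q n := mem_Pr.2 ⟨hm, hi, hn⟩
  rw [sv_eq S le_rfl, sv_eq (insert P S) le_rfl, sv_eq (insert P S) (Nat.sub_le n P.natDegree)]
  rw [← Finset.mul_prod_erase _ _ hPr, ← Finset.mul_prod_erase (Pr q n)
    (fun Q => 1 + C (if Q ∈ insert P S then (0 : ℂ) else 1) * X ^ Q.natDegree) hPr]
  have e : ∏ Q ∈ (Pr q n).erase P, (1 + C (if Q ∈ insert P S then (0 : ℂ) else 1) *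
      X ^ Q.natDegree) = ∏ Q ∈ (Pr q n).erase P, (1 + C (if Q ∈ S then (0 : ℂ) else 1) *
      X ^ Q.natDegree) := by
    refine Finset.prod_congr rfl fun Q hQ => ?_
    simp only [Finset.mem_insert, Finset.ne_of_mem_erase hQ, false_or]
  rw [e]
  simp only [hP, Finset.mem_insert_self, if_true, if_false, map_one, map_zero, one_mul, zero_mul,
    add_zero, add_mul, coeff_add]
  rw [coeff_X_pow_mul', if_pos hn]

/-- The numerator of the generating function of `sv`. -/
def Bq (q : ℕ) [Fact q.Prime] (K : ℕ) (S : Finset (Fqx q)) : ℂ[X] :=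
  (1 - C (q : ℂ) * X ^ 2) * ∏ P ∈ S, ((1 - X ^ P.natDegree) * cPp K P.natDegree)

lemma TE_sv {J K : ℕ} (hK : J ≤ K) {S : Finset (Fqx q)} (hS : S ⊆ Pr q J) :
    TE J ((∏ P ∈ Pr q J, (1 + C (if P ∈ S then (0 : ℂ) else 1) * X ^ P.natDegree)) *
      (1 - C (q : ℂ) * X)) (Bq q K S) := by
  set F := ∏ P ∈ Pr q J, (1 + C (if P ∈ S then (0 : ℂ) else 1) * X ^ P.natDegree) with hF
  set Y := ∏ P ∈ S, (((1 : ℂ[X]) - X ^ P.natDegree) * cPp K P.natDegree) with hY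
  have h1 : TE J (∏ P ∈ S, ((1 - X ^ (2 * P.natDegree)) * cPp K P.natDegree)) 1 := by
    have := TE.prod (J := J) (s := S) (p := fun P => (1 - X ^ (2 * P.natDegree)) *
      cPp K P.natDegree) (r := fun _ => 1)
      fun P hP => TE_cPp (mem_Pr.1 (hS hP)).2.1.natDegree_pos hK
    simpa using this
  have h2 : F * ∏ P ∈ S, ((1 : ℂ[X]) + X ^ P.natDegree) =
      ∏ P ∈ Pr q J, ((1 : ℂ[X]) + X ^ P.natDegree) := by
    rw [← Finset.inter_eq_right.2 hS, ← Finset.prod_ite_mem, hF, ← Finset.prod_mul_distrib]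
    refine Finset.prod_congr rfl fun P hP => ?_
    by_cases h : P ∈ S <;> simp [h]
  have h3 : ∏ P ∈ S, (((1 : ℂ[X]) - X ^ (2 * P.natDegree)) * cPp K P.natDegree) =
      (∏ P ∈ S, ((1 : ℂ[X]) + X ^ P.natDegree)) * Y := by
    rw [hY, ← Finset.prod_mul_distrib]
    refine Finset.prod_congr rfl fun P _ => ?_
    ring
  have h4 : (∏ P ∈ Pr q J, ((1 : ℂ[X]) + X ^ P.natDegree)) *
      ∏ P ∈ Pr q J, ((1 : ℂ[X]) - X ^ P.natDegree) =
      ∏ P ∈ Pr q J, ((1 : ℂ[X]) - X ^ (2 * P.natDegree)) := by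
    rw [← Finset.prod_mul_distrib]
    refine Finset.prod_congr rfl fun P _ => ?_
    ring
  have s1 : TE J (F * (1 - C (q : ℂ) * X)) (F * (1 - C (q : ℂ) * X) *
      ∏ P ∈ S, ((1 - X ^ (2 * P.natDegree)) * cPp K P.natDegree)) := by
    have := (TE.refl J (F * (1 - C (q : ℂ) * X))).mul h1.symm
    rwa [mul_one] at this
  refine s1.trans ?_
  rw [h3, show F * (1 - C (q : ℂ) * X) * ((∏ P ∈ S, ((1 : ℂ[X]) + X ^ P.natDegree)) * Y) =
    (F * ∏ P ∈ S, ((1 : ℂ[X]) + X ^ P.natDegree)) * (1 - C (q : ℂ) * X) * Y by ring, h2, Bq, ← hY]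
  refine TE.mul ?_ (TE.refl J Y)
  refine ((TE.refl J _).mul (TE_zeta (q := q) J).symm).trans ?_
  rw [h4]
  exact TE_zeta_two J

lemma sv_succ {S : Finset (Fqx q)} {J K n : ℕ} (hK : J ≤ K) (hS : S ⊆ Pr q J) (hn : n + 1 ≤ J) :
    sv q S (n + 1) - q * sv q S n = (Bq q K S).coeff (n + 1) := by
  rw [← (TE_sv hK hS).coeff hn, sv_eq S hn, sv_eq S (by omega : n ≤ J), mul_sub, mul_one, coeff_sub,
    mul_left_comm, coeff_C_mul, coeff_mul_X]

lemma exists_sv_succ_le {κ : ℝ} (hκ : 1 < κ) :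
    ∃ C c : ℝ, 0 ≤ C ∧ 1 ≤ c ∧ ∀ (S : Finset (Fqx q)), (∀ P ∈ S, P.Monic ∧ Irreducible P) →
      ∀ n, ‖sv q S (n + 1) - q * sv q S n‖ ≤ C * c ^ S.card * κ ^ (n + 1) := by
  have hκ0 : 0 < κ := by linarith
  have hρ1 : 1 / κ < 1 := by rw [div_lt_one hκ0]; exact hκ
  have hρ0 : 0 ≤ 1 / κ := by positivity
  have hc := one_le_c0 hρ0 hρ1
  refine ⟨1 + q, 2 * (1 / (1 - (1 / κ) ^ 2)), by positivity, by linarith, fun S hS n => ?_⟩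
  have hSP : S ⊆ Pr q (n + 1 + ∑ P ∈ S, P.natDegree) := fun P hP =>
    mem_Pr.2 ⟨(hS P hP).1, (hS P hP).2, (Finset.single_le_sum (f := fun P : Fqx q => P.natDegree)
      (fun _ _ => Nat.zero_le _) hP).trans (Nat.le_add_left _ _)⟩
  rw [sv_succ le_rfl hSP (by omega)]
  refine le_of_mul_inv_pow_le hκ0 _ (norm_coeff_mul_le _ (n + 1) hρ0 fun z hz => ?_)
  rw [Bq, eval_mul, norm_mul, eval_prod, norm_prod]
  refine mul_le_mul ?_ ?_ (Finset.prod_nonneg fun _ _ => norm_nonneg _) (by positivity)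
  · simp only [eval_sub, eval_one, eval_mul, eval_C, eval_pow, eval_X]
    refine (norm_sub_le _ _).trans ?_
    rw [norm_one, norm_mul, norm_pow, hz, Complex.norm_natCast]
    exact add_le_add le_rfl (mul_le_of_le_one_right (by positivity) (pow_le_one₀ hρ0 hρ1.le))
  · rw [← Finset.prod_const]
    refine Finset.prod_le_prod (fun _ _ => norm_nonneg _) fun P hP => ?_
    rw [eval_mul, norm_mul, eval_cPp]
    refine mul_le_mul ?_ (norm_cP_le (hS P hP).2.natDegree_pos hz.le hρ1) (norm_nonneg _)
      (by norm_num)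
    simp only [eval_sub, eval_one, eval_pow, eval_X]
    refine (norm_sub_le _ _).trans ?_
    rw [norm_one, norm_pow, hz]
    have := pow_le_one₀ hρ0 hρ1.le (n := P.natDegree)
    linarith

lemma norm_sv_le (S : Finset (Fqx q)) (n : ℕ) : ‖sv q S n‖ ≤ (q : ℝ) ^ n := by
  refine (norm_sum_le_of_le (n := fun _ => 1) _ fun D _ => ?_).trans ?_
  · rw [norm_prod]
    refine Finset.prod_le_one (fun _ _ => norm_nonneg _) fun P _ => ?_
    split_ifs <;> simp
  · rw [Finset.sum_const, nsmul_eq_mul, mul_one]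
    have h : Hn q n ⊆ Mn q n := fun D hD =>
      mem_Mn.2 ⟨(mem_Hn.1 hD).1, (mem_Hn.1 hD).2.1⟩
    have := Finset.card_le_card h
    rw [card_Mn] at this
    exact_mod_cast this

open Filter Topology

lemma exists_tendsto_sv {S : Finset (Fqx q)} (hS : ∀ P ∈ S, P.Monic ∧ Irreducible P) :
    ∃ l : ℂ, Tendsto (fun n => sv q S n / (q : ℂ) ^ n) atTop (𝓝 l) := by
  obtain ⟨C, c, hC, hc, h⟩ := exists_sv_succ_le (q := q) (κ := 2) (by norm_num)
  have hq5 : (5 : ℝ) ≤ q := by exact_mod_cast q_ge_five (q := q)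
  have hq0 := q_ne_zero (q := q)
  refine cauchySeq_tendsto_of_complete (cauchySeq_of_le_geometric (2 / q) (C * c ^ S.card) ?_ ?_)
  · rw [div_lt_one (by linarith)]; linarith
  · intro n
    have e : sv q S n / (q : ℂ) ^ n - sv q S (n + 1) / (q : ℂ) ^ (n + 1) =
        -(sv q S (n + 1) - q * sv q S n) / (q : ℂ) ^ (n + 1) := by
      rw [pow_succ]; field_simp; ring
    rw [dist_eq_norm, e, norm_div, norm_neg, norm_pow, Complex.norm_natCast, div_pow,
      div_le_iff₀ (by positivity)]
    refine (h S hS n).trans ?_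
    have e2 : C * c ^ S.card * (2 ^ n / (q : ℝ) ^ n) * (q : ℝ) ^ (n + 1) =
        C * c ^ S.card * (2 ^ n * q) := by
      rw [pow_succ]; field_simp
    rw [e2, pow_succ]
    gcongr
    linarith

lemma tendsto_sv (S : Finset (Fqx q)) : (∀ P ∈ S, P.Monic ∧ Irreducible P) →
    Tendsto (fun n => sv q S n / (q : ℂ) ^ n) atTop
      (𝓝 ((1 - 1 / q) * ∏ P ∈ S, (1 + 1 / (q : ℂ) ^ P.natDegree)⁻¹)) := by
  have hq0 := q_ne_zero (q := q)
  induction S using Finset.induction_on with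
  | empty =>
    intro _
    obtain ⟨l, hl⟩ := exists_tendsto_sv (q := q) (S := ∅) (by simp)
    have hst : ∀ n, sv q ∅ (n + 2) / (q : ℂ) ^ (n + 2) = 1 - 1 / q := by
      have hB (n : ℕ) := sv_succ (q := q) (S := ∅) (J := n + 1) (K := n + 1) (n := n) le_rfl
        (by simp) le_rfl
      simp only [Bq, Finset.prod_empty, mul_one, coeff_sub, coeff_one, coeff_C_mul, coeff_X_pow]
        at hB
      have h0 : sv q ∅ 0 = 1 := by
        simp [sv, Hn_zero]
      have h1 := hB 0
      have h2 := hB 1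
      norm_num [h0] at h1 h2
      intro n
      induction n with
      | zero =>
        rw [sub_eq_zero] at h1
        rw [h1] at h2
        have : sv q ∅ 2 = q * q - q := by linear_combination h2
        rw [zero_add, this]; field_simp
      | succ n ih =>
        have h3 := hB (n + 2)
        rw [if_neg (by omega), if_neg (by omega), mul_zero, sub_zero, sub_eq_zero] at h3
        rw [show n + 1 + 2 = n + 2 + 1 by ring, h3, ← ih, pow_succ]
        field_simp
    have := tendsto_nhds_unique ((tendsto_add_atTop_iff_nat 2).2 hl)
      ((tendsto_congr hst).2 tendsto_const_nhds)
    simpa [this] using hl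
  | insert P S hP ih =>
    intro hS
    obtain ⟨hm, hi⟩ := hS P (Finset.mem_insert_self _ _)
    have ih' := ih fun Q hQ => hS Q (Finset.mem_insert_of_mem hQ)
    obtain ⟨l, hl⟩ := exists_tendsto_sv hS
    set d := P.natDegree with hd
    have h1 : Tendsto (fun n => sv q S (n + d) / (q : ℂ) ^ (n + d)) atTop
        (𝓝 (l + 1 / (q : ℂ) ^ d * l)) := by
      have hl2 := (tendsto_add_atTop_iff_nat d).2 hl
      refine (tendsto_congr fun n => ?_).1 (hl2.add (hl.const_mul (1 / (q : ℂ) ^ d)))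
      rw [sv_insert hm hi hP (show P.natDegree ≤ n + d by omega), ← hd, Nat.add_sub_cancel, pow_add]
      field_simp
    have h2 := tendsto_nhds_unique ((tendsto_add_atTop_iff_nat d).2 ih') h1
    have hne : (1 + 1 / (q : ℂ) ^ d) ≠ 0 := by
      have : (1 + 1 / (q : ℂ) ^ d) = ((1 + 1 / (q : ℝ) ^ d : ℝ) : ℂ) := by push_cast; ring
      rw [this]
      have h0 : (0 : ℝ) < 1 + 1 / (q : ℝ) ^ d := by positivity
      exact_mod_cast h0.ne'
    have h3 : l = (1 - 1 / q) * ∏ P ∈ insert P S, (1 + 1 / (q : ℂ) ^ P.natDegree)⁻¹ := by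
      rw [Finset.prod_insert hP, ← hd, mul_left_comm, h2,
        show l + 1 / (q : ℂ) ^ d * l = (1 + 1 / (q : ℂ) ^ d) * l by ring, inv_mul_cancel_left₀ hne]
    rwa [← h3]

end

section
variable {q : ℕ} [Fact q.Prime] [hq4 : Fact (q % 4 = 1)]

/-- The contribution to the cubic moment of the square `f`. -/
def Ksq (q : ℕ) [Fact q.Prime] (N n : ℕ) : ℂ :=
  if Even N then ∑ b ∈ Mn q (N / 2), d3s b * sv q (pf b) n else 0

/-- The coefficient of the cubic moment of `L` at degree `N`. -/
def Kf (q : ℕ) [Fact q.Prime] (N n : ℕ) : ℂ :=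
  ∑ D ∈ Hn q n, ∑ f ∈ Mn q N, d3 f * chi q D f

lemma phi_one (b : Fqx q) : phi b 1 = 1 := by simp [phi, pf_one]

lemma Kf_eq (N n : ℕ) : Kf q N n = Kns q N n + Ksq q N n := by
  have h1 : Kf q N n = ∑ B ∈ Finset.range (N / 2 + 1), ∑ b ∈ Mn q B, d3s b *
      ∑ a ∈ Hn q (N - 2 * B), phi b a * ∑ D ∈ Hn q n, chi q D (a * b ^ 2) := by
    rw [Kf, Finset.sum_comm, sum_mul_sq]
    refine Finset.sum_congr rfl fun B _ => Finset.sum_congr rfl fun b hb => ?_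
    rw [Finset.mul_sum]
    refine Finset.sum_congr rfl fun a ha => ?_
    rw [← Finset.mul_sum, d3_mul_sq (mem_Hn.1 ha).1 (mem_Hn.1 ha).2.2 (mem_Mn.1 hb).1, mul_assoc]
  have h2 : ∀ B b, ∑ a ∈ Hn q (N - 2 * B), phi b a * ∑ D ∈ Hn q n, chi q D (a * b ^ 2) =
      ∑ a ∈ (Hn q (N - 2 * B)).erase 1, phi b a * ∑ D ∈ Hn q n, chi q D (a * b ^ 2) +
      if N - 2 * B = 0 then ∑ D ∈ Hn q n, chi q D (b ^ 2) else 0 := by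
    intro B b
    split_ifs with h
    · rw [h, Hn_zero]
      simp [phi_one]
    · rw [add_zero, Finset.erase_eq_of_notMem]
      intro h1
      exact h (by rw [← (mem_Hn.1 h1).2.1, natDegree_one])
  rw [h1, Kns, Ksq]
  simp only [h2, mul_add, Finset.sum_add_distrib]
  congr 1
  split_ifs with hN
  · obtain ⟨k, rfl⟩ := hN
    rw [Finset.sum_eq_single ((k + k) / 2)]
    · refine Finset.sum_congr rfl fun b hb => ?_
      rw [if_pos (by omega), sv_pf (mem_Mn.1 hb).1]
    · intro B hB hne
      have hc : ¬ k + k - 2 * B = 0 := by rw [Finset.mem_range] at hB; omega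
      simp only [if_neg hc, mul_zero, Finset.sum_const_zero]
    · intro h
      exact absurd (Finset.mem_range.2 (by omega)) h
  · refine Finset.sum_eq_zero fun B hB => ?_
    have hc : ¬ N - 2 * B = 0 := by rw [Finset.mem_range] at hB; rw [Nat.even_iff] at hN; omega
    simp only [if_neg hc, mul_zero, Finset.sum_const_zero]

/-- The normalised square contribution. -/
def msq (q : ℕ) [Fact q.Prime] (g N : ℕ) : ℂ :=
  Ksq q N (2 * g + 1) / ((q : ℂ) ^ (2 * g + 1) * (Real.sqrt q : ℂ) ^ N)

/-- The normalised coefficients of the cubic moment. -/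
def mm (q : ℕ) [Fact q.Prime] (g N : ℕ) : ℂ :=
  Kf q N (2 * g + 1) / ((q : ℂ) ^ (2 * g + 1) * (Real.sqrt q : ℂ) ^ N)

lemma mm_eq : mm q = mns q + msq q := by
  funext g N
  rw [Pi.add_apply, Pi.add_apply, mm, mns, msq, Kf_eq, add_div]

/-- The limit of the square contribution. -/
def rr (q : ℕ) [Fact q.Prime] (N : ℕ) : ℂ :=
  if Even N then (∑ b ∈ Mn q (N / 2), d3s b * ∏ P ∈ pf b, (1 + 1 / (q : ℂ) ^ P.natDegree)⁻¹) /
    (Real.sqrt q : ℂ) ^ N else 0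

lemma pf_prime {b : Fqx q} (hb : b.Monic) : ∀ P ∈ pf b, P.Monic ∧ Irreducible P := fun _ hP =>
  ⟨((mem_pf hb.ne_zero).1 hP).1, ((mem_pf hb.ne_zero).1 hP).2.1⟩

open Filter Topology

lemma tendsto_msq (N : ℕ) : Tendsto (fun g => msq q g N) atTop (𝓝 ((1 - 1 / q) * rr q N)) := by
  simp only [msq, Ksq, rr]
  split_ifs with hN
  · have hodd : Tendsto (fun g : ℕ => 2 * g + 1) atTop atTop :=
      tendsto_atTop_mono (fun g => by simp only [id]; omega) tendsto_id
    have h : ∀ b ∈ Mn q (N / 2), Tendsto (fun g : ℕ => d3s b * (sv q (pf b) (2 * g + 1) /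
        (q : ℂ) ^ (2 * g + 1))) atTop
        (𝓝 (d3s b * ((1 - 1 / q) * ∏ P ∈ pf b, (1 + 1 / (q : ℂ) ^ P.natDegree)⁻¹))) := fun b hb =>
      ((tendsto_sv (pf b) (pf_prime (mem_Mn.1 hb).1)).comp hodd).const_mul _
    have h2 := (tendsto_finsetSum _ h).div_const ((Real.sqrt q : ℂ) ^ N)
    convert h2 using 2
    · rw [Finset.sum_div, Finset.sum_div]
      refine Finset.sum_congr rfl fun b _ => ?_
      rw [mul_div_assoc', div_div]
    · rw [mul_div_assoc', Finset.mul_sum]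
      congr 1
      refine Finset.sum_congr rfl fun b _ => ?_
      ring
  · simp

lemma norm_Ksq_sum_le {N : ℕ} (hN : Even N) {C : ℝ} {F : Fqx q → ℂ}
    (h : ∀ b ∈ Mn q (N / 2), ‖F b‖ ≤ C) : ‖∑ b ∈ Mn q (N / 2), F b‖ ≤ C * Real.sqrt q ^ N := by
  obtain ⟨hs1, hs2⟩ := sqrt_facts (q := q)
  refine (norm_sum_le_of_le _ h).trans (le_of_eq ?_)
  rw [Finset.sum_const, card_Mn, nsmul_eq_mul]
  obtain ⟨k, rfl⟩ := hN
  rw [← two_mul, pow_mul, hs2]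
  push_cast
  rw [Nat.mul_div_cancel_left k (by norm_num), mul_comm]

lemma Bd_msq : Bd q (Tk 0 (msq q)) := by
  intro κ hκ
  obtain ⟨C, c, hC, hc, h⟩ := exists_sv_succ_le (q := q) hκ
  obtain ⟨C2, hC2, h2⟩ := exists_d3s_le (q := q) hκ c hc
  obtain ⟨hs1, hs2⟩ := sqrt_facts (q := q)
  have hq1 : (1 : ℝ) ≤ q := by exact_mod_cast (Fact.out : q.Prime).one_lt.le
  have hs0 : 0 < Real.sqrt q := by linarith
  have hκ0 : 0 < κ := by linarith
  have hq0 : (0 : ℝ) < q := by linarith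
  have hqc := q_ne_zero (q := q)
  have hsc := sqrt_cast_ne_zero (q := q)
  refine ⟨C2 * C * (1 + q) * κ + C2, by positivity, fun g N => ?_⟩
  have hR : κ ^ (3 * (N + g)) / (q : ℝ) ^ (2 * g) ≤
      κ ^ (3 * (N + g)) * (Real.sqrt q ^ N / (q : ℝ) ^ (2 * g) + 1 / (q : ℝ) ^ g) := by
    rw [div_eq_mul_one_div]
    refine mul_le_mul_of_nonneg_left ?_ (by positivity)
    have : 1 / (q : ℝ) ^ (2 * g) ≤ Real.sqrt q ^ N / (q : ℝ) ^ (2 * g) := by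
      gcongr
      exact one_le_pow₀ hs1
    have h0 : 0 ≤ 1 / (q : ℝ) ^ g := by positivity
    linarith
  rw [mul_assoc]
  refine le_trans ?_ (mul_le_mul_of_nonneg_left hR (by positivity))
  by_cases hN : Even N
  swap
  · simp only [Tk, msq, Ksq, hN, if_false, mul_zero, zero_div, Nat.sub_zero, ite_self, sub_zero,
      norm_zero]
    positivity
  rcases Nat.eq_zero_or_pos g with rfl | hg
  · simp only [Tk, msq, Ksq, hN, if_true, show ¬ (1 ≤ 0) by omega, false_and, if_false, sub_zero]
    rw [norm_div, norm_mul, norm_pow, norm_pow, Complex.norm_natCast, Complex.norm_real,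
      Real.norm_of_nonneg hs0.le, div_le_iff₀ (by positivity)]
    refine (norm_Ksq_sum_le hN (C := C2 * κ ^ N * q) fun b hb => ?_).trans ?_
    · obtain ⟨hbm, hbd⟩ := mem_Mn.1 hb
      rw [norm_mul]
      have k1 := h2 b hbm
      have k2 : ‖d3s b‖ ≤ ‖d3s b‖ * c ^ (pf b).card :=
        le_mul_of_one_le_right (norm_nonneg _) (one_le_pow₀ hc)
      have k3 : κ ^ b.natDegree ≤ κ ^ N := pow_le_pow_right₀ hκ.le (by omega)
      have k4 := norm_sv_le (pf b) 1
      simp only [mul_zero, zero_add, pow_one] at k4 ⊢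
      calc _ ≤ (C2 * κ ^ b.natDegree) * q := by gcongr; exact k2.trans k1
        _ ≤ _ := by gcongr
    · have k3 : κ ^ N ≤ κ ^ (3 * (N + 0)) := pow_le_pow_right₀ hκ.le (by omega)
      have k5 : 0 ≤ C2 * C * (1 + q) * κ := by positivity
      simp only [mul_zero, zero_add, pow_one, pow_zero, div_one]
      calc C2 * κ ^ N * q * Real.sqrt q ^ N = C2 * κ ^ N * (q * Real.sqrt q ^ N) := by ring
        _ ≤ (C2 * C * (1 + q) * κ + C2) * κ ^ (3 * (N + 0)) * (q * Real.sqrt q ^ N) := by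
            gcongr
            linarith
  · obtain ⟨m, rfl⟩ : ∃ m, g = m + 1 := ⟨g - 1, by omega⟩
    have e : Tk 0 (msq q) (m + 1) N = (∑ b ∈ Mn q (N / 2), d3s b *
        ((sv q (pf b) (2 * m + 2 + 1) - q * sv q (pf b) (2 * m + 2)) +
          q * (sv q (pf b) (2 * m + 1 + 1) - q * sv q (pf b) (2 * m + 1)))) /
        ((q : ℂ) ^ (2 * m + 3) * (Real.sqrt q : ℂ) ^ N) := by
      have e1 : ∑ b ∈ Mn q (N / 2), d3s b *
        ((sv q (pf b) (2 * m + 2 + 1) - q * sv q (pf b) (2 * m + 2)) +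
          q * (sv q (pf b) (2 * m + 1 + 1) - q * sv q (pf b) (2 * m + 1))) =
        ∑ b ∈ Mn q (N / 2), d3s b * sv q (pf b) (2 * m + 3) -
          (q : ℂ) ^ 2 * ∑ b ∈ Mn q (N / 2), d3s b * sv q (pf b) (2 * m + 1) := by
        rw [Finset.mul_sum, ← Finset.sum_sub_distrib]
        refine Finset.sum_congr rfl fun b _ => ?_
        ring
      simp only [Tk, msq, Ksq, hN, if_true, Nat.sub_zero, mul_zero, Nat.zero_le, and_true,
        Nat.add_sub_cancel, show 1 ≤ m + 1 by omega]
      rw [e1, sub_div, show 2 * (m + 1) + 1 = 2 * m + 3 by ring]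
      congr 1
      rw [show 2 * m + 3 = 2 * m + 1 + 2 by ring, pow_add _ (2 * m + 1)]
      field_simp
    rw [e, norm_div, norm_mul, norm_pow, norm_pow, Complex.norm_natCast, Complex.norm_real,
      Real.norm_of_nonneg hs0.le, div_le_iff₀ (by positivity)]
    refine (norm_Ksq_sum_le hN (C := C2 * C * (1 + q) * κ ^ (N + 2 * m + 3))
      fun b hb => ?_).trans ?_
    · obtain ⟨hbm, hbd⟩ := mem_Mn.1 hb
      rw [norm_mul]
      have k1 := h2 b hbm
      have k3 := h (pf b) (pf_prime hbm)
      have k4 : ‖(sv q (pf b) (2 * m + 2 + 1) - q * sv q (pf b) (2 * m + 2)) +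
          q * (sv q (pf b) (2 * m + 1 + 1) - q * sv q (pf b) (2 * m + 1))‖ ≤
          C * c ^ (pf b).card * κ ^ (2 * m + 3) * (1 + q) := by
        refine (norm_add_le _ _).trans ?_
        rw [norm_mul, Complex.norm_natCast]
        have k5 := k3 (2 * m + 2)
        have k6 : ‖sv q (pf b) (2 * m + 1 + 1) - q * sv q (pf b) (2 * m + 1)‖ ≤
            C * c ^ (pf b).card * κ ^ (2 * m + 3) := (k3 (2 * m + 1)).trans
              (mul_le_mul_of_nonneg_left (pow_le_pow_right₀ hκ.le (by omega)) (by positivity))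
        have k7 := mul_le_mul_of_nonneg_left k6 hq0.le
        linarith
      calc _ ≤ ‖d3s b‖ * (C * c ^ (pf b).card * κ ^ (2 * m + 3) * (1 + q)) := by gcongr
        _ = (‖d3s b‖ * c ^ (pf b).card) * (C * κ ^ (2 * m + 3) * (1 + q)) := by ring
        _ ≤ (C2 * κ ^ b.natDegree) * (C * κ ^ (2 * m + 3) * (1 + q)) := by gcongr
        _ = C2 * C * (1 + q) * κ ^ (b.natDegree + (2 * m + 3)) := by rw [pow_add]; ring
        _ ≤ _ := mul_le_mul_of_nonneg_left (pow_le_pow_right₀ hκ.le (by omega)) (by positivity)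
    · have k3 : κ ^ (N + 2 * m + 3) ≤ κ * κ ^ (3 * (N + (m + 1))) := by
        rw [← pow_succ']
        exact pow_le_pow_right₀ hκ.le (by omega)
      have e2 : (C2 * C * (1 + q) * κ + C2) * (κ ^ (3 * (N + (m + 1))) / (q : ℝ) ^ (2 * (m + 1))) *
          ((q : ℝ) ^ (2 * m + 3) * Real.sqrt q ^ N) =
          (C2 * C * (1 + q) * κ + C2) * κ ^ (3 * (N + (m + 1))) * (q * Real.sqrt q ^ N) := by
        rw [show 2 * m + 3 = 2 * (m + 1) + 1 by ring, pow_succ (q : ℝ)]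
        field_simp
      rw [e2]
      calc _ ≤ C2 * C * (1 + q) * (κ * κ ^ (3 * (N + (m + 1)))) * Real.sqrt q ^ N := by gcongr
        _ = (C2 * C * (1 + q) * κ) * κ ^ (3 * (N + (m + 1))) * (1 * Real.sqrt q ^ N) := by ring
        _ ≤ _ := by
            gcongr
            linarith

end

section
variable {q : ℕ} [Fact q.Prime] [hq4 : Fact (q % 4 = 1)]

lemma TE_lf_mul (J : ℕ) {d : ℕ} (hd : 1 ≤ d) {g h : ℕ → ℂ} {c : ℂ} (h0 : g 0 = h 0)
    (hs : ∀ k, g (k + 1) = h (k + 1) + c * g k) :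
    TE J (lf J g d * (1 - C c * X ^ d)) (lf J h d) := by
  have e : lf J g d * (1 - C c * X ^ d) - lf J h d = -(C (c * g J) * X ^ ((J + 1) * d)) := by
    rw [mul_sub, mul_one, lf, lf, Finset.sum_mul]
    have e1 : ∑ k ∈ Finset.range (J + 1), C (g k) * X ^ (k * d) * (C c * X ^ d) =
        ∑ k ∈ Finset.range (J + 1), C (c * g k) * (X : ℂ[X]) ^ ((k + 1) * d) :=
      Finset.sum_congr rfl fun k _ => by rw [C_mul]; ring
    rw [e1, Finset.sum_range_succ', Finset.sum_range_succ (fun k => C (c * g k) * _) J,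
      Finset.sum_range_succ' (fun k => C (h k) * _), h0]
    simp only [hs, C_add, add_mul, Finset.sum_add_distrib]
    ring
  rw [TE, e, dvd_neg]
  exact (pow_dvd_pow X (by nlinarith)).mul_left _

lemma lf_single (J : ℕ) {d : ℕ} {g : ℕ → ℂ} (h : ∀ k, g (k + 1) = 0) : lf J g d = C (g 0) := by
  rw [lf, Finset.sum_range_succ']
  simp [h]

lemma TE_lf_choose (J : ℕ) {d : ℕ} (hd : 1 ≤ d) (c : ℂ) :
    TE J (lf J (fun k => ((k + 2).choose 2 : ℂ) * c ^ k) d * (1 - C c * X ^ d) ^ 3) 1 := by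
  have h1 := TE_lf_mul J hd (g := fun k => ((k + 2).choose 2 : ℂ) * c ^ k)
    (h := fun k => (k + 1 : ℂ) * c ^ k) (c := c) (by simp) (fun k => by
      simp only [choose_two]; push_cast; ring)
  have h2 := TE_lf_mul J hd (g := fun k => (k + 1 : ℂ) * c ^ k)
    (h := fun k => c ^ k) (c := c) (by simp) (fun k => by push_cast; ring)
  have h3 := TE_geom J d c hd
  have e : lf J (fun k => ((k + 2).choose 2 : ℂ) * c ^ k) d * (1 - C c * X ^ d) ^ 3 =
    lf J (fun k => ((k + 2).choose 2 : ℂ) * c ^ k) d * (1 - C c * X ^ d) *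
      (1 - C c * X ^ d) * (1 - C c * X ^ d) := by ring
  rw [e]
  exact (((h1.mul (TE.refl J _)).trans h2).mul (TE.refl J _)).trans h3

/-- The `L`-function of `χ_D` as a polynomial in `q ^ (-s)`, up to degree `J`. -/
def Ldp (J : ℕ) (D : Fqx q) : ℂ[X] :=
  ∑ m ∈ Finset.range (J + 1), C (∑ f ∈ Mn q m, chi q D f) * X ^ m

lemma coeff_Ldp (J : ℕ) (D : Fqx q) {m : ℕ} (hm : m ≤ J) :
    (Ldp J D).coeff m = ∑ f ∈ Mn q m, chi q D f := by
  rw [Ldp, Polynomial.finsetSum_coeff]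
  simp only [coeff_C_mul, coeff_X_pow, mul_ite, mul_one, mul_zero]
  rw [Finset.sum_ite_eq, if_pos (Finset.mem_range.2 (by omega))]

lemma natDegree_Pr_pos {J : ℕ} {P : Fqx q} (hP : P ∈ Pr q J) : 1 ≤ P.natDegree :=
  (mem_Pr.1 hP).2.1.natDegree_pos

lemma sum_d3_chi (D : Fqx q) {N J : ℕ} (hN : N ≤ J) :
    ∑ f ∈ Mn q N, d3 f * chi q D f = (Ldp J D ^ 3).coeff N := by
  have e : ∑ f ∈ Mn q N, d3 f * chi q D f =
      ∑ f ∈ Mn q N, mf (fun P k => ((k + 2).choose 2 : ℂ) * chi q D P ^ k) f :=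
    Finset.sum_congr rfl fun f hf => by
      rw [chi_eq_mf D (mem_Mn.1 hf).1, d3, mf, mf, mf, Finset.prod_mul_distrib]
  rw [e, euler_product _ (fun P => by simp) J N hN]
  refine TE.coeff ?_ hN
  have h1 : TE J (Ldp J D) (∏ P ∈ Pr q J, lf J (fun k => chi q D P ^ k) P.natDegree) := by
    rw [TE_iff]
    intro j hj
    rw [coeff_Ldp J D hj, ← euler_product (fun P k => chi q D P ^ k) (fun P => by simp) J j hj]
    exact Finset.sum_congr rfl fun f hf => chi_eq_mf D (mem_Mn.1 hf).1
  refine TE.trans ?_ (h1.pow 3).symm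
  rw [← Finset.prod_pow]
  refine TE.prod fun P hP => ?_
  have hd := natDegree_Pr_pos hP
  have hc : (((1 : ℂ[X]) - C (chi q D P) * X ^ P.natDegree) ^ 3).coeff 0 ≠ 0 := by
    rw [coeff_zero_eq_eval_zero]
    simp [show P.natDegree ≠ 0 by omega]
  refine TE.cancel hc ((TE_lf_choose J hd _).trans ?_)
  rw [← mul_pow]
  simpa using ((TE_geom J P.natDegree (chi q D P) hd).symm.pow 3)

/-- The normalised `L`-function of `χ_D`. -/
def Ln (g : ℕ) (D : Fqx q) : ℂ[X] := (Ldp (2 * g) D).comp (C (1 / (Real.sqrt q : ℂ)) * X)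

lemma comp_C_mul_X_coeff' (p : ℂ[X]) (r : ℂ) (n : ℕ) :
    (p.comp (C r * X)).coeff n = p.coeff n * r ^ n := comp_C_mul_X_coeff

lemma coeff_Ln {g : ℕ} {D : Fqx q} {m : ℕ} (hm : m ≤ 2 * g) :
    (Ln g D).coeff m = (∑ f ∈ Mn q m, chi q D f) / (Real.sqrt q : ℂ) ^ m := by
  rw [Ln, comp_C_mul_X_coeff', coeff_Ldp _ _ hm, one_div, inv_pow, div_eq_mul_inv]

lemma natDegree_Ldp_le (J : ℕ) (D : Fqx q) : (Ldp J D).natDegree ≤ J :=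
  natDegree_sum_le_of_forall_le _ _ fun m hm =>
    (natDegree_C_mul_X_pow_le _ _).trans (by rw [Finset.mem_range] at hm; omega)

lemma natDegree_Ln_le (g : ℕ) (D : Fqx q) : (Ln g D).natDegree ≤ 2 * g := by
  refine natDegree_comp_le.trans ?_
  refine (Nat.mul_le_mul (natDegree_Ldp_le _ _) 
    (show _ ≤ 1 from (natDegree_C_mul_le _ _).trans natDegree_X_le)).trans (by omega)

lemma sum_chi_eq_XX {D : Fqx q} (hD : D.Monic) (m : ℕ) :
    ∑ f ∈ Mn q m, chi q D f = XX D m :=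
  Finset.sum_congr rfl fun _ hf => chi_recip hD (mem_Mn.1 hf).1

lemma Lp_eq {g : ℕ} {D : Fqx q} (hD : D ∈ Hn q (2 * g + 1)) {J : ℕ} (hJ : 2 * g ≤ J) :
    Ldp J D = Ldp (2 * g) D := by
  obtain ⟨hm, hd, hsq⟩ := mem_Hn.1 hD
  rw [Ldp, Ldp]
  symm
  refine Finset.sum_subset (fun m hm => by rw [Finset.mem_range] at *; omega) fun m _ hm2 => ?_
  rw [Finset.mem_range] at hm2
  rw [sum_chi_eq_XX hm, XX_eq_zero hm hsq (by omega) (by omega), C_0, zero_mul]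

lemma reflect_Ln {g : ℕ} {D : Fqx q} (hD : D ∈ Hn q (2 * g + 1)) :
    reflect (2 * g) (Ln g D) = Ln g D := by
  obtain ⟨hm, hd, hsq⟩ := mem_Hn.1 hD
  ext m
  rw [coeff_reflect]
  rcases le_or_gt m (2 * g) with h | h
  · rw [revAt_le h, coeff_Ln h, coeff_Ln (Nat.sub_le _ _), sum_chi_eq_XX hm, sum_chi_eq_XX hm]
    have hFE := XX_FE_odd hm hsq (r := 2 * g - m) (m := m) (k := g) (by omega) hd
    have hs := sqrt_cast_ne_zero (q := q)
    have hqs := sqrt_cast_sq (q := q)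
    rw [div_eq_div_iff (pow_ne_zero _ hs) (pow_ne_zero _ hs)]
    rw [← hqs, ← pow_mul, ← pow_mul] at hFE
    have e : (Real.sqrt q : ℂ) ^ (2 * g) = (Real.sqrt q : ℂ) ^ (2 * g - m) * (Real.sqrt q : ℂ) ^ m := by
      rw [← pow_add]; congr 1; omega
    rw [e, two_mul m, pow_add, mul_assoc] at hFE
    refine mul_left_cancel₀ (pow_ne_zero m hs) ?_
    linear_combination (-1) * hFE
  · rw [revAt_eq_self_of_lt h]

lemma natDegree_Ln_cube_le (g : ℕ) (D : Fqx q) : (Ln g D ^ 3).natDegree ≤ 6 * g :=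
  natDegree_pow_le.trans (by have := natDegree_Ln_le g D; omega)

lemma reflect_Ln_cube {g : ℕ} {D : Fqx q} (hD : D ∈ Hn q (2 * g + 1)) :
    reflect (6 * g) (Ln g D ^ 3) = Ln g D ^ 3 := by
  have h := natDegree_Ln_le g D
  have h2 : (Ln g D * Ln g D).natDegree ≤ 2 * g + 2 * g :=
    natDegree_mul_le.trans (by omega)
  rw [show 6 * g = 2 * g + 2 * g + 2 * g by ring, pow_succ, pow_two, reflect_mul _ _ h2 h,
    reflect_mul _ _ h h, reflect_Ln hD]

lemma mm_eq_sum (g N : ℕ) :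
    mm q g N = (∑ D ∈ Hn q (2 * g + 1), (Ln g D ^ 3).coeff N) / (q : ℂ) ^ (2 * g + 1) := by
  have h : ∀ D ∈ Hn q (2 * g + 1), ∑ f ∈ Mn q N, d3 f * chi q D f =
      (Ln g D ^ 3).coeff N * (Real.sqrt q : ℂ) ^ N := by
    intro D hD
    have hs := sqrt_cast_ne_zero (q := q)
    rw [sum_d3_chi D (J := 2 * g + N) (by omega), Lp_eq hD (by omega), Ln, ← pow_comp,
      comp_C_mul_X_coeff', mul_assoc, ← mul_pow, one_div_mul_cancel hs, one_pow, mul_one]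
  rw [mm, Kf, Finset.sum_congr rfl h, ← Finset.sum_mul]
  have hs := pow_ne_zero N (sqrt_cast_ne_zero (q := q))
  have hq := q_ne_zero (q := q)
  field_simp

lemma mm_eq_zero {g N : ℕ} (h : 6 * g < N) : mm q g N = 0 := by
  rw [mm_eq_sum, Finset.sum_eq_zero, zero_div]
  exact fun D _ => coeff_eq_zero_of_natDegree_lt ((natDegree_Ln_cube_le g D).trans_lt h)

lemma mm_symm {g N : ℕ} (h : N ≤ 6 * g) : mm q g (6 * g - N) = mm q g N := by
  rw [mm_eq_sum, mm_eq_sum]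
  congr 1
  refine Finset.sum_congr rfl fun D hD => ?_
  conv_rhs => rw [← reflect_Ln_cube hD]
  rw [coeff_reflect, revAt_le h]

lemma sqrt_pow_cast (n : ℕ) : (Real.sqrt ((q : ℝ) ^ n) : ℂ) = (Real.sqrt q : ℂ) ^ n := by
  rw [← Complex.ofReal_pow]
  congr 1
  rw [Real.sqrt_eq_rpow, Real.sqrt_eq_rpow, ← Real.rpow_natCast, ← Real.rpow_natCast,
    ← Real.rpow_mul (by positivity), ← Real.rpow_mul (by positivity), mul_comm]

lemma Lhalf_cube {g : ℕ} {D : Fqx q} (hD : D ∈ Hn q (2 * g + 1)) :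
    Lhalf q D ^ 3 = ∑ N ∈ Finset.range (6 * g + 1), (Ln g D ^ 3).coeff N := by
  have e : Lhalf q D = (Ln g D).eval 1 := by
    rw [Lhalf, (mem_Hn.1 hD).2.1, eval_eq_sum_range' (Nat.lt_succ_of_le (natDegree_Ln_le g D))]
    refine Finset.sum_congr rfl fun m hm => ?_
    rw [coeff_Ln (by rw [Finset.mem_range] at hm; omega), one_pow, mul_one, sumMn_eq, sqrt_pow_cast]
  rw [e, ← eval_pow, eval_eq_sum_range' (Nat.lt_succ_of_le (natDegree_Ln_cube_le g D))]
  simp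

lemma sumH_Lhalf (g : ℕ) : sumH q (2 * g + 1) (fun D => Lhalf q D ^ 3) =
    (q : ℂ) ^ (2 * g + 1) * ∑ N ∈ Finset.range (6 * g + 1), mm q g N := by
  rw [sumH_eq, Finset.sum_congr rfl fun D hD => Lhalf_cube hD, Finset.sum_comm, Finset.mul_sum]
  refine Finset.sum_congr rfl fun N _ => ?_
  rw [mm_eq_sum, mul_div_cancel₀ _ (pow_ne_zero _ q_ne_zero)]

end

section
variable {q : ℕ} [Fact q.Prime] [hq4 : Fact (q % 4 = 1)]

/-- Extension of a double sequence by zero to integral indices. -/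
def ex (u : ℕ → ℕ → ℂ) (g N : ℤ) : ℂ := if 0 ≤ g ∧ 0 ≤ N then u g.toNat N.toNat else 0

lemma ex_natCast (u : ℕ → ℕ → ℂ) (g N : ℕ) : ex u g N = u g N := by simp [ex]

lemma ex_Tk (k : ℕ) (u : ℕ → ℕ → ℂ) (g N : ℤ) :
    ex (Tk k u) g N = ex u g N - ex u (g - 1) (N - 2 * k) := by
  simp only [ex, Tk]
  by_cases h : 0 ≤ g ∧ 0 ≤ N
  · rw [if_pos h, if_pos h]
    congr 1
    by_cases h2 : 1 ≤ g.toNat ∧ 2 * k ≤ N.toNat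
    · rw [if_pos h2, if_pos (by omega)]
      congr 1 <;> omega
    · rw [if_neg h2, if_neg (by omega)]
  · rw [if_neg h, if_neg h, if_neg (by omega), sub_zero]

/-- The double sequence is supported on `N ≤ 6 * g` and symmetric under `N ↦ 6 * g - N`. -/
def Pal (u : ℕ → ℕ → ℂ) : Prop := ∀ g N : ℤ, ex u g (6 * g - N) = ex u g N

lemma Pal.Tk {u : ℕ → ℕ → ℂ} (hu : Pal u) {k l : ℕ} (hkl : k + l = 3) :
    Pal (Tk k (Tk l u)) := by
  intro g N
  have hl : (l : ℤ) = 3 - k := by omega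
  simp only [ex_Tk, hl]
  have h1 := hu g N
  have h2 := hu (g - 1) (N - 2 * k)
  have h3 := hu (g - 1) (N - 2 * (3 - k))
  have h4 := hu (g - 1 - 1) (N - 2 * k - 2 * (3 - k))
  rw [show 6 * (g - 1) - (N - 2 * k) = 6 * g - N - 2 * (3 - k) by ring] at h2
  rw [show 6 * (g - 1) - (N - 2 * (3 - k)) = 6 * g - N - 2 * k by ring] at h3
  rw [show 6 * (g - 1 - 1) - (N - 2 * k - 2 * (3 - k)) = 6 * g - N - 2 * k - 2 * (3 - k) by
    ring] at h4
  rw [h1, h2, h3, h4]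
  ring

lemma Pal.eq_zero {u : ℕ → ℕ → ℂ} (hu : Pal u) {g N : ℕ} (h : 6 * g < N) : u g N = 0 := by
  rw [← ex_natCast u, ← hu, ex, if_neg (by omega)]

lemma Pal.symm {u : ℕ → ℕ → ℂ} (hu : Pal u) {g N : ℕ} (h : N ≤ 6 * g) :
    u g (6 * g - N) = u g N := by
  rw [← ex_natCast u g N, ← ex_natCast u g (6 * g - N), ← hu g N]
  congr 1
  omega

lemma Pal_mm : Pal (mm q) := by
  intro g N
  by_cases hg : 0 ≤ g
  swap
  · simp [ex, hg]
  lift g to ℕ using hg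
  by_cases hN : 0 ≤ N
  swap
  · obtain ⟨M, hM⟩ : ∃ M : ℕ, 6 * (g : ℤ) - N = M := ⟨(6 * (g : ℤ) - N).toNat, by omega⟩
    rw [hM, ex_natCast, mm_eq_zero (by omega), ex, if_neg (by omega)]
  lift N to ℕ using hN
  rw [ex_natCast]
  by_cases h : N ≤ 6 * g
  · rw [← mm_symm h, ← ex_natCast (mm q)]
    congr 1
    omega
  · rw [mm_eq_zero (by omega), ex, if_neg (by omega)]

/-- The partially regularised cubic moment. -/
def vv3 (u : ℕ → ℕ → ℂ) : ℕ → ℕ → ℂ :=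
  Tk 2 (Tk 2 (Tk 2 (Tk 3 (Tk 1 (Tk 1 (Tk 1 u))))))

lemma vv3_add (u v : ℕ → ℕ → ℂ) : vv3 (u + v) = vv3 u + vv3 v := by
  simp only [vv3, Tk_add]

/-- The regularised cubic moment. -/
def hh (q : ℕ) [Fact q.Prime] : ℕ → ℕ → ℂ := Tk 0 (vv3 (mm q))

lemma Bd_hh : Bd q (hh q) := by
  rw [hh, mm_eq, vv3_add, Tk_add]
  refine Bd.add ?_ ?_
  · exact ((((Bd_mns.Tk 3).Tk 2).Tk 2).Tk 2).Tk 0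
  · have e : Tk 0 (vv3 (msq q)) = vv3 (Tk 0 (msq q)) := by
      simp only [vv3, Tk_comm 0]
    rw [e]
    exact ((((((Bd_msq.Tk 1).Tk 1).Tk 1).Tk 3).Tk 2).Tk 2).Tk 2

lemma Pal_hh : Pal (hh q) := by
  have e : hh q = Tk 0 (Tk 3 (Tk 1 (Tk 2 (Tk 1 (Tk 2 (Tk 1 (Tk 2 (mm q)))))))) := by
    simp only [hh, vv3]
    rw [Tk_comm 2 3, Tk_comm 2 3, Tk_comm 2 3, Tk_comm 2 1 (Tk 1 (Tk 1 (mm q))),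
      Tk_comm 2 1 (Tk 1 (mm q)), Tk_comm 2 1 (mm q),
      Tk_comm 2 1 (Tk 1 (Tk 1 (Tk 2 (mm q)))),
      Tk_comm 2 1 (Tk 1 (Tk 2 (mm q))),
      Tk_comm 2 1 (Tk 1 (Tk 2 (Tk 1 (Tk 2 (mm q)))))]
  rw [e]
  exact (((Pal_mm.Tk (k := 1) (l := 2) rfl).Tk (k := 1) (l := 2) rfl).Tk (k := 1) (l := 2) rfl).Tk
    (k := 0) (l := 3) rfl

lemma exists_pow_twelve {κ : ℝ} (hκ : 1 < κ) : ∃ τ : ℝ, 1 < τ ∧ τ ^ 12 = κ :=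
  ⟨κ ^ (1 / 12 : ℝ), Real.one_lt_rpow hκ (by norm_num), by
    rw [← Real.rpow_natCast, ← Real.rpow_mul (by linarith)]; norm_num⟩

lemma exists_hh_le {κ : ℝ} (hκ : 1 < κ) :
    ∃ C : ℝ, 0 ≤ C ∧ ∀ g N : ℕ, ‖hh q g N‖ ≤ C * (κ / Real.sqrt q) ^ g := by
  obtain ⟨τ, hτ, rfl⟩ := exists_pow_twelve hκ
  obtain ⟨C, hC, h⟩ := Bd_hh (q := q) τ hτ
  obtain ⟨hs1, hs2⟩ := sqrt_facts (q := q)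
  have hs0 : 0 < Real.sqrt q := by linarith
  have hτ0 : 0 < τ := by linarith
  have main : ∀ g N : ℕ, N ≤ 3 * g → ‖hh q g N‖ ≤ 2 * C * (τ ^ 12 / Real.sqrt q) ^ g := by
    intro g N hN
    refine (h g N).trans ?_
    have h1 : τ ^ (3 * (N + g)) ≤ τ ^ (12 * g) := pow_le_pow_right₀ hτ.le (by omega)
    have hqr : ∀ r, (q : ℝ) ^ r = Real.sqrt q ^ (2 * r) := fun r => by rw [pow_mul, hs2]
    have h2 : Real.sqrt q ^ N / (q : ℝ) ^ (2 * g) + 1 / (q : ℝ) ^ g ≤ 2 * (1 / Real.sqrt q ^ g) := by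
      have e1 : Real.sqrt q ^ N / (q : ℝ) ^ (2 * g) ≤ 1 / Real.sqrt q ^ g := by
        rw [hqr, div_le_div_iff₀ (by positivity) (by positivity), ← pow_add, one_mul]
        exact pow_le_pow_right₀ hs1 (by omega)
      have e2 : 1 / (q : ℝ) ^ g ≤ 1 / Real.sqrt q ^ g := by
        rw [hqr]
        exact one_div_le_one_div_of_le (by positivity) (pow_le_pow_right₀ hs1 (by omega))
      linarith
    calc _ ≤ C * τ ^ (12 * g) * (2 * (1 / Real.sqrt q ^ g)) := by gcongr
      _ = _ := by rw [div_pow, ← pow_mul]; ring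
  refine ⟨2 * C, by positivity, fun g N => ?_⟩
  rcases le_or_gt N (3 * g) with h1 | h1
  · exact main g N h1
  rcases le_or_gt N (6 * g) with h2 | h2
  · rw [← Pal_hh.symm h2]
    exact main g _ (by omega)
  · rw [Pal_hh.eq_zero h2, norm_zero]
    positivity

end

section
variable {q : ℕ} [Fact q.Prime] [hq4 : Fact (q % 4 = 1)]
open Filter Topology

/-- The sequence of coefficients of `F(x ^ 2)`. -/
def spr (F : PowerSeries ℂ) (N : ℕ) : ℂ := if Even N then PowerSeries.coeff (N / 2) F else 0

lemma spr_mul (k N : ℕ) (F : PowerSeries ℂ) : spr ((1 - PowerSeries.X ^ k) * F) N =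
    spr F N - if 2 * k ≤ N then spr F (N - 2 * k) else 0 := by
  simp only [spr]
  by_cases hN : Even N
  · obtain ⟨m, rfl⟩ := hN
    rw [if_pos ⟨m, rfl⟩, if_pos ⟨m, rfl⟩, sub_mul, one_mul, map_sub, PowerSeries.coeff_X_pow_mul']
    congr 1
    by_cases h : k ≤ m
    · rw [if_pos (by omega), if_pos (by omega), if_pos ⟨m - k, by omega⟩,
        show (m + m - 2 * k) / 2 = (m + m) / 2 - k by omega]
    · rw [if_neg (by omega), if_neg (by omega)]
  · rw [if_neg hN, if_neg hN, zero_sub, eq_comm, neg_eq_zero, ite_eq_right_iff]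
    intro h
    rw [if_neg]
    rw [Nat.even_iff] at *
    omega

lemma spr_smul (c : ℂ) (N : ℕ) (F : PowerSeries ℂ) :
    spr (PowerSeries.C c * F) N = c * spr F N := by
  simp only [spr, PowerSeries.coeff_C_mul, mul_ite, mul_zero]

lemma tendsto_Tk {u : ℕ → ℕ → ℂ} {F : PowerSeries ℂ} (k : ℕ)
    (h : ∀ N, Tendsto (fun g => u g N) atTop (𝓝 (spr F N))) (N : ℕ) :
    Tendsto (fun g => Tk k u g N) atTop (𝓝 (spr ((1 - PowerSeries.X ^ k) * F) N)) := by
  rw [spr_mul]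
  refine (h N).sub ?_
  split_ifs with hk
  · have h1 : Tendsto (fun g => u (g - 1) (N - 2 * k)) atTop (𝓝 (spr F (N - 2 * k))) :=
      (h (N - 2 * k)).comp (tendsto_sub_atTop_nat 1)
    refine h1.congr' ?_
    filter_upwards [eventually_ge_atTop 1] with g hg
    rw [if_pos ⟨hg, hk⟩]
  · simp [hk]

lemma Bd.tendsto {u : ℕ → ℕ → ℂ} (hu : Bd q u) (N : ℕ) :
    Tendsto (fun g => u g N) atTop (𝓝 0) := by
  obtain ⟨C, hC, h⟩ := hu (3 / 2) (by norm_num)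
  obtain ⟨hs1, hs2⟩ := sqrt_facts (q := q)
  have hq5 : (5 : ℝ) ≤ q := by exact_mod_cast q_ge_five (q := q)
  refine squeeze_zero_norm (a := fun g => C * (3 / 2) ^ (3 * N) * (Real.sqrt q ^ N + 1) *
    (27 / 40 : ℝ) ^ g) (fun g => (h g N).trans ?_) ?_
  · have e1 : Real.sqrt q ^ N / (q : ℝ) ^ (2 * g) + 1 / (q : ℝ) ^ g ≤
        (Real.sqrt q ^ N + 1) * (1 / 5 : ℝ) ^ g := by
      have a1 : 1 / (q : ℝ) ^ g ≤ (1 / 5 : ℝ) ^ g := by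
        rw [one_div_pow]
        exact one_div_le_one_div_of_le (by positivity) (by gcongr)
      have a2 : 1 / (q : ℝ) ^ (2 * g) ≤ 1 / (q : ℝ) ^ g :=
        one_div_le_one_div_of_le (by positivity) (pow_le_pow_right₀ (by linarith) (by omega))
      rw [add_mul, one_mul, div_eq_mul_one_div]
      exact add_le_add (mul_le_mul_of_nonneg_left (a2.trans a1) (by positivity)) a1
    calc _ ≤ C * (3 / 2) ^ (3 * (N + g)) * ((Real.sqrt q ^ N + 1) * (1 / 5 : ℝ) ^ g) := by gcongr
      _ = C * (3 / 2) ^ (3 * N) * (Real.sqrt q ^ N + 1) * ((3 / 2) ^ 3 * (1 / 5) : ℝ) ^ g := by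
        rw [mul_add, pow_add, pow_mul _ 3 g, mul_pow]; ring
      _ = _ := by norm_num
  · simpa using (tendsto_pow_atTop_nhds_zero_of_lt_one (r := (27 / 40 : ℝ)) (by norm_num)
      (by norm_num)).const_mul (C * (3 / 2) ^ (3 * N) * (Real.sqrt q ^ N + 1))

/-- The generating series of the limits of the square contributions. -/
def RR (q : ℕ) [Fact q.Prime] : PowerSeries ℂ := PowerSeries.mk fun j => rr q (2 * j)

lemma spr_RR (N : ℕ) : spr (RR q) N = rr q N := by
  rw [spr, RR, PowerSeries.coeff_mk]
  split_ifs with h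
  · rw [Nat.mul_div_cancel' h.two_dvd]
  · rw [rr, if_neg h]

/-- The generating series of the limits of the regularised square contributions. -/
def AA (q : ℕ) [Fact q.Prime] : PowerSeries ℂ := (1 - PowerSeries.X) ^ 6 * RR q

lemma tendsto_vv3 (N : ℕ) : Tendsto (fun g => vv3 (mm q) g N) atTop
    (𝓝 (spr (PowerSeries.C (1 - 1 / (q : ℂ)) * ((1 - PowerSeries.X ^ 3) *
      ((1 + PowerSeries.X) ^ 3 * AA q))) N)) := by
  rw [mm_eq, vv3_add]
  have h0 : ∀ N, Tendsto (fun g => msq q g N) atTop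
      (𝓝 (spr (PowerSeries.C (1 - 1 / (q : ℂ)) * RR q) N)) := fun N => by
    rw [spr_smul, spr_RR]
    exact tendsto_msq N
  have h1 : Tendsto (fun g => vv3 (mns q) g N) atTop (𝓝 0) :=
    ((((Bd_mns.Tk 3).Tk 2).Tk 2).Tk 2).tendsto N
  have h2 := tendsto_Tk 2 (tendsto_Tk 2 (tendsto_Tk 2 (tendsto_Tk 3 (tendsto_Tk 1 (tendsto_Tk 1
    (tendsto_Tk 1 h0)))))) N
  convert h1.add h2 using 2
  · rfl
  · rw [zero_add, AA]
    congr 1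
    ring

lemma sum_hh (G N : ℕ) : ∑ g ∈ Finset.range (G + 1), hh q g N = vv3 (mm q) G N := by
  induction G with
  | zero => simp [hh, Tk]
  | succ G ih =>
    rw [Finset.sum_range_succ, ih, hh, Tk, if_pos (by omega)]
    simp

end

section
variable {q : ℕ} [Fact q.Prime] [hq4 : Fact (q % 4 = 1)]
open Filter Topology

/-- The local factor of the arithmetic series at a prime of degree `d`. -/
def aPol (q d : ℕ) : ℂ[X] :=
  (C (1 + 1 / (q : ℂ) ^ d)⁻¹ * (1 + 3 * X ^ d) +
    C (1 - (1 + 1 / (q : ℂ) ^ d)⁻¹) * (1 - X ^ d) ^ 3) * (1 - X ^ d) ^ 3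

/-- The local coefficients of the main term. -/
def gP (q d : ℕ) (k : ℕ) : ℂ :=
  (1 + 1 / (q : ℂ) ^ d)⁻¹ * ((k + 1) * (2 * k + 1)) +
    (1 - (1 + 1 / (q : ℂ) ^ d)⁻¹) * if k = 0 then 1 else 0

lemma lf_linear (J d : ℕ) (a b : ℂ) (g h : ℕ → ℂ) :
    lf J (fun k => a * g k + b * h k) d = C a * lf J g d + C b * lf J h d := by
  simp only [lf, Finset.mul_sum, ← Finset.sum_add_distrib, C_add, C_mul, add_mul, mul_assoc]

lemma TE_lf_d3s (J : ℕ) {d : ℕ} (hd : 1 ≤ d) :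
    TE J (lf J (fun k => ((k + 1) * (2 * k + 1) : ℂ)) d * (1 - X ^ d) ^ 3) (1 + 3 * X ^ d) := by
  have h1 := TE_lf_mul J hd (g := fun k => ((k + 1) * (2 * k + 1) : ℂ))
    (h := fun k => (4 * k + 1 : ℂ)) (c := 1) (by simp) (fun k => by push_cast; ring)
  have h2 := TE_lf_mul J hd (g := fun k => (4 * k + 1 : ℂ))
    (h := fun k => if k = 0 then 1 else 4) (c := 1) (by simp) (fun k => by simp; ring)
  have h3 := TE_lf_mul J hd (g := fun k => if k = 0 then (1 : ℂ) else 4)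
    (h := fun k => if k = 0 then 1 else if k = 1 then 3 else 0) (c := 1) (by simp) (fun k => by
      rcases k with _ | k
      · norm_num
      · simp)
  have h4 : TE J (lf J (fun k => if k = 0 then 1 else if k = 1 then 3 else 0) d) (1 + 3 * X ^ d) := by
    rw [lf, Finset.sum_range_succ', TE]
    rcases J with _ | J
    · simp only [Finset.range_zero, Finset.sum_empty, zero_add, if_true, zero_mul, pow_zero, mul_one,
        C_1, sub_add_cancel_left, pow_one, dvd_neg]
      exact (dvd_pow_self X (by omega)).mul_left _
    · rw [Finset.sum_range_succ']
      simp [show (C 3 : ℂ[X]) = 3 from rfl, add_comm]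
  simp only [C_1, one_mul] at h1 h2 h3
  have e : lf J (fun k => ((k + 1) * (2 * k + 1) : ℂ)) d * (1 - X ^ d) ^ 3 =
    lf J (fun k => ((k + 1) * (2 * k + 1) : ℂ)) d * (1 - X ^ d) * (1 - X ^ d) * (1 - X ^ d) := by
    ring
  rw [e]
  exact ((((h1.mul (TE.refl J _)).trans h2).mul (TE.refl J _)).trans h3).trans h4

lemma TE_lf_gP (J : ℕ) {d : ℕ} (hd : 1 ≤ d) :
    TE J (lf J (gP q d) d * (1 - X ^ d) ^ 6) (aPol q d) := by
  have e1 : lf J (fun k => if k = 0 then (1 : ℂ) else 0) d = 1 := by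
    rw [lf_single J (fun k => if_neg (Nat.succ_ne_zero k)), if_pos rfl, C_1]
  have e : lf J (gP q d) d * (1 - X ^ d) ^ 6 = (C (1 + 1 / (q : ℂ) ^ d)⁻¹ *
      (lf J (fun k => ((k + 1) * (2 * k + 1) : ℂ)) d * (1 - X ^ d) ^ 3) +
      C (1 - (1 + 1 / (q : ℂ) ^ d)⁻¹) * (1 - X ^ d) ^ 3) * (1 - X ^ d) ^ 3 := by
    unfold gP
    rw [lf_linear, e1]
    ring
  rw [e, aPol]
  exact (((TE.refl J _).mul (TE_lf_d3s J hd)).add (TE.refl J _)).mul (TE.refl J _)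

/-- The truncated Euler product of the arithmetic series. -/
def prodA (q : ℕ) [Fact q.Prime] (J : ℕ) : ℂ[X] := ∏ P ∈ Pr q J, aPol q P.natDegree

lemma TE_prodA (J : ℕ) :
    TE J ((1 - C (q : ℂ) * X) ^ 6 * ∏ P ∈ Pr q J, lf J (gP q P.natDegree) P.natDegree)
      (prodA q J) := by
  refine (((TE_zeta (q := q) J).symm.pow 6).mul (TE.refl J _)).trans ?_
  rw [mul_comm, ← Finset.prod_pow, ← Finset.prod_mul_distrib]
  exact TE.prod fun P hP => TE_lf_gP J (natDegree_Pr_pos hP)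

lemma coeff_RR (j : ℕ) : PowerSeries.coeff j (RR q) =
    (1 / (q : ℂ)) ^ j * ∑ b ∈ Mn q j, mf (fun P k => gP q P.natDegree k) b := by
  rw [RR, PowerSeries.coeff_mk, rr, if_pos (even_two_mul j), Nat.mul_div_cancel_left j (by norm_num),
    pow_mul, sqrt_cast_sq, div_eq_mul_inv, mul_comm, one_div, inv_pow]
  congr 1
  refine Finset.sum_congr rfl fun b hb => ?_
  rw [d3s, mf, mf, ← Finset.prod_mul_distrib]
  refine Finset.prod_congr rfl fun P hP => ?_
  have hv : vv P b ≠ 0 := by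
    have := vv_pos hP
    omega
  rw [gP, if_neg hv]
  ring

lemma coeff_AA {j J : ℕ} (hj : j ≤ J) :
    PowerSeries.coeff j (AA q) = (1 / (q : ℂ)) ^ j * (prodA q J).coeff j := by
  have hq := q_ne_zero (q := q)
  set S : PowerSeries ℂ := PowerSeries.mk fun j => ∑ b ∈ Mn q j, mf (fun P k => gP q P.natDegree k) b
    with hS
  have e1 : RR q = PowerSeries.rescale (1 / (q : ℂ)) S := by
    ext j
    rw [coeff_RR, PowerSeries.coeff_rescale, hS, PowerSeries.coeff_mk]
  have e3 : PowerSeries.rescale (1 / (q : ℂ)) (PowerSeries.C (q : ℂ)) = PowerSeries.C (q : ℂ) := by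
    rw [PowerSeries.C_eq_algebraMap]
    ext n
    simp
  have e2 : (1 - PowerSeries.X : PowerSeries ℂ) ^ 6 = PowerSeries.rescale (1 / (q : ℂ))
      (((1 - C (q : ℂ) * X) ^ 6 : ℂ[X]) : PowerSeries ℂ) := by
    simp only [Polynomial.coe_pow, Polynomial.coe_sub, Polynomial.coe_one, Polynomial.coe_mul,
      Polynomial.coe_C, Polynomial.coe_X, map_pow, map_sub, map_one, map_mul, PowerSeries.rescale_X,
      e3]
    rw [← mul_assoc, ← map_mul, mul_one_div_cancel hq, map_one, one_mul]
  rw [AA, e1, e2, ← map_mul, PowerSeries.coeff_rescale]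
  congr 1
  rw [← (TE_prodA J).coeff hj, ← Polynomial.coeff_coe, Polynomial.coe_mul, PowerSeries.coeff_mul,
    PowerSeries.coeff_mul]
  refine Finset.sum_congr rfl fun x hx => ?_
  congr 1
  have hx' : x.1 + x.2 = j := Finset.HasAntidiagonal.mem_antidiagonal.1 hx
  rw [Polynomial.coeff_coe, hS, PowerSeries.coeff_mk, euler_product (fun P k => gP q P.natDegree k)
    (fun P => by simp [gP]) J _ (by omega)]

/-- The deviation of the local factor from one. -/
def wA (p Y : ℂ) : ℂ := (p * (-6 * Y ^ 2 + 8 * Y ^ 3 - 3 * Y ^ 4) + ((1 - Y) ^ 6 - 1)) / (p + 1)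

lemma q_pow_add_one_ne (d : ℕ) : (q : ℂ) ^ d + 1 ≠ 0 := by
  exact_mod_cast (Nat.succ_ne_zero (q ^ d))

lemma eval_aPol (d : ℕ) (z : ℂ) : (aPol q d).eval z = 1 + wA ((q : ℂ) ^ d) (z ^ d) := by
  have hq := pow_ne_zero d (q_ne_zero (q := q))
  have h1 := q_pow_add_one_ne (q := q) d
  have hw : (1 + 1 / (q : ℂ) ^ d)⁻¹ = (q : ℂ) ^ d / ((q : ℂ) ^ d + 1) := by
    field_simp
  simp only [aPol, hw, wA, eval_mul, eval_add, eval_C, eval_one, eval_sub, eval_pow, eval_X]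
  rw [show (3 : ℂ[X]) = C 3 from rfl, eval_C]
  field_simp
  ring

lemma norm_wA_le {p : ℝ} (hp : 1 ≤ p) {Y : ℂ} (hY : ‖Y‖ ≤ 1) :
    ‖wA p Y‖ ≤ 17 * ‖Y‖ ^ 2 + 63 * (‖Y‖ / p) := by
  have hp0 : 0 < p := by linarith
  have e : (p : ℂ) + 1 = ((p + 1 : ℝ) : ℂ) := by push_cast; rfl
  rw [wA, e, norm_div, Complex.norm_real, Real.norm_of_nonneg (by linarith)]
  set y := ‖Y‖
  have hy0 : 0 ≤ y := norm_nonneg _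
  have hpow : ∀ k, y ^ k ≤ 1 := fun k => pow_le_one₀ hy0 hY
  have a1 : ‖-6 * Y ^ 2 + 8 * Y ^ 3 - 3 * Y ^ 4‖ ≤ 17 * y ^ 2 := by
    have : -6 * Y ^ 2 + 8 * Y ^ 3 - 3 * Y ^ 4 = Y ^ 2 * (-6 + 8 * Y - 3 * Y ^ 2) := by ring
    rw [this, norm_mul, norm_pow, mul_comm]
    refine mul_le_mul_of_nonneg_right ?_ (by positivity)
    refine (norm_sub_le _ _).trans ?_
    refine (add_le_add_left (norm_add_le _ _) _).trans ?_
    rw [norm_mul, norm_mul, norm_pow, norm_neg]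
    simp only [Complex.norm_ofNat]
    have := hpow 2
    linarith
  have a2 : ‖(1 - Y) ^ 6 - 1‖ ≤ 63 * y := by
    have : (1 - Y) ^ 6 - 1 = Y * (-6 + (15 * Y + (-20 * Y ^ 2 + (15 * Y ^ 3 + (-6 * Y ^ 4 + Y ^ 5))))) := by
      ring
    rw [this, norm_mul, mul_comm]
    refine mul_le_mul_of_nonneg_right ?_ hy0
    refine (norm_add_le _ _).trans ?_
    have b1 := norm_add_le (15 * Y) (-20 * Y ^ 2 + (15 * Y ^ 3 + (-6 * Y ^ 4 + Y ^ 5)))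
    have b2 := norm_add_le (-20 * Y ^ 2) (15 * Y ^ 3 + (-6 * Y ^ 4 + Y ^ 5))
    have b3 := norm_add_le (15 * Y ^ 3) (-6 * Y ^ 4 + Y ^ 5)
    have b4 := norm_add_le (-6 * Y ^ 4) (Y ^ 5)
    simp only [norm_mul, norm_pow, norm_neg, Complex.norm_ofNat] at b1 b2 b3 b4 ⊢
    have c1 := hpow 2
    have c2 := hpow 3
    have c3 := hpow 4
    have c4 := hpow 5
    linarith
  rw [div_le_iff₀ (by linarith)]
  refine (norm_add_le _ _).trans ?_
  rw [norm_mul, Complex.norm_real, Real.norm_of_nonneg hp0.le]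
  have a3 : p * ‖-6 * Y ^ 2 + 8 * Y ^ 3 - 3 * Y ^ 4‖ ≤ p * (17 * y ^ 2) :=
    mul_le_mul_of_nonneg_left a1 hp0.le
  have a4 : 63 * (y / p) * p = 63 * y := by field_simp
  have a5 : 0 ≤ 63 * (y / p) := by positivity
  nlinarith [sq_nonneg y]

lemma norm_wA_pow_le {d : ℕ} {z : ℂ} (hz : ‖z‖ ≤ 1) : ‖wA ((q : ℂ) ^ d) (z ^ d)‖ ≤
    17 * (‖z‖ ^ 2) ^ d + 63 * (‖z‖ / q) ^ d := by
  have hq1 : (1 : ℝ) ≤ q := by exact_mod_cast (Fact.out : q.Prime).one_lt.le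
  have h := norm_wA_le (one_le_pow₀ hq1 (n := d)) (Y := z ^ d) (by
    rw [norm_pow]; exact pow_le_one₀ (norm_nonneg _) hz)
  push_cast at h
  rw [norm_pow, ← div_pow, ← pow_mul, mul_comm d, pow_mul] at h
  exact h

end

section
variable {q : ℕ} [Fact q.Prime] [hq4 : Fact (q % 4 = 1)]
open Filter Topology

lemma eval_prodA (J : ℕ) (z : ℂ) : (prodA q J).eval z =
    ∏ P ∈ Pr q J, (1 + wA ((q : ℂ) ^ P.natDegree) (z ^ P.natDegree)) := by
  rw [prodA, eval_prod]
  exact Finset.prod_congr rfl fun P _ => eval_aPol _ _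

lemma two_lt_sqrt : 2 < Real.sqrt q := by
  have hq5 : (5 : ℝ) ≤ q := by exact_mod_cast q_ge_five (q := q)
  rw [Real.lt_sqrt (by norm_num)]
  linarith

lemma sum_wA_le (J : ℕ) {z : ℂ} (hz : ‖z‖ ≤ 1 / (2 * Real.sqrt q)) :
    ∑ P ∈ Pr q J, ‖wA ((q : ℂ) ^ P.natDegree) (z ^ P.natDegree)‖ ≤ 149 := by
  obtain ⟨hs1, hs2⟩ := sqrt_facts (q := q)
  have hs := two_lt_sqrt (q := q)
  have hq1 : (1 : ℝ) ≤ q := by exact_mod_cast (Fact.out : q.Prime).one_lt.le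
  have hz4 : ‖z‖ ≤ 1 / 4 := hz.trans (one_div_le_one_div_of_le (by norm_num) (by linarith))
  have hz0 := norm_nonneg z
  have h1 : q * (‖z‖ ^ 2) ≤ 1 / 4 := by
    have : ‖z‖ * (2 * Real.sqrt q) ≤ 1 := by rwa [le_div_iff₀ (by linarith)] at hz
    have h2 : (‖z‖ * (2 * Real.sqrt q)) ^ 2 ≤ 1 := pow_le_one₀ (by positivity) this
    rw [mul_pow, mul_pow, hs2] at h2
    linarith
  have h2 : q * (‖z‖ / q) ≤ 1 / 4 := by
    rw [mul_div_cancel₀ _ (by linarith)]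
    exact hz4
  have s1 := sum_Pr_pow_le (q := q) (θ := ‖z‖ ^ 2) (by positivity) (by linarith) J
  have s2 := sum_Pr_pow_le (q := q) (θ := ‖z‖ / q) (by positivity) (by linarith) J
  have t1 : 1 / (1 - q * (‖z‖ ^ 2)) ≤ 4 / 3 := by
    rw [div_le_div_iff₀ (by linarith) (by norm_num)]; linarith
  have t2 : 1 / (1 - q * (‖z‖ / q)) ≤ 4 / 3 := by
    rw [div_le_div_iff₀ (by linarith) (by norm_num)]; linarith
  refine (Finset.sum_le_sum fun P _ => norm_wA_pow_le (by linarith)).trans ?_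
  rw [Finset.sum_add_distrib, ← Finset.mul_sum, ← Finset.mul_sum]
  linarith

lemma norm_coeff_prodA_le (J j : ℕ) :
    ‖(prodA q J).coeff j‖ ≤ Real.exp 149 * (2 * Real.sqrt q) ^ j := by
  have hs := two_lt_sqrt (q := q)
  refine le_of_mul_inv_pow_le (by linarith) j (norm_coeff_mul_le _ j (by positivity) fun z hz => ?_)
  rw [eval_prodA]
  exact (norm_prod_one_add_le_exp' _ _).trans (Real.exp_le_exp.2 (sum_wA_le J hz.le))

lemma norm_coeff_prodA_mul_le (J j : ℕ) :
    ‖(1 / (q : ℂ)) ^ j * (prodA q J).coeff j‖ ≤ Real.exp 149 * (2 / Real.sqrt q) ^ j := by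
  obtain ⟨hs1, hs2⟩ := sqrt_facts (q := q)
  have hs0 : Real.sqrt q ≠ 0 := by linarith
  have e : (2 / Real.sqrt q) = 1 / q * (2 * Real.sqrt q) := by
    have hq0 : (q : ℝ) ≠ 0 := by rw [← hs2]; positivity
    field_simp
    exact hs2.symm
  rw [norm_mul, norm_pow, norm_div, norm_one, Complex.norm_natCast, e, mul_pow, mul_left_comm]
  exact mul_le_mul_of_nonneg_left (norm_coeff_prodA_le J j) (by positivity)

lemma norm_coeff_AA_le (j : ℕ) :
    ‖PowerSeries.coeff j (AA q)‖ ≤ Real.exp 149 * (2 / Real.sqrt q) ^ j := by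
  rw [coeff_AA le_rfl]
  exact norm_coeff_prodA_mul_le j j

lemma two_div_sqrt : 0 ≤ 2 / Real.sqrt q ∧ 2 / Real.sqrt q < 1 := by
  have hs := two_lt_sqrt (q := q)
  exact ⟨by positivity, by rw [div_lt_one (by linarith)]; exact hs⟩

/-- The arithmetic factor of the leading coefficient. -/
def A3 (q : ℕ) [Fact q.Prime] : ℂ := ∏' P : MIrr q,
  (1 - (12 * nm q P.1 ^ 5 - 23 * nm q P.1 ^ 4 + 23 * nm q P.1 ^ 3
    - 15 * nm q P.1 ^ 2 + 6 * nm q P.1 - 1) / (nm q P.1 ^ 6 * (nm q P.1 + 1)))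

lemma one_add_wA (d : ℕ) : 1 - (12 * ((q : ℂ) ^ d) ^ 5 - 23 * ((q : ℂ) ^ d) ^ 4 +
    23 * ((q : ℂ) ^ d) ^ 3 - 15 * ((q : ℂ) ^ d) ^ 2 + 6 * (q : ℂ) ^ d - 1) /
      (((q : ℂ) ^ d) ^ 6 * ((q : ℂ) ^ d + 1)) = 1 + wA ((q : ℂ) ^ d) ((1 / (q : ℂ)) ^ d) := by
  have hq := pow_ne_zero d (q_ne_zero (q := q))
  have h1 := q_pow_add_one_ne (q := q) d
  rw [wA, one_div_pow]
  generalize (q : ℂ) ^ d = p at *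
  field_simp
  ring

lemma A3_eq : A3 q = ∏' P : MIrr q,
    (1 + wA ((q : ℂ) ^ P.1.natDegree) ((1 / (q : ℂ)) ^ P.1.natDegree)) := by
  rw [A3]
  exact tprod_congr fun _ => one_add_wA _

lemma norm_one_div_q : ‖1 / (q : ℂ)‖ ≤ 1 / (2 * Real.sqrt q) := by
  obtain ⟨hs1, hs2⟩ := sqrt_facts (q := q)
  have hs := two_lt_sqrt (q := q)
  rw [norm_div, norm_one, Complex.norm_natCast]
  refine one_div_le_one_div_of_le (by linarith) ?_
  nlinarith

/-- The primes of degree at most `J`, as a finite subset of the type of primes. -/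
def PrI (q : ℕ) [Fact q.Prime] (J : ℕ) : Finset (MIrr q) :=
  (Pr q J).subtype fun P => P.Monic ∧ Irreducible P

lemma sum_PrI (J : ℕ) (F : Fqx q → ℝ) : ∑ P ∈ PrI q J, F P.1 = ∑ P ∈ Pr q J, F P :=
  Finset.sum_subtype_of_mem F fun _ hP => ⟨(mem_Pr.1 hP).1, (mem_Pr.1 hP).2.1⟩

lemma prod_PrI (J : ℕ) (F : Fqx q → ℂ) : ∏ P ∈ PrI q J, F P.1 = ∏ P ∈ Pr q J, F P :=
  Finset.prod_subtype_of_mem F fun _ hP => ⟨(mem_Pr.1 hP).1, (mem_Pr.1 hP).2.1⟩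

lemma mem_PrI {J : ℕ} {P : MIrr q} : P ∈ PrI q J ↔ P.1.natDegree ≤ J := by
  rw [PrI, Finset.mem_subtype, mem_Pr]
  exact ⟨fun h => h.2.2, fun h => ⟨P.2.1, P.2.2, h⟩⟩

lemma tendsto_PrI : Tendsto (PrI q) atTop atTop :=
  tendsto_atTop_finset_of_monotone (fun _ _ h _ hP => mem_PrI.2 ((mem_PrI.1 hP).trans h))
    fun P => ⟨P.1.natDegree, mem_PrI.2 le_rfl⟩

lemma summable_wA : Summable fun P : MIrr q =>
    ‖wA ((q : ℂ) ^ P.1.natDegree) ((1 / (q : ℂ)) ^ P.1.natDegree)‖ := by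
  refine summable_of_sum_le (c := 149) (fun _ => norm_nonneg _) fun u => ?_
  refine le_trans ?_ (sum_wA_le (q := q) (u.sup fun P => P.1.natDegree) norm_one_div_q)
  rw [← sum_PrI _ (fun P => ‖wA ((q : ℂ) ^ P.natDegree) ((1 / (q : ℂ)) ^ P.natDegree)‖)]
  exact Finset.sum_le_sum_of_subset_of_nonneg
    (fun P hP => mem_PrI.2 (Finset.le_sup (f := fun P : MIrr q => P.1.natDegree) hP))
    fun _ _ _ => norm_nonneg _

lemma one_add_wA_ne_zero {d : ℕ} (hd : 1 ≤ d) :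
    1 + wA ((q : ℂ) ^ d) ((1 / (q : ℂ)) ^ d) ≠ 0 := by
  have hq1 : (1 : ℝ) < q := by exact_mod_cast (Fact.out : q.Prime).one_lt
  have hp : (1 : ℝ) < (q : ℝ) ^ d := one_lt_pow₀ hq1 (by omega)
  have e : 1 + wA ((q : ℂ) ^ d) ((1 / (q : ℂ)) ^ d) =
      (((q : ℝ) ^ d * ((1 - 1 / (q : ℝ) ^ d) ^ 3 * (1 + 3 * (1 / (q : ℝ) ^ d))) +
        (1 - 1 / (q : ℝ) ^ d) ^ 6) / ((q : ℝ) ^ d + 1) : ℝ) := by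
    have h1 := q_pow_add_one_ne (q := q) d
    have hq := pow_ne_zero d (q_ne_zero (q := q))
    rw [wA, one_div_pow]
    push_cast
    generalize (q : ℂ) ^ d = p at *
    field_simp
    ring
  rw [e, Complex.ofReal_ne_zero]
  have h1 : 1 / (q : ℝ) ^ d < 1 := by rw [div_lt_one (by linarith)]; exact hp
  have h2 : 0 < 1 - 1 / (q : ℝ) ^ d := by linarith
  have : 0 < (q : ℝ) ^ d := by linarith
  positivity

lemma A3_ne_zero : A3 q ≠ 0 := by
  rw [A3_eq]
  exact tprod_one_add_ne_zero_of_summable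
    (fun P => one_add_wA_ne_zero P.2.2.natDegree_pos) summable_wA

lemma tendsto_prodA : Tendsto (fun J => (prodA q J).eval (1 / (q : ℂ))) atTop (𝓝 (A3 q)) := by
  have h := (multipliable_one_add_of_summable (summable_wA (q := q))).hasProd
  rw [← A3_eq] at h
  refine (h.comp tendsto_PrI).congr fun J => ?_
  rw [eval_prodA]
  exact prod_PrI J (fun P => 1 + wA ((q : ℂ) ^ P.natDegree) ((1 / (q : ℂ)) ^ P.natDegree))

lemma summable_AA : Summable fun j => ‖PowerSeries.coeff j (AA q)‖ := by
  obtain ⟨h0, h1⟩ := two_div_sqrt (q := q)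
  exact ((summable_geometric_of_lt_one h0 h1).mul_left (Real.exp 149)).of_nonneg_of_le
    (fun _ => norm_nonneg _) norm_coeff_AA_le

lemma summable_mul_AA : Summable fun j : ℕ => (j : ℂ) * PowerSeries.coeff j (AA q) := by
  obtain ⟨h0, h1⟩ := two_div_sqrt (q := q)
  have h := summable_pow_mul_geometric_of_norm_lt_one 1 (r := 2 / Real.sqrt q)
    (by rwa [Real.norm_of_nonneg h0])
  refine Summable.of_norm_bounded (h.mul_left (Real.exp 149)) fun j => ?_
  rw [norm_mul, Complex.norm_natCast, pow_one, mul_left_comm]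
  exact mul_le_mul_of_nonneg_left (norm_coeff_AA_le j) (by positivity)

lemma eval_prodA_sub_le (J : ℕ) : ‖(prodA q J).eval (1 / (q : ℂ)) -
    ∑ j ∈ Finset.range (J + 1), PowerSeries.coeff j (AA q)‖ ≤
    Real.exp 149 * ((2 / Real.sqrt q) ^ (J + 1) * (1 - 2 / Real.sqrt q)⁻¹) := by
  obtain ⟨h0, h1⟩ := two_div_sqrt (q := q)
  set r := 2 / Real.sqrt q
  set M := (prodA q J).natDegree
  rw [eval_eq_sum_range' (n := J + 1 + (M + 1)) (by omega), Finset.sum_range_add]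
  have e : ∑ j ∈ Finset.range (J + 1), (prodA q J).coeff j * (1 / (q : ℂ)) ^ j =
      ∑ j ∈ Finset.range (J + 1), PowerSeries.coeff j (AA q) :=
    Finset.sum_congr rfl fun j hj => by
      rw [coeff_AA (Nat.lt_succ_iff.1 (Finset.mem_range.1 hj)), mul_comm]
  rw [e, add_sub_cancel_left]
  refine (norm_sum_le _ _).trans ?_
  refine (Finset.sum_le_sum (g := fun i => Real.exp 149 * (r ^ (J + 1) * r ^ i)) fun i _ => ?_).trans ?_
  · rw [mul_comm, ← pow_add]
    exact norm_coeff_prodA_mul_le J _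
  · rw [← Finset.mul_sum, ← Finset.mul_sum]
    refine mul_le_mul_of_nonneg_left (mul_le_mul_of_nonneg_left ?_ (by positivity)) (by positivity)
    rw [← tsum_geometric_of_lt_one h0 h1]
    exact (summable_geometric_of_lt_one h0 h1).sum_le_tsum _ (fun _ _ => by positivity)

lemma hasSum_AA : HasSum (fun j => PowerSeries.coeff j (AA q)) (A3 q) := by
  obtain ⟨h0, h1⟩ := two_div_sqrt (q := q)
  rw [(summable_AA (q := q)).of_norm.hasSum_iff_tendsto_nat, ← tendsto_add_atTop_iff_nat 1]
  have h2 : Tendsto (fun J => (prodA q J).eval (1 / (q : ℂ)) -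
      ∑ j ∈ Finset.range (J + 1), PowerSeries.coeff j (AA q)) atTop (𝓝 0) := by
    refine squeeze_zero_norm (fun J => eval_prodA_sub_le (q := q) J) ?_
    simpa using (((tendsto_pow_atTop_nhds_zero_of_lt_one h0 h1).comp
      (tendsto_add_atTop_nat 1)).mul_const (1 - 2 / Real.sqrt q)⁻¹).const_mul (Real.exp 149)
  simpa using (tendsto_prodA (q := q)).sub h2

end

section
variable {q : ℕ} [Fact q.Prime] [hq4 : Fact (q % 4 = 1)]
open Filter Topology

/-- The power series `F` converges at `1`, with value `s₀` and derivative `s₁`. -/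
def Mom (F : PowerSeries ℂ) (s₀ s₁ : ℂ) : Prop :=
  HasSum (fun j => PowerSeries.coeff j F) s₀ ∧
    HasSum (fun j : ℕ => (j : ℂ) * PowerSeries.coeff j F) s₁

lemma Mom.add {F F' : PowerSeries ℂ} {a b a' b' : ℂ} (h : Mom F a b) (h' : Mom F' a' b') :
    Mom (F + F') (a + a') (b + b') := by
  refine ⟨by simpa using h.1.add h'.1, ?_⟩
  simpa [mul_add] using h.2.add h'.2

lemma Mom.C_mul {F : PowerSeries ℂ} {a b : ℂ} (c : ℂ) (h : Mom F a b) :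
    Mom (PowerSeries.C c * F) (c * a) (c * b) := by
  refine ⟨by simpa using h.1.mul_left c, ?_⟩
  simpa [mul_left_comm] using h.2.mul_left c

lemma Mom.X_pow_mul {F : PowerSeries ℂ} {a b : ℂ} (k : ℕ) (h : Mom F a b) :
    Mom (PowerSeries.X ^ k * F) a (b + k * a) := by
  have hi : Function.Injective (fun j : ℕ => j + k) := add_left_injective k
  have hz : ∀ x ∉ Set.range (fun j : ℕ => j + k),
      PowerSeries.coeff x (PowerSeries.X ^ k * F) = 0 := fun x hx => by
    rw [PowerSeries.coeff_X_pow_mul', if_neg]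
    exact fun hk => hx ⟨x - k, Nat.sub_add_cancel hk⟩
  refine ⟨(hi.hasSum_iff hz).1 ?_, (hi.hasSum_iff fun x hx => by rw [hz x hx, mul_zero]).1 ?_⟩
  · simpa [Function.comp_def, PowerSeries.coeff_X_pow_mul] using h.1
  · simpa [Function.comp_def, PowerSeries.coeff_X_pow_mul, add_mul] using
      h.2.add (h.1.mul_left (k : ℂ))

lemma Mom.one_add_X_mul {F : PowerSeries ℂ} {a b : ℂ} (h : Mom F a b) :
    Mom ((1 + PowerSeries.X) * F) (2 * a) (2 * b + a) := by
  have := h.add (h.X_pow_mul 1)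
  convert this using 1 <;> push_cast <;> ring

lemma Mom.one_sub_X_pow_mul {F : PowerSeries ℂ} {a b : ℂ} (k : ℕ) (h : Mom F a b) :
    Mom ((1 - PowerSeries.X ^ k) * F) 0 (-(k * a)) := by
  have := h.add ((h.X_pow_mul k).C_mul (-1))
  convert this using 1
  · rw [map_neg, map_one]; ring
  · ring
  · ring

lemma Mom.hasSum_spr {F : PowerSeries ℂ} {a b : ℂ} (h : Mom F a b) :
    HasSum (spr F) a ∧ HasSum (fun N : ℕ => (N : ℂ) * spr F N) (2 * b) := by
  have hi : Function.Injective (fun j : ℕ => 2 * j) := fun x y hxy => by simpa using hxy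
  have hz : ∀ x ∉ Set.range (fun j : ℕ => 2 * j), spr F x = 0 := fun x hx => by
    rw [spr, if_neg]
    rintro ⟨m, rfl⟩
    exact hx ⟨m, two_mul m⟩
  have hs : ∀ j, spr F (2 * j) = PowerSeries.coeff j F := fun j => by
    rw [spr, if_pos (even_two_mul j), Nat.mul_div_cancel_left _ two_pos]
  refine ⟨(hi.hasSum_iff hz).1 ?_, (hi.hasSum_iff fun x hx => by rw [hz x hx, mul_zero]).1 ?_⟩
  · simpa only [Function.comp_def, hs] using h.1
  · simpa only [Function.comp_def, hs, Nat.cast_mul, Nat.cast_ofNat, mul_assoc] using h.2.mul_left 2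

lemma hasSum_limits (c : ℂ) :
    HasSum (spr (PowerSeries.C c * ((1 - PowerSeries.X ^ 3) *
      ((1 + PowerSeries.X) ^ 3 * AA q)))) 0 ∧
    HasSum (fun N : ℕ => (N : ℂ) * spr (PowerSeries.C c * ((1 - PowerSeries.X ^ 3) *
      ((1 + PowerSeries.X) ^ 3 * AA q))) N) (-(48 * c * A3 q)) := by
  have h : Mom (AA q) (A3 q) _ := ⟨hasSum_AA, summable_mul_AA.hasSum⟩
  have h2 := (((h.one_add_X_mul.one_add_X_mul.one_add_X_mul).one_sub_X_pow_mul 3).C_mul c).hasSum_spr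
  have e : (1 + PowerSeries.X) ^ 3 * AA q = (1 + PowerSeries.X) * ((1 + PowerSeries.X) *
    ((1 + PowerSeries.X) * AA q)) := by ring
  rw [e]
  convert h2 using 2 <;> push_cast <;> ring

section Swap
variable {h : ℕ → ℕ → ℂ} {C r : ℝ}

lemma summable_swap (hr0 : 0 ≤ r) (hr1 : r < 1) (hb : ∀ g N, ‖h g N‖ ≤ C * r ^ g)
    (hz : ∀ g N, 6 * g < N → h g N = 0) {w : ℕ → ℂ} (hw : ∀ N, ‖w N‖ ≤ N + 1) :
    Summable fun p : ℕ × ℕ => w p.2 * h p.1 p.2 := by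
  have hf : ∀ g, ∀ N ∉ Finset.range (6 * g + 1), ‖w N * h g N‖ = 0 := fun g N hN => by
    rw [hz g N (by simpa using hN), mul_zero, norm_zero]
  have hC : 0 ≤ C := by simpa using (norm_nonneg _).trans (hb 0 0)
  refine Summable.of_norm ((summable_prod_of_nonneg fun _ => norm_nonneg _).2
    ⟨fun g => summable_of_ne_finset_zero (hf g), ?_⟩)
  have hs : Summable fun g : ℕ => C * (49 * ((g : ℝ) ^ 2 * r ^ g) + 49 * r ^ g) := by
    have h2 := summable_pow_mul_geometric_of_norm_lt_one 2 (r := r)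
      (by rwa [Real.norm_of_nonneg hr0])
    exact ((h2.mul_left 49).add ((summable_geometric_of_lt_one hr0 hr1).mul_left 49)).mul_left C
  refine hs.of_nonneg_of_le (fun g => tsum_nonneg fun _ => norm_nonneg _) fun g => ?_
  dsimp only
  rw [tsum_eq_sum (hf g)]
  have h1 : ∀ N ∈ Finset.range (6 * g + 1), ‖w N * h g N‖ ≤ (6 * g + 1) * (C * r ^ g) := by
    intro N hN
    rw [norm_mul]
    have : (N : ℝ) ≤ 6 * g := by
      exact_mod_cast Nat.lt_succ_iff.1 (Finset.mem_range.1 hN)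
    exact mul_le_mul ((hw N).trans (by linarith)) (hb g N) (norm_nonneg _) (by positivity)
  refine (Finset.sum_le_sum h1).trans ?_
  rw [Finset.sum_const, Finset.card_range, nsmul_eq_mul]
  have hp : 0 ≤ C * r ^ g := by positivity
  have h3 : (6 * (g : ℝ) + 1) ^ 2 ≤ 49 * (g : ℝ) ^ 2 + 49 := by nlinarith [sq_nonneg ((g : ℝ) - 1)]
  calc _ = (6 * (g : ℝ) + 1) ^ 2 * (C * r ^ g) := by push_cast; ring
    _ ≤ (49 * (g : ℝ) ^ 2 + 49) * (C * r ^ g) := mul_le_mul_of_nonneg_right h3 hp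
    _ = _ := by ring

lemma hasSum_swap (hr0 : 0 ≤ r) (hr1 : r < 1) (hb : ∀ g N, ‖h g N‖ ≤ C * r ^ g)
    (hz : ∀ g N, 6 * g < N → h g N = 0) {η : ℕ → ℂ} (hη : ∀ N, HasSum (fun g => h g N) (η N))
    {w : ℕ → ℂ} (hw : ∀ N, ‖w N‖ ≤ N + 1) {s : ℂ} (hs : HasSum (fun N => w N * η N) s) :
    HasSum (fun g => ∑ N ∈ Finset.range (6 * g + 1), w N * h g N) s := by
  have hT := (summable_swap hr0 hr1 hb hz hw).hasSum
  have h1 := HasSum.prod_fiberwise hT fun g => hasSum_sum_of_ne_finset_zero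
    (s := Finset.range (6 * g + 1)) (f := fun N => w N * h g N) fun N hN => by
      rw [hz g N (by simpa using hN), mul_zero]
  have h2 := HasSum.prod_fiberwise ((Equiv.prodComm ℕ ℕ).hasSum_iff.2 hT)
    fun N => (hη N).mul_left (w N)
  rwa [h2.unique hs] at h1

end Swap

/-- The value at `1` of the regularised cubic moment. -/
def GG (q : ℕ) [Fact q.Prime] (g : ℕ) : ℂ := ∑ N ∈ Finset.range (6 * g + 1), hh q g N

lemma sum_mul_hh (g : ℕ) :
    ∑ N ∈ Finset.range (6 * g + 1), (N : ℂ) * hh q g N = 3 * (g * GG q g) := by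
  have h1 := Finset.sum_range_reflect (fun N : ℕ => (N : ℂ) * hh q g N) (6 * g + 1)
  have h2 : ∑ N ∈ Finset.range (6 * g + 1), ((6 * g + 1 - 1 - N : ℕ) : ℂ) *
      hh q g (6 * g + 1 - 1 - N) = 6 * g * GG q g - ∑ N ∈ Finset.range (6 * g + 1),
        (N : ℂ) * hh q g N := by
    rw [GG, Finset.mul_sum, ← Finset.sum_sub_distrib]
    refine Finset.sum_congr rfl fun N hN => ?_
    have hN' : N ≤ 6 * g := Nat.lt_succ_iff.1 (Finset.mem_range.1 hN)
    rw [Nat.add_sub_cancel, Pal_hh.symm hN', Nat.cast_sub hN']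
    push_cast
    ring
  rw [h2] at h1
  linear_combination -h1 / 2

lemma exists_GG_le {κ : ℝ} (hκ : 1 < κ) :
    ∃ C : ℝ, 0 ≤ C ∧ ∀ g : ℕ, ‖GG q g‖ ≤ (6 * g + 1) * (C * (κ / Real.sqrt q) ^ g) := by
  obtain ⟨C, hC, h⟩ := exists_hh_le (q := q) hκ
  refine ⟨C, hC, fun g => ?_⟩
  refine (norm_sum_le _ _).trans ((Finset.sum_le_sum fun N _ => h g N).trans ?_)
  rw [Finset.sum_const, Finset.card_range, nsmul_eq_mul]
  push_cast
  rfl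

lemma hasSum_GG : HasSum (GG q) 0 ∧
    HasSum (fun g : ℕ => (g : ℂ) * GG q g) (-(16 * (1 - 1 / (q : ℂ)) * A3 q)) := by
  have hs := two_lt_sqrt (q := q)
  obtain ⟨C, hC, hb⟩ := exists_hh_le (q := q) (κ := 3 / 2) (by norm_num)
  have hr0 : 0 ≤ 3 / 2 / Real.sqrt q := by positivity
  have hr1 : 3 / 2 / Real.sqrt q < 1 := by rw [div_lt_one (by linarith)]; linarith
  have hz : ∀ g N, 6 * g < N → hh q g N = 0 := fun g N h => Pal_hh.eq_zero h
  have hη : ∀ N, HasSum (fun g => hh q g N) (spr (PowerSeries.C (1 - 1 / (q : ℂ)) *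
      ((1 - PowerSeries.X ^ 3) * ((1 + PowerSeries.X) ^ 3 * AA q))) N) := fun N => by
    have hsum : Summable fun g => hh q g N :=
      Summable.of_norm_bounded ((summable_geometric_of_lt_one hr0 hr1).mul_left C)
        fun g => hb g N
    rw [hsum.hasSum_iff_tendsto_nat, ← tendsto_add_atTop_iff_nat 1]
    simp only [sum_hh]
    exact tendsto_vv3 N
  obtain ⟨l0, l1⟩ := hasSum_limits (q := q) (1 - 1 / (q : ℂ))
  constructor
  · have := hasSum_swap hr0 hr1 hb hz hη (w := fun _ => 1) (fun N => by simp)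
      (by simpa only [one_mul] using l0)
    simp only [one_mul] at this
    exact this
  · have := (hasSum_swap hr0 hr1 hb hz hη (w := fun N => (N : ℂ))
      (fun N => by simp) l1).mul_left (1 / 3)
    simp only [sum_mul_hh] at this
    rw [show 1 / 3 * -(48 * (1 - 1 / (q : ℂ)) * A3 q) = -(16 * (1 - 1 / (q : ℂ)) * A3 q) by
      ring] at this
    refine (congrArg (HasSum · _) (funext fun g => ?_)).mp this
    ring

end

section
variable {q : ℕ} [Fact q.Prime] [hq4 : Fact (q % 4 = 1)]
open Filter Topology

/-- The double sequence vanishes for `N > 6 * g`. -/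
def Sup (u : ℕ → ℕ → ℂ) : Prop := ∀ g N : ℕ, 6 * g < N → u g N = 0

lemma Sup.Tk {u : ℕ → ℕ → ℂ} (hu : Sup u) (k : ℕ) (hk : k ≤ 3) : Sup (Tk k u) := by
  intro g N h
  rw [TM.Tk, hu g N h, zero_sub, neg_eq_zero, ite_eq_right_iff]
  exact fun _ => hu _ _ (by omega)

/-- The generating series of the values at `1` of a double sequence of polynomials. -/
def sm (u : ℕ → ℕ → ℂ) : PowerSeries ℂ :=
  PowerSeries.mk fun g => ∑ N ∈ Finset.range (6 * g + 1), u g N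

lemma sm_Tk {u : ℕ → ℕ → ℂ} (hu : Sup u) {k : ℕ} (hk : k ≤ 3) :
    sm (Tk k u) = (1 - PowerSeries.X) * sm u := by
  ext g
  rw [sub_mul, one_mul, map_sub, sm, sm, PowerSeries.coeff_mk, PowerSeries.coeff_mk]
  simp only [Tk, Finset.sum_sub_distrib]
  congr 1
  cases g with
  | zero => simp
  | succ g =>
    rw [PowerSeries.coeff_succ_X_mul, PowerSeries.coeff_mk,
      show 6 * (g + 1) + 1 = 2 * k + ((6 * g + 1) + (6 - 2 * k)) by omega, Finset.sum_range_add,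
      Finset.sum_eq_zero fun N hN => ?_, zero_add, Finset.sum_range_add]
    · rw [Finset.sum_eq_zero (s := Finset.range (6 - 2 * k)) fun N _ => ?_, add_zero]
      · refine Finset.sum_congr rfl fun N _ => ?_
        rw [if_pos (by omega)]
        congr 1
        omega
      · rw [if_pos (by omega)]
        exact hu _ _ (by omega)
    · rw [Finset.mem_range] at hN
      rw [if_neg (by omega)]

lemma sm_hh : sm (hh q) = (1 - PowerSeries.X) ^ 8 * sm (mm q) := by
  have h0 : Sup (mm q) := fun g N h => Pal_mm.eq_zero h
  have h1 := h0.Tk 1 (by norm_num)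
  have h2 := h1.Tk 1 (by norm_num)
  have h3 := h2.Tk 1 (by norm_num)
  have h4 := h3.Tk 3 (by norm_num)
  have h5 := h4.Tk 2 (by norm_num)
  have h6 := h5.Tk 2 (by norm_num)
  have h7 := h6.Tk 2 (by norm_num)
  rw [hh, vv3, sm_Tk h7 (by norm_num), sm_Tk h6 (by norm_num), sm_Tk h5 (by norm_num),
    sm_Tk h4 (by norm_num), sm_Tk h3 (by norm_num), sm_Tk h2 (by norm_num),
    sm_Tk h1 (by norm_num), sm_Tk h0 (by norm_num)]
  ring

lemma sum_mm_eq (g : ℕ) : ∑ N ∈ Finset.range (6 * g + 1), mm q g N =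
    ∑ k ∈ Finset.range (g + 1), GG q k * ((7 + (g - k)).choose 7 : ℂ) := by
  have h1 := PowerSeries.mk_add_choose_mul_one_sub_pow_eq_one ℂ 7
  have h2 : sm (mm q) = sm (hh q) * PowerSeries.mk fun n => ((7 + n).choose 7 : ℂ) := by
    rw [sm_hh, mul_right_comm, mul_comm _ (PowerSeries.mk _), h1, one_mul]
  have h3 := congrArg (PowerSeries.coeff g) h2
  rw [PowerSeries.coeff_mul, Finset.Nat.sum_antidiagonal_eq_sum_range_succ_mk] at h3
  simpa only [sm, PowerSeries.coeff_mk, GG] using h3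

/-- The coefficients of `(y + 1) (y + 3) ⋯ (y + 13) / 645120`. -/
def cw (i : ℕ) : ℂ := ([135135, 264207, 177331, 57379, 10045, 973, 49, 1].getD i 0 : ℕ) / 645120

lemma choose_eq_sum_cw (n : ℕ) :
    ((7 + n).choose 7 : ℂ) = ∑ i ∈ Finset.range 8, cw i * (2 * n + 1) ^ i := by
  have h := Nat.descFactorial_eq_factorial_mul_choose (7 + n) 7
  have h2 : (7 + n).descFactorial 7 =
      (n + 1) * ((n + 2) * ((n + 3) * ((n + 4) * ((n + 5) * ((n + 6) * (n + 7)))))) := by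
    simp [Nat.descFactorial, add_comm 7 n]
  rw [h2] at h
  have h3 : ((7 + n).choose 7 : ℂ) = ((n + 1) * ((n + 2) * ((n + 3) * ((n + 4) * ((n + 5) *
      ((n + 6) * (n + 7)))))) : ℂ) / 5040 := by
    rw [eq_div_iff (by norm_num)]
    have h4 := congrArg (Nat.cast (R := ℂ)) h
    rw [show Nat.factorial 7 = 5040 from rfl] at h4
    push_cast at h4
    rw [h4]
    ring
  rw [h3]
  simp only [Finset.sum_range_succ, Finset.sum_range_zero, cw, List.getD_cons_zero,
    List.getD_cons_succ]
  push_cast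
  ring

end

section
variable {q : ℕ} [Fact q.Prime] [hq4 : Fact (q % 4 = 1)]
open Filter Topology

lemma exists_norm_GG_le {κ : ℝ} (hκ : 1 < κ) :
    ∃ C : ℝ, 0 ≤ C ∧ ∀ g : ℕ, ‖GG q g‖ ≤ C * (κ / Real.sqrt q) ^ g := by
  obtain ⟨τ, hτ, rfl⟩ := exists_pow_twelve hκ
  obtain ⟨C, hC, h⟩ := exists_GG_le (q := q) hτ
  obtain ⟨D, hD, h1⟩ := exists_poly_le_pow 1 hτ
  obtain ⟨hs1, -⟩ := sqrt_facts (q := q)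
  have hs0 : 0 < Real.sqrt q := by linarith
  have hτ0 : 0 < τ := by linarith
  refine ⟨6 * D * C, by positivity, fun g => (h g).trans ?_⟩
  have h2 : 6 * (g : ℝ) + 1 ≤ 6 * (D * τ ^ g) := by
    have := h1 g
    rw [pow_one] at this
    linarith
  calc _ ≤ 6 * (D * τ ^ g) * (C * (τ / Real.sqrt q) ^ g) := by gcongr
    _ = 6 * D * C * (τ ^ (2 * g) / Real.sqrt q ^ g) := by rw [div_pow, two_mul, pow_add]; ring
    _ ≤ 6 * D * C * (τ ^ (12 * g) / Real.sqrt q ^ g) := by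
      gcongr
      · exact hτ.le
      · omega
    _ = _ := by rw [div_pow, pow_mul]

lemma summable_pow_GG (n : ℕ) : Summable fun k : ℕ => (k : ℂ) ^ n * GG q k := by
  have hs := two_lt_sqrt (q := q)
  obtain ⟨C, hC, hb⟩ := exists_norm_GG_le (q := q) (κ := 3 / 2) (by norm_num)
  have hr0 : 0 ≤ 3 / 2 / Real.sqrt q := by positivity
  have hr1 : 3 / 2 / Real.sqrt q < 1 := by rw [div_lt_one (by linarith)]; linarith
  have h := summable_pow_mul_geometric_of_norm_lt_one n (r := 3 / 2 / Real.sqrt q)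
    (by rwa [Real.norm_of_nonneg hr0])
  refine Summable.of_norm_bounded (h.mul_left C) fun k => ?_
  rw [norm_mul, norm_pow, Complex.norm_natCast, mul_left_comm]
  exact mul_le_mul_of_nonneg_left (hb k) (by positivity)

/-- The moments of the sequence `GG q`. -/
def SS (q : ℕ) [Fact q.Prime] (n : ℕ) : ℂ := ∑' k : ℕ, (k : ℂ) ^ n * GG q k

lemma SS_zero : SS q 0 = 0 := by
  simp only [SS, pow_zero, one_mul]
  exact hasSum_GG.1.tsum_eq

lemma SS_one : SS q 1 = -(16 * (1 - 1 / (q : ℂ)) * A3 q) := by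
  simp only [SS, pow_one]
  exact hasSum_GG.2.tsum_eq

lemma one_sub_inv_ne_zero : (1 - 1 / (q : ℂ)) ≠ 0 := by
  have hq := q_ne_zero (q := q)
  have hq1 : (q : ℂ) ≠ 1 := by exact_mod_cast (Fact.out : q.Prime).one_lt.ne'
  rw [sub_ne_zero, ne_comm, ne_eq, div_eq_iff hq, one_mul]
  exact hq1.symm

/-- The polynomial in the main term. -/
def QQ (q : ℕ) [Fact q.Prime] : ℂ[X] := C (1 / (1 - 1 / (q : ℂ))) *
  ∑ i ∈ Finset.range 8, ∑ j ∈ Finset.range (i + 1),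
    C (cw i * (i.choose j * ((-2) ^ (i - j) * SS q (i - j)))) * X ^ j

lemma coeff_QQ (m : ℕ) : (QQ q).coeff m = 1 / (1 - 1 / (q : ℂ)) *
    ∑ i ∈ Finset.range 8, ∑ j ∈ Finset.range (i + 1),
      if m = j then cw i * (i.choose j * ((-2) ^ (i - j) * SS q (i - j))) else 0 := by
  simp only [QQ, coeff_C_mul, finsetSum_coeff, coeff_X_pow, mul_ite, mul_one, mul_zero]

lemma coeff_QQ_six : (QQ q).coeff 6 = A3 q / 2880 := by
  have hc := one_sub_inv_ne_zero (q := q)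
  rw [coeff_QQ]
  simp [Finset.sum_range_succ, cw, SS_zero, SS_one]
  rw [← one_div]
  field_simp
  ring

lemma degree_QQ : (QQ q).degree = 6 := by
  refine degree_eq_of_le_of_coeff_ne_zero ((degree_le_iff_coeff_zero _ _).2 fun m hm => ?_) ?_
  · have hm' : 6 < m := by exact_mod_cast hm
    rw [coeff_QQ, Finset.sum_eq_zero, mul_zero]
    refine fun i hi => Finset.sum_eq_zero fun j hj => ?_
    rw [Finset.mem_range] at hi hj
    split_ifs with h
    · rw [show i - j = 0 by omega, SS_zero, mul_zero, mul_zero, mul_zero]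
    · rfl
  · rw [coeff_QQ_six]
    exact div_ne_zero A3_ne_zero (by norm_num)

/-- The polynomial function interpolating `n ↦ (n + 7).choose 7` at the odd numbers. -/
def ww (y : ℂ) : ℂ := ∑ i ∈ Finset.range 8, cw i * y ^ i

lemma hasSum_QQ (x : ℂ) :
    HasSum (fun k : ℕ => GG q k * ww (x - 2 * k)) ((1 - 1 / (q : ℂ)) * (QQ q).eval x) := by
  have hc := one_sub_inv_ne_zero (q := q)
  have h : HasSum (fun k : ℕ => ∑ i ∈ Finset.range 8, ∑ j ∈ Finset.range (i + 1),
      cw i * (i.choose j * (-2) ^ (i - j)) * x ^ j * ((k : ℂ) ^ (i - j) * GG q k))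
      (∑ i ∈ Finset.range 8, ∑ j ∈ Finset.range (i + 1),
      cw i * (i.choose j * (-2) ^ (i - j)) * x ^ j * SS q (i - j)) :=
    hasSum_sum fun i _ => hasSum_sum fun j _ => (summable_pow_GG (i - j)).hasSum.mul_left _
  have e1 : (1 - 1 / (q : ℂ)) * (QQ q).eval x = ∑ i ∈ Finset.range 8, ∑ j ∈ Finset.range (i + 1),
      cw i * (i.choose j * (-2) ^ (i - j)) * x ^ j * SS q (i - j) := by
    rw [QQ, eval_mul, eval_C, ← mul_assoc, mul_one_div_cancel hc, one_mul, eval_finsetSum]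
    refine Finset.sum_congr rfl fun i _ => ?_
    rw [eval_finsetSum]
    refine Finset.sum_congr rfl fun j _ => ?_
    rw [eval_mul, eval_C, eval_pow, eval_X]
    ring
  rw [e1]
  refine (congrArg (HasSum · _) (funext fun k => ?_)).mp h
  rw [ww, Finset.mul_sum]
  refine Finset.sum_congr rfl fun i _ => ?_
  rw [sub_eq_add_neg, add_pow, Finset.mul_sum, Finset.mul_sum]
  refine Finset.sum_congr rfl fun j _ => ?_
  rw [← neg_mul, mul_pow]
  ring

lemma exists_norm_ww_le : ∃ E : ℝ, 0 ≤ E ∧ ∀ m : ℕ, ‖ww (-(2 * m + 1))‖ ≤ E * ((m : ℝ) + 1) ^ 7 := by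
  refine ⟨∑ i ∈ Finset.range 8, ‖cw i‖ * 2 ^ 7, by positivity, fun m => ?_⟩
  rw [ww, Finset.sum_mul]
  refine (norm_sum_le _ _).trans (Finset.sum_le_sum fun i hi => ?_)
  rw [norm_mul, norm_pow, norm_neg, mul_assoc, ← mul_pow]
  have e : ‖(2 * (m : ℂ) + 1)‖ = 2 * m + 1 := by
    have := Complex.norm_natCast (2 * m + 1)
    push_cast at this
    exact this
  rw [e]
  have hm : (0 : ℝ) ≤ m := by positivity
  refine mul_le_mul_of_nonneg_left ?_ (norm_nonneg _)
  calc (2 * (m : ℝ) + 1) ^ i ≤ (2 * (m + 1)) ^ i := by gcongr; linarith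
    _ ≤ _ := pow_le_pow_right₀ (by linarith) (by rw [Finset.mem_range] at hi; omega)

lemma exists_moment_sub_le {κ : ℝ} (hκ : 1 < κ) (hκ2 : κ ≤ 3 / 2) :
    ∃ K : ℝ, 0 ≤ K ∧ ∀ g : ℕ, ‖∑ N ∈ Finset.range (6 * g + 1), mm q g N -
      (1 - 1 / (q : ℂ)) * (QQ q).eval ((2 * g + 1 : ℕ) : ℂ)‖ ≤ K * (κ / Real.sqrt q) ^ g := by
  have hs := two_lt_sqrt (q := q)
  obtain ⟨C, hC, hb⟩ := exists_norm_GG_le (q := q) hκ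
  obtain ⟨E, hE, hw⟩ := exists_norm_ww_le
  set r := κ / Real.sqrt q with hr
  have hr0 : 0 ≤ r := by positivity
  have hr1 : r < 1 := by rw [hr, div_lt_one (by linarith)]; linarith
  have hsum : Summable fun m : ℕ => ((m + 1 : ℕ) : ℝ) ^ 7 * r ^ (m + 1) :=
    (summable_nat_add_iff 1).2 (summable_pow_mul_geometric_of_norm_lt_one 7 (r := r)
      (by rwa [Real.norm_of_nonneg hr0]))
  refine ⟨C * E * ∑' m : ℕ, ((m + 1 : ℕ) : ℝ) ^ 7 * r ^ (m + 1),
    mul_nonneg (mul_nonneg hC hE) (tsum_nonneg fun _ => by positivity), fun g => ?_⟩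
  have h := hasSum_QQ (q := q) ((2 * g + 1 : ℕ) : ℂ)
  have h1 : ∑ N ∈ Finset.range (6 * g + 1), mm q g N =
      ∑ k ∈ Finset.range (g + 1), GG q k * ww (((2 * g + 1 : ℕ) : ℂ) - 2 * k) := by
    rw [sum_mm_eq]
    refine Finset.sum_congr rfl fun k hk => ?_
    rw [choose_eq_sum_cw, ww, Nat.cast_sub (Nat.lt_succ_iff.1 (Finset.mem_range.1 hk))]
    refine congrArg _ (Finset.sum_congr rfl fun i _ => ?_)
    push_cast
    ring
  rw [h1, ← h.tsum_eq, ← h.summable.sum_add_tsum_nat_add (g + 1), sub_add_cancel_left, norm_neg,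
    mul_right_comm, ← tsum_mul_left]
  refine tsum_of_norm_bounded (hsum.mul_left _).hasSum fun m => ?_
  have e : ((2 * g + 1 : ℕ) : ℂ) - 2 * ((m + (g + 1) : ℕ) : ℂ) = -(2 * m + 1) := by
    push_cast
    ring
  rw [e, norm_mul]
  refine (mul_le_mul (hb _) (hw m) (norm_nonneg _) (by positivity)).trans (le_of_eq ?_)
  rw [pow_add r m]
  push_cast
  ring

end

section
variable {q : ℕ} [Fact q.Prime] [hq4 : Fact (q % 4 = 1)]

lemma exists_third_moment_sub_le {ε : ℝ} (hε : 0 < ε) : ∃ K : ℝ, 0 < K ∧ ∀ g : ℕ,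
    ‖sumH q (2 * g + 1) (fun D => Lhalf q D ^ 3) -
      (q : ℂ) ^ (2 * g + 1) * (1 - 1 / q) * (QQ q).eval ((2 * g + 1 : ℕ) : ℂ)‖ ≤
        K * (q : ℝ) ^ (3 * (g : ℝ) / 2 * (1 + ε)) := by
  have hq1 : (1 : ℝ) < q := by exact_mod_cast (Fact.out : q.Prime).one_lt
  have hq0 : (0 : ℝ) < q := by linarith
  have hκ0 : (1 : ℝ) < (q : ℝ) ^ (3 / 2 * ε) := Real.one_lt_rpow hq1 (by positivity)
  obtain ⟨K, hK, h⟩ := exists_moment_sub_le (q := q) (κ := min ((q : ℝ) ^ (3 / 2 * ε)) (3 / 2))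
    (lt_min hκ0 (by norm_num)) (min_le_right _ _)
  refine ⟨q * K + 1, by positivity, fun g => ?_⟩
  rw [sumH_Lhalf, mul_assoc, ← mul_sub, norm_mul, norm_pow, Complex.norm_natCast]
  have h1 : (min ((q : ℝ) ^ (3 / 2 * ε)) (3 / 2) / Real.sqrt q) ^ g ≤
      (q : ℝ) ^ (3 / 2 * ε * g - 1 / 2 * g) := by
    have e : (q : ℝ) ^ (3 / 2 * ε * g - 1 / 2 * g) =
        ((q : ℝ) ^ (3 / 2 * ε) / Real.sqrt q) ^ g := by
      rw [Real.sqrt_eq_rpow, ← Real.rpow_sub hq0, ← Real.rpow_mul_natCast hq0.le]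
      congr 1
      ring
    rw [e]
    gcongr
    exact min_le_left _ _
  calc _ ≤ (q : ℝ) ^ (2 * g + 1) * (K * (q : ℝ) ^ (3 / 2 * ε * g - 1 / 2 * g)) :=
        mul_le_mul_of_nonneg_left ((h g).trans (mul_le_mul_of_nonneg_left h1 hK)) (by positivity)
    _ = q * K * ((q : ℝ) ^ (2 * (g : ℝ)) * (q : ℝ) ^ (3 / 2 * ε * g - 1 / 2 * g)) := by
        rw [pow_succ, ← Real.rpow_natCast (q : ℝ) (2 * g)]
        push_cast
        ring
    _ = q * K * (q : ℝ) ^ (3 * (g : ℝ) / 2 * (1 + ε)) := by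
        rw [← Real.rpow_add hq0]
        congr 2
        ring
    _ ≤ _ := mul_le_mul_of_nonneg_right (by linarith) (by positivity)

end

end TM
end

/-- the third moment of `L(1/2, χ_D)` over `H_{2g+1}`:
there is a polynomial `Q` of degree `6` with leading coefficient `A₃/2880`, where
`A₃ = ∏_P (1 - (12|P|⁵-23|P|⁴+23|P|³-15|P|²+6|P|-1)/(|P|⁶(|P|+1)))`, such that
`∑_{D ∈ H_{2g+1}} L(1/2,χ_D)³ = (q^{2g+1}/ζ(2)) Q(2g+1) + O_ε(q^{(3g/2)(1+ε)})`. -/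
theorem third_moment_quadratic_L (q : ℕ) [Fact q.Prime] (hq4 : q % 4 = 1) :
    ∃ Q : Polynomial ℂ, Q.degree = 6 ∧
      Q.coeff 6 = (∏' P : MIrr q,
        (1 - (12 * nm q P.1 ^ 5 - 23 * nm q P.1 ^ 4 + 23 * nm q P.1 ^ 3
          - 15 * nm q P.1 ^ 2 + 6 * nm q P.1 - 1) /
            (nm q P.1 ^ 6 * (nm q P.1 + 1)))) / 2880 ∧
      ∀ ε : ℝ, 0 < ε → ∃ K : ℝ, 0 < K ∧ ∀ g : ℕ,
        ‖sumH q (2 * g + 1) (fun D => Lhalf q D ^ 3) -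
            (q : ℂ) ^ (2 * g + 1) * (1 - 1 / q) * Q.eval ((2 * g + 1 : ℕ) : ℂ)‖ ≤
          K * (q : ℝ) ^ (3 * (g : ℝ) / 2 * (1 + ε)) := by
  have : Fact (q % 4 = 1) := ⟨hq4⟩
  exact ⟨TM.QQ q, TM.degree_QQ, TM.coeff_QQ_six, fun ε hε => TM.exists_third_moment_sub_le hε⟩
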